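/- Let ρ : [0, ∞) → ℝ be the Dickman function: ρ is continuous, ρ(u) = 1 for 0 ≤ u ≤ 1, and ρ is differentiable on (1, ∞) with u·ρ'(u) + ρ(u − 1) = 0 for u > 1. For every ε > 0 there exists C_ε > 0 such that the following holds. Let f be a completely multiplicative function with |f(n)| ≤ 1 for all n, let a ≥ 0, y ≥ 2, and let c ≥ y^{−1/7} be such that |Ψ_f(t, y)| ≤ c·ρ(log t / log y)·t for all t with y^a ≤ t ≤ y^{a+1}, where Ψ_f(t, y) := ∑_{n ≤ t, all prime factors of n are ≤ y} f(n). Then for every x with x ≥ y^a and log y ≥ (log₂ x)^{5/3 + ε}, writing u_x := log x / log y, one has |Ψ_f(x, y)| ≤ c·x·ρ(u_x)·(1 + C_ε·u_x·log(u_x + 1)/log x). -/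

import Mathlib

section
open Finset
open scoped Classical

/-- `Psif f t y = ∑_{n ≤ t, n is y-smooth} f n`. -/
noncomputable def Psif (f : ℕ → ℝ) (t y : ℝ) : ℝ :=
  ∑ n ∈ (Finset.Icc 1 ⌊t⌋₊).filter
      (fun n => ∀ p : ℕ, p ∈ n.primeFactors → (p : ℝ) ≤ y), f n

end

namespace VK
open Finset

/-- Newton: equal power sums give equal elementary symmetric functions. -/
lemma esymm_eq_of_psum_eq {R : Type*} [CommRing R] {k : ℕ} (x y : Fin k → R)
    (hu : ∀ j : ℕ, 1 ≤ j → j ≤ k → IsUnit (j : R))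
    (h : ∀ j : ℕ, 1 ≤ j → j ≤ k → ∑ i, x i ^ j = ∑ i, y i ^ j) (n : ℕ) (hn : n ≤ k) :
    MvPolynomial.aeval x (MvPolynomial.esymm (Fin k) ℤ n) =
      MvPolynomial.aeval y (MvPolynomial.esymm (Fin k) ℤ n) := by
  induction n using Nat.strong_induction_on with
  | _ n ih =>
    rcases Nat.eq_zero_or_pos n with h0 | h0
    · subst h0; simp
    · have e := fun z : Fin k → R => congrArg (MvPolynomial.aeval z)
        (MvPolynomial.mul_esymm_eq_sum (Fin k) ℤ n)
      have ex := e x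
      have ey := e y
      simp only [map_mul, map_natCast, map_sum, map_pow, map_neg, map_one] at ex ey
      apply (hu n h0 hn).mul_left_cancel
      rw [ex, ey]
      congr 1
      apply Finset.sum_congr rfl
      intro a ha
      simp only [mem_filter, HasAntidiagonal.mem_antidiagonal] at ha
      rw [ih a.1 ha.2 (by omega)]
      congr 1
      simp only [MvPolynomial.psum, map_sum, map_pow, MvPolynomial.aeval_X]
      exact h a.2 (by omega) (by omega)

lemma prod_sub_eq {R : Type*} [CommRing R] {k : ℕ} (x y : Fin k → R)
    (hu : ∀ j : ℕ, 1 ≤ j → j ≤ k → IsUnit (j : R))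
    (h : ∀ j : ℕ, 1 ≤ j → j ≤ k → ∑ i, x i ^ j = ∑ i, y i ^ j) (z : R) :
    ∏ i, (z - x i) = ∏ i, (z - y i) := by
  have key : ∀ w : Fin k → R, ∏ i, (z - w i) = ∑ j ∈ range (k + 1),
      (-1) ^ j * ((MvPolynomial.aeval w (MvPolynomial.esymm (Fin k) ℤ j)) * z ^ (k - j)) := by
    intro w
    have := congrArg (Polynomial.eval z)
      (Multiset.prod_X_sub_X_eq_sum_esymm (univ.val.map w))
    rw [Polynomial.eval_multiset_prod] at this
    simp only [Multiset.map_map, Function.comp_def, Polynomial.eval_sub, Polynomial.eval_X,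
      Polynomial.eval_C, Polynomial.eval_finsetSum, Polynomial.eval_mul, Polynomial.eval_pow,
      Polynomial.eval_neg, Polynomial.eval_one, Multiset.card_map, Finset.card_val,
      Finset.card_univ, Fintype.card_fin] at this
    simp only [MvPolynomial.aeval_esymm_eq_multiset_esymm]
    exact this
  rw [key, key]
  apply Finset.sum_congr rfl
  intro j hj
  rw [esymm_eq_of_psum_eq x y hu h j (by simpa [Nat.lt_succ_iff] using hj)]

/-- roots: in `ZMod (p^k)`, if `y` distinct mod `p`, and `∏ (x - y i) = 0` then `x = y i`. -/
lemma exists_eq_of_prod_zero {p e k : ℕ} (hp : p.Prime) (z : ℤ) (y : Fin k → ℤ)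
    (hy : ∀ i j, (p : ℤ) ∣ y i - y j → i = j)
    (hk : 0 < e) (h : ((p : ℤ) ^ e) ∣ ∏ i, (z - y i)) : ∃ i, ((p : ℤ) ^ e) ∣ z - y i := by
  have hpp : Prime (p : ℤ) := Nat.prime_iff_prime_int.mp hp
  have h1 : (p : ℤ) ∣ ∏ i, (z - y i) := (dvd_pow_self _ hk.ne').trans h
  obtain ⟨i, -, hi⟩ := (hpp.dvd_finsetProd_iff _).mp h1
  refine ⟨i, ?_⟩
  rw [← Finset.mul_prod_erase univ _ (mem_univ i)] at h
  refine hpp.pow_dvd_of_dvd_mul_right e ?_ h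
  intro hd
  obtain ⟨j, hj, hj'⟩ := (hpp.dvd_finsetProd_iff _).mp hd
  have : i = j := by
    apply hy
    have := dvd_sub hj' hi
    simpa using this
  simp [this] at hj

/-- fibers: at most `k!` tuples with given power sums mod `p^k`. -/
lemma fiber_card {p k : ℕ} (hp : p.Prime) (hk : 0 < k) (hkp : k < p) (P : ℕ) (hP : P ≤ p ^ k)
    (S : Finset (Fin k → ℤ))
    (hS : ∀ y ∈ S, (∀ i, 0 ≤ y i ∧ y i < P) ∧ ∀ i j, (p : ℤ) ∣ y i - y j → i = j)
    (hc : ∀ y ∈ S, ∀ y' ∈ S, ∀ j : ℕ, 1 ≤ j → j ≤ k →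
      ((p : ℤ) ^ k) ∣ ∑ i, y i ^ j - ∑ i, y' i ^ j) :
    S.card ≤ k.factorial := by
  rcases S.eq_empty_or_nonempty with h | ⟨y0, h0⟩
  · simp [h]
  have key : S ⊆ (univ : Finset (Equiv.Perm (Fin k))).image (fun σ : Equiv.Perm (Fin k) => y0 ∘ ⇑σ) := by
    intro y hy
    have hu : ∀ j : ℕ, 1 ≤ j → j ≤ k → IsUnit (j : ZMod (p ^ k)) := by
      intro j h1 h2
      rw [ZMod.isUnit_iff_coprime]
      exact Nat.Coprime.pow_right _ ((Nat.coprime_comm.mp (hp.coprime_iff_not_dvd.mpr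
        (fun hd => by have := Nat.le_of_dvd h1 hd; omega))))
    have hpow : ∀ j : ℕ, 1 ≤ j → j ≤ k →
        ∑ i, ((y i : ZMod (p ^ k))) ^ j = ∑ i, ((y0 i : ZMod (p ^ k))) ^ j := by
      intro j h1 h2
      have := hc y hy y0 h0 j h1 h2
      have h3 : ((∑ i, y i ^ j - ∑ i, y0 i ^ j : ℤ) : ZMod (p ^ k)) = 0 := by
        rw [ZMod.intCast_zmod_eq_zero_iff_dvd]; exact_mod_cast this
      push_cast at h3
      exact sub_eq_zero.mp h3
    have hex : ∀ i, ∃ j, y i = y0 j := by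
      intro i
      have e := prod_sub_eq (fun i => (y i : ZMod (p ^ k))) (fun i => (y0 i : ZMod (p ^ k)))
        hu hpow (y i : ZMod (p ^ k))
      rw [Finset.prod_eq_zero (mem_univ i) (sub_self _)] at e
      have h3 : ((p : ℤ) ^ k) ∣ ∏ j, (y i - y0 j) := by
        have : ((∏ j, (y i - y0 j) : ℤ) : ZMod (p ^ k)) = 0 := by
          push_cast; exact e.symm
        rw [ZMod.intCast_zmod_eq_zero_iff_dvd] at this
        exact_mod_cast this
      obtain ⟨j, hj⟩ := exists_eq_of_prod_zero hp (y i) y0 (hS y0 h0).2 hk h3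
      refine ⟨j, ?_⟩
      have hb1 := (hS y hy).1 i
      have hb2 := (hS y0 h0).1 j
      have hP' : (P : ℤ) ≤ (p : ℤ) ^ k := by exact_mod_cast hP
      have : y i - y0 j = 0 := by
        apply Int.eq_zero_of_abs_lt_dvd hj
        rw [abs_lt]; constructor <;> linarith
      linarith
    choose τ hτ using hex
    have hinj : Function.Injective τ := by
      intro a b hab
      apply (hS y hy).2
      rw [hτ a, hτ b, hab]; simp
    rw [mem_image]
    refine ⟨Equiv.ofBijective τ ((Finite.injective_iff_bijective).mp hinj), mem_univ _, ?_⟩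
    funext i
    simp [hτ i]
  calc S.card ≤ _ := card_le_card key
    _ ≤ (univ : Finset (Equiv.Perm (Fin k))).card := card_image_le
    _ = k.factorial := by rw [card_univ, Fintype.card_perm, Fintype.card_fin]

/-- Linnik lemma. -/
lemma linnik {p k : ℕ} (hp : p.Prime) (hk : 0 < k) (hkp : k < p) (P : ℕ) (hP : P ≤ p ^ k)
    (m : Fin k → ℤ) (S : Finset (Fin k → ℤ))
    (hS : ∀ y ∈ S, (∀ i, 0 ≤ y i ∧ y i < P) ∧ ∀ i j, (p : ℤ) ∣ y i - y j → i = j)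
    (hc : ∀ y ∈ S, ∀ j : Fin k, ((p : ℤ) ^ (j.val + 1)) ∣ ∑ i, y i ^ (j.val + 1) - m j) :
    S.card ≤ k.factorial * p ^ (k * (k - 1) / 2) := by
  have hp0 : 0 < p := hp.pos
  let φ : (Fin k → ℤ) → (Fin k → ℤ) := fun y j =>
    ((∑ i, y i ^ (j.val + 1) - m j) / (p : ℤ) ^ (j.val + 1)) % (p : ℤ) ^ (k - 1 - j.val)
  let T : Finset (Fin k → ℤ) := Fintype.piFinset fun j : Fin k => Ico (0 : ℤ) ((p : ℤ) ^ (k - 1 - j.val))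
  have hT : T.card = p ^ (k * (k - 1) / 2) := by
    simp only [T, Fintype.card_piFinset, Int.card_Ico, sub_zero]
    have : ∀ j : Fin k, ((p : ℤ) ^ (k - 1 - j.val)).toNat = p ^ (k - 1 - j.val) := by
      intro j
      have : ((p : ℤ) ^ (k - 1 - j.val)) = ((p ^ (k - 1 - j.val) : ℕ) : ℤ) := by push_cast; rfl
      rw [this, Int.toNat_natCast]
    simp only [this]
    rw [Fin.prod_univ_eq_prod_range (fun j => p ^ (k - 1 - j)) k, Finset.prod_range_reflect (fun j => p ^ j) k,
      Finset.prod_pow_eq_pow_sum, Finset.sum_range_id]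
  have hmaps : ∀ y ∈ S, φ y ∈ T := by
    intro y hy
    simp only [T, Fintype.mem_piFinset, mem_Ico, φ]
    intro j
    have : (0 : ℤ) < (p : ℤ) ^ (k - 1 - j.val) := by positivity
    exact ⟨Int.emod_nonneg _ this.ne', Int.emod_lt_of_pos _ this⟩
  rw [← hT]
  have := Finset.card_le_mul_card_image_of_maps_to hmaps k.factorial ?_
  · exact this
  intro b hb
  apply fiber_card hp hk hkp P hP
  · intro y hy; exact hS y (mem_of_mem_filter y hy)
  · intro y hy y' hy' j h1 h2
    rw [mem_filter] at hy hy'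
    have e := congrFun (hy.2.trans hy'.2.symm) ⟨j - 1, by omega⟩
    simp only [φ] at e
    have d := hc y hy.1 ⟨j - 1, by omega⟩
    have d' := hc y' hy'.1 ⟨j - 1, by omega⟩
    simp only [show j - 1 + 1 = j by omega] at e d d'
    obtain ⟨c, hc1⟩ := d
    obtain ⟨c', hc1'⟩ := d'
    have hpj : ((p : ℤ) ^ j) ≠ 0 := by positivity
    rw [hc1, hc1', Int.mul_ediv_cancel_left _ hpj, Int.mul_ediv_cancel_left _ hpj] at e
    have e2 : (p : ℤ) ^ (k - 1 - (j - 1)) ∣ c - c' := Int.ModEq.dvd (Int.ModEq.symm e)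
    have e3 : ∑ i, y i ^ j - ∑ i, y' i ^ j = (p : ℤ) ^ j * (c - c') := by
      linear_combination hc1 - hc1'
    rw [e3, show k = j + (k - 1 - (j - 1)) by omega, pow_add]
    exact mul_dvd_mul_left _ e2

end VK

namespace VK
open Finset

/-- number of pairs with equal value -/
def energy {T : Type*} {k : ℕ} (X : Finset T) (v : T → Fin k → ℤ) : ℕ :=
  ((X ×ˢ X).filter fun q => v q.1 = v q.2).card

def rep {T : Type*} {k : ℕ} (X : Finset T) (v : T → Fin k → ℤ) (μ : Fin k → ℤ) : ℕ :=
  (X.filter fun x => v x = μ).card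

lemma pairs_eq {T T' : Type*} {k : ℕ} (X : Finset T) (v : T → Fin k → ℤ) (X' : Finset T')
    (v' : T' → Fin k → ℤ)
    (V : Finset (Fin k → ℤ)) (hV : ∀ x ∈ X, v x ∈ V) :
    ((X ×ˢ X').filter fun q => v q.1 = v' q.2).card = ∑ μ ∈ V, rep X v μ * rep X' v' μ := by
  classical
  rw [Finset.card_eq_sum_card_fiberwise (f := fun q => v q.1) (t := V)]
  · apply Finset.sum_congr rfl
    intro μ _
    unfold rep
    rw [← card_product]
    congr 1
    ext q
    simp only [mem_filter, mem_product]
    constructor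
    · rintro ⟨⟨⟨h1, h2⟩, h3⟩, h4⟩; exact ⟨⟨h1, h4⟩, h2, by rw [← h3, h4]⟩
    · rintro ⟨⟨h1, h2⟩, h3, h4⟩; exact ⟨⟨⟨h1, h3⟩, by rw [h2, h4]⟩, h2⟩
  · intro q hq
    simp only [coe_filter, mem_product, Set.mem_ofPred_eq] at hq
    exact hV _ hq.1.1

lemma energy_eq {T : Type*} {k : ℕ} (X : Finset T) (v : T → Fin k → ℤ)
    (V : Finset (Fin k → ℤ)) (hV : ∀ x ∈ X, v x ∈ V) :
    energy X v = ∑ μ ∈ V, rep X v μ ^ 2 := by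
  unfold energy
  rw [pairs_eq X v X v V hV]
  exact Finset.sum_congr rfl fun _ _ => by ring

lemma energy_mono {T : Type*} {k : ℕ} {X Y : Finset T} (h : X ⊆ Y) (v : T → Fin k → ℤ) :
    energy X v ≤ energy Y v := by
  unfold energy
  exact card_le_card (filter_subset_filter _ (product_subset_product h h))

lemma rep_sq_sum_le {T : Type*} {k : ℕ} (X : Finset T) (v : T → Fin k → ℤ)
    (V : Finset (Fin k → ℤ)) : ∑ μ ∈ V, rep X v μ ^ 2 ≤ energy X v := by
  classical
  rw [energy_eq X v (V ∪ X.image v) (fun x hx => mem_union_right _ (mem_image_of_mem _ hx))]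
  exact Finset.sum_le_sum_of_subset subset_union_left

lemma energy_cover {T I : Type*} {k : ℕ} (X : Finset T) (v : T → Fin k → ℤ) (s : Finset I)
    (Y : I → Finset T) (h : ∀ x ∈ X, ∃ i ∈ s, x ∈ Y i) :
    energy X v ≤ s.card * ∑ i ∈ s, energy (Y i) v := by
  classical
  rw [energy_eq X v (X.image v) (fun x hx => mem_image_of_mem _ hx)]
  calc ∑ μ ∈ X.image v, rep X v μ ^ 2
      ≤ ∑ μ ∈ X.image v, (∑ i ∈ s, rep (Y i) v μ) ^ 2 := by
        gcongr with μ _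
        calc rep X v μ ≤ (s.biUnion fun i => (Y i).filter fun x => v x = μ).card := by
              apply card_le_card
              intro x hx
              rw [mem_filter] at hx
              obtain ⟨i, hi, hxi⟩ := h x hx.1
              exact mem_biUnion.mpr ⟨i, hi, mem_filter.mpr ⟨hxi, hx.2⟩⟩
          _ ≤ _ := card_biUnion_le
    _ ≤ ∑ μ ∈ X.image v, s.card * ∑ i ∈ s, rep (Y i) v μ ^ 2 := by
        gcongr with μ _
        exact sq_sum_le_card_mul_sum_sq
    _ = s.card * ∑ i ∈ s, ∑ μ ∈ X.image v, rep (Y i) v μ ^ 2 := by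
        rw [← Finset.mul_sum, Finset.sum_comm]
    _ ≤ _ := by
        gcongr with i _
        exact rep_sq_sum_le _ _ _

lemma shifted_le {T : Type*} {k : ℕ} (X : Finset T) (v : T → Fin k → ℤ) (l : Fin k → ℤ) :
    ((X ×ˢ X).filter fun q => v q.1 = v q.2 + l).card ≤ energy X v := by
  classical
  rw [pairs_eq X v X (fun x => v x + l) (X.image v) (fun x hx => mem_image_of_mem _ hx)]
  have h1 := rep_sq_sum_le X v (X.image v)
  have h2 : ∑ μ ∈ X.image v, rep X (fun x => v x + l) μ ^ 2 ≤ energy X v := by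
    calc _ = ∑ μ ∈ (X.image v).image (fun μ => μ - l), rep X v μ ^ 2 := by
          refine Eq.trans ?_ (Finset.sum_image (by intro a _ b _ hab; simpa using hab)).symm
          apply Finset.sum_congr rfl
          intro μ _
          unfold rep
          simp only [eq_sub_iff_add_eq]
      _ ≤ _ := rep_sq_sum_le _ _ _
  have h3 : 2 * ∑ μ ∈ X.image v, rep X v μ * rep X (fun x => v x + l) μ ≤
      ∑ μ ∈ X.image v, rep X v μ ^ 2 + ∑ μ ∈ X.image v, rep X (fun x => v x + l) μ ^ 2 := by
    rw [Finset.mul_sum, ← Finset.sum_add_distrib]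
    gcongr with μ _
    have := two_mul_le_add_sq (rep X v μ) (rep X (fun x => v x + l) μ)
    linarith
  omega

/-- energy transfers along an injective map -/
lemma energy_le_of_map {T T' : Type*} {k : ℕ} (X : Finset T) (v : T → Fin k → ℤ) (X' : Finset T')
    (v' : T' → Fin k → ℤ) (g : T → T') (hg : Set.InjOn g X) (hm : ∀ x ∈ X, g x ∈ X')
    (hv : ∀ x ∈ X, ∀ y ∈ X, v x = v y → v' (g x) = v' (g y)) :
    energy X v ≤ energy X' v' := by
  unfold energy
  apply Finset.card_le_card_of_injOn (fun q => (g q.1, g q.2))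
  · intro q hq
    simp only [coe_filter, mem_product, Set.mem_ofPred_eq] at hq ⊢
    exact ⟨⟨hm _ hq.1.1, hm _ hq.1.2⟩, hv _ hq.1.1 _ hq.1.2 hq.2⟩
  · intro q hq r hr h
    simp only [coe_filter, mem_product, Set.mem_ofPred_eq] at hq hr
    simp only [Prod.mk.injEq] at h
    exact Prod.ext (hg hq.1.1 hr.1.1 h.1) (hg hq.1.2 hr.1.2 h.2)

/-! Fourier analysis -/

noncomputable def ech (m : ℕ) [NeZero m] {k : ℕ} (α : Fin k → ZMod m) (w : Fin k → ℤ) : ℂ :=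
  ZMod.stdAddChar (∑ j, α j * (w j : ZMod m))

lemma ech_add (m : ℕ) [NeZero m] {k : ℕ} (α : Fin k → ZMod m) (w w' : Fin k → ℤ) :
    ech m α (w + w') = ech m α w * ech m α w' := by
  unfold ech
  rw [← AddChar.map_add_eq_mul, ← Finset.sum_add_distrib]
  congr 1
  exact Finset.sum_congr rfl fun j _ => by push_cast [Pi.add_apply]; ring

lemma ech_zero (m : ℕ) [NeZero m] {k : ℕ} (α : Fin k → ZMod m) :
    ech m α (0 : Fin k → ℤ) = 1 := by
  unfold ech
  simp

lemma ech_sum (m : ℕ) [NeZero m] {k : ℕ} (α : Fin k → ZMod m) {ι : Type*} (s : Finset ι)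
    (w : ι → Fin k → ℤ) :
    ech m α (∑ i ∈ s, w i) = ∏ i ∈ s, ech m α (w i) := by
  classical
  induction s using Finset.induction_on with
  | empty => simp [ech_zero]
  | insert a s ha ih => rw [sum_insert ha, prod_insert ha, ech_add, ih]

lemma stdAddChar_sum (m : ℕ) [NeZero m] {ι : Type*} (s : Finset ι) (w : ι → ZMod m) :
    (ZMod.stdAddChar (∑ i ∈ s, w i) : ℂ) = ∏ i ∈ s, ZMod.stdAddChar (w i) := by
  classical
  induction s using Finset.induction_on with
  | empty => simp
  | insert a s ha ih => rw [sum_insert ha, prod_insert ha, AddChar.map_add_eq_mul, ih]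

lemma ech_orth (m : ℕ) [NeZero m] {k : ℕ} (w w' : Fin k → ℤ) :
    ∑ α : Fin k → ZMod m, ech m α w * (starRingEnd ℂ) (ech m α w') =
      if ∀ j, (w j : ZMod m) = (w' j : ZMod m) then (m : ℂ) ^ k else 0 := by
  have h1 : ∀ α : Fin k → ZMod m, ech m α w * (starRingEnd ℂ) (ech m α w') =
      ∏ j, ZMod.stdAddChar (α j * ((w j : ZMod m) - (w' j : ZMod m))) := by
    intro α
    unfold ech
    rw [← AddChar.map_neg_eq_conj, ← AddChar.map_add_eq_mul, ← stdAddChar_sum]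
    congr 1
    rw [← sub_eq_add_neg, ← Finset.sum_sub_distrib]
    exact Finset.sum_congr rfl fun j _ => by ring
  simp only [h1]
  have h2 := (Finset.prod_univ_sum (fun _ : Fin k => (univ : Finset (ZMod m)))
    (fun j a => (ZMod.stdAddChar (a * ((w j : ZMod m) - (w' j : ZMod m))) : ℂ))).symm
  rw [Fintype.piFinset_univ] at h2
  rw [h2]
  simp only [AddChar.sum_mulShift _ (ZMod.isPrimitive_stdAddChar m), sub_eq_zero, ZMod.card]
  split_ifs with h
  · simp [h]
  · push Not at h
    obtain ⟨j, hj⟩ := h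
    exact Finset.prod_eq_zero (mem_univ j) (by simp [hj])

lemma energy_fourier {T : Type*} {k : ℕ} (X : Finset T) (v : T → Fin k → ℤ) (m : ℕ) [NeZero m]
    (hm : ∀ x ∈ X, ∀ y ∈ X, ∀ j, |v x j - v y j| < m) :
    ∑ α : Fin k → ZMod m, ‖∑ x ∈ X, ech m α (v x)‖ ^ 2 = (m : ℝ) ^ k * energy X v := by
  have h : ∀ x ∈ X, ∀ y ∈ X, ((∀ j, (v x j : ZMod m) = (v y j : ZMod m)) ↔ v x = v y) := by
    intro x hx y hy
    constructor
    · intro h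
      funext j
      have h1 := h j
      rw [← sub_eq_zero, ← Int.cast_sub, ZMod.intCast_zmod_eq_zero_iff_dvd] at h1
      have := Int.eq_zero_of_abs_lt_dvd h1 (hm x hx y hy j)
      linarith
    · intro h j; rw [h]
  have key : (∑ α : Fin k → ZMod m, ((‖∑ x ∈ X, ech m α (v x)‖ ^ 2 : ℝ) : ℂ)) =
      (m : ℂ) ^ k * energy X v := by
    calc _ = ∑ α : Fin k → ZMod m, ∑ x ∈ X, ∑ y ∈ X,
          ech m α (v x) * (starRingEnd ℂ) (ech m α (v y)) := by
          apply Finset.sum_congr rfl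
          intro α _
          rw [Complex.ofReal_pow, ← Complex.mul_conj', map_sum, Finset.sum_mul_sum]
      _ = ∑ x ∈ X, ∑ y ∈ X, if v x = v y then (m : ℂ) ^ k else 0 := by
          rw [Finset.sum_comm]
          apply Finset.sum_congr rfl
          intro x hx
          rw [Finset.sum_comm]
          apply Finset.sum_congr rfl
          intro y hy
          rw [ech_orth]
          simp only [h x hx y hy]
      _ = _ := by
          rw [← Finset.sum_product', ← Finset.sum_filter, Finset.sum_const, nsmul_eq_mul,
            mul_comm]
          rfl
  exact_mod_cast key

lemma eventually_good {T : Type*} {k : ℕ} (X : Finset T) (v : T → Fin k → ℤ) :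
    ∀ᶠ m : ℕ in Filter.atTop, ∀ x ∈ X, ∀ y ∈ X, ∀ j, |v x j - v y j| < m := by
  simp only [Filter.eventually_all_finset, Filter.eventually_all]
  intro x _ y _ j
  filter_upwards [Filter.eventually_gt_atTop (|v x j - v y j|).toNat] with m hm
  omega

/-- pointwise Fourier inequality gives energy inequality -/
lemma energy_le_of_fourier {T : Type*} {I : Type*} {T' : I → Type*} {k : ℕ} (X : Finset T)
    (v : T → Fin k → ℤ) (s : Finset I) (Y : ∀ i, Finset (T' i)) (w : ∀ i, T' i → Fin k → ℤ) (c : ℕ)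
    (h : ∀ (m : ℕ) [NeZero m] (α : Fin k → ZMod m), ‖∑ x ∈ X, ech m α (v x)‖ ^ 2 ≤
      c * ∑ i ∈ s, ‖∑ x ∈ Y i, ech m α (w i x)‖ ^ 2) :
    energy X v ≤ c * ∑ i ∈ s, energy (Y i) (w i) := by
  have h1 : ∀ᶠ m : ℕ in Filter.atTop, ∀ i ∈ s, ∀ x ∈ Y i, ∀ y ∈ Y i, ∀ j,
      |w i x j - w i y j| < m := by
    rw [Filter.eventually_all_finset]
    intro i _
    exact eventually_good _ _
  obtain ⟨m, hm, hmX, hmY⟩ := ((Filter.eventually_gt_atTop 0).and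
    ((eventually_good X v).and h1)).exists
  have : NeZero m := ⟨hm.ne'⟩
  have h2 := Finset.sum_le_sum (s := univ) fun α (_ : α ∈ (univ : Finset (Fin k → ZMod m))) => h m α
  rw [energy_fourier X v m hmX, ← Finset.mul_sum, Finset.sum_comm,
    Finset.sum_congr rfl (fun i hi => energy_fourier (Y i) (w i) m (hmY i hi)),
    ← Finset.mul_sum] at h2
  have hmk : (0 : ℝ) < (m : ℝ) ^ k := by positivity
  have h3 : (energy X v : ℝ) ≤ c * ∑ i ∈ s, (energy (Y i) (w i) : ℝ) := by
    have : (m : ℝ) ^ k * (energy X v : ℝ) ≤ (m : ℝ) ^ k * (c * ∑ i ∈ s, (energy (Y i) (w i) : ℝ)) := by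
      linarith
    exact le_of_mul_le_mul_left this hmk
  exact_mod_cast h3

/-! power sums -/

def ps (k : ℕ) {ι : Type*} [Fintype ι] (x : ι → ℤ) : Fin k → ℤ := fun j => ∑ i, x i ^ (j.val + 1)

def mono (k : ℕ) (x : ℤ) : Fin k → ℤ := fun j => x ^ (j.val + 1)

lemma ps_eq_sum (k : ℕ) {ι : Type*} [Fintype ι] (x : ι → ℤ) : ps k x = ∑ i, mono k (x i) := by
  funext j; simp [ps, mono, Finset.sum_apply]

/-- Vinogradov count -/
def JJ (k s : ℕ) (A : Finset ℤ) : ℕ := energy (Fintype.piFinset fun _ : Fin s => A) (ps k)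

lemma sum_pi_ech (m : ℕ) [NeZero m] {k : ℕ} (α : Fin k → ZMod m) {ι : Type*} [Fintype ι]
    [DecidableEq ι] (A : ι → Finset ℤ) :
    ∑ x ∈ Fintype.piFinset A, ech m α (ps k x) = ∏ i, ∑ a ∈ A i, ech m α (mono k a) := by
  rw [Finset.prod_univ_sum]
  apply Finset.sum_congr rfl
  intro x _
  rw [ps_eq_sum, ech_sum]

lemma prod_le_sum_pow {ι : Type*} [Fintype ι] [Nonempty ι] (b : ι → ℝ) (hb : ∀ i, 0 ≤ b i) :
    ∏ i, b i ≤ ∑ i, b i ^ (Fintype.card ι) := by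
  obtain ⟨i0, -, hi0⟩ := Finset.exists_max_image univ b univ_nonempty
  calc ∏ i, b i ≤ ∏ _i : ι, b i0 := Finset.prod_le_prod (fun i _ => hb i) (fun i hi => hi0 i hi)
    _ = b i0 ^ (Fintype.card ι) := by simp
    _ ≤ _ := Finset.single_le_sum (f := fun i => b i ^ (Fintype.card ι))
        (fun i _ => pow_nonneg (hb i) _) (mem_univ i0)

lemma energy_pi_le {k s : ℕ} (hs : 0 < s) (A : Fin s → Finset ℤ) (K : ℕ) (hK : ∀ i, JJ k s (A i) ≤ K) :
    energy (Fintype.piFinset A) (ps k) ≤ s * K := by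
  have : Nonempty (Fin s) := ⟨⟨0, hs⟩⟩
  have := energy_le_of_fourier (Fintype.piFinset A) (ps k) (univ : Finset (Fin s))
    (fun i => Fintype.piFinset fun _ : Fin s => A i) (fun _ => ps k) 1 (by
      intro m _ α
      simp only [sum_pi_ech, norm_prod]
      have := prod_le_sum_pow (fun i => ‖∑ a ∈ A i, ech m α (mono k a)‖ ^ 2) (fun i => by positivity)
      rw [← Finset.prod_pow]
      simp only [Finset.prod_const, card_univ, Fintype.card_fin, ← pow_mul, mul_comm _ 2] at this ⊢
      simpa using this)
  calc _ ≤ 1 * ∑ i : Fin s, JJ k s (A i) := this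
    _ ≤ 1 * ∑ i : Fin s, K := by gcongr with i _; exact hK i
    _ = s * K := by simp

/-- power mean step -/
lemma energy_prod_le {k r : ℕ} (hr : 0 < r) (Y : Finset (Fin k → ℤ)) {I : Type*} (s : Finset I)
    (A : Finset ℤ) (B : I → Finset ℤ)
    (hA : ∀ g : ℤ → ℂ, ∑ a ∈ A, g a = ∑ i ∈ s, ∑ a ∈ B i, g a) (K : ℕ)
    (hK : ∀ i ∈ s, energy (Y ×ˢ Fintype.piFinset fun _ : Fin r => B i)
      (fun q => ps k q.1 + ps k q.2) ≤ K) :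
    energy (Y ×ˢ Fintype.piFinset fun _ : Fin r => A) (fun q => ps k q.1 + ps k q.2) ≤
      s.card ^ (2 * r) * K := by
  have hsplit : ∀ (C : Finset ℤ) (m : ℕ) [NeZero m] (α : Fin k → ZMod m),
      ∑ q ∈ Y ×ˢ Fintype.piFinset (fun _ : Fin r => C), ech m α (ps k q.1 + ps k q.2) =
      (∑ y ∈ Y, ech m α (ps k y)) * (∑ a ∈ C, ech m α (mono k a)) ^ r := by
    intro C m _ α
    rw [Finset.sum_product]
    simp only [ech_add, ← Finset.mul_sum, sum_pi_ech, Finset.prod_const, card_univ, Fintype.card_fin]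
    rw [Finset.sum_mul]
  have := energy_le_of_fourier (Y ×ˢ Fintype.piFinset fun _ : Fin r => A)
    (fun q => ps k q.1 + ps k q.2) s
    (fun i => Y ×ˢ Fintype.piFinset fun _ : Fin r => B i) (fun _ q => ps k q.1 + ps k q.2)
    (s.card ^ (2 * r - 1)) (by
      intro m _ α
      simp only [hsplit, norm_mul, norm_pow, mul_pow]
      rw [← Finset.mul_sum, hA]
      have h1 : ‖∑ i ∈ s, ∑ a ∈ B i, ech m α (mono k a)‖ ^ (2 * r) ≤
          (s.card : ℝ) ^ (2 * r - 1) * ∑ i ∈ s, ‖∑ a ∈ B i, ech m α (mono k a)‖ ^ (2 * r) := by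
        obtain ⟨n, hn⟩ : ∃ n, 2 * r = n + 1 := ⟨2 * r - 1, by omega⟩
        rw [hn]
        calc _ ≤ (∑ i ∈ s, ‖∑ a ∈ B i, ech m α (mono k a)‖) ^ (n + 1) := by
              gcongr; exact norm_sum_le _ _
          _ ≤ _ := by
              exact pow_sum_le_card_mul_sum_pow (fun i _ => norm_nonneg _) n
      simp only [← pow_mul, mul_comm r 2]
      push_cast
      calc _ ≤ ‖∑ y ∈ Y, ech m α (ps k y)‖ ^ 2 * ((s.card : ℝ) ^ (2 * r - 1) *
            ∑ i ∈ s, ‖∑ a ∈ B i, ech m α (mono k a)‖ ^ (2 * r)) := by gcongr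
        _ = _ := by ring)
  calc _ ≤ _ := this
    _ ≤ s.card ^ (2 * r - 1) * ∑ i ∈ s, K := by gcongr with i hi; exact hK i hi
    _ = s.card ^ (2 * r) * K := by
      rw [Finset.sum_const, smul_eq_mul, ← mul_assoc, ← pow_succ]
      congr 2; omega

end VK

namespace VK
open Finset

lemma ps_shift_aux {k : ℕ} {ι ι' : Type*} [Fintype ι] [Fintype ι'] (x y : ι → ℤ) (z w : ι' → ℤ)
    (h : ps k x + ps k z = ps k y + ps k w) (c : ℤ) :
    ps k (fun i => x i + c) + ps k (fun i => z i + c) =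
      ps k (fun i => y i + c) + ps k (fun i => w i + c) := by
  have key : ∀ n : ℕ, n < k + 1 → ∑ i, x i ^ n + ∑ i, z i ^ n = ∑ i, y i ^ n + ∑ i, w i ^ n := by
    intro n hn
    cases n with
    | zero => simp
    | succ n =>
      have := congrFun h ⟨n, by omega⟩
      simpa [ps] using this
  funext j
  simp only [ps, Pi.add_apply, add_pow]
  rw [Finset.sum_comm, Finset.sum_comm (s := (univ : Finset ι')),
    Finset.sum_comm (s := (univ : Finset ι)), Finset.sum_comm (s := (univ : Finset ι')),
    ← Finset.sum_add_distrib, ← Finset.sum_add_distrib]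
  apply Finset.sum_congr rfl
  intro n hn
  have := key n (by have := j.2; simp only [Finset.mem_range] at hn; omega)
  simp only [mul_assoc]
  rw [← Finset.sum_mul, ← Finset.sum_mul, ← Finset.sum_mul, ← Finset.sum_mul, ← add_mul, ← add_mul,
    this]

lemma ps_shift {k : ℕ} {ι : Type*} [Fintype ι] (x y : ι → ℤ)
    (h : ps k x = ps k y) (c : ℤ) :
    ps k (fun i => x i + c) = ps k (fun i => y i + c) := by
  have := ps_shift_aux x y (fun i : Fin 0 => (0 : ℤ)) (fun i : Fin 0 => (0 : ℤ)) (by rw [h]) c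
  simpa using this

lemma ps_smul {k : ℕ} {ι : Type*} [Fintype ι] (x : ι → ℤ) (p : ℤ) (j : Fin k) :
    ps k (fun i => p * x i) j = p ^ (j.val + 1) * ps k x j := by
  simp [ps, mul_pow, Finset.mul_sum]

/-- class of `a` mod `p` -/
def cls (p : ℕ) (A : Finset ℤ) (a : ℕ) : Finset ℤ := A.filter fun x => x % p = a

lemma mem_cls_eq {p : ℕ} {A : Finset ℤ} {a : ℕ} {x : ℤ} (h : x ∈ cls p A a) :
    x = p * (x / p) + a := by
  have := (mem_filter.mp h).2
  have h2 := Int.mul_ediv_add_emod x p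
  omega

lemma JJ_cls_le (k r p P a : ℕ) (hp : 0 < p) :
    JJ k r (cls p (Ico 0 (P : ℤ)) a) ≤ JJ k r (Ico 0 ((P / p + 1 : ℕ) : ℤ)) := by
  unfold JJ
  apply energy_le_of_map _ _ _ _ (fun (x : Fin r → ℤ) i => x i / p)
  · intro x hx y hy h
    funext i
    rw [Finset.mem_coe, Fintype.mem_piFinset] at hx hy
    have h1 := mem_cls_eq (hx i)
    have h2 := mem_cls_eq (hy i)
    have h3 := congrFun h i
    simp only at h3
    rw [h1, h2, h3]
  · intro x hx
    rw [Fintype.mem_piFinset] at hx ⊢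
    intro i
    have h0 := (mem_filter.mp (hx i)).1
    rw [mem_Ico] at h0 ⊢
    constructor
    · exact Int.ediv_nonneg h0.1 (by positivity)
    · have : x i / p ≤ (P : ℤ) / p := Int.ediv_le_ediv (by positivity) h0.2.le
      push_cast
      omega
  · intro x hx y hy h
    rw [Fintype.mem_piFinset] at hx hy
    have h1 := ps_shift x y h (-a)
    have hx' : (fun i => x i + (-a : ℤ)) = fun i => (p : ℤ) * (x i / p) := by
      funext i; have := mem_cls_eq (hx i); omega
    have hy' : (fun i => y i + (-a : ℤ)) = fun i => (p : ℤ) * (y i / p) := by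
      funext i; have := mem_cls_eq (hy i); omega
    rw [hx', hy'] at h1
    funext j
    have h2 := congrFun h1 j
    rw [ps_smul, ps_smul] at h2
    exact mul_left_cancel₀ (by positivity) h2

lemma energy_mixed {T U : Type*} {k : ℕ} (Y : Finset T) (B : Finset U) (v : T → Fin k → ℤ)
    (w : U → Fin k → ℤ) (N : ℕ)
    (h : ∀ y' ∈ Y, (Y.filter fun y => ∃ z ∈ B, ∃ z' ∈ B, v y + w z = v y' + w z').card ≤ N) :
    energy (Y ×ˢ B) (fun q => v q.1 + w q.2) ≤ Y.card * N * energy B w := by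
  classical
  unfold energy
  set E := ((Y ×ˢ B) ×ˢ (Y ×ˢ B)).filter fun q => v q.1.1 + w q.1.2 = v q.2.1 + w q.2.2 with hE
  set G : Finset (T × T) := Y.biUnion fun y' =>
    (Y.filter fun y => ∃ z ∈ B, ∃ z' ∈ B, v y + w z = v y' + w z').image fun y => (y, y') with hG
  have hGc : G.card ≤ Y.card * N := by
    calc G.card ≤ ∑ y' ∈ Y, _ := card_biUnion_le
      _ ≤ ∑ y' ∈ Y, N := Finset.sum_le_sum fun y' hy' => card_image_le.trans (h y' hy')
      _ = _ := by simp
  have hmaps : ∀ q ∈ E, (q.1.1, q.2.1) ∈ G := by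
    intro q hq
    simp only [hE, mem_filter, mem_product] at hq
    simp only [hG, mem_biUnion, mem_image, mem_filter]
    exact ⟨q.2.1, hq.1.2.1, q.1.1, ⟨hq.1.1.1, q.1.2, hq.1.1.2, q.2.2, hq.1.2.2, hq.2⟩, rfl⟩
  calc E.card ≤ energy B w * G.card := by
        apply Finset.card_le_mul_card_image_of_maps_to hmaps
        rintro ⟨y, y'⟩ -
        refine le_trans ?_ (shifted_le B w (v y' - v y))
        apply Finset.card_le_card_of_injOn (fun q => (q.1.2, q.2.2))
        · intro q hq
          simp only [hE, coe_filter, mem_filter, mem_product, Set.mem_ofPred_eq, Prod.mk.injEq] at hq ⊢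
          obtain ⟨⟨⟨⟨_, h1⟩, _, h2⟩, h3⟩, h4, h5⟩ := hq
          refine ⟨⟨h1, h2⟩, ?_⟩
          rw [← h4, ← h5]
          have : w q.1.2 = v q.2.1 + w q.2.2 - v q.1.1 := by rw [← h3]; abel
          rw [this]; abel
        · intro q hq q' hq' hqq
          simp only [coe_filter, Set.mem_ofPred_eq, Prod.mk.injEq] at hq hq' hqq
          obtain ⟨-, h1, h2⟩ := hq
          obtain ⟨-, h3, h4⟩ := hq'
          ext1 <;> ext1
          · rw [h1, h3]
          · exact hqq.1
          · rw [h2, h4]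
          · exact hqq.2
    _ ≤ energy B w * (Y.card * N) := by gcongr
    _ = _ := by unfold energy; ring

/-- tuples distinct mod `p` -/
noncomputable def YY (k p P : ℕ) : Finset (Fin k → ℤ) :=
  (Fintype.piFinset fun _ : Fin k => Ico 0 (P : ℤ)).filter
    fun y => ∀ i j, (p : ℤ) ∣ y i - y j → i = j

lemma YY_card (k p P : ℕ) : (YY k p P).card ≤ P ^ k := by
  refine (card_filter_le _ _).trans ?_
  simp

lemma energy_YY {k p P r : ℕ} (hp : p.Prime) (hk : 0 < k) (hkp : k < p) (hP : P ≤ p ^ k) (a : ℕ) :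
    energy (YY k p P ×ˢ Fintype.piFinset fun _ : Fin r => cls p (Ico 0 (P : ℤ)) a)
      (fun q => ps k q.1 + ps k q.2) ≤
      P ^ k * (k.factorial * p ^ (k * (k - 1) / 2)) * JJ k r (Ico 0 ((P / p + 1 : ℕ) : ℤ)) := by
  classical
  refine (energy_mixed _ _ _ _ (k.factorial * p ^ (k * (k - 1) / 2)) ?_).trans ?_
  · intro y' hy'
    set S := (YY k p P).filter fun y => ∃ z ∈ Fintype.piFinset fun _ : Fin r => cls p (Ico 0 (P : ℤ)) a,
      ∃ z' ∈ Fintype.piFinset fun _ : Fin r => cls p (Ico 0 (P : ℤ)) a,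
        ps k y + ps k z = ps k y' + ps k z' with hS
    set g : (Fin k → ℤ) → Fin k → ℤ := fun y i => (y i - a) % ((p : ℤ) ^ k) with hg
    have hpk : (0 : ℤ) < (p : ℤ) ^ k := by have := hp.pos; positivity
    have hPk : (P : ℤ) ≤ (p : ℤ) ^ k := by exact_mod_cast hP
    have hYm : ∀ y ∈ YY k p P, ∀ i, 0 ≤ y i ∧ y i < P := by
      intro y hy i
      have := Fintype.mem_piFinset.mp (mem_filter.mp hy).1 i
      rwa [mem_Ico] at this
    have hinj : Set.InjOn g S := by
      intro x hx y hy h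
      funext i
      have h1 := congrFun h i
      simp only [hg] at h1
      have hx1 := hYm x (mem_filter.mp hx).1 i
      have hy1 := hYm y (mem_filter.mp hy).1 i
      have h2 : (p : ℤ) ^ k ∣ (x i - a) - (y i - a) := Int.ModEq.dvd (show _ ≡ _ [ZMOD _] from h1.symm)
      have h3 := Int.eq_zero_of_abs_lt_dvd h2 (by rw [abs_lt]; constructor <;> linarith)
      linarith
    rw [← card_image_of_injOn hinj]
    have hdv : ∀ y : Fin k → ℤ, ∀ i, (p : ℤ) ^ k ∣ (y i - a) - g y i := fun y i =>
      Int.dvd_self_sub_emod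
    apply linnik hp hk hkp (p ^ k) le_rfl (ps k fun i => y' i - a)
    · intro y hy
      obtain ⟨x, hx, rfl⟩ := mem_image.mp hy
      refine ⟨fun i => ⟨Int.emod_nonneg _ hpk.ne', by push_cast; exact Int.emod_lt_of_pos _ hpk⟩, ?_⟩
      intro i j hij
      apply (mem_filter.mp (mem_filter.mp hx).1).2 i j
      have hpp : (p : ℤ) ∣ (p : ℤ) ^ k := dvd_pow_self _ hk.ne'
      have h1 := hpp.trans (hdv x i)
      have h2 := hpp.trans (hdv x j)
      have := (h1.sub h2).add hij
      have e : x i - x j = x i - a - g x i - (x j - a - g x j) + (g x i - g x j) := by ring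
      rw [e]; exact this
    · intro y hy j
      obtain ⟨x, hx, rfl⟩ := mem_image.mp hy
      obtain ⟨z, hz, z', hz', h⟩ := (mem_filter.mp hx).2
      rw [Fintype.mem_piFinset] at hz hz'
      have h1 := ps_shift_aux x y' z z' h (-a)
      have e1 : (fun i => z i + (-a : ℤ)) = fun i => (p : ℤ) * (z i / p) := by
        funext i; have := mem_cls_eq (hz i); omega
      have e2 : (fun i => z' i + (-a : ℤ)) = fun i => (p : ℤ) * (z' i / p) := by
        funext i; have := mem_cls_eq (hz' i); omega
      rw [e1, e2] at h1
      have h2 := congrFun h1 j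
      simp only [Pi.add_apply, ps_smul] at h2
      have hjk : (p : ℤ) ^ (j.val + 1) ∣ (p : ℤ) ^ k := pow_dvd_pow _ j.2
      have h3 : (p : ℤ) ^ (j.val + 1) ∣ ps k (fun i => x i - a) j - ∑ i, g x i ^ (j.val + 1) := by
        simp only [ps, ← Finset.sum_sub_distrib]
        apply Finset.dvd_sum
        intro i _
        exact (hjk.trans (hdv x i)).trans (sub_dvd_pow_sub_pow _ _ _)
      have h4 : (p : ℤ) ^ (j.val + 1) ∣ ps k (fun i => x i - a) j - ps k (fun i => y' i - a) j := by
        refine ⟨ps k (fun i => z' i / p) j - ps k (fun i => z i / p) j, ?_⟩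
        simp only [sub_eq_add_neg] at h2 ⊢
        linear_combination h2
      have := h4.sub h3
      have e : ∑ i, g x i ^ (j.val + 1) - ps k (fun i => y' i - a) j =
        ps k (fun i => x i - a) j - ps k (fun i => y' i - a) j -
          (ps k (fun i => x i - a) j - ∑ i, g x i ^ (j.val + 1)) := by ring
      rw [e]; exact this
  · gcongr
    · exact YY_card k p P
    · exact JJ_cls_le k r p P a hp.pos

lemma energy_YA {k p P r : ℕ} (hp : p.Prime) (hk : 0 < k) (hkp : k < p) (hP : P ≤ p ^ k) (hr : 0 < r) :
    energy (YY k p P ×ˢ Fintype.piFinset fun _ : Fin r => Ico 0 (P : ℤ))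
      (fun q => ps k q.1 + ps k q.2) ≤ p ^ (2 * r) *
      (P ^ k * (k.factorial * p ^ (k * (k - 1) / 2)) * JJ k r (Ico 0 ((P / p + 1 : ℕ) : ℤ))) := by
  have := energy_prod_le hr (YY k p P) (range p) (Ico 0 (P : ℤ)) (fun a => cls p (Ico 0 (P : ℤ)) a)
    (fun g => by
      symm
      have hp' : (0 : ℤ) < p := by exact_mod_cast hp.pos
      have := Finset.sum_fiberwise_of_maps_to (s := Ico 0 (P : ℤ)) (t := range p)
        (g := fun x => (x % p).toNat) (by
          intro x _
          rw [mem_range]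
          have := Int.emod_lt_of_pos x hp'
          have := Int.emod_nonneg x hp'.ne'
          omega) g
      rw [← this]
      apply Finset.sum_congr rfl
      intro a _
      apply Finset.sum_congr _ (fun _ _ => rfl)
      unfold cls
      apply Finset.filter_congr
      intro x _
      have := Int.emod_nonneg x hp'.ne'
      omega) _ (fun a _ => energy_YY hp hk hkp hP a)
  simpa using this

lemma exists_equiv {k r : ℕ} (σ : Fin k ↪ Fin (r + k)) :
    ∃ e : Fin k ⊕ Fin r ≃ Fin (r + k), ∀ i, e (Sum.inl i) = σ i := by
  classical
  have hc : Fintype.card ↥(Set.range σ)ᶜ = r := by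
    rw [Fintype.card_compl_set, Set.card_range_of_injective σ.injective]
    simp
  let e1 : Fin r ≃ ↥(Set.range σ)ᶜ := (Fintype.equivFinOfCardEq hc).symm
  let e2 : Fin k ≃ ↥(Set.range σ) := Equiv.ofInjective σ σ.injective
  refine ⟨(Equiv.sumCongr e2 e1).trans (Equiv.Set.sumCompl (Set.range σ)), fun i => ?_⟩
  simp [e2]

lemma energy_nondeg {k p P r : ℕ} (hp : p.Prime) (hk : 0 < k) (hkp : k < p) (hP : P ≤ p ^ k)
    (hr : 0 < r) (σ : Fin k ↪ Fin (r + k)) :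
    energy ((Fintype.piFinset fun _ : Fin (r + k) => Ico 0 (P : ℤ)).filter fun x =>
        ∀ i j, (p : ℤ) ∣ x (σ i) - x (σ j) → i = j) (ps k) ≤ p ^ (2 * r) *
      (P ^ k * (k.factorial * p ^ (k * (k - 1) / 2)) * JJ k r (Ico 0 ((P / p + 1 : ℕ) : ℤ))) := by
  classical
  obtain ⟨e, he⟩ := exists_equiv σ
  refine le_trans ?_ (energy_YA hp hk hkp hP hr)
  have hps : ∀ x : Fin (r + k) → ℤ, ps k (fun i => x (σ i)) + ps k (fun i => x (e (Sum.inr i))) =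
      ps k x := by
    intro x
    funext j
    simp only [ps, Pi.add_apply, ← he]
    rw [← e.sum_comp, Fintype.sum_sum_type]
  apply energy_le_of_map _ _ _ _ (fun x => (fun i => x (σ i), fun i => x (e (Sum.inr i))))
  · intro x _ y _ h
    simp only [Prod.mk.injEq] at h
    funext i
    obtain ⟨j, rfl⟩ := e.surjective i
    rcases j with j | j
    · rw [he]; exact congrFun h.1 j
    · exact congrFun h.2 j
  · intro x hx
    rw [mem_filter, Fintype.mem_piFinset] at hx
    simp only [YY, mem_product, mem_filter, Fintype.mem_piFinset]
    exact ⟨⟨fun i => hx.1 _, hx.2⟩, fun i => hx.1 _⟩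
  · intro x _ y _ h
    simp only [hps, h]

lemma energy_deg {k p P s : ℕ} (hp : p.Prime) (hkp : k < p) (hs : 0 < s) (X : Finset (Fin s → ℤ))
    (hX : X ⊆ Fintype.piFinset fun _ : Fin s => Ico 0 (P : ℤ))
    (hX2 : ∀ x ∈ X, ∀ σ : Fin k ↪ Fin s, ¬ ∀ i j, (p : ℤ) ∣ x (σ i) - x (σ j) → i = j) :
    energy X (ps k) ≤ (p ^ (k - 1) * (k - 1) ^ s) ^ 2 * (s * JJ k s (Ico 0 ((P / p + 1 : ℕ) : ℤ))) := by
  classical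
  have hp' : (0 : ℤ) < p := by exact_mod_cast hp.pos
  let I := (Fin (k - 1) → Fin p) × (Fin s → Fin (k - 1))
  have hcov : ∀ x ∈ X, ∃ i ∈ (univ : Finset I), x ∈
      Fintype.piFinset fun l => cls p (Ico 0 (P : ℤ)) (i.1 (i.2 l)).val := by
    intro x hx
    have hlt : ∀ l, (x l % p).toNat < p := by
      intro l
      have := Int.emod_lt_of_pos (x l) hp'
      have := Int.emod_nonneg (x l) hp'.ne'
      omega
    let res : Fin s → Fin p := fun l => ⟨(x l % p).toNat, hlt l⟩
    have hcard : (univ.image res).card ≤ k - 1 := by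
      by_contra hc
      push Not at hc
      have hc' : k ≤ (univ.image res).card := by omega
      obtain ⟨R, hR, hRc⟩ := Finset.exists_subset_card_eq hc'
      have hpre : ∀ c : R, ∃ l, res l = c := by
        intro c
        obtain ⟨l, -, hl⟩ := mem_image.mp (hR c.2)
        exact ⟨l, hl⟩
      choose pre hpre using hpre
      let e := (Finset.equivFinOfCardEq hRc).symm
      refine hX2 x hx ⟨fun i => pre (e i), ?_⟩ ?_
      · intro i j hij
        simp only at hij
        apply e.injective
        apply Subtype.ext
        rw [← hpre, ← hpre, hij]
      · intro i j hij
        apply e.injective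
        apply Subtype.ext
        rw [← hpre, ← hpre]
        apply Fin.ext
        simp only [res]
        have : x (pre (e i)) % p = x (pre (e j)) % p := Int.ModEq.symm (Int.modEq_iff_dvd.mpr hij)
        rw [this]
    obtain ⟨R, hR, hRc⟩ := Finset.exists_superset_card_eq hcard (by simp; omega)
    let e := Finset.equivFinOfCardEq hRc
    refine ⟨(fun c => (e.symm c).1, fun l => e ⟨res l, hR (mem_image_of_mem _ (mem_univ l))⟩),
      mem_univ _, ?_⟩
    rw [Fintype.mem_piFinset]
    intro l
    have := Fintype.mem_piFinset.mp (hX hx) l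
    simp only [cls, mem_filter, this, true_and, Equiv.symm_apply_apply, res]
    have := Int.emod_nonneg (x l) hp'.ne'
    omega
  refine (energy_cover X (ps k) univ _ hcov).trans ?_
  calc _ ≤ (univ : Finset I).card * ∑ i ∈ (univ : Finset I),
        s * JJ k s (Ico 0 ((P / p + 1 : ℕ) : ℤ)) := by
        gcongr with i _
        exact energy_pi_le hs _ _ (fun l => JJ_cls_le k s p P _ hp.pos)
    _ = _ := by
        simp [I]
        ring

/-- The main recursion. -/
theorem JJ_rec {k p P r : ℕ} (hp : p.Prime) (hk : 0 < k) (hkp : k < p) (hP : P ≤ p ^ k)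
    (hr : 0 < r) :
    JJ k (r + k) (Ico 0 (P : ℤ)) ≤ 2 * (((r + k) ^ k) ^ 2 * (p ^ (2 * r) *
      (P ^ k * (k.factorial * p ^ (k * (k - 1) / 2)) * JJ k r (Ico 0 ((P / p + 1 : ℕ) : ℤ)))) +
      (p ^ (k - 1) * (k - 1) ^ (r + k)) ^ 2 *
        ((r + k) * JJ k (r + k) (Ico 0 ((P / p + 1 : ℕ) : ℤ)))) := by
  classical
  set A := Fintype.piFinset fun _ : Fin (r + k) => Ico 0 (P : ℤ) with hA
  let NN := A.filter fun x => ∃ σ : Fin k ↪ Fin (r + k), ∀ i j, (p : ℤ) ∣ x (σ i) - x (σ j) → i = j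
  let DD := A.filter fun x => ¬ ∃ σ : Fin k ↪ Fin (r + k), ∀ i j, (p : ℤ) ∣ x (σ i) - x (σ j) → i = j
  have h1 := energy_cover A (ps k) (univ : Finset Bool) (fun b => if b then NN else DD) (by
    intro x hx
    by_cases h : ∃ σ : Fin k ↪ Fin (r + k), ∀ i j, (p : ℤ) ∣ x (σ i) - x (σ j) → i = j
    · exact ⟨true, mem_univ _, by simp only [if_true]; exact mem_filter.mpr ⟨hx, h⟩⟩
    · exact ⟨false, mem_univ _, by simp only [Bool.false_eq_true, if_false]; exact mem_filter.mpr ⟨hx, h⟩⟩)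
  simp only [Fintype.sum_bool, if_true, Bool.false_eq_true, if_false, card_univ, Fintype.card_bool] at h1
  refine h1.trans ?_
  gcongr
  · refine (energy_cover NN (ps k) (univ : Finset (Fin k ↪ Fin (r + k))) (fun σ => A.filter fun x =>
        ∀ i j, (p : ℤ) ∣ x (σ i) - x (σ j) → i = j) ?_).trans ?_
    · intro x hx
      obtain ⟨σ, hσ⟩ := (mem_filter.mp hx).2
      exact ⟨σ, mem_univ _, mem_filter.mpr ⟨(mem_filter.mp hx).1, hσ⟩⟩
    · have hc : (univ : Finset (Fin k ↪ Fin (r + k))).card ≤ (r + k) ^ k := by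
        rw [card_univ, Fintype.card_embedding_eq]
        simpa using Nat.descFactorial_le_pow _ _
      calc _ ≤ (univ : Finset (Fin k ↪ Fin (r + k))).card * ∑ σ ∈ (univ : Finset (Fin k ↪ Fin (r + k))),
            p ^ (2 * r) * (P ^ k * (k.factorial * p ^ (k * (k - 1) / 2)) *
              JJ k r (Ico 0 ((P / p + 1 : ℕ) : ℤ))) := by
            gcongr with σ _
            exact energy_nondeg hp hk hkp hP hr σ
        _ = (univ : Finset (Fin k ↪ Fin (r + k))).card ^ 2 * (p ^ (2 * r) *
            (P ^ k * (k.factorial * p ^ (k * (k - 1) / 2)) *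
              JJ k r (Ico 0 ((P / p + 1 : ℕ) : ℤ)))) := by
            rw [Finset.sum_const, smul_eq_mul]; ring
        _ ≤ _ := by gcongr
  · apply energy_deg hp hkp (by omega)
    · exact filter_subset _ _
    · intro x hx σ h
      exact (mem_filter.mp hx).2 ⟨σ, h⟩

end VK

namespace VK
open Finset

lemma JJ_trivial (k s P : ℕ) : JJ k s (Ico 0 (P : ℤ)) ≤ P ^ (2 * s) := by
  unfold JJ energy
  refine (card_filter_le _ _).trans ?_
  rw [card_product]
  simp [two_mul, pow_add]

lemma one_add_pow_le {x e : ℝ} (hx : 0 ≤ x) (he : 0 ≤ e) (h : x * e ≤ 1) : (1 + x) ^ e ≤ 3 := by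
  calc (1 + x) ^ e ≤ (Real.exp x) ^ e := by
        apply Real.rpow_le_rpow (by linarith) _ he
        linarith [Real.add_one_le_exp x]
    _ = Real.exp (x * e) := by rw [← Real.exp_mul]
    _ ≤ Real.exp 1 := Real.exp_le_exp.mpr h
    _ ≤ 3 := by linarith [Real.exp_one_lt_d9]

set_option maxHeartbeats 1000000 in
lemma JJ_step {k p P r : ℕ} (hp : p.Prime) (hk : 4 ≤ k) (hr : k * k ≤ r) (hP : P ≤ p ^ k)
    (hpb : (64 : ℝ) * k ^ 4 ≤ p) (hp4 : (p : ℝ) ≤ 4 * (P : ℝ) ^ ((1 : ℝ) / k))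
    (hP2 : 2 * ((r : ℝ) + k) * p ≤ P) (η D D' : ℝ) (hη : 0 ≤ η) (hη2 : η ≤ (k : ℝ) * (k + 1) / 2)
    (hD : 0 ≤ D)
    (hDD : 12 * ((r : ℝ) + k) ^ (2 * k) * k ^ k * 4 ^ (k * k) * D ≤ D')
    (h1 : (JJ k r (Ico 0 ((P / p + 1 : ℕ) : ℤ)) : ℝ) ≤
      D * ((P / p + 1 : ℕ) : ℝ) ^ (2 * (r : ℝ) - (k : ℝ) * (k + 1) / 2 + η))
    (h2 : (JJ k (r + k) (Ico 0 ((P / p + 1 : ℕ) : ℤ)) : ℝ) ≤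
      D' * ((P / p + 1 : ℕ) : ℝ) ^ (2 * ((r : ℝ) + k) - (k : ℝ) * (k + 1) / 2 + η * (1 - 1 / k))) :
    (JJ k (r + k) (Ico 0 (P : ℤ)) : ℝ) ≤
      D' * (P : ℝ) ^ (2 * ((r : ℝ) + k) - (k : ℝ) * (k + 1) / 2 + η * (1 - 1 / k)) := by
  have hk0 : (4 : ℝ) ≤ k := by exact_mod_cast hk
  have hrk : (k : ℝ) * k ≤ r := by exact_mod_cast hr
  have hk1 : (1 : ℝ) / k ≤ 1 / 4 := by apply one_div_le_one_div_of_le <;> linarith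
  have hk2 : (0 : ℝ) < 1 / k := by positivity
  set K : ℝ := (k : ℝ) * (k + 1) / 2 with hK
  set e : ℝ := 2 * (r : ℝ) - K + η with he
  set E : ℝ := 2 * ((r : ℝ) + k) - K + η * (1 - 1 / k) with hE
  have hp0 : (0 : ℝ) < p := by exact_mod_cast hp.pos
  have hp1 : (1 : ℝ) ≤ p := by exact_mod_cast hp.one_le
  have hP0 : (0 : ℝ) < P := by
    have : 0 < 2 * ((r : ℝ) + k) * p := by positivity
    linarith
  have hKk : K ≤ (k : ℝ) * k := by rw [hK]; nlinarith only [hk0]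
  have hKr : K ≤ r := by linarith
  have he0 : 0 ≤ e := by rw [he]; linarith
  have hηk : 0 ≤ η * (1 - 1 / k) := mul_nonneg hη (by linarith)
  have hηk2 : η * (1 - 1 / k) ≤ η := by nlinarith
  have hE0 : (r : ℝ) + k ≤ E := by rw [hE]; linarith
  have hE2 : E ≤ 2 * ((r : ℝ) + k) := by rw [hE]; linarith
  have he2 : e ≤ 2 * ((r : ℝ) + k) := by rw [he]; linarith
  have hx : (p : ℝ) / P * (2 * ((r : ℝ) + k)) ≤ 1 := by
    rw [div_mul_eq_mul_div, div_le_one hP0]; linarith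
  have hQ : (((P / p + 1 : ℕ)) : ℝ) ≤ P / p * (1 + p / P) := by
    push_cast
    have : ((P / p : ℕ) : ℝ) ≤ P / p := Nat.cast_div_le
    have h3 : (P : ℝ) / p * (1 + p / P) = P / p + 1 := by field_simp
    rw [h3]; linarith
  have hQe : ∀ t : ℝ, 0 ≤ t → t ≤ 2 * ((r : ℝ) + k) →
      (((P / p + 1 : ℕ)) : ℝ) ^ t ≤ (P / p) ^ t * 3 := by
    intro t ht ht2
    calc (((P / p + 1 : ℕ)) : ℝ) ^ t ≤ (P / p * (1 + p / P)) ^ t :=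
          Real.rpow_le_rpow (by positivity) hQ ht
      _ = (P / p) ^ t * (1 + p / P) ^ t := Real.mul_rpow (by positivity) (by positivity)
      _ ≤ _ := by
          gcongr
          apply one_add_pow_le (by positivity) ht
          refine le_trans ?_ hx
          gcongr
  have hD' : 0 ≤ D' := le_trans (by positivity) hDD
  have hrec := JJ_rec (r := r) hp (by omega) (by
    have : (k : ℝ) < p := by
      have : (k : ℝ) ≤ k ^ 4 := by
        calc (k : ℝ) = k * 1 := by ring
          _ ≤ k * k ^ 3 := by gcongr; exact one_le_pow₀ (by linarith)
          _ = _ := by ring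
      nlinarith
    exact_mod_cast this) hP (by nlinarith)
  have hrec' := (Nat.cast_le (α := ℝ)).mpr hrec
  push_cast at hrec'
  have hkk : ((k * (k - 1) / 2 : ℕ) : ℝ) = (k : ℝ) * (k - 1) / 2 := by
    rw [← Nat.choose_two_right, Nat.cast_choose_two]
  have t1 : (((r : ℝ) + k) ^ k) ^ 2 * ((p : ℝ) ^ (2 * r) *
      ((P : ℝ) ^ k * ((k.factorial : ℝ) * (p : ℝ) ^ (k * (k - 1) / 2)) *
        (JJ k r (Ico 0 ((P / p + 1 : ℕ) : ℤ)) : ℝ))) ≤ D' / 4 * (P : ℝ) ^ E := by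
    have a1 : (JJ k r (Ico 0 ((P / p + 1 : ℕ) : ℤ)) : ℝ) ≤ D * ((P / p) ^ e * 3) :=
      h1.trans (by gcongr; exact hQe e he0 he2)
    have a2 : (p : ℝ) ^ (2 * r) * (p : ℝ) ^ (k * (k - 1) / 2) * (p : ℝ) ^ (-e) ≤
        4 ^ (k * k) * (P : ℝ) ^ ((k : ℝ) - η / k) := by
      rw [← pow_add, ← Real.rpow_natCast (p : ℝ), ← Real.rpow_add hp0]
      push_cast
      rw [hkk]
      have : 2 * (r : ℝ) + (k : ℝ) * (k - 1) / 2 + -e = k * k - η := by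
        rw [he, hK]; ring
      rw [this]
      have hexp : 0 ≤ (k : ℝ) * k - η := by linarith
      calc (p : ℝ) ^ ((k : ℝ) * k - η) ≤ (4 * (P : ℝ) ^ ((1 : ℝ) / k)) ^ ((k : ℝ) * k - η) :=
            Real.rpow_le_rpow hp0.le hp4 hexp
        _ = 4 ^ ((k : ℝ) * k - η) * (P : ℝ) ^ ((k : ℝ) - η / k) := by
            rw [Real.mul_rpow (by norm_num) (by positivity), ← Real.rpow_mul hP0.le]
            congr 2
            field_simp
        _ ≤ 4 ^ ((k : ℝ) * k) * (P : ℝ) ^ ((k : ℝ) - η / k) := by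
            gcongr
            · norm_num
            · linarith
        _ = _ := by
            congr 1
            rw [← Real.rpow_natCast]
            push_cast; rfl
    have a3 : (k.factorial : ℝ) ≤ (k : ℝ) ^ k := by exact_mod_cast Nat.factorial_le_pow k
    calc _ ≤ (((r : ℝ) + k) ^ k) ^ 2 * ((p : ℝ) ^ (2 * r) *
      ((P : ℝ) ^ k * ((k : ℝ) ^ k * (p : ℝ) ^ (k * (k - 1) / 2)) * (D * ((P / p) ^ e * 3)))) := by
          gcongr
      _ = 3 * (((r : ℝ) + k) ^ (2 * k)) * k ^ k * D * ((P : ℝ) ^ k * (P : ℝ) ^ e) *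
          ((p : ℝ) ^ (2 * r) * (p : ℝ) ^ (k * (k - 1) / 2) * (p : ℝ) ^ (-e)) := by
          rw [Real.div_rpow hP0.le hp0.le, Real.rpow_neg hp0.le, pow_mul' _ 2 k]
          field_simp
      _ ≤ 3 * (((r : ℝ) + k) ^ (2 * k)) * k ^ k * D * ((P : ℝ) ^ k * (P : ℝ) ^ e) *
          (4 ^ (k * k) * (P : ℝ) ^ ((k : ℝ) - η / k)) := by gcongr
      _ = (12 * ((r : ℝ) + k) ^ (2 * k) * k ^ k * 4 ^ (k * k) * D) / 4 *
          ((P : ℝ) ^ k * (P : ℝ) ^ e * (P : ℝ) ^ ((k : ℝ) - η / k)) := by ring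
      _ = (12 * ((r : ℝ) + k) ^ (2 * k) * k ^ k * 4 ^ (k * k) * D) / 4 * (P : ℝ) ^ E := by
          rw [← Real.rpow_natCast (P : ℝ), ← Real.rpow_add hP0, ← Real.rpow_add hP0]
          congr 2
          rw [he, hE]; ring
      _ ≤ _ := by gcongr
  have t2 : ((p : ℝ) ^ (k - 1) * ((k - 1 : ℕ) : ℝ) ^ (r + k)) ^ 2 *
        (((r : ℝ) + k) * (JJ k (r + k) (Ico 0 ((P / p + 1 : ℕ) : ℤ)) : ℝ)) ≤ D' / 4 * (P : ℝ) ^ E := by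
    have a1 : (JJ k (r + k) (Ico 0 ((P / p + 1 : ℕ) : ℤ)) : ℝ) ≤ D' * ((P / p) ^ E * 3) :=
      h2.trans (by gcongr; exact hQe E (by linarith) hE2)
    have b1 : ((k - 1 : ℕ) : ℝ) ≤ k := by exact_mod_cast Nat.sub_le k 1
    have hsN : 4 * k ≤ r + k := by nlinarith
    have b2 : 12 * ((r : ℝ) + k) * (((k : ℝ) ^ (r + k)) ^ 2 * ((p : ℝ) ^ (k - 1)) ^ 2) ≤
        (p : ℝ) ^ E := by
      have c0 : (12 : ℝ) * ((r : ℝ) + k) ≤ 8 ^ (r + k) := by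
        have : ∀ n : ℕ, 2 ≤ n → 12 * n ≤ 8 ^ n := by
          intro n hn
          induction n, hn using Nat.le_induction with
          | base => norm_num
          | succ n hn ih => rw [pow_succ]; omega
        exact_mod_cast this (r + k) (by omega)
      have c1 : (8 : ℝ) ^ (r + k) * ((k : ℝ) ^ (r + k)) ^ 2 ≤ (p : ℝ) ^ (((r : ℝ) + k) / 2) := by
        calc (8 : ℝ) ^ (r + k) * ((k : ℝ) ^ (r + k)) ^ 2 = (8 * (k : ℝ) ^ 2) ^ (r + k) := by
              rw [mul_pow, ← pow_mul, ← pow_mul, mul_comm]; ring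
          _ = ((64 * (k : ℝ) ^ 4) ^ ((1 : ℝ) / 2)) ^ (r + k) := by
              congr 1
              rw [← Real.sqrt_eq_rpow, eq_comm, Real.sqrt_eq_iff_mul_self_eq (by positivity) (by positivity)]
              ring
          _ ≤ ((p : ℝ) ^ ((1 : ℝ) / 2)) ^ (r + k) := by gcongr
          _ = _ := by
              rw [← Real.rpow_natCast, ← Real.rpow_mul hp0.le]
              congr 1; push_cast; ring
      have c2 : ((p : ℝ) ^ (k - 1)) ^ 2 ≤ (p : ℝ) ^ (((r : ℝ) + k) / 2) := by
        rw [← pow_mul, ← Real.rpow_natCast]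
        apply Real.rpow_le_rpow_of_exponent_le hp1
        have h5 : (k - 1) * 2 * 2 ≤ r + k := by omega
        have h6 : (((k - 1) * 2 : ℕ) : ℝ) * 2 ≤ r + k := by exact_mod_cast h5
        linarith
      calc _ ≤ (8 : ℝ) ^ (r + k) * (((k : ℝ) ^ (r + k)) ^ 2 * ((p : ℝ) ^ (k - 1)) ^ 2) := by gcongr
        _ = (8 : ℝ) ^ (r + k) * ((k : ℝ) ^ (r + k)) ^ 2 * ((p : ℝ) ^ (k - 1)) ^ 2 := by ring
        _ ≤ (p : ℝ) ^ (((r : ℝ) + k) / 2) * (p : ℝ) ^ (((r : ℝ) + k) / 2) := by gcongr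
        _ = (p : ℝ) ^ ((r : ℝ) + k) := by rw [← Real.rpow_add hp0]; congr 1; ring
        _ ≤ _ := Real.rpow_le_rpow_of_exponent_le hp1 hE0
    calc _ ≤ ((p : ℝ) ^ (k - 1) * (k : ℝ) ^ (r + k)) ^ 2 *
        (((r : ℝ) + k) * (D' * ((P / p) ^ E * 3))) := by gcongr
      _ = (12 * ((r : ℝ) + k) * (((k : ℝ) ^ (r + k)) ^ 2 * ((p : ℝ) ^ (k - 1)) ^ 2)) *
          (D' / 4 * (P / p) ^ E) := by ring
      _ ≤ (p : ℝ) ^ E * (D' / 4 * (P / p) ^ E) := by gcongr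
      _ = _ := by
          rw [Real.div_rpow hP0.le hp0.le]
          have : (p : ℝ) ^ E ≠ 0 := by positivity
          field_simp
  push_cast at t1 t2
  linarith

/-- Vinogradov mean value, with full recursion. -/
theorem JJ_bound {k L : ℕ} (hk : 4 ≤ k) (hL : k * k + L * k ≤ k ^ 4) :
    ∀ l ≤ L, ∀ P : ℕ, 1 ≤ P → (JJ k (k * k + l * k) (Ico 0 (P : ℤ)) : ℝ) ≤
      ((64 * (k : ℝ) ^ 4) ^ k) ^ ((k : ℝ) * (k + 1) / 2) *
        (12 * ((k : ℝ) ^ 4) ^ (2 * k) * k ^ k * 4 ^ (k * k)) ^ l *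
      (P : ℝ) ^ (2 * ((k * k + l * k : ℕ) : ℝ) - (k : ℝ) * (k + 1) / 2 +
        (k : ℝ) * (k + 1) / 2 * (1 - 1 / k) ^ l) := by
  have hk0 : (4 : ℝ) ≤ k := by exact_mod_cast hk
  set K : ℝ := (k : ℝ) * (k + 1) / 2 with hK
  have hK0 : 0 ≤ K := by positivity
  set P0 : ℝ := (64 * (k : ℝ) ^ 4) ^ k with hP0
  set G : ℝ := 12 * ((k : ℝ) ^ 4) ^ (2 * k) * k ^ k * 4 ^ (k * k) with hG
  have hk4 : (1 : ℝ) ≤ (k : ℝ) ^ 4 := one_le_pow₀ (by linarith)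
  have hP01 : 1 ≤ P0 := one_le_pow₀ (by linarith)
  have hG1 : 1 ≤ G := by
    rw [hG]
    have a1 : (1 : ℝ) ≤ ((k : ℝ) ^ 4) ^ (2 * k) := one_le_pow₀ hk4
    have a2 : (1 : ℝ) ≤ (k : ℝ) ^ k := one_le_pow₀ (by linarith)
    have a3 : (1 : ℝ) ≤ 4 ^ (k * k) := one_le_pow₀ (by norm_num)
    have := one_le_mul_of_one_le_of_one_le (one_le_mul_of_one_le_of_one_le a1 a2) a3
    nlinarith
  have hkinv : (0 : ℝ) < 1 / k := by positivity
  have hkinv1 : (1 : ℝ) / k ≤ 1 := by rw [div_le_one] <;> linarith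
  have hq0 : (0 : ℝ) ≤ 1 - 1 / k := by linarith
  have hq1 : (1 : ℝ) - 1 / k ≤ 1 := by linarith
  intro l
  induction l with
  | zero =>
    intro _ P hP
    have h1 : (JJ k (k * k + 0 * k) (Ico 0 (P : ℤ)) : ℝ) ≤ (P : ℝ) ^ (2 * (k * k + 0 * k)) := by
      exact_mod_cast JJ_trivial k _ P
    refine h1.trans ?_
    have h2 : (1 : ℝ) ≤ P0 ^ K * G ^ 0 := by
      rw [pow_zero, mul_one]; exact Real.one_le_rpow hP01 hK0
    have h3 : (P : ℝ) ^ (2 * (k * k + 0 * k)) =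
        (P : ℝ) ^ (2 * ((k * k + 0 * k : ℕ) : ℝ) - K + K * (1 - 1 / k) ^ 0) := by
      rw [← Real.rpow_natCast]; congr 1; push_cast; ring
    rw [← h3]
    exact le_mul_of_one_le_left (by positivity) h2
  | succ l ih =>
    intro hl P
    have ih' := ih (by omega)
    set r := k * k + l * k with hr
    have hs : k * k + (l + 1) * k = r + k := by rw [hr]; ring
    have hsb : r + k ≤ k ^ 4 := by
      rw [← hs]; refine le_trans ?_ hL; gcongr
    rw [hs]
    have hsb' : (r : ℝ) + k ≤ (k : ℝ) ^ 4 := by exact_mod_cast hsb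
    induction P using Nat.strong_induction_on with
    | _ P ihP =>
    intro hP
    have hPr : (1 : ℝ) ≤ P := by exact_mod_cast hP
    have hη0 : 0 ≤ K * (1 - 1 / k) ^ (l + 1) := by positivity
    have hη1 : K * (1 - 1 / k) ^ l ≤ K := by
      have : (1 - 1 / (k : ℝ)) ^ l ≤ 1 := pow_le_one₀ hq0 hq1
      nlinarith
    rcases le_or_gt (P : ℝ) P0 with hsmall | hbig
    · have h1 : (JJ k (r + k) (Ico 0 (P : ℤ)) : ℝ) ≤ (P : ℝ) ^ (2 * (r + k)) := by
        exact_mod_cast JJ_trivial k _ P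
      refine h1.trans ?_
      calc (P : ℝ) ^ (2 * (r + k)) = (P : ℝ) ^ K * (P : ℝ) ^ (2 * ((r + k : ℕ) : ℝ) - K) := by
            rw [← Real.rpow_natCast, ← Real.rpow_add (by linarith)]; congr 1; push_cast; ring
        _ ≤ P0 ^ K * (P : ℝ) ^ (2 * ((r + k : ℕ) : ℝ) - K + K * (1 - 1 / k) ^ (l + 1)) := by
            gcongr
            linarith
        _ ≤ _ := by
            gcongr
            apply le_mul_of_one_le_right (by positivity)
            exact one_le_pow₀ hG1
    · -- choose the prime
      have hk' : (k : ℝ) ≠ 0 := by positivity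
      set y : ℝ := (P : ℝ) ^ ((1 : ℝ) / k) with hy
      have hyk : y ^ k = P := by
        rw [hy, ← Real.rpow_natCast, ← Real.rpow_mul (by linarith)]
        rw [one_div_mul_cancel hk', Real.rpow_one]
      have hyb : 64 * (k : ℝ) ^ 4 ≤ y := by
        by_contra hc
        push Not at hc
        have : y ^ k ≤ P0 := by rw [hP0]; gcongr
        linarith
      obtain ⟨p, hp, hp1, hp2⟩ := Nat.exists_prime_lt_and_le_two_mul ⌈y⌉₊ (by
        have : 0 < ⌈y⌉₊ := Nat.ceil_pos.mpr (by linarith)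
        omega)
      have hyp : y ≤ p := (Nat.le_ceil y).trans (by exact_mod_cast hp1.le)
      have hp4 : (p : ℝ) ≤ 4 * y := by
        have h1 : (p : ℝ) ≤ 2 * (⌈y⌉₊ : ℝ) := by exact_mod_cast hp2
        have h2 := Nat.ceil_lt_add_one (a := y) (by linarith)
        linarith
      have hPp : P ≤ p ^ k := by
        have : (P : ℝ) ≤ (p : ℝ) ^ k := by rw [← hyk]; gcongr
        exact_mod_cast this
      have hP2 : 2 * ((r : ℝ) + k) * p ≤ P := by
        calc 2 * ((r : ℝ) + k) * p ≤ 2 * (k : ℝ) ^ 4 * (4 * y) := by gcongr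
          _ ≤ y * y := by nlinarith
          _ = y ^ 2 := by ring
          _ ≤ y ^ k := by
              gcongr
              · linarith
              · omega
          _ = P := hyk
      have hpge : (2 : ℝ) ≤ p := by exact_mod_cast hp.two_le
      have hQ1 : P / p + 1 < P := by
        have h3 : (3 : ℝ) ≤ P := by nlinarith
        have h4 : 3 ≤ P := by exact_mod_cast h3
        have : P / p ≤ P / 2 := Nat.div_le_div_left hp.two_le (by norm_num)
        omega
      have h1 := ih' (P / p + 1) (Nat.le_add_left _ _)
      have h2 := ihP (P / p + 1) hQ1 (Nat.le_add_left _ _)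
      have hstep := JJ_step (k := k) (p := p) (P := P) (r := r) hp hk (by omega) hPp
        (hyb.trans hyp) hp4 hP2 (K * (1 - 1 / k) ^ l) (P0 ^ K * G ^ l) (P0 ^ K * G ^ (l + 1))
        (by positivity) hη1 (by positivity) (by
          calc _ ≤ G * (P0 ^ K * G ^ l) := by
                rw [hG]; gcongr
            _ = _ := by ring) h1 (by
          convert h2 using 3
          push_cast
          ring)
      convert hstep using 3
      push_cast
      ring

end VK

namespace VK
open Finset

/-- `e(θ)` -/
noncomputable def ee (θ : ℝ) : ℂ := Complex.exp (2 * Real.pi * θ * Complex.I)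

lemma ee_add (a b : ℝ) : ee (a + b) = ee a * ee b := by
  unfold ee; rw [← Complex.exp_add]; congr 1; push_cast; ring

lemma ee_zero : ee 0 = 1 := by simp [ee]

lemma norm_ee (a : ℝ) : ‖ee a‖ = 1 := by
  unfold ee
  rw [show (2 * Real.pi * a * Complex.I : ℂ) = ((2 * Real.pi * a : ℝ) : ℂ) * Complex.I by push_cast; ring]
  exact Complex.norm_exp_ofReal_mul_I _

lemma ee_conj (a : ℝ) : (starRingEnd ℂ) (ee a) = ee (-a) := by
  unfold ee
  rw [← Complex.exp_conj]
  congr 1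
  simp [Complex.conj_ofNat]

lemma ee_sum {ι : Type*} (s : Finset ι) (f : ι → ℝ) : ee (∑ i ∈ s, f i) = ∏ i ∈ s, ee (f i) := by
  classical
  induction s using Finset.induction_on with
  | empty => simp [ee_zero]
  | insert a s ha ih => rw [sum_insert ha, prod_insert ha, ee_add, ih]

/-- linear form -/
noncomputable def lf {k : ℕ} (β : Fin k → ℝ) (w : Fin k → ℤ) : ℝ := ∑ j, β j * w j

lemma lf_sub {k : ℕ} (β : Fin k → ℝ) (w w' : Fin k → ℤ) : lf β (w - w') = lf β w - lf β w' := by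
  unfold lf
  rw [← Finset.sum_sub_distrib]
  exact Finset.sum_congr rfl fun j _ => by push_cast [Pi.sub_apply]; ring

lemma lf_sum {k : ℕ} (β : Fin k → ℝ) {ι : Type*} (s : Finset ι) (w : ι → Fin k → ℤ) :
    lf β (∑ i ∈ s, w i) = ∑ i ∈ s, lf β (w i) := by
  unfold lf
  rw [Finset.sum_comm]
  refine Finset.sum_congr rfl fun j _ => ?_
  rw [Finset.sum_apply, Int.cast_sum, Finset.mul_sum]

lemma pow_expand {k : ℕ} (s : ℕ) (β : Fin k → ℝ) (A : Finset ℤ) :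
    ((‖∑ a ∈ A, ee (lf β (mono k a))‖ ^ (2 * s) : ℝ) : ℂ) =
      ∑ q ∈ (Fintype.piFinset fun _ : Fin s => A) ×ˢ (Fintype.piFinset fun _ : Fin s => A),
        ee (lf β (ps k q.1 - ps k q.2)) := by
  have h1 : (∑ a ∈ A, ee (lf β (mono k a))) ^ s =
      ∑ y ∈ (Fintype.piFinset fun _ : Fin s => A), ee (lf β (ps k y)) := by
    have := Finset.prod_univ_sum (fun _ : Fin s => A) (fun _ a => ee (lf β (mono k a)))
    rw [Finset.prod_const, card_univ, Fintype.card_fin] at this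
    rw [this]
    apply Finset.sum_congr rfl
    intro y _
    rw [ps_eq_sum, lf_sum, ee_sum]
  rw [pow_mul', ← norm_pow, h1, Complex.ofReal_pow, ← Complex.mul_conj', map_sum,
    Finset.sum_mul_sum, ← Finset.sum_product']
  apply Finset.sum_congr rfl
  intro q _
  rw [lf_sub, sub_eq_add_neg, ee_add, ee_conj]

lemma fiber_le {k s : ℕ} (A : Finset ℤ) (V : Finset (Fin k → ℤ))
    (hV : ∀ q ∈ (Fintype.piFinset fun _ : Fin s => A) ×ˢ (Fintype.piFinset fun _ : Fin s => A),
      ps k q.1 - ps k q.2 ∈ V) (h : (Fin k → ℤ) → ℝ) (h0 : ∀ μ, 0 ≤ h μ) :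
    ∑ q ∈ (Fintype.piFinset fun _ : Fin s => A) ×ˢ (Fintype.piFinset fun _ : Fin s => A),
      h (ps k q.1 - ps k q.2) ≤ JJ k s A * ∑ μ ∈ V, h μ := by
  classical
  rw [← Finset.sum_fiberwise_of_maps_to hV, Finset.mul_sum]
  apply Finset.sum_le_sum
  intro μ _
  rw [Finset.sum_congr rfl (g := fun _ => h μ) (fun q hq => by rw [(mem_filter.mp hq).2])]
  rw [Finset.sum_const, nsmul_eq_mul]
  gcongr
  · exact h0 μ
  refine le_trans (le_of_eq ?_) (shifted_le _ (ps k) μ)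
  congr 1
  ext q
  simp only [mem_filter, sub_eq_iff_eq_add, add_comm μ]

/-- the box -/
noncomputable def box (k s Q : ℕ) : Finset (Fin k → ℤ) :=
  Fintype.piFinset fun j : Fin k => Icc (-((s * Q ^ (j.val + 1) : ℕ) : ℤ)) ((s * Q ^ (j.val + 1) : ℕ) : ℤ)

lemma mem_box {k s Q : ℕ} (q : (Fin s → ℤ) × (Fin s → ℤ))
    (hq : q ∈ (Fintype.piFinset fun _ : Fin s => Ico 0 (Q : ℤ)) ×ˢ
      (Fintype.piFinset fun _ : Fin s => Ico 0 (Q : ℤ))) : ps k q.1 - ps k q.2 ∈ box k s Q := by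
  have key : ∀ y ∈ Fintype.piFinset fun _ : Fin s => Ico 0 (Q : ℤ), ∀ j : Fin k,
      0 ≤ ps k y j ∧ ps k y j ≤ ((s * Q ^ (j.val + 1) : ℕ) : ℤ) := by
    intro y hy j
    rw [Fintype.mem_piFinset] at hy
    simp only [mem_Ico] at hy
    constructor
    · exact Finset.sum_nonneg fun i _ => pow_nonneg (hy i).1 _
    · calc ps k y j ≤ ∑ i : Fin s, (Q : ℤ) ^ (j.val + 1) :=
            Finset.sum_le_sum fun i _ => pow_le_pow_left₀ (hy i).1 (hy i).2.le _
        _ = _ := by simp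
  rw [mem_product] at hq
  unfold box
  rw [Fintype.mem_piFinset]
  intro j
  have h1 := key _ hq.1 j
  have h2 := key _ hq.2 j
  rw [mem_Icc, Pi.sub_apply]
  constructor <;> linarith

noncomputable def WW (α : ℝ) (A : ℕ) : ℝ :=
  ∑ l ∈ Icc (-(A : ℤ)) A, ‖∑ m ∈ Icc (-(A : ℤ)) A, ee (α * l * m)‖

theorem bilinear {k s Q : ℕ} (hs : 0 < s) (α : Fin k → ℝ) :
    ‖∑ x ∈ Ico 0 (Q : ℤ), ∑ y ∈ Ico 0 (Q : ℤ), ee (∑ j : Fin k, α j * (x * y : ℝ) ^ (j.val + 1))‖ ^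
        (2 * s * (2 * s)) ≤
      ((Q : ℝ) ^ (2 * s - 1)) ^ (2 * s) * ((Q : ℝ) ^ (2 * s)) ^ (2 * s - 1) *
        ((JJ k s (Ico 0 (Q : ℤ)) : ℝ) * ((JJ k s (Ico 0 (Q : ℤ)) : ℝ) *
          ∏ j : Fin k, WW (α j) (s * Q ^ (j.val + 1)))) := by
  classical
  set A := Ico 0 (Q : ℤ) with hA
  have hAc : (A.card : ℝ) = Q := by simp [hA]
  set YY2 := (Fintype.piFinset fun _ : Fin s => A) ×ˢ (Fintype.piFinset fun _ : Fin s => A) with hYY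
  have hYc : (YY2.card : ℝ) = (Q : ℝ) ^ (2 * s) := by
    simp [hYY, hA, two_mul, pow_add]
  set G : (Fin k → ℤ) → ℝ := fun μ => ‖∑ x ∈ A, ee (lf (fun j => α j * μ j) (mono k x))‖ with hG
  set H : (Fin k → ℤ) → ℝ := fun l => ‖∑ μ ∈ box k s Q, ee (lf (fun j => α j * μ j) l)‖ with hH
  obtain ⟨n, hn⟩ : ∃ n, 2 * s = n + 1 := ⟨2 * s - 1, by omega⟩
  have hn' : 2 * s - 1 = n := by omega
  -- step 1
  have s1 : ‖∑ x ∈ A, ∑ y ∈ A, ee (∑ j : Fin k, α j * (x * y : ℝ) ^ (j.val + 1))‖ ^ (2 * s) ≤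
      (Q : ℝ) ^ (2 * s - 1) * ∑ q ∈ YY2, G (ps k q.1 - ps k q.2) := by
    have e1 : ∀ x y : ℤ, ∑ j : Fin k, α j * (x * y : ℝ) ^ (j.val + 1) =
        lf (fun j => α j * (x : ℝ) ^ (j.val + 1)) (mono k y) := by
      intro x y
      unfold lf mono
      refine Finset.sum_congr rfl fun j _ => ?_
      push_cast; rw [mul_pow]; ring
    simp only [e1]
    calc _ ≤ (∑ x ∈ A, ‖∑ y ∈ A, ee (lf (fun j => α j * (x : ℝ) ^ (j.val + 1)) (mono k y))‖) ^ (2 * s) := by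
          gcongr; exact norm_sum_le _ _
      _ ≤ (Q : ℝ) ^ (2 * s - 1) * ∑ x ∈ A,
          ‖∑ y ∈ A, ee (lf (fun j => α j * (x : ℝ) ^ (j.val + 1)) (mono k y))‖ ^ (2 * s) := by
          rw [hn', hn, ← hAc]
          exact pow_sum_le_card_mul_sum_pow (fun i _ => norm_nonneg _) n
      _ ≤ _ := by
          gcongr
          have e2 : ((∑ x ∈ A, ‖∑ y ∈ A, ee (lf (fun j => α j * (x : ℝ) ^ (j.val + 1)) (mono k y))‖ ^
              (2 * s) : ℝ) : ℂ) = ∑ q ∈ YY2, ∑ x ∈ A,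
                ee (lf (fun j => α j * ((ps k q.1 - ps k q.2) j : ℝ)) (mono k x)) := by
            rw [Complex.ofReal_sum, Finset.sum_comm]
            apply Finset.sum_congr rfl
            intro x _
            rw [pow_expand]
            apply Finset.sum_congr rfl
            intro q _
            congr 1
            unfold lf mono
            refine Finset.sum_congr rfl fun j _ => ?_
            push_cast; ring
          have e3 : ∀ r : ℝ, 0 ≤ r → r = ‖(r : ℂ)‖ := fun r hr => by
            rw [Complex.norm_real, Real.norm_of_nonneg hr]
          rw [e3 _ (Finset.sum_nonneg fun x _ => by positivity), e2]
          exact norm_sum_le _ _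
  -- step 2
  have s2 : (∑ q ∈ YY2, G (ps k q.1 - ps k q.2)) ^ (2 * s) ≤
      ((Q : ℝ) ^ (2 * s)) ^ (2 * s - 1) * ((JJ k s A : ℝ) * ∑ μ ∈ box k s Q, G μ ^ (2 * s)) := by
    calc _ ≤ ((Q : ℝ) ^ (2 * s)) ^ (2 * s - 1) * ∑ q ∈ YY2, G (ps k q.1 - ps k q.2) ^ (2 * s) := by
          rw [hn', ← hYc, hn]
          exact pow_sum_le_card_mul_sum_pow (fun i _ => norm_nonneg _) n
      _ ≤ _ := by
          gcongr
          exact fiber_le A (box k s Q) (fun q hq => mem_box q hq) (fun μ => G μ ^ (2 * s))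
            (fun μ => by positivity)
  -- step 3
  have s3 : ∑ μ ∈ box k s Q, G μ ^ (2 * s) ≤ (JJ k s A : ℝ) * ∑ l ∈ box k s Q, H l := by
    refine le_trans ?_ (fiber_le A (box k s Q) (fun q hq => mem_box q hq) H (fun μ => norm_nonneg _))
    have e2 : ((∑ μ ∈ box k s Q, G μ ^ (2 * s) : ℝ) : ℂ) = ∑ q ∈ YY2, ∑ μ ∈ box k s Q,
        ee (lf (fun j => α j * μ j) (ps k q.1 - ps k q.2)) := by
      rw [Complex.ofReal_sum, Finset.sum_comm]
      apply Finset.sum_congr rfl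
      intro x _
      rw [hG, pow_expand]
    have e3 : ∀ r : ℝ, 0 ≤ r → r = ‖(r : ℂ)‖ := fun r hr => by
      rw [Complex.norm_real, Real.norm_of_nonneg hr]
    rw [e3 _ (Finset.sum_nonneg fun x _ => by positivity), e2]
    exact norm_sum_le _ _
  -- step 4
  have s4 : ∑ l ∈ box k s Q, H l = ∏ j : Fin k, WW (α j) (s * Q ^ (j.val + 1)) := by
    unfold WW
    rw [Finset.prod_univ_sum]
    apply Finset.sum_congr rfl
    intro l _
    rw [← norm_prod, Finset.prod_univ_sum]
    simp only [hH, box]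
    congr 1
    apply Finset.sum_congr rfl
    intro μ _
    unfold lf
    rw [ee_sum]
    refine Finset.prod_congr rfl fun j _ => ?_
    congr 1; ring
  have hJ0 : (0 : ℝ) ≤ (JJ k s A : ℝ) := by positivity
  have hG0 : 0 ≤ ∑ q ∈ YY2, G (ps k q.1 - ps k q.2) := Finset.sum_nonneg fun _ _ => norm_nonneg _
  calc _ = (‖∑ x ∈ A, ∑ y ∈ A, ee (∑ j : Fin k, α j * (x * y : ℝ) ^ (j.val + 1))‖ ^ (2 * s)) ^ (2 * s) := by
        rw [← pow_mul]
    _ ≤ ((Q : ℝ) ^ (2 * s - 1) * ∑ q ∈ YY2, G (ps k q.1 - ps k q.2)) ^ (2 * s) := by gcongr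
    _ = ((Q : ℝ) ^ (2 * s - 1)) ^ (2 * s) * (∑ q ∈ YY2, G (ps k q.1 - ps k q.2)) ^ (2 * s) := by
        rw [mul_pow]
    _ ≤ ((Q : ℝ) ^ (2 * s - 1)) ^ (2 * s) * (((Q : ℝ) ^ (2 * s)) ^ (2 * s - 1) *
        ((JJ k s A : ℝ) * ((JJ k s A : ℝ) * ∑ l ∈ box k s Q, H l))) := by
        gcongr
        exact s2.trans (by gcongr)
    _ = _ := by rw [s4]; ring

end VK

namespace VK
open Finset

lemma ee_int (n : ℤ) : ee n = 1 := by
  unfold ee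
  rw [Complex.exp_eq_one_iff]
  exact ⟨n, by push_cast; ring⟩

lemma norm_ee_sub_one (θ : ℝ) (δ : ℝ) (hθ : ∀ n : ℤ, δ ≤ |θ - n|) : 4 * δ ≤ ‖ee θ - 1‖ := by
  set x := θ - round θ with hx
  have h1 : ee θ = ee x := by
    have : θ = x + (round θ : ℤ) := by rw [hx]; ring
    conv_lhs => rw [this]
    rw [ee_add, ee_int, mul_one]
  have h2 : |x| ≤ 1 / 2 := abs_sub_round θ
  have h3 : ee x = Complex.exp (Complex.I * ((2 * Real.pi * x : ℝ) : ℂ)) := by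
    unfold ee; congr 1; push_cast; ring
  rw [h1, h3, Complex.norm_exp_I_mul_ofReal_sub_one]
  have h4 : 2 * Real.pi * x / 2 = Real.pi * x := by ring
  rw [h4, norm_mul, Real.norm_eq_abs, Real.norm_eq_abs]
  have hpi := Real.pi_pos
  have h5 := Real.mul_abs_le_abs_sin (x := Real.pi * x) (by
    rw [abs_mul, abs_of_pos hpi]; nlinarith)
  rw [abs_mul Real.pi, abs_of_pos hpi] at h5
  have h6 : 2 / Real.pi * (Real.pi * |x|) = 2 * |x| := by field_simp
  rw [h6] at h5
  have := hθ (round θ)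
  rw [abs_of_pos (by norm_num : (0 : ℝ) < 2)]
  linarith

lemma geom_tele (θ : ℝ) (A : ℕ) : (ee θ - 1) * ∑ m ∈ Icc (-(A : ℤ)) A, ee (θ * m) =
    ee (θ * (A + 1)) - ee (θ * (-A)) := by
  induction A with
  | zero => simp [ee_zero]
  | succ n ih =>
    have h1 : Icc (-((n + 1 : ℕ) : ℤ)) ((n + 1 : ℕ) : ℤ) =
        insert (-((n + 1 : ℕ) : ℤ)) (insert ((n + 1 : ℕ) : ℤ) (Icc (-(n : ℤ)) n)) := by
      ext x; simp only [mem_Icc, mem_insert]; push_cast; omega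
    rw [h1, sum_insert (by simp only [mem_insert, mem_Icc]; push_cast; omega),
      sum_insert (by simp only [mem_Icc]; push_cast; omega), mul_add, mul_add, ih]
    have e1 : ee θ * ee (θ * (-((n + 1 : ℕ) : ℤ) : ℤ)) = ee (θ * (-n)) := by
      rw [← ee_add]; congr 1; push_cast; ring
    have e2 : ee θ * ee (θ * (((n + 1 : ℕ) : ℤ) : ℤ)) = ee (θ * (((n + 1 : ℕ) : ℝ) + 1)) := by
      rw [← ee_add]; congr 1; push_cast; ring
    have e3 : ee (θ * (((n + 1 : ℕ) : ℤ) : ℤ)) = ee (θ * ((n : ℝ) + 1)) := by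
      congr 1; push_cast; ring
    have e4 : ee (θ * (-((n + 1 : ℕ) : ℤ) : ℤ)) = ee (θ * (-((n + 1 : ℕ) : ℝ))) := by
      congr 1; push_cast; ring
    rw [sub_mul, sub_mul, one_mul, one_mul, e1, e2, e3, e4]
    ring

lemma geom_bound (θ : ℝ) (A : ℕ) (δ : ℝ) (hδ : 0 < δ) (hθ : ∀ n : ℤ, δ ≤ |θ - n|) :
    ‖∑ m ∈ Icc (-(A : ℤ)) A, ee (θ * m)‖ ≤ 1 / δ := by
  have h1 := norm_ee_sub_one θ δ hθ
  have h2 : ‖ee θ - 1‖ * ‖∑ m ∈ Icc (-(A : ℤ)) A, ee (θ * m)‖ ≤ 2 := by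
    rw [← norm_mul, geom_tele]
    refine (norm_sub_le _ _).trans ?_
    rw [norm_ee, norm_ee]; norm_num
  rw [le_div_iff₀ hδ]
  nlinarith [norm_nonneg (∑ m ∈ Icc (-(A : ℤ)) A, ee (θ * m))]

lemma sum_triv (f : ℤ → ℝ) (A : ℕ) : ‖∑ m ∈ Icc (-(A : ℤ)) A, ee (f m)‖ ≤ 2 * A + 1 := by
  refine (norm_sum_le _ _).trans ?_
  simp only [norm_ee, sum_const, Int.card_Icc, nsmul_eq_mul, mul_one]
  have : ((A : ℤ) + 1 - -(A : ℤ)).toNat = 2 * A + 1 := by omega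
  rw [this]; push_cast; exact le_refl _

lemma cardI (A : ℕ) : ((Icc (-(A : ℤ)) A).card : ℝ) = 2 * A + 1 := by
  rw [Int.card_Icc]
  have : ((A : ℤ) + 1 - -(A : ℤ)).toNat = 2 * A + 1 := by omega
  rw [this]; push_cast; rfl

lemma WW_triv (α : ℝ) (A : ℕ) : WW α A ≤ (2 * A + 1) ^ 2 := by
  unfold WW
  calc _ ≤ ∑ l ∈ Icc (-(A : ℤ)) A, (2 * (A : ℝ) + 1) := by
        gcongr with l _
        exact sum_triv (fun m => α * l * m) A
    _ = _ := by rw [sum_const, nsmul_eq_mul, cardI]; ring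

lemma WW_neg (α : ℝ) (A : ℕ) : WW (-α) A = WW α A := by
  unfold WW
  apply Finset.sum_congr rfl
  intro l _
  rw [← Complex.norm_conj, map_sum]
  congr 1
  apply Finset.sum_congr rfl
  intro m _
  rw [ee_conj]
  congr 1; ring

lemma count_int (c r : ℝ) (hr : 0 ≤ r) (S : Finset ℤ) (hS : ∀ n ∈ S, |(n : ℝ) - c| ≤ r) :
    (S.card : ℝ) ≤ 2 * r + 1 := by
  have h1 : S ⊆ Icc ⌈c - r⌉ ⌊c + r⌋ := by
    intro n hn
    have := abs_le.mp (hS n hn)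
    rw [mem_Icc, Int.ceil_le, Int.le_floor]
    constructor <;> linarith
  have h2 := card_le_card h1
  rw [Int.card_Icc] at h2
  have h3 : (⌊c + r⌋ : ℝ) ≤ c + r := Int.floor_le _
  have h4 : c - r ≤ (⌈c - r⌉ : ℝ) := Int.le_ceil _
  rcases le_or_gt 0 (⌊c + r⌋ + 1 - ⌈c - r⌉) with h5 | h5
  · have h6 : ((⌊c + r⌋ + 1 - ⌈c - r⌉).toNat : ℤ) = ⌊c + r⌋ + 1 - ⌈c - r⌉ := Int.toNat_of_nonneg h5
    have h7 : (S.card : ℤ) ≤ ⌊c + r⌋ + 1 - ⌈c - r⌉ := by omega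
    have h8 : (S.card : ℝ) ≤ ⌊c + r⌋ + 1 - ⌈c - r⌉ := by exact_mod_cast h7
    linarith
  · have : S.card = 0 := by omega
    rw [this]; push_cast; linarith

lemma count_near (α δ : ℝ) (A : ℕ) (hα : 0 < α) (hδ : 0 < δ) (hδ1 : δ ≤ 1) (S : Finset ℤ)
    (hS : ∀ l ∈ S, |(l : ℝ)| ≤ A ∧ ∃ n : ℤ, |α * l - n| < δ) :
    (S.card : ℝ) ≤ (2 * α * A + 3) * (2 * δ / α + 1) := by
  classical
  choose! n hn using fun l hl => (hS l hl).2
  have h1 : (S.card : ℝ) ≤ ∑ m ∈ S.image n, (2 * δ / α + 1) := by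
    rw [Finset.card_eq_sum_card_image n S]
    push_cast
    apply Finset.sum_le_sum
    intro m _
    have := count_int (m / α) (δ / α) (by positivity) (S.filter fun l => n l = m) (by
      intro l hl
      rw [mem_filter] at hl
      have h2 := hn l hl.1
      rw [hl.2] at h2
      have : (l : ℝ) - m / α = (α * l - m) / α := by field_simp
      rw [this, abs_div, abs_of_pos hα]
      gcongr)
    calc _ ≤ _ := this
      _ = _ := by ring
  rw [sum_const, nsmul_eq_mul] at h1
  refine h1.trans ?_
  gcongr
  have := count_int 0 (α * A + 1) (by positivity) (S.image n) (by
    intro m hm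
    obtain ⟨l, hl, rfl⟩ := mem_image.mp hm
    have h2 := hn l hl
    have h3 := (hS l hl).1
    rw [sub_zero]
    have h4 : |(n l : ℝ)| ≤ |α * l| + |α * l - n l| := by
      have := abs_sub_abs_le_abs_sub (n l : ℝ) (α * l)
      rw [abs_sub_comm] at this
      linarith
    rw [abs_mul, abs_of_pos hα] at h4
    nlinarith)
  linarith

lemma WW_bound (α δ : ℝ) (A : ℕ) (hα : 0 < α) (hδ : 0 < δ) (hδ1 : δ ≤ 1) :
    WW α A ≤ (2 * A + 1) * ((2 * α * A + 3) * (2 * δ / α + 1) + 1 / δ) := by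
  classical
  unfold WW
  rw [← Finset.sum_filter_add_sum_filter_not _ (fun l : ℤ => ∃ n : ℤ, |α * l - n| < δ), mul_add]
  gcongr
  · calc _ ≤ ∑ l ∈ (Icc (-(A : ℤ)) A).filter (fun l : ℤ => ∃ n : ℤ, |α * l - n| < δ), (2 * (A : ℝ) + 1) := by
          gcongr with l _
          exact sum_triv (fun m => α * l * m) A
      _ ≤ _ := by
          rw [sum_const, nsmul_eq_mul, mul_comm]
          gcongr
          apply count_near α δ A hα hδ hδ1
          intro l hl
          rw [mem_filter, mem_Icc] at hl
          refine ⟨?_, hl.2⟩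
          rw [abs_le]
          constructor
          · exact_mod_cast hl.1.1
          · exact_mod_cast hl.1.2
  · calc _ ≤ ∑ l ∈ (Icc (-(A : ℤ)) A).filter (fun l : ℤ => ¬ ∃ n : ℤ, |α * l - n| < δ), 1 / δ := by
          gcongr with l hl
          apply geom_bound _ _ _ hδ
          intro n
          have := (mem_filter.mp hl).2
          push Not at this
          exact this n
      _ ≤ _ := by
          rw [sum_const, nsmul_eq_mul]
          gcongr
          rw [← cardI]
          exact_mod_cast card_filter_le _ _

end VK

namespace VK
open Finset

lemma WW_abs (α : ℝ) (A : ℕ) : WW α A = WW |α| A := by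
  rcases abs_choice α with h | h
  · rw [h]
  · rw [h, WW_neg]

set_option maxHeartbeats 2000000 in
lemma good_W {M κ t n : ℝ} {Q s J : ℕ} (hM : 1 ≤ M) (hκ : 0 < κ) (ht : t = M ^ κ) (hn1 : M ≤ n)
    (hn2 : n ≤ 2 * M) (hQ : 1 ≤ Q) (hQ2 : M ^ (0.4 : ℝ) ≤ 2 * Q) (hs : 1 ≤ s) (hJ : 1 ≤ J)
    (hJ1 : 1.2 * κ ≤ J) (hJ2 : J ≤ 2.4 * κ) (α : ℝ) (hα : |α| = t / (2 * Real.pi * J * n ^ J)) :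
    WW α (s * Q ^ J) ≤ 9 * (s : ℝ) ^ 2 * (Q : ℝ) ^ (2 * J) * (17 * 8 ^ J * M ^ (-0.04 * κ)) := by
  have hM0 : 0 < M := by linarith
  have hn0 : 0 < n := by linarith
  have hpi := Real.pi_pos
  have hpi4 := Real.pi_le_four
  have hpi3 := Real.pi_gt_three
  have hJr : (1 : ℝ) ≤ J := by exact_mod_cast hJ
  have hsr : (1 : ℝ) ≤ s := by exact_mod_cast hs
  have hQr : (1 : ℝ) ≤ Q := by exact_mod_cast hQ
  rw [WW_abs, hα]
  have ht0 : 0 < t := by rw [ht]; positivity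
  set a := t / (2 * Real.pi * J * n ^ J) with ha
  have ha0 : 0 < a := by positivity
  set δ := M ^ (-0.2 * (J : ℝ)) with hδ
  have hδ0 : 0 < δ := by positivity
  have hδ1 : δ ≤ 1 := Real.rpow_le_one_of_one_le_of_nonpos hM (by nlinarith)
  set A : ℕ := s * Q ^ J with hA
  have hAr : (A : ℝ) = s * (Q : ℝ) ^ J := by rw [hA]; push_cast; ring
  have hA1 : (1 : ℝ) ≤ A := by
    rw [hAr]
    exact one_le_mul_of_one_le_of_one_le hsr (one_le_pow₀ hQr)
  have hA0 : (0 : ℝ) < A := by linarith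
  set g := M ^ (-0.04 * κ) with hg
  have hg0 : 0 < g := by positivity
  have mono : ∀ x : ℝ, x ≤ -0.04 * κ → M ^ x ≤ g := fun x hx =>
    Real.rpow_le_rpow_of_exponent_le hM hx
  have b1 : δ ≤ g := mono _ (by nlinarith)
  have hMJ : M ^ J = M ^ (J : ℝ) := (Real.rpow_natCast _ _).symm
  have b2 : 2 * a ≤ g := by
    calc 2 * a ≤ t / M ^ J := by
          rw [ha, mul_div_assoc', div_le_div_iff₀ (by positivity) (by positivity)]
          have : M ^ J ≤ n ^ J := by gcongr
          have h1 : (2 : ℝ) ≤ 2 * Real.pi * J := by nlinarith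
          have h2 : 2 * M ^ J ≤ 2 * Real.pi * J * n ^ J := by gcongr
          calc 2 * t * M ^ J = t * (2 * M ^ J) := by ring
            _ ≤ _ := by gcongr
      _ = M ^ (κ - J) := by rw [ht, hMJ, ← Real.rpow_sub hM0]
      _ ≤ g := mono _ (by linarith)
  have hAinv : 1 / (A : ℝ) ≤ 2 ^ J * M ^ (-0.4 * (J : ℝ)) := by
    have h1 : M ^ (0.4 * (J : ℝ)) ≤ 2 ^ J * A := by
      calc M ^ (0.4 * (J : ℝ)) = (M ^ (0.4 : ℝ)) ^ J := by
            rw [← Real.rpow_natCast, ← Real.rpow_mul hM0.le]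
        _ ≤ (2 * Q) ^ J := by gcongr
        _ = 2 ^ J * (1 * (Q : ℝ) ^ J) := by rw [mul_pow, one_mul]
        _ ≤ 2 ^ J * A := by rw [hAr]; gcongr
    rw [show (-0.4 * (J : ℝ)) = -(0.4 * J) by ring, Real.rpow_neg hM0.le, ← div_eq_mul_inv,
      div_le_div_iff₀ hA0 (by positivity)]
    linarith
  have h2J : (1 : ℝ) ≤ 2 ^ J := one_le_pow₀ (by norm_num)
  have b3 : 1 / (A : ℝ) ≤ 2 ^ J * g := hAinv.trans (by gcongr; exact mono _ (by linarith))
  have b4 : 1 / (δ * A) ≤ 2 ^ J * g := by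
    calc 1 / (δ * A) = δ⁻¹ * (1 / A) := by field_simp
      _ ≤ M ^ (0.2 * (J : ℝ)) * (2 ^ J * M ^ (-0.4 * (J : ℝ))) := by
          gcongr
          rw [hδ, ← Real.rpow_neg hM0.le]
          apply le_of_eq; congr 1; ring
      _ = 2 ^ J * M ^ (-0.2 * (J : ℝ)) := by
          rw [mul_left_comm, ← Real.rpow_add hM0]; congr 2; ring
      _ ≤ _ := by gcongr
  have b5 : δ / (a * A) ≤ 8 * J * 4 ^ J * g := by
    have h1 : 1 / a ≤ 8 * J * 2 ^ J * M ^ ((J : ℝ) - κ) := by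
      rw [ha, one_div_div, Real.rpow_sub hM0, ← hMJ, ← ht, mul_div_assoc']
      apply div_le_div_of_nonneg_right _ ht0.le
      calc 2 * Real.pi * J * n ^ J ≤ 2 * 4 * J * (2 * M) ^ J := by gcongr
        _ = _ := by rw [mul_pow]; ring
    calc δ / (a * A) = δ * (1 / a) * (1 / A) := by field_simp
      _ ≤ δ * (8 * J * 2 ^ J * M ^ ((J : ℝ) - κ)) * (2 ^ J * M ^ (-0.4 * (J : ℝ))) := by gcongr
      _ = 8 * J * (2 * 2) ^ J * (M ^ (-0.2 * (J : ℝ)) * M ^ ((J : ℝ) - κ) * M ^ (-0.4 * (J : ℝ))) := by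
          rw [mul_pow, hδ]; ring
      _ ≤ 8 * J * (2 * 2) ^ J * g := by
          gcongr
          rw [← Real.rpow_add hM0, ← Real.rpow_add hM0]
          apply mono; linarith
      _ = _ := by norm_num
  have hWb := WW_bound a δ A ha0 hδ0 hδ1
  refine hWb.trans ?_
  have hJ2 : (J : ℝ) ≤ 2 ^ J := by exact_mod_cast (Nat.lt_two_pow_self (n := J)).le
  have h48 : (4 : ℝ) ^ J * 2 ^ J = 8 ^ J := by rw [← mul_pow]; norm_num
  have h8 : (8 : ℝ) ≤ 8 ^ J := by
    calc (8 : ℝ) = 8 ^ 1 := by norm_num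
      _ ≤ 8 ^ J := pow_le_pow_right₀ (by norm_num) hJ
  have h24 : 4 * (2 : ℝ) ^ J ≤ 8 ^ J := by
    have h4 : (4 : ℝ) ≤ 4 ^ J := by
      calc (4 : ℝ) = 4 ^ 1 := by norm_num
        _ ≤ 4 ^ J := pow_le_pow_right₀ (by norm_num) hJ
    rw [← h48]; gcongr
  calc (2 * (A : ℝ) + 1) * ((2 * a * A + 3) * (2 * δ / a + 1) + 1 / δ)
      ≤ (3 * A) * ((2 * a * A + 3) * (2 * δ / a + 1) + 1 / δ) := by gcongr; linarith
    _ = 3 * A ^ 2 * (4 * δ + 2 * a + 6 * (δ / (a * A)) + 3 * (1 / A) + 1 / (δ * A)) := by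
        field_simp; ring
    _ ≤ 3 * A ^ 2 * (4 * g + g + 6 * (8 * J * 4 ^ J * g) + 3 * (2 ^ J * g) + 2 ^ J * g) := by
        gcongr
    _ = 3 * A ^ 2 * ((5 + 48 * (4 ^ J * J) + 4 * 2 ^ J) * g) := by ring
    _ ≤ 3 * A ^ 2 * ((5 / 8 * 8 ^ J + 48 * (4 ^ J * 2 ^ J) + 8 ^ J) * g) := by
        have h5 : (5:ℝ) ≤ 5 / 8 * 8 ^ J := by linarith only [h8]
        gcongr
    _ = 3 * A ^ 2 * ((5 / 8 + 48 + 1) * 8 ^ J * g) := by rw [h48]; ring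
    _ ≤ _ := by
        have h0 : (0:ℝ) ≤ s ^ 2 * (Q : ℝ) ^ (2 * J) * (8 ^ J * g) := by positivity
        have e1 : 3 * (A:ℝ) ^ 2 * ((5 / 8 + 48 + 1) * 8 ^ J * g) =
          3 * (5 / 8 + 48 + 1) * (s ^ 2 * (Q : ℝ) ^ (2 * J) * (8 ^ J * g)) := by
          rw [hAr, pow_mul' (Q:ℝ) 2 J]; ring
        have e2 : 9 * (s : ℝ) ^ 2 * (Q : ℝ) ^ (2 * J) * (17 * 8 ^ J * g) =
          153 * (s ^ 2 * (Q : ℝ) ^ (2 * J) * (8 ^ J * g)) := by ring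
        rw [e1, e2]
        linarith only [h0]

end VK

namespace VK
open Finset

lemma le_exp_half {x : ℝ} (hx : 0 ≤ x) : x ≤ Real.exp (x / 2) := by
  have := Real.quadratic_le_exp_of_nonneg (x := x / 2) (by linarith)
  nlinarith [sq_nonneg (x - 2)]

lemma exp_ge_two_pow (n : ℕ) : (2 : ℝ) ^ n ≤ Real.exp n := by
  have h : (2:ℝ) ≤ Real.exp 1 := by have := Real.add_one_le_exp (1:ℝ); linarith
  calc (2:ℝ) ^ n ≤ (Real.exp 1) ^ n := by gcongr
    _ = Real.exp n := by rw [← Real.exp_nat_mul, mul_one]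

set_option maxHeartbeats 1000000 in
lemma JJ_cor {k : ℕ} (hk : 4 ≤ k) (P : ℕ) (hP : 1 ≤ P) :
    (JJ k (11 * k ^ 2) (Ico 0 (P:ℤ)) : ℝ) ≤ Real.exp (40 * (k:ℝ)^4) *
      (P:ℝ) ^ (2 * (11 * (k:ℝ) ^ 2) - (k:ℝ)*(k+1)/2 + (k:ℝ)*(k+1)/2 / 20000) := by
  have hkr : (4:ℝ) ≤ k := by exact_mod_cast hk
  have h0 := JJ_bound (L := 10 * k) hk (by nlinarith [Nat.mul_le_mul hk hk, Nat.zero_le (k*k)]) (10 * k) le_rfl P hP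
  have e0 : k * k + 10 * k * k = 11 * k ^ 2 := by ring
  rw [e0] at h0
  refine h0.trans ?_
  have hk4 : (k:ℝ)^4 ≤ Real.exp (2 * k) := by
    calc (k:ℝ)^4 ≤ (Real.exp (k/2))^4 := by gcongr; exact le_exp_half (by positivity)
      _ = _ := by rw [← Real.exp_nat_mul]; congr 1; push_cast; ring
  have hk1 : (k:ℝ) ≤ Real.exp k := (Real.add_one_le_exp (k:ℝ)).trans' (by linarith)
  have h64 : (64:ℝ) ≤ Real.exp 6 := by have := exp_ge_two_pow 6; norm_num at this; exact this
  have h12 : (12:ℝ) ≤ Real.exp 4 := by have := exp_ge_two_pow 4; norm_num at this; linarith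
  have h4 : (4:ℝ) ≤ Real.exp 2 := by have := exp_ge_two_pow 2; norm_num at this; linarith
  have hA : ((64*(k:ℝ)^4)^k)^((k:ℝ)*(k+1)/2) ≤ Real.exp (4 * (k:ℝ)^4) := by
    have h1 : (64*(k:ℝ)^4)^k ≤ Real.exp (4 * k ^ 2) := by
      calc (64*(k:ℝ)^4)^k ≤ (Real.exp 6 * Real.exp (2 * k)) ^ k := by gcongr
        _ = Real.exp (k * (6 + 2 * k)) := by rw [← Real.exp_add, ← Real.exp_nat_mul]
        _ ≤ _ := by apply Real.exp_le_exp.mpr; nlinarith only [hkr]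
    calc _ ≤ (Real.exp (4 * k ^ 2)) ^ ((k:ℝ)*(k+1)/2) := by gcongr
      _ = Real.exp (4 * k ^ 2 * ((k:ℝ)*(k+1)/2)) := by rw [← Real.exp_mul]
      _ ≤ _ := by
        apply Real.exp_le_exp.mpr
        have : (k:ℝ) * (k+1)/2 ≤ k^2 := by nlinarith
        calc 4 * (k:ℝ) ^ 2 * ((k:ℝ)*(k+1)/2) ≤ 4 * (k:ℝ)^2 * k^2 := by gcongr
          _ = _ := by ring
  have hB : (12*((k:ℝ)^4)^(2*k)*k^k*4^(k*k))^(10*k) ≤ Real.exp (36 * (k:ℝ)^4) := by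
    have h1 : 12*((k:ℝ)^4)^(2*k)*k^k*4^(k*k) ≤ Real.exp (8 * k ^ 2) := by
      calc 12*((k:ℝ)^4)^(2*k)*k^k*4^(k*k) ≤
          Real.exp 4 * (Real.exp (2 * k)) ^ (2 * k) * (Real.exp k) ^ k * (Real.exp 2) ^ (k * k) := by gcongr
        _ = Real.exp (4 + 7 * k ^ 2) := by
          rw [← Real.exp_nat_mul, ← Real.exp_nat_mul, ← Real.exp_nat_mul, ← Real.exp_add, ← Real.exp_add, ← Real.exp_add]
          congr 1; push_cast; ring
        _ ≤ _ := by apply Real.exp_le_exp.mpr; nlinarith only [hkr]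
    calc _ ≤ (Real.exp (8 * k ^ 2)) ^ (10 * k) := by gcongr
      _ = Real.exp (80 * k ^ 3) := by rw [← Real.exp_nat_mul]; congr 1; push_cast; ring
      _ ≤ _ := by
        apply Real.exp_le_exp.mpr
        have : 0 ≤ (k:ℝ)^3 := by positivity
        nlinarith only [this, hkr]
  have hC : (1 - 1/(k:ℝ))^(10*k) ≤ 1 / 20000 := by
    have h1 : 1 - 1/(k:ℝ) ≤ Real.exp (-(1/k)) := by
      have := Real.add_one_le_exp (-(1/(k:ℝ))); linarith
    have h0 : 0 ≤ 1 - 1/(k:ℝ) := by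
      have : 1/(k:ℝ) ≤ 1 := by rw [div_le_one (by positivity)]; linarith
      linarith
    calc (1 - 1/(k:ℝ))^(10*k) ≤ (Real.exp (-(1/k)))^(10*k) := by gcongr
      _ = Real.exp (-10) := by
        rw [← Real.exp_nat_mul]; congr 1; push_cast; field_simp
      _ ≤ _ := by
        rw [Real.exp_neg, ← one_div]
        apply one_div_le_one_div_of_le (by norm_num)
        have : (2.7:ℝ) ^ 10 ≤ Real.exp 10 := by
          calc (2.7:ℝ) ^ 10 ≤ (Real.exp 1) ^ 10 := by
                gcongr; have := Real.exp_one_gt_d9; linarith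
            _ = Real.exp 10 := by rw [← Real.exp_nat_mul]; norm_num
        norm_num at this ⊢; linarith
  have hP1 : (1:ℝ) ≤ P := by exact_mod_cast hP
  have hD : (P:ℝ)^(2*((11 * k ^ 2:ℕ):ℝ) - (k:ℝ)*(k+1)/2 + (k:ℝ)*(k+1)/2*(1-1/k)^(10 * k)) ≤
     (P:ℝ) ^ (2 * (11 * (k:ℝ) ^ 2) - (k:ℝ)*(k+1)/2 + (k:ℝ)*(k+1)/2 / 20000) := by
    apply Real.rpow_le_rpow_of_exponent_le hP1
    push_cast
    have : (k:ℝ)*(k+1)/2*(1-1/k)^(10 * k) ≤ (k:ℝ)*(k+1)/2 * (1/20000) := by gcongr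
    linarith
  calc _ ≤ Real.exp (4 * (k:ℝ)^4) * Real.exp (36 * (k:ℝ)^4) * (P:ℝ) ^ (2 * (11 * (k:ℝ) ^ 2) - (k:ℝ)*(k+1)/2 + (k:ℝ)*(k+1)/2 / 20000) := by gcongr
    _ = _ := by rw [← Real.exp_add, show 4 * (k:ℝ)^4 + 36 * (k:ℝ)^4 = 40 * (k:ℝ)^4 by ring]

lemma good_card {κ : ℝ} {k : ℕ} (hκ : 1/2 ≤ κ) (hk : 5 * κ ≤ k) :
    0.4 * κ ≤ ((univ : Finset (Fin k)).filter
      (fun j => 1.2 * κ ≤ (j.val + 1 : ℕ) ∧ ((j.val + 1 : ℕ) : ℝ) ≤ 2.4 * κ)).card := by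
  have hsub : Icc ⌈1.2 * κ⌉₊ ⌊2.4 * κ⌋₊ ⊆ ((univ : Finset (Fin k)).filter
      (fun j => 1.2 * κ ≤ (j.val + 1 : ℕ) ∧ ((j.val + 1 : ℕ) : ℝ) ≤ 2.4 * κ)).image (fun j => j.val + 1) := by
    intro J hJ
    rw [mem_Icc] at hJ
    have h1 : 1.2 * κ ≤ J := Nat.ceil_le.mp hJ.1
    have h2 : (J:ℝ) ≤ 2.4 * κ := (Nat.le_floor_iff (by linarith)).mp hJ.2
    have h3 : 1 ≤ J := by
      by_contra h
      have : J = 0 := by omega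
      rw [this] at h1; push_cast at h1; linarith
    have h4 : J ≤ k := by
      have : (J:ℝ) ≤ k := by linarith
      exact_mod_cast this
    rw [mem_image]
    refine ⟨⟨J - 1, by omega⟩, ?_, by simp; omega⟩
    have : J - 1 + 1 = J := by omega
    simp only [mem_filter, mem_univ, true_and, this]
    exact ⟨h1, h2⟩
  have hc := (card_le_card hsub).trans card_image_le
  have hc' : ((Icc ⌈1.2 * κ⌉₊ ⌊2.4 * κ⌋₊).card : ℝ) ≤ _ := Nat.cast_le.mpr hc
  refine le_trans ?_ hc'
  rw [Nat.card_Icc]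
  have f1 := Nat.lt_floor_add_one (2.4 * κ)
  have f2 := Nat.ceil_lt_add_one (a := 1.2 * κ) (by linarith)
  by_cases hh : 1.25 ≤ κ
  · have : ⌈1.2 * κ⌉₊ ≤ ⌊2.4 * κ⌋₊ + 1 := by
      have : (⌈1.2 * κ⌉₊ : ℝ) ≤ (⌊2.4 * κ⌋₊ + 1 : ℕ) := by push_cast; linarith
      exact_mod_cast this
    rw [Nat.cast_sub this]; push_cast; linarith
  · have hge : 1 ≤ ⌊2.4 * κ⌋₊ := by
      rw [Nat.le_floor_iff (by linarith)]; push_cast; linarith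
    have : ⌈1.2 * κ⌉₊ ≤ ⌊2.4 * κ⌋₊ := by
      rw [Nat.ceil_le]
      have : (1:ℝ) ≤ ⌊2.4 * κ⌋₊ := by exact_mod_cast hge
      linarith
    have h1 : 1 ≤ ⌊2.4 * κ⌋₊ + 1 - ⌈1.2 * κ⌉₊ := by omega
    have : (1:ℝ) ≤ (⌊2.4 * κ⌋₊ + 1 - ⌈1.2 * κ⌉₊ : ℕ) := by exact_mod_cast h1
    linarith

end VK

namespace VK
open Finset

set_option maxHeartbeats 1000000 in
lemma prodW {M κ t n : ℝ} {Q k : ℕ} (hM : 1 ≤ M) (hκ : 1/2 ≤ κ) (ht : t = M ^ κ) (hn1 : M ≤ n)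
    (hn2 : n ≤ 2 * M) (hQ : 1 ≤ Q) (hQ2 : M ^ (0.4 : ℝ) ≤ 2 * Q) (hk4 : 4 ≤ k) (hk : 5 * κ ≤ k)
    (α : Fin k → ℝ) (hα : ∀ j, |α j| = t / (2 * Real.pi * (j.val + 1 : ℕ) * n ^ (j.val + 1))) :
    ∏ j, WW (α j) (11 * k ^ 2 * Q ^ (j.val + 1)) ≤
      Real.exp (8 * k ^ 2) * (Q:ℝ) ^ (k * (k + 1)) * M ^ (-0.016 * κ ^ 2) := by
  have hkr : (4:ℝ) ≤ k := by exact_mod_cast hk4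
  have hM0 : 0 < M := by linarith
  have hQr : (1 : ℝ) ≤ Q := by exact_mod_cast hQ
  set g := M ^ (-0.04 * κ) with hg
  have hg0 : 0 < g := by positivity
  set s := 11 * k ^ 2 with hs
  have hs1 : 1 ≤ s := by rw [hs]; nlinarith
  have hsr : (s:ℝ) = 11 * k ^ 2 := by rw [hs]; push_cast; ring
  have h9 : 9 * (s:ℝ)^2 ≤ Real.exp (4 * k) := by
    rw [hsr]
    have hk4 : (k:ℝ)^4 ≤ Real.exp (2 * k) := by
      calc (k:ℝ)^4 ≤ (Real.exp (k/2))^4 := by gcongr; exact le_exp_half (by positivity)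
        _ = _ := by rw [← Real.exp_nat_mul]; congr 1; push_cast; ring
    have h1 : (1089:ℝ) ≤ Real.exp (2 * k) := by
      calc (1089:ℝ) ≤ 2.7 ^ 8 := by norm_num
        _ ≤ (Real.exp 1) ^ 8 := by
              gcongr; have := Real.exp_one_gt_d9; linarith
        _ = Real.exp 8 := by rw [← Real.exp_nat_mul]; norm_num
        _ ≤ _ := by apply Real.exp_le_exp.mpr; linarith
    calc 9 * (11 * (k:ℝ) ^ 2)^2 = 1089 * k ^ 4 := by ring
      _ ≤ Real.exp (2 * k) * Real.exp (2 * k) := by gcongr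
      _ = _ := by rw [← Real.exp_add]; congr 1; ring
  have h17 : ∀ J : ℕ, J ≤ k → (17 : ℝ) * 8 ^ J ≤ Real.exp (4 * k) := by
    intro J hJ
    have h1 : (17:ℝ) ≤ Real.exp k := by
      calc (17:ℝ) ≤ 2.7 ^ 4 := by norm_num
        _ ≤ (Real.exp 1) ^ 4 := by
              gcongr; have := Real.exp_one_gt_d9; linarith
        _ = Real.exp 4 := by rw [← Real.exp_nat_mul]; norm_num
        _ ≤ _ := by apply Real.exp_le_exp.mpr; linarith
    have h2 : (8:ℝ) ≤ Real.exp 3 := by have := exp_ge_two_pow 3; norm_num at this; exact this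
    calc (17 : ℝ) * 8 ^ J ≤ Real.exp k * 8 ^ k := by
          gcongr; norm_num
      _ ≤ Real.exp k * (Real.exp 3) ^ k := by gcongr
      _ = _ := by rw [← Real.exp_nat_mul, ← Real.exp_add]; congr 1; ring
  let P : Fin k → Prop := fun j => 1.2 * κ ≤ (j.val + 1 : ℕ) ∧ ((j.val + 1 : ℕ) : ℝ) ≤ 2.4 * κ
  classical
  have step : ∀ j : Fin k, WW (α j) (s * Q ^ (j.val + 1)) ≤
      Real.exp (8 * k) * (Q:ℝ) ^ (2 * (j.val + 1)) * (if P j then g else 1) := by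
    intro j
    have e8 : Real.exp (8 * k) = Real.exp (4 * k) * Real.exp (4 * k) := by
      rw [← Real.exp_add]; congr 1; ring
    split_ifs with hP
    · refine (good_W hM (by linarith) ht hn1 hn2 hQ hQ2 hs1 (by omega) hP.1 hP.2 (α j) (hα j)).trans ?_
      rw [e8]
      calc _ ≤ Real.exp (4 * k) * (Q:ℝ) ^ (2 * (j.val + 1)) * (Real.exp (4 * k) * g) := by
            gcongr
            exact h17 _ (by omega)
        _ = _ := by ring
    · refine (WW_triv _ _).trans ?_
      have hA : (1:ℝ) ≤ (s * Q ^ (j.val + 1) : ℕ) := by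
        have : 1 ≤ s * Q ^ (j.val + 1) := Nat.mul_pos hs1 (Nat.pow_pos hQ)
        exact_mod_cast this
      calc (2 * ((s * Q ^ (j.val + 1) : ℕ) : ℝ) + 1)^2 ≤ (3 * ((s * Q ^ (j.val + 1) : ℕ) : ℝ))^2 := by
            gcongr; linarith
        _ = 9 * (s:ℝ)^2 * (Q:ℝ) ^ (2 * (j.val + 1)) := by push_cast; ring
        _ ≤ Real.exp (8 * k) * (Q:ℝ) ^ (2 * (j.val + 1)) * 1 := by
            rw [mul_one]; gcongr
            refine h9.trans (Real.exp_le_exp.mpr (by linarith))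
  have hnn : ∀ (β : ℝ) A, 0 ≤ WW β A := fun β A => Finset.sum_nonneg (fun _ _ => norm_nonneg _)
  refine (Finset.prod_le_prod (fun j _ => hnn _ _) (fun j _ => step j)).trans ?_
  rw [prod_mul_distrib, prod_mul_distrib, prod_const, prod_pow_eq_pow_sum, prod_ite, prod_const, prod_const_one, mul_one,
    card_univ, Fintype.card_fin]
  have es : ∑ i : Fin k, 2 * (i.val + 1) = k * (k + 1) := by
    rw [Fin.sum_univ_eq_sum_range (fun i => 2 * (i + 1)) k]
    clear * -
    induction k with
    | zero => simp
    | succ m ih => rw [sum_range_succ, ih]; ring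
  rw [es, ← Real.exp_nat_mul]
  have hc := good_card hκ hk
  have hgc : g ^ (univ.filter P).card ≤ M ^ (-0.016 * κ ^ 2) := by
    rw [← Real.rpow_natCast, hg, ← Real.rpow_mul hM0.le]
    apply Real.rpow_le_rpow_of_exponent_le hM
    have : 0.4 * κ ≤ ((univ.filter P).card : ℝ) := by convert hc
    nlinarith only [this, hκ]
  calc _ ≤ Real.exp (k * (8 * k)) * (Q:ℝ) ^ (k * (k + 1)) * M ^ (-0.016 * κ ^ 2) := by gcongr
    _ = _ := by congr 3; ring

set_option maxHeartbeats 1000000 in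
lemma Sn_bound {M κ t n : ℝ} {Q k : ℕ} (hM : 1 ≤ M) (hκ : 1/2 ≤ κ) (ht : t = M ^ κ) (hn1 : M ≤ n)
    (hn2 : n ≤ 2 * M) (hQ : 1 ≤ Q) (hQ2 : M ^ (0.4 : ℝ) ≤ 2 * Q) (hQ3 : (Q:ℝ) ≤ M ^ (0.4:ℝ))
    (hk : 5 * κ ≤ k) (hk4 : 4 ≤ k) (hk' : k ≤ 5 * κ + 3)
    (α : Fin k → ℝ) (hα : ∀ j, |α j| = t / (2 * Real.pi * (j.val + 1 : ℕ) * n ^ (j.val + 1))) :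
    ‖∑ x ∈ Ico 0 (Q:ℤ), ∑ y ∈ Ico 0 (Q:ℤ), ee (∑ j:Fin k, α j*(x*y:ℝ)^(j.val+1))‖ ≤
      2 * (Q:ℝ) ^ 2 * M ^ (-(0.000000001) / κ ^ 2) := by
  have hkr : (4:ℝ) ≤ k := by exact_mod_cast hk4
  have hM0 : 0 < M := by linarith
  have hQr : (1 : ℝ) ≤ Q := by exact_mod_cast hQ
  have hQ0 : (0 : ℝ) < Q := by linarith
  have hs1 : 1 ≤ 11 * k ^ 2 := by nlinarith
  have hb := bilinear (k := k) (s := 11 * k ^ 2) (Q := Q) hs1 α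
  have hW := prodW hM hκ ht hn1 hn2 hQ hQ2 hk4 hk α hα
  have hJ := JJ_cor hk4 Q hQ
  set X := ‖∑ x ∈ Ico 0 (Q:ℤ), ∑ y ∈ Ico 0 (Q:ℤ), ee (∑ j:Fin k, α j*(x*y:ℝ)^(j.val+1))‖ with hX
  set K : ℝ := (k:ℝ)*(k+1)/2 with hK
  set N := 2*(11 * k ^ 2)*(2*(11 * k ^ 2)) with hN
  have hNk : N = 484 * k ^ 4 := by rw [hN]; ring
  have hNr : (N:ℝ) = 484 * k ^ 4 := by rw [hNk]; push_cast; ring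
  have hN0 : N ≠ 0 := by rw [hNk]; positivity
  have eQ : ((Q:ℝ)^(2*(11 * k ^ 2)-1))^(2*(11 * k ^ 2)) * ((Q:ℝ)^(2*(11 * k ^ 2)))^(2*(11 * k ^ 2)-1) =
      (Q:ℝ) ^ (2 * (N:ℝ) - 4 * (11 * k ^ 2)) := by
    rw [← pow_mul, ← pow_mul, ← pow_add, ← Real.rpow_natCast]
    congr 1
    rw [hNr]
    push_cast [Nat.cast_sub (show 1 ≤ 2*(11 * k ^ 2) by omega)]
    ring
  rw [eQ] at hb
  have hWnn : 0 ≤ ∏ j, WW (α j) (11 * k ^ 2 * Q ^ (j.val + 1)) :=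
    Finset.prod_nonneg (fun j _ => Finset.sum_nonneg (fun _ _ => norm_nonneg _))
  have key : X ^ N ≤ (2 * (Q:ℝ) ^ 2 * M ^ (-(0.000000001) / κ ^ 2)) ^ N := by
    refine hb.trans ?_
    set R := 2 * (11 * (k:ℝ) ^ 2) - K + K / 20000 with hR
    calc _ ≤ (Q:ℝ) ^ (2 * (N:ℝ) - 4 * (11 * k ^ 2)) * ((Real.exp (40 * (k:ℝ)^4) * (Q:ℝ) ^ R) *
          ((Real.exp (40 * (k:ℝ)^4) * (Q:ℝ) ^ R) *
            (Real.exp (8 * k ^ 2) * (Q:ℝ) ^ (k * (k + 1)) * M ^ (-0.016 * κ ^ 2)))) := by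
          gcongr
      _ = (Real.exp (40 * (k:ℝ)^4) * Real.exp (40 * (k:ℝ)^4) * Real.exp (8 * k ^ 2)) *
            ((Q:ℝ) ^ (2 * (N:ℝ) - 4 * (11 * k ^ 2)) * (Q:ℝ) ^ R * (Q:ℝ) ^ R * (Q:ℝ) ^ (k * (k + 1))) *
            M ^ (-0.016 * κ ^ 2) := by ring
      _ = Real.exp (80 * (k:ℝ)^4 + 8 * k ^ 2) * (((Q:ℝ) ^ 2) ^ N * (Q:ℝ) ^ (K / 10000)) *
            M ^ (-0.016 * κ ^ 2) := by
          rw [← Real.exp_add, ← Real.exp_add, ← Real.rpow_natCast (Q:ℝ) (k * (k + 1)), ← pow_mul,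
            ← Real.rpow_natCast (Q:ℝ) (2 * N), ← Real.rpow_add hQ0, ← Real.rpow_add hQ0, ← Real.rpow_add hQ0,
            ← Real.rpow_add hQ0]
          congr 3
          · ring
          · rw [hR, hK]; push_cast; ring
      _ ≤ (2:ℝ) ^ N * (((Q:ℝ) ^ 2) ^ N * M ^ (0.003 * κ ^ 2)) * M ^ (-0.016 * κ ^ 2) := by
          have h1 : Real.exp (80 * (k:ℝ)^4 + 8 * k ^ 2) ≤ 2 ^ N := by
            have hlog : (0.5:ℝ) ≤ Real.log 2 := by have := Real.log_two_gt_d9; linarith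
            rw [← Real.exp_log (show (0:ℝ) < 2 by norm_num), ← Real.exp_nat_mul]
            apply Real.exp_le_exp.mpr
            rw [hNr]
            have hk2 : (16:ℝ) ≤ k ^ 2 := by nlinarith only [hkr]
            have : (k:ℝ)^4 = k^2 * k^2 := by ring
            have h4 : (k:ℝ)^2 ≤ k^4 := by rw [this]; nlinarith only [hk2]
            have h5 : 0 ≤ (k:ℝ)^4 := by positivity
            nlinarith only [h4, h5, hlog]
          have h2 : (Q:ℝ) ^ (K / 10000) ≤ M ^ (0.003 * κ ^ 2) := by
            have hK0 : 0 ≤ K := by positivity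
            calc (Q:ℝ) ^ (K / 10000) ≤ (M ^ (0.4:ℝ)) ^ (K / 10000) := by gcongr
              _ = M ^ (0.4 * (K / 10000)) := by rw [← Real.rpow_mul hM0.le]
              _ ≤ _ := by
                apply Real.rpow_le_rpow_of_exponent_le hM
                rw [hK]
                have a1 : (k:ℝ) ≤ 11 * κ := by linarith
                have a2 : (k:ℝ) + 1 ≤ 13 * κ := by linarith
                have : (k:ℝ) * (k+1) ≤ (11 * κ) * (13 * κ) := by gcongr
                nlinarith only [this, sq_nonneg κ]
          gcongr
      _ = (2:ℝ) ^ N * ((Q:ℝ) ^ 2) ^ N * M ^ (-0.013 * κ ^ 2) := by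
          have : M ^ (-0.013 * κ ^ 2) = M ^ (0.003 * κ ^ 2) * M ^ (-0.016 * κ ^ 2) := by
            rw [← Real.rpow_add hM0]; congr 1; ring
          rw [this]; ring
      _ ≤ (2:ℝ) ^ N * ((Q:ℝ) ^ 2) ^ N * (M ^ (-(0.000000001) / κ ^ 2)) ^ N := by
          gcongr
          rw [← Real.rpow_natCast (M ^ (-(0.000000001) / κ ^ 2)) N, ← Real.rpow_mul hM0.le]
          apply Real.rpow_le_rpow_of_exponent_le hM
          rw [hNr]
          have a1 : (k:ℝ) ≤ 11 * κ := by linarith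
          have a4 : (k:ℝ)^4 ≤ (11 * κ)^4 := by gcongr
          have hκ0 : 0 < κ := by linarith
          rw [div_mul_eq_mul_div, le_div_iff₀ (by positivity)]
          have : 0 ≤ κ ^ 4 := by positivity
          nlinarith only [a4, this]
      _ = _ := by rw [← mul_pow, ← mul_pow]
  exact le_of_pow_le_pow_left₀ hN0 (by positivity) key

end VK

namespace VK
open Finset

lemma shift_one (ψ : ℕ → ℂ) (h : ∀ n, ‖ψ n‖ ≤ 1) (N b : ℕ) (hb : N ≤ b) :
    ‖∑ n ∈ Ioc N b, ψ n - ∑ n ∈ Ioc N b, ψ (n + 1)‖ ≤ 2 := by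
  have : ∑ n ∈ Ioc N b, ψ n - ∑ n ∈ Ioc N b, ψ (n + 1) = ψ (N + 1) - ψ (b + 1) := by
    induction b, hb using Nat.le_induction with
    | base => simp
    | succ b hb ih =>
      rw [sum_Ioc_succ_top (by omega), sum_Ioc_succ_top (by omega)]
      linear_combination ih
  rw [this]
  have := norm_sub_le (ψ (N+1)) (ψ (b+1))
  linarith [h (N+1), h (b+1)]

lemma shift_sum (ψ : ℕ → ℂ) (h : ∀ n, ‖ψ n‖ ≤ 1) (N b : ℕ) (hb : N ≤ b) (m : ℕ) :
    ‖∑ n ∈ Ioc N b, ψ n - ∑ n ∈ Ioc N b, ψ (n + m)‖ ≤ 2 * m := by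
  induction m with
  | zero => simp
  | succ m ih =>
    have h1 := shift_one (fun n => ψ (n + m)) (fun n => h _) N b hb
    have e : ∑ n ∈ Ioc N b, ψ n - ∑ n ∈ Ioc N b, ψ (n + (m + 1)) =
      (∑ n ∈ Ioc N b, ψ n - ∑ n ∈ Ioc N b, ψ (n + m)) +
      (∑ n ∈ Ioc N b, ψ (n + m) - ∑ n ∈ Ioc N b, ψ (n + 1 + m)) := by
      have : ∀ n, n + (m + 1) = n + 1 + m := fun n => by ring
      simp only [this]; ring
    rw [e]
    refine (norm_add_le _ _).trans ?_
    push_cast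
    linarith

lemma ee_lip (a b : ℝ) : ‖ee a - ee b‖ ≤ 2 * Real.pi * |a - b| := by
  have e : ee a - ee b = ee b * (ee (a - b) - 1) := by
    rw [mul_sub, ← ee_add]; simp
  rw [e, norm_mul, norm_ee, one_mul]
  unfold ee
  have : (2 * Real.pi * ((a - b : ℝ) : ℂ) * Complex.I) = Complex.I * ((2 * Real.pi * (a - b) : ℝ) : ℂ) := by
    push_cast; ring
  have h := Real.norm_exp_I_mul_ofReal_sub_one_le (x := 2 * Real.pi * (a - b))
  refine le_trans (le_of_eq ?_) (h.trans ?_)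
  · rw [← this]
  · rw [Real.norm_eq_abs, abs_mul, abs_of_pos (by positivity)]

set_option maxHeartbeats 1000000 in
lemma inner_bound {N : ℕ} {κ t : ℝ} {n Q k : ℕ} (hN : 32 ≤ N) (hκ : 1/2 ≤ κ) (ht : t = (N:ℝ) ^ κ) (hn1 : N ≤ n)
    (hn2 : n ≤ 2 * N) (hQ : 1 ≤ Q) (hQ2 : (N:ℝ) ^ (0.4 : ℝ) ≤ 2 * Q) (hQ3 : (Q:ℝ) ≤ (N:ℝ) ^ (0.4:ℝ))
    (hk : 5 * κ ≤ k) (hk4 : 4 ≤ k) (hk' : k ≤ 5 * κ + 3) :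
    ‖∑ x ∈ Ico 0 (Q:ℤ), ∑ y ∈ Ico 0 (Q:ℤ), ee (-(t / (2 * Real.pi)) * Real.log ((n + (x * y).toNat : ℕ) : ℝ))‖ ≤
      (Q:ℝ) ^ 2 * (2 * (N:ℝ) ^ (-(0.000000001) / κ ^ 2) + 2 * (N:ℝ) ^ (-0.2:ℝ)) := by
  have hNr : (32:ℝ) ≤ N := by exact_mod_cast hN
  have hN0 : (0:ℝ) < N := by linarith
  have hn1r : (N:ℝ) ≤ n := by exact_mod_cast hn1
  have hn2r : (n:ℝ) ≤ 2 * N := by exact_mod_cast hn2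
  have hn0 : (0:ℝ) < n := by linarith
  have hpi := Real.pi_pos
  have ht0 : 0 < t := by rw [ht]; positivity
  let α : Fin k → ℝ := fun j => (t / (2 * Real.pi)) * ((-1) ^ (j.val + 1) / ((j.val + 1 : ℕ) * (n:ℝ) ^ (j.val + 1)))
  have hα : ∀ j, |α j| = t / (2 * Real.pi * (j.val + 1 : ℕ) * (n:ℝ) ^ (j.val + 1)) := by
    intro j
    simp only [α]
    rw [abs_mul, abs_div ((-1) ^ (j.val + 1)), abs_pow, abs_neg, abs_one, one_pow, abs_of_pos (show 0 < t / (2 * Real.pi) by positivity), abs_of_pos (by positivity)]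
    field_simp
  have hS := Sn_bound (by linarith) hκ ht hn1r hn2r hQ hQ2 hQ3 hk hk4 hk' α hα
  have hd : ∀ x ∈ Ico 0 (Q:ℤ), ∀ y ∈ Ico 0 (Q:ℤ),
      ‖ee (-(t / (2 * Real.pi)) * Real.log ((n + (x * y).toNat : ℕ) : ℝ)) -
        ee (-(t / (2 * Real.pi)) * Real.log n) * ee (∑ j:Fin k, α j*(x*y:ℝ)^(j.val+1))‖ ≤ 2 * (N:ℝ) ^ (-0.2:ℝ) := by
    intro x hx y hy
    rw [mem_Ico] at hx hy
    have hxy : 0 ≤ x * y := mul_nonneg hx.1 hy.1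
    have hx0 : (0:ℝ) ≤ x := by exact_mod_cast hx.1
    have hy0 : (0:ℝ) ≤ y := by exact_mod_cast hy.1
    have hxQ : (x:ℝ) ≤ Q := by exact_mod_cast hx.2.le
    have hyQ : (y:ℝ) ≤ Q := by exact_mod_cast hy.2.le
    have hcast : (((x * y).toNat : ℕ) : ℝ) = x * y := by
      have : (((x * y).toNat : ℕ) : ℤ) = x * y := Int.toNat_of_nonneg hxy
      exact_mod_cast congrArg (Int.cast (R := ℝ)) this
    set z : ℝ := x * y / n with hz
    have hz0 : 0 ≤ z := by positivity
    have hz1 : z ≤ (N:ℝ) ^ (-0.2:ℝ) := by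
      rw [hz, div_le_iff₀ hn0]
      calc (x:ℝ) * y ≤ Q * Q := by gcongr
        _ ≤ (N:ℝ) ^ (0.4:ℝ) * (N:ℝ) ^ (0.4:ℝ) := by gcongr
        _ = (N:ℝ) ^ (-0.2:ℝ) * (N:ℝ) ^ (1:ℝ) := by
          rw [← Real.rpow_add hN0, ← Real.rpow_add hN0]; norm_num
        _ ≤ (N:ℝ) ^ (-0.2:ℝ) * n := by rw [Real.rpow_one]; gcongr
    have hN2 : (N:ℝ) ^ (-0.2:ℝ) ≤ 1/2 := by
      have h32 : (2:ℝ) ≤ (N:ℝ) ^ (0.2:ℝ) := by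
        calc (2:ℝ) = ((2:ℝ)^(5:ℝ)) ^ (0.2:ℝ) := by rw [← Real.rpow_mul (by norm_num)]; norm_num
          _ ≤ (N:ℝ) ^ (0.2:ℝ) := by gcongr; norm_num; linarith
      rw [Real.rpow_neg hN0.le, ← one_div]
      exact one_div_le_one_div_of_le (by norm_num) h32
    have hlog : Real.log ((n + (x * y).toNat : ℕ) : ℝ) = Real.log n + Real.log (1 - -z) := by
      rw [← Real.log_mul hn0.ne' (by linarith)]
      congr 1
      push_cast [hcast]
      rw [hz]; field_simp; ring
    have hT := Real.abs_log_sub_add_sum_range_le (x := -z) (by rw [abs_neg, abs_of_nonneg hz0]; linarith) k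
    rw [hlog, mul_add, ee_add, ← mul_sub, norm_mul, norm_ee, one_mul]
    refine (ee_lip _ _).trans ?_
    have es : ∑ j:Fin k, α j*(x*y:ℝ)^(j.val+1) = (t / (2 * Real.pi)) * ∑ i ∈ range k, (-z) ^ (i + 1) / (i + 1) := by
      rw [← Fin.sum_univ_eq_sum_range (fun i => (-z) ^ (i + 1) / ((i:ℝ) + 1)) k, mul_sum]
      apply sum_congr rfl
      intro j _
      simp only [α, hz]
      rw [neg_pow (x * y / n : ℝ), div_pow]
      push_cast
      field_simp
    have e2 : -(t / (2 * Real.pi)) * Real.log (1 - -z) - ∑ j:Fin k, α j*(x*y:ℝ)^(j.val+1) =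
       -(t / (2 * Real.pi)) * (∑ i ∈ range k, (-z) ^ (i + 1) / (i + 1) + Real.log (1 - -z)) := by rw [es]; ring
    rw [e2, abs_mul, abs_neg, abs_of_pos (show 0 < t / (2 * Real.pi) by positivity)]
    rw [abs_neg, abs_of_nonneg hz0] at hT
    calc 2 * Real.pi * (t / (2 * Real.pi) * |∑ i ∈ range k, (-z) ^ (i + 1) / ((i:ℝ) + 1) + Real.log (1 - -z)|)
        = t * |∑ i ∈ range k, (-z) ^ (i + 1) / ((i:ℝ) + 1) + Real.log (1 - -z)| := by field_simp
      _ ≤ t * (z ^ (k+1) / (1 - z)) := by gcongr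
      _ ≤ t * (((N:ℝ) ^ (-0.2:ℝ)) ^ (k+1) / (1/2)) := by
          gcongr; linarith
      _ = 2 * (N:ℝ) ^ (κ + -0.2 * ((k + 1 : ℕ):ℝ)) := by
          rw [ht, ← Real.rpow_natCast, ← Real.rpow_mul hN0.le, Real.rpow_add hN0]; ring
      _ ≤ _ := by
          gcongr
          · linarith
          · push_cast; linarith
  have hsum : ‖∑ x ∈ Ico 0 (Q:ℤ), ∑ y ∈ Ico 0 (Q:ℤ), ee (-(t / (2 * Real.pi)) * Real.log ((n + (x * y).toNat : ℕ) : ℝ)) -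
      ee (-(t / (2 * Real.pi)) * Real.log n) * ∑ x ∈ Ico 0 (Q:ℤ), ∑ y ∈ Ico 0 (Q:ℤ), ee (∑ j:Fin k, α j*(x*y:ℝ)^(j.val+1))‖
      ≤ (Q:ℝ)^2 * (2 * (N:ℝ) ^ (-0.2:ℝ)) := by
    rw [mul_sum, ← sum_sub_distrib]
    simp_rw [mul_sum, ← sum_sub_distrib]
    calc _ ≤ ∑ x ∈ Ico 0 (Q:ℤ), ∑ y ∈ Ico 0 (Q:ℤ), 2 * (N:ℝ) ^ (-0.2:ℝ) :=
          norm_sum_le_of_le _ fun x hx => norm_sum_le_of_le _ fun y hy => hd x hx y hy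
      _ = _ := by simp; ring
  have h3 := norm_le_norm_add_norm_sub' (∑ x ∈ Ico 0 (Q:ℤ), ∑ y ∈ Ico 0 (Q:ℤ), ee (-(t / (2 * Real.pi)) * Real.log ((n + (x * y).toNat : ℕ) : ℝ)))
    (ee (-(t / (2 * Real.pi)) * Real.log n) * ∑ x ∈ Ico 0 (Q:ℤ), ∑ y ∈ Ico 0 (Q:ℤ), ee (∑ j:Fin k, α j*(x*y:ℝ)^(j.val+1)))
  rw [norm_mul, norm_ee, one_mul] at h3
  nlinarith only [h3, hsum, hS]

set_option maxHeartbeats 1000000 in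
theorem exp_sum {N b : ℕ} {t : ℝ} (hN : 1 ≤ N) (hb1 : N ≤ b) (hb2 : b ≤ 2 * N) (ht : 2 ≤ t) (hNt : (N:ℝ) ≤ t ^ 2) :
    ‖∑ n ∈ Ioc N b, ee (-(t / (2 * Real.pi)) * Real.log (n:ℝ))‖ ≤
      32 * N * Real.exp (-(0.000000001) * Real.log N ^ 3 / Real.log t ^ 2) := by
  have hNr : (1:ℝ) ≤ N := by exact_mod_cast hN
  have hN0 : (0:ℝ) < N := by linarith
  have hl : 0 < Real.log t := Real.log_pos (by linarith)
  have hL0 : 0 ≤ Real.log N := Real.log_nonneg hNr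
  have hL : Real.log N ≤ 2 * Real.log t := by
    have := Real.log_le_log hN0 hNt
    rw [Real.log_pow] at this; exact_mod_cast this
  have hcard : ((Ioc N b).card : ℝ) ≤ N := by
    rw [Nat.card_Ioc]
    have : b - N ≤ N := by omega
    exact_mod_cast this
  by_cases h32 : N < 32
  · have h1 : ‖∑ n ∈ Ioc N b, ee (-(t / (2 * Real.pi)) * Real.log (n:ℝ))‖ ≤ N := by
      refine (norm_sum_le _ _).trans ?_
      simp only [norm_ee, sum_const, nsmul_eq_mul, mul_one]
      exact hcard
    have h2 : Real.log N ≤ 31 := by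
      have : (N:ℝ) ≤ 31 := by exact_mod_cast (by omega : N ≤ 31)
      linarith [Real.log_le_sub_one_of_pos hN0]
    have h3 : 0.000000001 * Real.log N ^ 3 / Real.log t ^ 2 ≤ 1/2 := by
      rw [div_le_iff₀ (by positivity)]
      have : Real.log N ^ 2 ≤ (2 * Real.log t) ^ 2 := by gcongr
      calc 0.000000001 * Real.log N ^ 3 = 0.000000001 * Real.log N * Real.log N ^ 2 := by ring
        _ ≤ 0.000000001 * 31 * (2 * Real.log t) ^ 2 := by gcongr
        _ ≤ _ := by nlinarith [sq_nonneg (Real.log t)]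
    have h4 := Real.add_one_le_exp (-(0.000000001) * Real.log N ^ 3 / Real.log t ^ 2)
    have h5 : -(0.000000001) * Real.log N ^ 3 / Real.log t ^ 2 = -(0.000000001 * Real.log N ^ 3 / Real.log t ^ 2) := by ring
    rw [h5] at h4 ⊢
    refine h1.trans ?_
    have : 1 ≤ 32 * Real.exp (-(0.000000001 * Real.log N ^ 3 / Real.log t ^ 2)) := by linarith
    nlinarith
  push Not at h32
  have h32r : (32:ℝ) ≤ N := by exact_mod_cast h32
  have hLpos : 0 < Real.log N := Real.log_pos (by linarith)
  set κ := Real.log t / Real.log N with hκ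
  have hκ2 : 1/2 ≤ κ := by rw [hκ, le_div_iff₀ hLpos]; linarith
  have htκ : t = (N:ℝ) ^ κ := by
    rw [Real.rpow_def_of_pos hN0, hκ, mul_div_cancel₀ _ hLpos.ne', Real.exp_log (by linarith)]
  set k := ⌈5 * κ⌉₊ + 2 with hk
  have hk1 : 5 * κ ≤ k := by rw [hk]; push_cast; linarith [Nat.le_ceil (5 * κ)]
  have hk3 : (k:ℝ) ≤ 5 * κ + 3 := by
    rw [hk]; push_cast; linarith [Nat.ceil_lt_add_one (a := 5 * κ) (by linarith)]
  have hk4 : 4 ≤ k := by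
    have : (2:ℝ) < ⌈5 * κ⌉₊ := by linarith [Nat.le_ceil (5 * κ)]
    have : 2 < ⌈5 * κ⌉₊ := by exact_mod_cast this
    omega
  set Q := ⌊(N:ℝ) ^ (0.4:ℝ)⌋₊ with hQd
  have hp1 : 1 ≤ (N:ℝ) ^ (0.4:ℝ) := Real.one_le_rpow hNr (by norm_num)
  have hQ : 1 ≤ Q := by rw [hQd, Nat.le_floor_iff (by positivity)]; push_cast; exact hp1
  have hQr : (1:ℝ) ≤ Q := by exact_mod_cast hQ
  have hQ3 : (Q:ℝ) ≤ (N:ℝ) ^ (0.4:ℝ) := Nat.floor_le (by positivity)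
  have hQ2 : (N:ℝ) ^ (0.4:ℝ) ≤ 2 * Q := by
    have := Nat.lt_floor_add_one ((N:ℝ) ^ (0.4:ℝ))
    rw [← hQd] at this
    linarith
  set φ : ℕ → ℂ := fun n => ee (-(t / (2 * Real.pi)) * Real.log (n:ℝ)) with hφ
  have hφ1 : ∀ n, ‖φ n‖ ≤ 1 := fun n => (norm_ee _).le
  set T := ∑ n ∈ Ioc N b, φ n with hT
  have hs : ‖∑ x ∈ Ico 0 (Q:ℤ), ∑ y ∈ Ico 0 (Q:ℤ), (T - ∑ n ∈ Ioc N b, φ (n + (x * y).toNat))‖ ≤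
      (Q:ℝ) ^ 2 * (2 * (Q:ℝ) ^ 2) := by
    calc _ ≤ ∑ x ∈ Ico 0 (Q:ℤ), ∑ y ∈ Ico 0 (Q:ℤ), 2 * (Q:ℝ) ^ 2 := by
          refine norm_sum_le_of_le _ fun x hx => norm_sum_le_of_le _ fun y hy => ?_
          refine (shift_sum φ hφ1 N b hb1 _).trans ?_
          rw [mem_Ico] at hx hy
          have h1 : x * y ≤ Q * Q := mul_le_mul hx.2.le hy.2.le hy.1 (by omega)
          have h2 : (x * y).toNat ≤ Q * Q := by
            rw [Int.toNat_le]; exact_mod_cast h1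
          have h3 : (((x * y).toNat : ℕ) : ℝ) ≤ Q * Q := by exact_mod_cast h2
          nlinarith only [h3]
      _ = _ := by simp; ring
  have e1 : ∑ x ∈ Ico 0 (Q:ℤ), ∑ y ∈ Ico 0 (Q:ℤ), (T - ∑ n ∈ Ioc N b, φ (n + (x * y).toNat)) =
     (Q:ℂ) ^ 2 * T - ∑ n ∈ Ioc N b, ∑ x ∈ Ico 0 (Q:ℤ), ∑ y ∈ Ico 0 (Q:ℤ), φ (n + (x * y).toNat) := by
    simp_rw [sum_sub_distrib]
    congr 1
    · simp; ring
    · rw [sum_comm (s := Ioc N b)]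
      apply sum_congr rfl
      intro x _
      rw [sum_comm]
  have h2 : ‖∑ n ∈ Ioc N b, ∑ x ∈ Ico 0 (Q:ℤ), ∑ y ∈ Ico 0 (Q:ℤ), φ (n + (x * y).toNat)‖ ≤
      N * ((Q:ℝ) ^ 2 * (2 * (N:ℝ) ^ (-(0.000000001) / κ ^ 2) + 2 * (N:ℝ) ^ (-0.2:ℝ))) := by
    calc _ ≤ ∑ n ∈ Ioc N b, ((Q:ℝ) ^ 2 * (2 * (N:ℝ) ^ (-(0.000000001) / κ ^ 2) + 2 * (N:ℝ) ^ (-0.2:ℝ))) := by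
          refine norm_sum_le_of_le _ fun n hn => ?_
          rw [mem_Ioc] at hn
          exact inner_bound h32 hκ2 htκ hn.1.le (by omega) hQ hQ2 hQ3 hk1 hk4 hk3
      _ = ((Ioc N b).card : ℝ) * ((Q:ℝ) ^ 2 * (2 * (N:ℝ) ^ (-(0.000000001) / κ ^ 2) + 2 * (N:ℝ) ^ (-0.2:ℝ))) := by rw [sum_const, nsmul_eq_mul]
      _ ≤ _ := by gcongr
  rw [e1] at hs
  have h3 : ‖(Q:ℂ) ^ 2 * T‖ ≤ (Q:ℝ) ^ 2 * (2 * (Q:ℝ) ^ 2) +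
      N * ((Q:ℝ) ^ 2 * (2 * (N:ℝ) ^ (-(0.000000001) / κ ^ 2) + 2 * (N:ℝ) ^ (-0.2:ℝ))) := by
    have := norm_le_norm_add_norm_sub' ((Q:ℂ) ^ 2 * T)
      (∑ n ∈ Ioc N b, ∑ x ∈ Ico 0 (Q:ℤ), ∑ y ∈ Ico 0 (Q:ℤ), φ (n + (x * y).toNat))
    linarith
  have h4 : ‖T‖ ≤ 2 * (Q:ℝ) ^ 2 + N * (2 * (N:ℝ) ^ (-(0.000000001) / κ ^ 2) + 2 * (N:ℝ) ^ (-0.2:ℝ)) := by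
    rw [norm_mul, norm_pow, Complex.norm_natCast] at h3
    have : (0:ℝ) < (Q:ℝ)^2 := by positivity
    refine le_of_mul_le_mul_left ?_ this
    linarith
  have hκ4 : 0.000000001 / κ ^ 2 ≤ 0.2 := by
    rw [div_le_iff₀ (by positivity)]
    nlinarith
  have h5 : (N:ℝ) ^ (-0.2:ℝ) ≤ (N:ℝ) ^ (-(0.000000001) / κ ^ 2) := by
    apply Real.rpow_le_rpow_of_exponent_le hNr
    rw [neg_div]; linarith
  have h6 : (Q:ℝ)^2 ≤ N * (N:ℝ) ^ (-0.2:ℝ) := by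
    calc (Q:ℝ)^2 ≤ ((N:ℝ) ^ (0.4:ℝ)) ^ 2 := by gcongr
      _ = (N:ℝ) ^ (1 + -0.2:ℝ) := by rw [← Real.rpow_natCast, ← Real.rpow_mul hN0.le]; norm_num
      _ = _ := by rw [Real.rpow_add hN0, Real.rpow_one]
  have h7 : (N:ℝ) ^ (-(0.000000001) / κ ^ 2) = Real.exp (-(0.000000001) * Real.log N ^ 3 / Real.log t ^ 2) := by
    rw [Real.rpow_def_of_pos hN0, hκ]
    congr 1
    field_simp
  rw [← h7]
  have h8 : 0 ≤ (N:ℝ) * (N:ℝ) ^ (-(0.000000001) / κ ^ 2) := by positivity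
  have h9 : (N:ℝ) * (N:ℝ) ^ (-0.2:ℝ) ≤ N * (N:ℝ) ^ (-(0.000000001) / κ ^ 2) := by gcongr
  nlinarith only [h4, h6, h8, h9]

end VK

namespace VK
open Finset

/-- terms of the Euler-Maclaurin type continuation of `(s-1) ζ(s)` -/
noncomputable def vt (n : ℕ) (s : ℂ) : ℂ :=
  (s - 1) * ((n:ℂ) + 1) ^ (-s) + ((n:ℂ) + 2) ^ (1 - s) - ((n:ℂ) + 1) ^ (1 - s)

lemma cpow_sub_bound {n x : ℝ} (hn : 0 < n) (hx : n ≤ x) {s : ℂ} (hs : 0 < s.re) :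
    ‖(n:ℂ) ^ (-s) - (x:ℂ) ^ (-s)‖ ≤ ‖s‖ * n ^ (-s.re - 1) * (x - n) := by
  have hs0 : s ≠ 0 := by rintro rfl; simp at hs
  have h := Convex.norm_image_sub_le_of_norm_hasDerivWithin_le (𝕜 := ℝ) (f := fun y : ℝ => (y:ℂ) ^ (-s))
    (f' := fun y : ℝ => (-s) * (y:ℂ) ^ (-s - 1)) (s := Set.Ici n) (x := n) (y := x)
    (C := ‖s‖ * n ^ (-s.re - 1))
    (fun y hy => (hasDerivAt_ofReal_cpow_const (by rw [Set.mem_Ici] at hy; linarith) (neg_ne_zero.mpr hs0)).hasDerivWithinAt)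
    (by
      intro y hy
      rw [Set.mem_Ici] at hy
      rw [norm_mul, norm_neg, Complex.norm_cpow_eq_rpow_re_of_pos (by linarith)]
      gcongr ‖s‖ * ?_
      simp only [Complex.sub_re, Complex.neg_re, Complex.one_re]
      exact Real.rpow_le_rpow_of_nonpos hn hy (by linarith))
    (convex_Ici n) (Set.mem_Ici.mpr le_rfl) (Set.mem_Ici.mpr hx)
  rw [norm_sub_rev, Real.norm_of_nonneg (by linarith)] at h
  exact h

lemma vt_bound (n : ℕ) {s : ℂ} (hs : 0 < s.re) :
    ‖vt n s‖ ≤ ‖s - 1‖ * ‖s‖ * ((n:ℝ) + 1) ^ (-s.re - 1) := by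
  by_cases hs1 : s = 1
  · subst hs1; simp [vt]
  have h1s : 1 - s ≠ 0 := sub_ne_zero.mpr (Ne.symm hs1)
  set m : ℝ := (n:ℝ) + 1 with hm
  have hm0 : 0 < m := by positivity
  have h := Convex.norm_image_sub_le_of_norm_hasDerivWithin_le (𝕜 := ℝ)
    (f := fun y : ℝ => (s - 1) * (m:ℂ) ^ (-s) * (y:ℂ) + (y:ℂ) ^ (1 - s))
    (f' := fun y : ℝ => (s - 1) * (m:ℂ) ^ (-s) * 1 + (1 - s) * (y:ℂ) ^ (1 - s - 1)) (s := Set.Icc m (m + 1))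
    (x := m) (y := m + 1)
    (C := ‖s - 1‖ * ‖s‖ * m ^ (-s.re - 1))
    (fun y hy => (HasDerivAt.add ((HasDerivAt.ofReal_comp (hasDerivAt_id y)).const_mul _)
      (hasDerivAt_ofReal_cpow_const (by rw [Set.mem_Icc] at hy; linarith) h1s)).hasDerivWithinAt)
    (by
      intro y hy
      rw [Set.mem_Icc] at hy
      have e : (s - 1) * (m:ℂ) ^ (-s) * 1 + (1 - s) * (y:ℂ) ^ (1 - s - 1) =
        (s - 1) * ((m:ℂ) ^ (-s) - (y:ℂ) ^ (-s)) := by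
        rw [show (1 - s - 1) = -s by ring]; ring
      rw [e, norm_mul, mul_assoc]
      gcongr
      refine (cpow_sub_bound hm0 hy.1 hs).trans ?_
      have : 0 ≤ ‖s‖ * m ^ (-s.re - 1) := by positivity
      nlinarith)
    (convex_Icc _ _) (Set.mem_Icc.mpr ⟨le_rfl, by linarith⟩) (Set.mem_Icc.mpr ⟨by linarith, le_rfl⟩)
  rw [add_sub_cancel_left, norm_one, mul_one] at h
  refine le_trans (le_of_eq ?_) h
  congr 1
  rw [vt, hm]
  push_cast
  rw [show (n:ℂ) + 1 + 1 = n + 2 by ring]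
  ring

lemma vt_sum (K : ℕ) (s : ℂ) : ∑ n ∈ range K, vt n s =
    (s - 1) * ∑ n ∈ range K, ((n:ℂ) + 1) ^ (-s) + ((K:ℂ) + 1) ^ (1 - s) - 1 := by
  induction K with
  | zero => simp
  | succ K ih =>
    rw [sum_range_succ, ih, sum_range_succ, vt]
    push_cast
    rw [show (K:ℂ) + 1 + 1 = K + 2 by ring]
    ring

lemma tail_step {n σ : ℝ} (hn : 0 < n) (hσ : 0 < σ) :
    (n + 1) ^ (-σ - 1) ≤ (n ^ (-σ) - (n + 1) ^ (-σ)) / σ := by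
  rw [le_div_iff₀ hσ]
  have h1 : n ^ (-σ) = (n + 1) ^ (-σ) * ((n + 1) / n) ^ σ := by
    rw [Real.div_rpow (by positivity) hn.le, Real.rpow_neg hn.le, Real.rpow_neg (by positivity)]
    field_simp
  have h2 : 1 + σ * (1 / (n + 1)) ≤ ((n + 1) / n) ^ σ := by
    rw [Real.rpow_def_of_pos (by positivity)]
    refine le_trans ?_ (Real.add_one_le_exp _)
    have := Real.one_sub_inv_le_log_of_pos (show 0 < (n + 1) / n by positivity)
    have e : 1 - ((n + 1) / n)⁻¹ = 1 / (n + 1) := by field_simp; ring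
    rw [e] at this
    nlinarith
  have h3 : (n + 1) ^ (-σ - 1) = (n + 1) ^ (-σ) * (1 / (n + 1)) := by
    rw [Real.rpow_sub (by positivity), Real.rpow_one]; ring
  rw [h3, h1]
  have : 0 < (n + 1) ^ (-σ) := by positivity
  nlinarith

lemma tail_sum (K m : ℕ) (hK : 1 ≤ K) {σ : ℝ} (hσ : 0 < σ) :
    ∑ i ∈ range m, (((i + K : ℕ):ℝ) + 1) ^ (-σ - 1) ≤ (K:ℝ) ^ (-σ) / σ := by
  have : ∑ i ∈ range m, (((i + K : ℕ):ℝ) + 1) ^ (-σ - 1) ≤ ((K:ℝ) ^ (-σ) - ((m + K : ℕ):ℝ) ^ (-σ)) / σ := by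
    induction m with
    | zero => simp
    | succ m ih =>
      rw [sum_range_succ]
      have hp : (0:ℝ) < (m + K : ℕ) := by exact_mod_cast (by omega : 0 < m + K)
      have := tail_step hp hσ
      have e : ((m + 1 + K : ℕ):ℝ) = (m + K : ℕ) + 1 := by push_cast; ring
      rw [e]
      calc _ ≤ _ := add_le_add ih this
        _ = _ := by ring
  refine this.trans ?_
  gcongr
  have : 0 ≤ ((m + K : ℕ):ℝ) ^ (-σ) := by positivity
  linarith

lemma vt_summable {s : ℂ} (hs : 0 < s.re) : Summable (fun n => vt n s) := by
  apply Summable.of_norm_bounded (g := fun n : ℕ => ‖s - 1‖ * ‖s‖ * ((n:ℝ) + 1) ^ (-s.re - 1)) _ (fun n => vt_bound n hs)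
  apply Summable.mul_left
  have := (Real.summable_nat_rpow (p := -s.re - 1)).mpr (by linarith)
  have h2 := (summable_nat_add_iff 1).mpr this
  simpa using h2

lemma vt_diff (n : ℕ) : Differentiable ℂ (vt n) := by
  have h1 : (n:ℂ) + 1 ≠ 0 := by exact_mod_cast Nat.succ_ne_zero n
  have h2 : (n:ℂ) + 2 ≠ 0 := by exact_mod_cast Nat.succ_ne_zero (n+1)
  unfold vt
  intro s
  have d1 : DifferentiableAt ℂ (fun s : ℂ => ((n:ℂ) + 1) ^ (-s)) s :=
    (differentiableAt_id.neg).const_cpow (Or.inl h1)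
  have d2 : DifferentiableAt ℂ (fun s : ℂ => ((n:ℂ) + 2) ^ (1 - s)) s :=
    ((differentiableAt_const _).sub differentiableAt_id).const_cpow (Or.inl h2)
  have d3 : DifferentiableAt ℂ (fun s : ℂ => ((n:ℂ) + 1) ^ (1 - s)) s :=
    ((differentiableAt_const _).sub differentiableAt_id).const_cpow (Or.inl h1)
  exact (((differentiableAt_id.sub (differentiableAt_const _)).mul d1).add d2).sub d3

lemma isOpen_half : IsOpen {s : ℂ | 0 < s.re} := isOpen_lt continuous_const Complex.continuous_re

lemma vt_tsum_diff : DifferentiableOn ℂ (fun s => ∑' n, vt n s) {s : ℂ | 0 < s.re} := by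
  intro s0 hs0
  simp only [Set.mem_ofPred_eq] at hs0
  set δ := s0.re / 2 with hδ
  have hδ0 : 0 < δ := by positivity
  set U := Metric.ball s0 δ with hU
  have hre : ∀ w ∈ U, δ < w.re := by
    intro w hw
    rw [hU, Metric.mem_ball, dist_eq_norm] at hw
    have := (Complex.abs_re_le_norm (w - s0)).trans_lt hw
    rw [abs_lt] at this
    simp only [Complex.sub_re] at this
    linarith [this.1]
  have hnorm : ∀ w ∈ U, ‖w‖ ≤ ‖s0‖ + δ := by
    intro w hw
    rw [hU, Metric.mem_ball, dist_eq_norm] at hw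
    have := norm_le_norm_add_norm_sub' w s0
    linarith
  have h := Complex.differentiableOn_tsum_of_summable_norm (F := fun n s => vt n s) (U := U)
    (u := fun n : ℕ => (‖s0‖ + δ + 1) * (‖s0‖ + δ) * ((n:ℝ) + 1) ^ (-δ - 1)) (by
      apply Summable.mul_left
      have := (Real.summable_nat_rpow (p := -δ - 1)).mpr (by linarith)
      have h2 := (summable_nat_add_iff 1).mpr this
      simpa using h2) (fun n => (vt_diff n).differentiableOn) Metric.isOpen_ball (by
      intro n w hw
      refine (vt_bound n (hδ0.trans (hre w hw))).trans ?_
      have h1 : ‖w - 1‖ ≤ ‖s0‖ + δ + 1 := by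
        have := norm_sub_le w 1
        rw [norm_one] at this
        linarith [hnorm w hw]
      have h2 : ((n:ℝ) + 1) ^ (-w.re - 1) ≤ ((n:ℝ) + 1) ^ (-δ - 1) := by
        apply Real.rpow_le_rpow_of_exponent_le
        · have : (0:ℝ) ≤ n := by positivity
          linarith
        · linarith [hre w hw]
      have h3 := hnorm w hw
      gcongr)
  exact ((h.differentiableAt (Metric.isOpen_ball.mem_nhds (Metric.mem_ball_self hδ0)))).differentiableWithinAt

lemma zeta1_eq_of_one_lt {s : ℂ} (hs : 1 < s.re) : riemannZeta₁ s = 1 + ∑' n, vt n s := by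
  have hs1 : s ≠ 1 := by rintro rfl; simp at hs
  have h1 : riemannZeta₁ s = (s - 1) * riemannZeta s := by
    rw [riemannZeta_eq_inv_sub_mul hs1, ← mul_assoc, mul_inv_cancel₀ (sub_ne_zero.mpr hs1), one_mul]
  have hz : Filter.Tendsto (fun K : ℕ => ∑ n ∈ range K, ((n:ℂ) + 1) ^ (-s)) Filter.atTop (nhds (riemannZeta s)) := by
    have hsum : Summable (fun n : ℕ => ((n:ℂ) + 1) ^ (-s)) := by
      have := (summable_nat_add_iff 1).mpr (Complex.summable_one_div_nat_cpow.mpr hs)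
      refine this.congr (fun n => ?_)
      rw [Complex.cpow_neg, one_div]; push_cast; rfl
    have := hsum.hasSum.tendsto_sum_nat
    rw [zeta_eq_tsum_one_div_nat_add_one_cpow hs]
    convert this using 3
    funext n
    rw [Complex.cpow_neg, one_div]
  have hp : Filter.Tendsto (fun K : ℕ => ((K:ℂ) + 1) ^ (1 - s)) Filter.atTop (nhds 0) := by
    rw [tendsto_zero_iff_norm_tendsto_zero]
    have e : ∀ K : ℕ, ‖((K:ℂ) + 1) ^ (1 - s)‖ = (((K+1 : ℕ):ℝ)) ^ (-(s.re - 1)) := by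
      intro K
      have := Complex.norm_cpow_eq_rpow_re_of_pos (show (0:ℝ) < ((K+1:ℕ):ℝ) by positivity) (1 - s)
      rw [show -(s.re - 1) = (1 - s).re by simp]
      rw [← this]; push_cast; rfl
    simp_rw [e]
    exact ((tendsto_rpow_neg_atTop (show 0 < s.re - 1 by linarith)).comp tendsto_natCast_atTop_atTop).comp
      (Filter.tendsto_add_atTop_nat 1)
  have ht := (vt_summable (s := s) (by linarith)).hasSum.tendsto_sum_nat
  simp_rw [vt_sum] at ht
  have ht2 := ((hz.const_mul (s - 1)).add hp).sub_const 1
  have := tendsto_nhds_unique ht ht2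
  rw [this, h1]; ring

lemma zeta1_eq {s : ℂ} (hs : 0 < s.re) : riemannZeta₁ s = 1 + ∑' n, vt n s := by
  have hA : AnalyticOnNhd ℂ riemannZeta₁ {s : ℂ | 0 < s.re} :=
    differentiable_riemannZeta₁.differentiableOn.analyticOnNhd isOpen_half
  have hB : AnalyticOnNhd ℂ (fun s => 1 + ∑' n, vt n s) {s : ℂ | 0 < s.re} :=
    ((differentiableOn_const 1).add vt_tsum_diff).analyticOnNhd isOpen_half
  have hconv : IsPreconnected {s : ℂ | 0 < s.re} := (convex_halfSpace_re_gt 0).isPreconnected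
  refine hA.eqOn_of_preconnected_of_eventuallyEq hB hconv (z₀ := 2) (by simp) ?_ hs
  have : {s : ℂ | 1 < s.re} ∈ nhds (2:ℂ) := (isOpen_lt continuous_const Complex.continuous_re).mem_nhds (by simp)
  filter_upwards [this] with w hw
  exact zeta1_eq_of_one_lt hw

theorem zeta_approx (K : ℕ) (hK : 1 ≤ K) {s : ℂ} (hs : 0 < s.re) (hs1 : s ≠ 1) :
    ‖riemannZeta s - ∑ n ∈ range K, ((n:ℂ) + 1) ^ (-s) - ((K:ℂ) + 1) ^ (1 - s) / (s - 1)‖ ≤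
      ‖s‖ * ((K:ℝ) ^ (-s.re) / s.re) := by
  have h0 : s - 1 ≠ 0 := sub_ne_zero.mpr hs1
  have hsum := vt_summable hs
  have e1 := zeta1_eq hs
  rw [← hsum.sum_add_tsum_nat_add K, vt_sum] at e1
  have e2 : riemannZeta s - ∑ n ∈ range K, ((n:ℂ) + 1) ^ (-s) - ((K:ℂ) + 1) ^ (1 - s) / (s - 1) =
      (s - 1)⁻¹ * ∑' i, vt (i + K) s := by
    rw [riemannZeta_eq_inv_sub_mul hs1, e1]
    field_simp
    ring
  have h3 : ‖∑' i, vt (i + K) s‖ ≤ ‖s - 1‖ * ‖s‖ * ((K:ℝ) ^ (-s.re) / s.re) := by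
    have ht := ((summable_nat_add_iff K).mpr hsum).hasSum.tendsto_sum_nat
    refine le_of_tendsto ht.norm (Filter.Eventually.of_forall fun m => ?_)
    calc ‖∑ i ∈ range m, vt (i + K) s‖ ≤ ∑ i ∈ range m, ‖s - 1‖ * ‖s‖ * (((i + K : ℕ):ℝ) + 1) ^ (-s.re - 1) :=
          norm_sum_le_of_le _ fun i _ => vt_bound (i + K) hs
      _ = ‖s - 1‖ * ‖s‖ * ∑ i ∈ range m, (((i + K : ℕ):ℝ) + 1) ^ (-s.re - 1) := by rw [mul_sum]
      _ ≤ _ := by gcongr; exact tail_sum K m hK hs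
  rw [e2, norm_mul, norm_inv]
  have hn : 0 < ‖s - 1‖ := norm_pos_iff.mpr h0
  rw [inv_mul_le_iff₀ hn]
  linarith
end VK

namespace VK
open Finset

lemma abel_ineq (a : ℕ → ℂ) (w : ℕ → ℝ) (N M : ℕ) (hNM : N ≤ M) (B : ℝ) 
    (hw0 : ∀ n, N < n → 0 ≤ w n) (hw : ∀ n, N < n → w (n+1) ≤ w n)
    (hB : ∀ b, N ≤ b → b ≤ M → ‖∑ n ∈ Ioc N b, a n‖ ≤ B) :
    ‖∑ n ∈ Ioc N M, (w n : ℂ) * a n‖ ≤ w (N+1) * B := by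
  have key : ∀ M, N ≤ M → ∑ n ∈ Ioc N M, (w n : ℂ) * a n = (w (M+1) : ℂ) * ∑ n ∈ Ioc N M, a n
      + ∑ n ∈ Ioc N M, ((w n - w (n+1) : ℝ) : ℂ) * ∑ m ∈ Ioc N n, a m := by
    intro M hM
    induction M, hM using Nat.le_induction with
    | base => simp
    | succ k hk ih =>
      rw [sum_Ioc_succ_top hk, ih, sum_Ioc_succ_top hk, sum_Ioc_succ_top (f := fun n => ((w n - w (n+1) : ℝ) : ℂ) * ∑ m ∈ Ioc N n, a m) hk, sum_Ioc_succ_top hk]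
      push_cast
      ring
  have tel : ∀ M, N ≤ M → ∑ n ∈ Ioc N M, (w n - w (n+1)) = w (N+1) - w (M+1) := by
    intro M hM
    induction M, hM using Nat.le_induction with
    | base => simp
    | succ k hk ih => rw [sum_Ioc_succ_top hk, ih]; ring
  rw [key M hNM]
  refine (norm_add_le _ _).trans ?_
  have h1 : ‖(w (M+1) : ℂ) * ∑ n ∈ Ioc N M, a n‖ ≤ w (M+1) * B := by
    rw [norm_mul, Complex.norm_real, Real.norm_of_nonneg (hw0 _ (by omega))]
    exact mul_le_mul_of_nonneg_left (hB M hNM le_rfl) (hw0 _ (by omega))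
  have h2 : ‖∑ n ∈ Ioc N M, ((w n - w (n+1) : ℝ) : ℂ) * ∑ m ∈ Ioc N n, a m‖ ≤ ∑ n ∈ Ioc N M, (w n - w (n+1)) * B := by
    refine norm_sum_le_of_le _ (fun n hn => ?_)
    rw [mem_Ioc] at hn
    have h0 : 0 ≤ w n - w (n+1) := sub_nonneg.mpr (hw n hn.1)
    rw [norm_mul, Complex.norm_real, Real.norm_of_nonneg h0]
    exact mul_le_mul_of_nonneg_left (hB n hn.1.le hn.2) h0
  rw [← sum_mul, tel M hNM] at h2
  linarith

lemma cpow_ee {n : ℕ} (hn : 1 ≤ n) (σ t : ℝ) : (n:ℂ) ^ (-(σ + t * Complex.I : ℂ)) = (((n:ℝ) ^ (-σ) : ℝ) : ℂ) * ee (-(t / (2 * Real.pi)) * Real.log (n:ℝ)) := by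
  have hn0 : (n:ℂ) ≠ 0 := by exact_mod_cast (by omega : n ≠ 0)
  have hp : (0:ℝ) < n := by exact_mod_cast hn
  rw [neg_add, Complex.cpow_add _ _ hn0, Complex.ofReal_cpow hp.le]
  push_cast
  congr 1
  rw [Complex.cpow_def_of_ne_zero hn0, ee]
  congr 1
  rw [← Complex.natCast_log]
  push_cast
  have : (Real.pi : ℂ) ≠ 0 := by exact_mod_cast Real.pi_ne_zero
  field_simp

lemma block_bound {j : ℕ} {σ t : ℝ} (ht : 2 ≤ t) (hσ : 1 - 0.0001 * Real.log t ^ (-(2:ℝ)/3) ≤ σ) (hσ0 : 0 ≤ σ)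
    (hj : (2:ℝ)^j ≤ t^2) : 
    ‖∑ n ∈ Ioc ((2:ℕ)^j) (2^(j+1)), (n:ℂ) ^ (-(σ + t * Complex.I : ℂ))‖ ≤ 96 := by
  have hl : 0 < Real.log t := Real.log_pos (by linarith)
  have hN : 1 ≤ (2:ℕ)^j := Nat.one_le_two_pow
  have e1 : ∑ n ∈ Ioc ((2:ℕ)^j) (2^(j+1)), (n:ℂ) ^ (-(σ + t * Complex.I : ℂ)) = 
    ∑ n ∈ Ioc ((2:ℕ)^j) (2^(j+1)), (((n:ℝ) ^ (-σ) : ℝ) : ℂ) * ee (-(t / (2 * Real.pi)) * Real.log (n:ℝ)) := by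
    refine sum_congr rfl (fun n hn => ?_)
    rw [mem_Ioc] at hn
    exact cpow_ee (by omega) σ t
  rw [e1]
  set N : ℕ := 2^j with hNd
  have hNr : (0:ℝ) < N := by exact_mod_cast hN
  have hmono : ∀ m n : ℕ, 1 ≤ m → m ≤ n → ((n:ℝ)) ^ (-σ) ≤ (m:ℝ) ^ (-σ) := by
    intro m n hm hmn
    apply Real.rpow_le_rpow_of_nonpos
    · exact_mod_cast hm
    · exact_mod_cast hmn
    · linarith
  have := abel_ineq (fun n => ee (-(t / (2 * Real.pi)) * Real.log (n:ℝ))) (fun n => (n:ℝ) ^ (-σ)) N (2^(j+1)) 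
    (by rw [pow_succ]; omega) (32 * N * Real.exp (-(0.000000001) * Real.log N ^ 3 / Real.log t ^ 2))
    (fun n _ => by positivity) (fun n hn => hmono n (n+1) (by omega) (by omega))
    (fun b hb1 hb2 => exp_sum hN hb1 (by rw [pow_succ] at hb2; omega) ht (by rw [hNd]; push_cast; exact hj))
  refine this.trans ?_
  have h1 := hmono N (N+1) hN (by omega)
  set L := Real.log N with hL
  set l := Real.log t
  have hL0 : 0 ≤ L := Real.log_nonneg (by exact_mod_cast hN)
  have e2 : (N:ℝ) ^ (-σ) * N = Real.exp (L * (1 - σ)) := by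
    rw [Real.rpow_def_of_pos hNr, show L * (1-σ) = L * (-σ) + L by ring, Real.exp_add]
    congr 1
    rw [hL, Real.exp_log hNr]
  set x := L * l ^ (-(2:ℝ)/3) with hx
  have hx0 : 0 ≤ x := by positivity
  have hx3 : x^3 = L^3 / l^2 := by
    rw [hx, mul_pow, ← Real.rpow_natCast (l ^ (-(2:ℝ)/3)) 3, ← Real.rpow_mul hl.le]
    norm_num
    rw [div_eq_mul_inv]
  have hb : L * (1 - σ) + -(0.000000001) * L^3 / l^2 ≤ 1 := by
    have a1 : L * (1 - σ) ≤ 0.0001 * x := by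
      have : L * (1 - σ) ≤ L * (0.0001 * l ^ (-(2:ℝ)/3)) := mul_le_mul_of_nonneg_left (by linarith) hL0
      rw [hx]; linarith
    have a2 : -(0.000000001) * L^3 / l^2 = -(0.000000001) * x^3 := by rw [hx3]; ring
    rw [a2]
    rcases le_or_gt x 10000 with h | h
    · have : 0 ≤ x^3 := by positivity
      nlinarith
    · have : x^2 ≥ 100000000 := by nlinarith
      have : x^3 ≥ 100000000 * x := by nlinarith
      nlinarith
  calc ((N+1:ℕ):ℝ) ^ (-σ) * (32 * N * Real.exp (-(0.000000001) * L ^ 3 / l ^ 2)) 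
      ≤ (N:ℝ) ^ (-σ) * (32 * N * Real.exp (-(0.000000001) * L ^ 3 / l ^ 2)) := by gcongr
    _ = 32 * (((N:ℝ) ^ (-σ) * N) * Real.exp (-(0.000000001) * L ^ 3 / l ^ 2)) := by ring
    _ = 32 * Real.exp (L * (1 - σ) + -(0.000000001) * L^3 / l^2) := by rw [e2, ← Real.exp_add]
    _ ≤ 32 * Real.exp 1 := by
      gcongr
    _ ≤ 96 := by have := Real.exp_one_lt_d9; linarith

theorem zeta_bound {σ t : ℝ} (ht : 2 ≤ t) (hσ : 1 - 0.0001 * Real.log t ^ (-(2:ℝ)/3) ≤ σ) (hσ3 : σ ≤ 3) :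
    ‖riemannZeta (σ + t * Complex.I)‖ ≤ 500 * Real.log t := by
  have hl2 : 0.69 ≤ Real.log t := by
    have := Real.log_le_log (by norm_num) ht
    have := Real.log_two_gt_d9
    linarith
  have hl : 0 < Real.log t := by linarith
  have hσh : 1/2 ≤ σ := by
    have : Real.log t ^ (-(2:ℝ)/3) ≤ 0.69 ^ (-(2:ℝ)/3) := Real.rpow_le_rpow_of_nonpos (by norm_num) hl2 (by norm_num)
    have h2 : (0.69:ℝ) ^ (-(2:ℝ)/3) ≤ 0.69 ^ (-(1:ℝ)) := Real.rpow_le_rpow_of_exponent_ge (by norm_num) (by norm_num) (by norm_num)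
    rw [Real.rpow_neg_one] at h2
    norm_num at h2 this hσ ⊢
    linarith
  obtain ⟨m, hm1, hm2⟩ := exists_nat_pow_near (show (1:ℝ) ≤ t^2 by nlinarith) (show (1:ℝ) < 2 by norm_num)
  set s : ℂ := σ + t * Complex.I with hs
  have hsre : s.re = σ := by simp [hs]
  have hsim : s.im = t := by simp [hs]
  have hs1 : s ≠ 1 := by
    intro h; rw [h] at hsim; simp at hsim; linarith
  have happ := zeta_approx (2^(m+1)) Nat.one_le_two_pow (s := s) (by rw [hsre]; linarith) hs1
  have hsplit : ∀ J : ℕ, ∑ n ∈ range (2^J), ((n:ℂ)+1)^(-s) = 1 + ∑ j ∈ range J, ∑ n ∈ Ioc ((2:ℕ)^j) (2^(j+1)), (n:ℂ)^(-s) := by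
    intro J
    have e : ∀ K : ℕ, ∑ n ∈ range K, ((n:ℂ)+1)^(-s) = ∑ n ∈ Ioc 0 K, (n:ℂ)^(-s) := by
      intro K
      induction K with
      | zero => simp
      | succ k ih => rw [sum_range_succ, ih, sum_Ioc_succ_top (by omega)]; push_cast; rfl
    rw [e]
    induction J with
    | zero => 
      rw [pow_zero, show Ioc 0 1 = {1} from rfl]; simp
    | succ J ih =>
      rw [sum_range_succ, ← add_assoc, ← ih, ← sum_Ioc_consecutive _ (Nat.zero_le _) (Nat.pow_le_pow_right (by norm_num) (Nat.le_succ J))]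
  have hsum : ‖∑ n ∈ range (2^(m+1)), ((n:ℂ)+1)^(-s)‖ ≤ 1 + (m+1) * 96 := by
    rw [hsplit]
    refine (norm_add_le _ _).trans ?_
    rw [norm_one]
    have : ‖∑ j ∈ range (m+1), ∑ n ∈ Ioc ((2:ℕ)^j) (2^(j+1)), (n:ℂ)^(-s)‖ ≤ ∑ j ∈ range (m+1), (96:ℝ) := by
      refine norm_sum_le_of_le _ (fun j hj => ?_)
      rw [mem_range] at hj
      refine block_bound ht hσ (by linarith) (le_trans ?_ hm1)
      exact pow_le_pow_right₀ (by norm_num) (by omega)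
    simp only [sum_const, card_range, nsmul_eq_mul] at this
    push_cast at this
    linarith
  have hK1 : (2:ℝ)^(m+1) ≤ 2 * t^2 := by rw [pow_succ]; linarith
  have hT1 : ‖(((2^(m+1) : ℕ):ℂ)+1)^(1-s)/(s-1)‖ ≤ 2 := by
    have hKp : (0:ℝ) < (2:ℝ)^(m+1) + 1 := by positivity
    have hc := Complex.norm_cpow_eq_rpow_re_of_pos hKp (1 - s)
    push_cast at hc ⊢
    rw [norm_div, hc]
    have h1 : ((2:ℝ)^(m+1) + 1) ^ ((1 - s).re) ≤ ((2:ℝ)^(m+1) + 1) ^ ((1:ℝ)/2) := by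
      apply Real.rpow_le_rpow_of_exponent_le
      · have : (0:ℝ) ≤ 2^(m+1) := by positivity
        linarith
      · simp [hsre]; linarith
    have h2 : ((2:ℝ)^(m+1) + 1) ^ ((1:ℝ)/2) ≤ 2 * t := by
      rw [← Real.sqrt_eq_rpow]
      apply Real.sqrt_le_iff.mpr
      constructor
      · linarith
      · nlinarith
    have h3 : t ≤ ‖s - 1‖ := by
      have := Complex.abs_im_le_norm (s - 1)
      simp [hsim] at this
      exact (le_abs_self t).trans this
    rw [div_le_iff₀ (by linarith)]
    linarith
  have hT2 : ‖s‖ * ((((2^(m+1) : ℕ)):ℝ)^(-s.re)/s.re) ≤ 5 := by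
    have h1 : ‖s‖ ≤ 2.5 * t := by
      refine (norm_add_le _ _).trans ?_
      rw [norm_mul, Complex.norm_I, Complex.norm_real, Complex.norm_real, Real.norm_of_nonneg (by linarith), Real.norm_of_nonneg (by linarith)]
      linarith
    rw [hsre]
    push_cast
    have h2 : ((2:ℝ)^(m+1))^(-σ) ≤ 1 / t := by
      calc ((2:ℝ)^(m+1))^(-σ) ≤ ((2:ℝ)^(m+1))^(-(1/2:ℝ)) := by
            apply Real.rpow_le_rpow_of_exponent_le
            · exact one_le_pow₀ (by norm_num)
            · linarith
        _ ≤ (t^2)^(-(1/2:ℝ)) := Real.rpow_le_rpow_of_nonpos (by positivity) hm2.le (by norm_num)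
        _ = 1 / t := by
          rw [Real.rpow_neg (by positivity), ← Real.sqrt_eq_rpow, Real.sqrt_sq (by linarith), one_div]
    have h3 : ((2:ℝ)^(m+1))^(-σ) / σ ≤ 2 / t := by
      rw [div_le_iff₀ (by linarith)]
      refine h2.trans ?_
      rw [div_mul_eq_mul_div]
      gcongr
      linarith
    calc ‖s‖ * (((2:ℝ)^(m+1))^(-σ) / σ) ≤ 2.5 * t * (2 / t) := by gcongr
      _ = 5 := by field_simp; norm_num
  have hm : (m:ℝ) ≤ 3 * Real.log t := by
    have := Real.log_le_log (by positivity) hm1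
    rw [Real.log_pow, Real.log_pow] at this
    have h2 := Real.log_two_gt_d9
    push_cast at this
    have : (m:ℝ) * 0.69 ≤ m * Real.log 2 := by gcongr; linarith
    linarith
  have hfin : ‖riemannZeta s‖ ≤ 1 + (m+1) * 96 + 2 + 5 := by
    have := norm_add₃_le (a := riemannZeta s - ∑ n ∈ range (2^(m+1)), ((n:ℂ)+1)^(-s) - (((2^(m+1):ℕ):ℂ)+1)^(1-s)/(s-1))
      (b := ∑ n ∈ range (2^(m+1)), ((n:ℂ)+1)^(-s)) (c := (((2^(m+1):ℕ):ℂ)+1)^(1-s)/(s-1))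
    rw [show riemannZeta s - ∑ n ∈ range (2^(m+1)), ((n:ℂ)+1)^(-s) - (((2^(m+1):ℕ):ℂ)+1)^(1-s)/(s-1) + ∑ n ∈ range (2^(m+1)), ((n:ℂ)+1)^(-s) + (((2^(m+1):ℕ):ℂ)+1)^(1-s)/(s-1) = riemannZeta s by ring] at this
    linarith
  linarith

end VK

namespace VK
open Finset Metric

lemma exists_log {g : ℂ → ℂ} {r M : ℝ} (hr : 0 < r) (hM : 0 < M) (hg : Differentiable ℂ g)
    (hne : ∀ z ∈ ball (0:ℂ) r, g z ≠ 0) (hb : ∀ z ∈ ball (0:ℂ) r, ‖g z‖ ≤ Real.exp M * ‖g 0‖) :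
    ∃ h : ℂ → ℂ, (∀ z ∈ ball (0:ℂ) r, HasDerivAt h (deriv g z / g z) z) ∧
      ∀ z ∈ ball (0:ℂ) r, ‖h z‖ ≤ 2 * M * ‖z‖ / (r - ‖z‖) := by
  have h0 : (0:ℂ) ∈ ball (0:ℂ) r := mem_ball_self hr
  have hd : DifferentiableOn ℂ (fun z => deriv g z / g z) (ball 0 r) := by
    intro z hz
    exact (((hg.contDiff (n := 2)).differentiable_deriv_two z).div (hg z) (hne z hz)).differentiableWithinAt
  obtain ⟨h, hh0, hh⟩ := (hd.isExactOn_ball).with_val_at 0 0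
  refine ⟨h, hh, fun z hz => ?_⟩
  have hdh : DifferentiableOn ℂ h (ball 0 r) := fun z hz => (hh z hz).differentiableAt.differentiableWithinAt
  have hconst : ∀ z ∈ ball (0:ℂ) r, g z * Complex.exp (-h z) = g 0 := by
    intro z hz
    have hD : ∀ w ∈ ball (0:ℂ) r, HasDerivAt (fun w => g w * Complex.exp (-h w)) 0 w := by
      intro w hw
      have := (hg w).hasDerivAt.fun_mul ((hh w hw).fun_neg.cexp)
      have h3 : g w * (deriv g w / g w) = deriv g w := mul_div_cancel₀ _ (hne w hw)
      have h4 : deriv g w * Complex.exp (-h w) + g w * (Complex.exp (-h w) * -(deriv g w / g w)) = 0 := by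
        linear_combination (-Complex.exp (-h w)) * h3
      rw [h4] at this
      exact this
    have := (convex_ball (0:ℂ) r).is_const_of_fderivWithin_eq_zero (𝕜 := ℂ) (f := fun w => g w * Complex.exp (-h w))
      (fun w hw => (hD w hw).differentiableAt.differentiableWithinAt) (fun w hw => by
        have h1 := (hD w hw).hasFDerivAt.hasFDerivWithinAt (s := ball (0:ℂ) r)
        rw [h1.fderivWithin (isOpen_ball.uniqueDiffWithinAt hw)]
        ext; simp) hz h0
    simpa [hh0] using this
  have hre : Set.MapsTo h (ball 0 r) {z | z.re ≤ M} := by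
    intro z hz
    have e := hconst z hz
    have h1 := congrArg norm e
    rw [norm_mul, Complex.norm_exp, Complex.neg_re, Real.exp_neg] at h1
    have hg0 : 0 < ‖g 0‖ := norm_pos_iff.mpr (hne 0 h0)
    have h2 : ‖g z‖ = ‖g 0‖ * Real.exp (h z).re := by
      rw [← h1]; field_simp
    have h3 := hb z hz
    rw [h2, mul_comm] at h3
    exact Real.exp_le_exp.mp (le_of_mul_le_mul_right h3 hg0)
  exact Complex.borelCaratheodory_zero hM hdh hre hr hz hh0

/-- log-derivative bound at the center -/
lemma logderiv_ball {g : ℂ → ℂ} {r M : ℝ} (hr : 0 < r) (hM : 0 < M) (hg : Differentiable ℂ g)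
    (hne : ∀ z ∈ ball (0:ℂ) r, g z ≠ 0) (hb : ∀ z ∈ ball (0:ℂ) r, ‖g z‖ ≤ Real.exp M * ‖g 0‖) {z : ℂ} (hz : ‖z‖ ≤ r / 2) :
    ‖deriv g z / g z‖ ≤ 24 * M / r := by
  obtain ⟨h, hh, hB⟩ := exists_log hr hM hg hne hb
  have hsub : ∀ w ∈ closedBall z (r/4), ‖w‖ ≤ 3 * r / 4 := by
    intro w hw
    rw [mem_closedBall, dist_eq_norm] at hw
    have := norm_le_norm_add_norm_sub' w z
    linarith
  have hin : ∀ w ∈ closedBall z (r/4), w ∈ ball (0:ℂ) r := by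
    intro w hw; have := hsub w hw; rw [mem_ball_zero_iff]; linarith
  have hd : DiffContOnCl ℂ h (ball z (r/4)) := by
    apply DifferentiableOn.diffContOnCl
    rw [closure_ball z (by positivity)]
    exact fun w hw => (hh w (hin w hw)).differentiableAt.differentiableWithinAt
  have := Complex.norm_deriv_le_of_forall_mem_sphere_norm_le (by positivity : 0 < r/4) hd (C := 6 * M) (by
    intro w hw
    have hw' := sphere_subset_closedBall hw
    refine (hB w (hin w hw')).trans ?_
    have := hsub w hw'
    rw [div_le_iff₀ (by linarith)]
    nlinarith)
  rw [(hh z (hin z (mem_closedBall_self (by positivity)))).deriv] at this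
  refine this.trans (le_of_eq ?_)
  field_simp
  norm_num

lemma remove_zero {g : ℂ → ℂ} (hg : Differentiable ℂ g) (h0 : ∃ z, g z ≠ 0) (v : ℂ) :
    ∃ (n : ℕ) (h : ℂ → ℂ), Differentiable ℂ h ∧ h v ≠ 0 ∧ ∀ z, g z = (z - v) ^ n * h z := by
  have hA : AnalyticAt ℂ g v := hg.analyticAt v
  have hno : ¬ ∀ᶠ z in nhds v, g z = 0 := by
    intro h
    obtain ⟨w, hw⟩ := h0
    have hAn : AnalyticOnNhd ℂ g Set.univ := fun z _ => hg.analyticAt z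
    exact hw (hAn.eqOn_zero_of_preconnected_of_eventuallyEq_zero isPreconnected_univ (Set.mem_univ v) h (Set.mem_univ w))
  obtain ⟨n, k, hk, hkv, hke⟩ := hA.exists_eventuallyEq_pow_smul_nonzero_iff.mpr hno
  refine ⟨n, fun z => if z = v then k v else g z / (z - v)^n, ?_, by simpa using hkv, ?_⟩
  · intro z
    by_cases hz : z = v
    · subst hz
      have : (fun w => if w = z then k z else g w / (w - z)^n) =ᶠ[nhds z] k := by
        filter_upwards [hke] with w hw
        split_ifs with h
        · rw [h]
        · rw [hw, smul_eq_mul]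
          field_simp [sub_ne_zero.mpr h]
      exact hk.differentiableAt.congr_of_eventuallyEq this
    · have : (fun w => if w = v then k v else g w / (w - v)^n) =ᶠ[nhds z] fun w => g w / (w - v)^n := by
        filter_upwards [isOpen_ne.mem_nhds hz] with w hw
        rw [if_neg hw]
      refine DifferentiableAt.congr_of_eventuallyEq ?_ this
      exact (hg z).div (by fun_prop) (pow_ne_zero _ (sub_ne_zero.mpr hz))
  · intro z
    by_cases hz : z = v
    · subst hz
      simp only [if_true]
      rw [hke.self_of_nhds, smul_eq_mul]
    · simp only [if_neg hz]
      field_simp [sub_ne_zero.mpr hz]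

lemma factor_finset {f : ℂ → ℂ} (hf : Differentiable ℂ f) (h0 : ∃ z, f z ≠ 0) (S : Finset ℂ) :
    ∃ (D : ℂ → ℕ) (g : ℂ → ℂ), Differentiable ℂ g ∧ (∀ u ∈ S, g u ≠ 0) ∧ ∀ z, f z = (∏ u ∈ S, (z - u) ^ D u) * g z := by
  classical
  induction S using Finset.induction_on with
  | empty => exact ⟨fun _ => 0, f, hf, by simp, by simp⟩
  | insert v S hv ih =>
    obtain ⟨D, g, hg, hgS, hfg⟩ := ih
    have hg0 : ∃ z, g z ≠ 0 := by
      obtain ⟨z, hz⟩ := h0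
      exact ⟨z, fun h => hz (by rw [hfg, h, mul_zero])⟩
    obtain ⟨n, h, hh, hhv, hgh⟩ := remove_zero hg hg0 v
    refine ⟨fun u => if u = v then n else D u, h, hh, ?_, ?_⟩
    · intro u hu
      rcases Finset.mem_insert.mp hu with rfl | hu
      · exact hhv
      · intro h'
        exact hgS u hu (by rw [hgh, h', mul_zero])
    · intro z
      simp only
      rw [Finset.prod_insert hv, if_pos rfl, hfg, hgh]
      have : ∏ u ∈ S, (z - u) ^ (if u = v then n else D u) = ∏ u ∈ S, (z - u) ^ D u := by
        refine Finset.prod_congr rfl (fun u hu => ?_)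
        rw [if_neg (by rintro rfl; exact hv hu)]
      rw [this]; ring

lemma zeros_finite {f : ℂ → ℂ} (hf : Differentiable ℂ f) (h0 : ∃ z, f z ≠ 0) (r : ℝ) :
    (closedBall (0:ℂ) r ∩ {z | f z = 0}).Finite := by
  have hloc : ∀ v : ℂ, ∃ U ∈ nhds v, ∀ z ∈ U, f z = 0 → z = v := by
    intro v
    obtain ⟨n, h, hh, hhv, hfh⟩ := remove_zero hf h0 v
    refine ⟨{z | h z ≠ 0}, hh.continuous.continuousAt.eventually_ne hhv, fun z hz hfz => ?_⟩
    rw [hfh] at hfz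
    rcases mul_eq_zero.mp hfz with h1 | h1
    · exact sub_eq_zero.mp (by by_contra h2; exact pow_ne_zero _ h2 h1)
    · exact absurd h1 hz
  choose U hU hUz using hloc
  obtain ⟨t, -, ht⟩ := (isCompact_closedBall (0:ℂ) r).elim_nhds_subcover U (fun x _ => hU x)
  refine t.finite_toSet.subset ?_
  rintro z ⟨hz, hfz⟩
  obtain ⟨x, hx, hzx⟩ := Set.mem_iUnion₂.mp (ht hz)
  rw [hUz x z hzx hfz]
  exact hx

theorem landau {f : ℂ → ℂ} {R M : ℝ} (hR : 0 < R) (hM : 0 < M) (hf : Differentiable ℂ f) (h0 : f 0 ≠ 0)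
    (hb : ∀ z, ‖z‖ = R → ‖f z‖ ≤ Real.exp M * ‖f 0‖)
    (hz : ∀ z, ‖z‖ ≤ R / 2 → f z = 0 → z.re ≤ 0) :
    -(deriv f 0 / f 0).re ≤ 48 * M / R ∧ ∀ w, ‖w‖ ≤ R / 2 → f w = 0 → -(deriv f 0 / f 0).re ≤ 48 * M / R + (1 / w).re := by
  classical
  set S := (zeros_finite hf ⟨0, h0⟩ (R/2)).toFinset with hS
  have hSm : ∀ u, u ∈ S ↔ ‖u‖ ≤ R/2 ∧ f u = 0 := by
    intro u; rw [hS, Set.Finite.mem_toFinset]; simp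
  obtain ⟨D, g, hg, hgS, hfg⟩ := factor_finset hf ⟨0, h0⟩ S
  have hu0 : ∀ u ∈ S, u ≠ 0 := by
    rintro u hu rfl; exact h0 ((hSm 0).mp hu).2
  have hgne : ∀ z, ‖z‖ ≤ R/2 → g z ≠ 0 := by
    intro z hz hgz
    exact hgS z ((hSm z).mpr ⟨hz, by rw [hfg, hgz, mul_zero]⟩) hgz
  have hg0 : g 0 ≠ 0 := hgne 0 (by simp; positivity)
  have hsph : ∀ z ∈ frontier (ball (0:ℂ) R), ‖g z‖ ≤ Real.exp M * ‖g 0‖ := by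
    intro z hz
    rw [frontier_ball _ hR.ne', mem_sphere_zero_iff_norm] at hz
    have h1 := hb z hz
    rw [hfg z, hfg 0, norm_mul, norm_mul, norm_prod, norm_prod] at h1
    have h2 : ∏ u ∈ S, ‖(0 - u) ^ D u‖ ≤ ∏ u ∈ S, ‖(z - u) ^ D u‖ := by
      refine Finset.prod_le_prod (fun _ _ => norm_nonneg _) (fun u hu => ?_)
      rw [norm_pow, norm_pow]
      refine pow_le_pow_left₀ (norm_nonneg _) ?_ _
      have h3 := ((hSm u).mp hu).1
      have h4 := norm_sub_norm_le z u
      rw [zero_sub, norm_neg]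
      linarith
    have h3 : 0 < ∏ u ∈ S, ‖(0 - u) ^ D u‖ := Finset.prod_pos (fun u hu => by
      rw [norm_pos_iff]; exact pow_ne_zero _ (by simpa using hu0 u hu))
    have h4 : (∏ u ∈ S, ‖(0 - u) ^ D u‖) * ‖g z‖ ≤ (∏ u ∈ S, ‖(0 - u) ^ D u‖) * (Real.exp M * ‖g 0‖) := by
      calc _ ≤ (∏ u ∈ S, ‖(z - u) ^ D u‖) * ‖g z‖ := mul_le_mul_of_nonneg_right h2 (norm_nonneg _)
        _ ≤ _ := h1
        _ = _ := by ring
    exact le_of_mul_le_mul_left h4 h3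
  have hball : ∀ z ∈ ball (0:ℂ) (R/2), ‖g z‖ ≤ Real.exp M * ‖g 0‖ := by
    intro z hz
    refine Complex.norm_le_of_forall_mem_frontier_norm_le isBounded_ball hg.diffContOnCl hsph ?_
    rw [closure_ball _ hR.ne', mem_closedBall_zero_iff]
    rw [mem_ball_zero_iff] at hz; linarith
  have hlog := logderiv_ball (half_pos hR) hM hg (fun z hz => hgne z (by rw [mem_ball_zero_iff] at hz; exact hz.le)) hball
    (z := 0) (by simp; positivity)
  have hfun : f = fun z => (∏ u ∈ S, (z - u) ^ D u) * g z := funext hfg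
  have hld : deriv f 0 / f 0 = ∑ u ∈ S, (D u : ℂ) * (-1 / u) + deriv g 0 / g 0 := by
    have e1 : deriv f 0 / f 0 = logDeriv f 0 := rfl
    rw [e1, hfun, logDeriv_mul 0 (Finset.prod_ne_zero_iff.mpr (fun u hu => pow_ne_zero _ (by simpa using hu0 u hu))) hg0
      (by fun_prop) (hg 0)]
    congr 1
    rw [logDeriv_prod (f := fun u z => (z - u) ^ D u) (fun u hu => pow_ne_zero _ (by simpa using hu0 u hu)) (fun u hu => by fun_prop)]
    refine Finset.sum_congr rfl (fun u hu => ?_)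
    rw [logDeriv_fun_pow (by fun_prop)]
    congr 1
    simp [logDeriv_apply]
    ring
  have hre : -(deriv f 0 / f 0).re = ∑ u ∈ S, (D u : ℝ) * (1 / u).re - (deriv g 0 / g 0).re := by
    rw [hld, Complex.add_re, Complex.re_sum, neg_add, ← Finset.sum_neg_distrib, sub_eq_add_neg]
    congr 1
    refine Finset.sum_congr rfl (fun u hu => ?_)
    rw [neg_div, mul_neg, Complex.neg_re, neg_neg]
    simp [Complex.mul_re]
  have hgb : -(deriv g 0 / g 0).re ≤ 48 * M / R := by
    have := (neg_le_abs _).trans ((Complex.abs_re_le_norm (deriv g 0 / g 0)).trans hlog)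
    refine this.trans (le_of_eq ?_)
    field_simp; norm_num
  have hneg : ∀ u ∈ S, (1 / u).re ≤ 0 := by
    intro u hu
    rw [one_div, Complex.inv_re]
    exact div_nonpos_of_nonpos_of_nonneg (hz u ((hSm u).mp hu).1 ((hSm u).mp hu).2) (Complex.normSq_nonneg _)
  have hneg' : ∀ u ∈ S, (D u : ℝ) * (1 / u).re ≤ 0 := fun u hu => 
    mul_nonpos_of_nonneg_of_nonpos (Nat.cast_nonneg _) (hneg u hu)
  constructor
  · have := Finset.sum_nonpos hneg'
    linarith
  · intro w hw hfw
    have hwS : w ∈ S := (hSm w).mpr ⟨hw, hfw⟩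
    have h1 : 1 ≤ D w := by
      by_contra h
      have hD : D w = 0 := by omega
      have h2 := hfg w
      rw [hfw] at h2
      rcases mul_eq_zero.mp h2.symm with h3 | h3
      · obtain ⟨u, hu, hu2⟩ := Finset.prod_eq_zero_iff.mp h3
        by_cases huw : u = w
        · subst huw; rw [hD] at hu2; simp at hu2
        · exact pow_ne_zero _ (sub_ne_zero.mpr (Ne.symm huw)) hu2
      · exact hgS w hwS h3
    have h2 : ∑ u ∈ S, (D u : ℝ) * (1 / u).re ≤ (D w : ℝ) * (1 / w).re := by
      rw [← Finset.add_sum_erase _ _ hwS]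
      have := Finset.sum_nonpos (s := S.erase w) (fun u hu => hneg' u (Finset.mem_of_mem_erase hu))
      linarith
    have h3 : (D w : ℝ) * (1 / w).re ≤ (1 / w).re := by
      have := hneg w hwS
      have h4 : (1:ℝ) ≤ D w := by exact_mod_cast h1
      nlinarith
    linarith

end VK

namespace VK
open Finset

noncomputable def ld (s : ℂ) : ℂ := deriv riemannZeta₁ s / riemannZeta₁ s
noncomputable def LL (s : ℂ) : ℂ := LSeries (fun n => (ArithmeticFunction.vonMangoldt n : ℂ)) s

lemma z1_mul {s : ℂ} (hs : s ≠ 1) : riemannZeta₁ s = (s - 1) * riemannZeta s := by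
  rw [riemannZeta_eq_inv_sub_mul hs, ← mul_assoc, mul_inv_cancel₀ (sub_ne_zero.mpr hs), one_mul]

lemma z1_ne {s : ℂ} (hs : 1 ≤ s.re) : riemannZeta₁ s ≠ 0 := by
  by_cases h : s = 1
  · rw [h, riemannZeta₁_one]; exact one_ne_zero
  · rw [z1_mul h]
    exact mul_ne_zero (sub_ne_zero.mpr h) (riemannZeta_ne_zero_of_one_le_re hs)

lemma LL_eq {s : ℂ} (hs : 1 < s.re) : LL s = 1 / (s - 1) - ld s := by
  have h1 : s ≠ 1 := by rintro rfl; simp at hs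
  have h2 : LL s = -deriv riemannZeta s / riemannZeta s := ArithmeticFunction.LSeries_vonMangoldt_eq_deriv_riemannZeta_div hs
  have h3 : deriv riemannZeta₁ s = riemannZeta s + (s - 1) * deriv riemannZeta s := by
    have e : riemannZeta₁ =ᶠ[nhds s] fun z => (z - 1) * riemannZeta z := by
      filter_upwards [isOpen_ne.mem_nhds h1] with z hz using z1_mul hz
    rw [e.deriv_eq]
    have := ((hasDerivAt_id s).sub_const 1).fun_mul (differentiableAt_riemannZeta h1).hasDerivAt
    rw [HasDerivAt.deriv (f := fun z => (z - 1) * riemannZeta z) this]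
    simp
  have h4 := riemannZeta_ne_zero_of_one_le_re hs.le
  have h5 := sub_ne_zero.mpr h1
  rw [h2, ld, h3, z1_mul h1]
  field_simp
  ring

lemma LL_summable {s : ℂ} (hs : 1 < s.re) : Summable (fun n : ℕ => LSeries.term (fun n => (ArithmeticFunction.vonMangoldt n : ℂ)) s n) :=
  ArithmeticFunction.LSeriesSummable_vonMangoldt hs

lemma term_re (n : ℕ) (σ t : ℝ) : (LSeries.term (fun n => (ArithmeticFunction.vonMangoldt n : ℂ)) (σ + t * Complex.I) n).re
    = ArithmeticFunction.vonMangoldt n * (n:ℝ) ^ (-σ) * Real.cos (t * Real.log n) := by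
  rcases Nat.eq_zero_or_pos n with rfl | hn
  · simp
  have hn0 : (n:ℂ) ≠ 0 := by exact_mod_cast hn.ne'
  have hp : (0:ℝ) < n := by exact_mod_cast hn
  rw [LSeries.term_of_ne_zero hn.ne', div_eq_mul_inv, ← Complex.cpow_neg, neg_add, Complex.cpow_add _ _ hn0]
  have e1 : (n:ℂ) ^ (-(σ:ℂ)) = (((n:ℝ)^(-σ) : ℝ) : ℂ) := by
    rw [Complex.ofReal_cpow hp.le]; push_cast; rfl
  have e2 : (n:ℂ) ^ (-(t * Complex.I)) = Complex.exp (((-(t * Real.log n) : ℝ) : ℂ) * Complex.I) := by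
    rw [Complex.cpow_def_of_ne_zero hn0, ← Complex.natCast_log]; push_cast; congr 1; ring
  rw [e1, e2, ← mul_assoc, ← Complex.ofReal_mul, Complex.re_ofReal_mul, Complex.exp_ofReal_mul_I_re, Real.cos_neg]

lemma term_norm (n : ℕ) (σ t : ℝ) : ‖LSeries.term (fun n => (ArithmeticFunction.vonMangoldt n : ℂ)) (σ + t * Complex.I) n‖
    = ArithmeticFunction.vonMangoldt n * (n:ℝ) ^ (-σ) := by
  rw [LSeries.norm_term_eq]
  split_ifs with h
  · subst h; simp
  · rw [Complex.norm_real, Real.norm_of_nonneg ArithmeticFunction.vonMangoldt_nonneg, Real.rpow_neg (Nat.cast_nonneg _), div_eq_mul_inv]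
    simp

lemma LL_re_hasSum {σ : ℝ} (hσ : 1 < σ) (t : ℝ) : HasSum (fun n : ℕ => ArithmeticFunction.vonMangoldt n * (n:ℝ) ^ (-σ) * Real.cos (t * Real.log n)) (LL (σ + t * Complex.I)).re := by
  have h := Complex.hasSum_re (LL_summable (s := σ + t * Complex.I) (by simpa using hσ)).hasSum
  simp only [term_re] at h
  exact h

lemma three_four_one {σ : ℝ} (hσ : 1 < σ) (t : ℝ) : 
    0 ≤ 3 * (LL σ).re + 4 * (LL (σ + t * Complex.I)).re + (LL (σ + (2 * t : ℝ) * Complex.I)).re := by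
  have h0 := LL_re_hasSum hσ 0
  have h1 := LL_re_hasSum hσ t
  have h2 := LL_re_hasSum hσ (2 * t)
  have h := ((h0.mul_left 3).add (h1.mul_left 4)).add h2
  rw [show ((σ:ℂ) + (0:ℝ) * Complex.I) = σ by simp] at h
  refine h.nonneg (fun n => ?_)
  have hL : 0 ≤ ArithmeticFunction.vonMangoldt n * (n:ℝ) ^ (-σ) := mul_nonneg ArithmeticFunction.vonMangoldt_nonneg (by positivity)
  have e : Real.cos (2 * t * Real.log n) = 2 * Real.cos (t * Real.log n) ^ 2 - 1 := by
    rw [mul_assoc, Real.cos_two_mul]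
  rw [e]
  simp only [zero_mul, Real.cos_zero]
  nlinarith [mul_nonneg hL (sq_nonneg (Real.cos (t * Real.log n) + 1))]

lemma LL_norm_le {σ : ℝ} (hσ : 1 < σ) (t : ℝ) : ‖LL (σ + t * Complex.I)‖ ≤ (LL σ).re := by
  have h0 := LL_re_hasSum hσ 0
  rw [show ((σ:ℂ) + (0:ℝ) * Complex.I) = σ by simp] at h0
  simp only [zero_mul, Real.cos_zero, mul_one] at h0
  refine tsum_of_norm_bounded h0 (fun n => ?_)
  exact (term_norm n σ t).le

lemma ld_bdd : ∃ C > 0, ∀ σ : ℝ, 1 ≤ σ → σ ≤ 2 → ‖ld σ‖ ≤ C := by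
  have hc : ContinuousOn (fun σ : ℝ => ld σ) (Set.Icc 1 2) := by
    have hd : Continuous (deriv riemannZeta₁) := (differentiable_riemannZeta₁.contDiff (n := 1)).continuous_deriv le_rfl
    unfold ld
    refine ContinuousOn.div (by fun_prop) ?_ (fun σ hσ => z1_ne (by simpa using hσ.1))
    exact (differentiable_riemannZeta₁.continuous.comp Complex.continuous_ofReal).continuousOn
  obtain ⟨C, hC⟩ := isCompact_Icc.exists_bound_of_continuousOn hc
  exact ⟨max C 1, by positivity, fun σ h1 h2 => (hC σ ⟨h1, h2⟩).trans (le_max_left _ _)⟩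

lemma LL_real_le : ∃ C > 0, ∀ σ : ℝ, 1 < σ → σ ≤ 2 → (LL σ).re ≤ 1 / (σ - 1) + C := by
  obtain ⟨C, hC0, hC⟩ := ld_bdd
  refine ⟨C, hC0, fun σ h1 h2 => ?_⟩
  rw [LL_eq (by simpa using h1), Complex.sub_re]
  have e : (1 / ((σ:ℂ) - 1)).re = 1 / (σ - 1) := by
    rw [← Complex.ofReal_one, ← Complex.ofReal_sub, ← Complex.ofReal_div, Complex.ofReal_re]
  rw [e]
  have := (neg_le_abs _).trans ((Complex.abs_re_le_norm (ld σ)).trans (hC σ h1.le h2))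
  linarith

lemma zeta_two_sided : ∃ C ≥ 1, ∀ σ t : ℝ, 1 < σ → σ ≤ 2 → 
    ‖riemannZeta (σ + t * Complex.I)‖ ≤ C / (σ - 1) ∧ (σ - 1) / C ≤ ‖riemannZeta (σ + t * Complex.I)‖ := by
  obtain ⟨C, hC⟩ := isCompact_Icc.exists_bound_of_continuousOn (s := Set.Icc (1:ℝ) 2) (f := fun σ : ℝ => riemannZeta₁ σ)
    (differentiable_riemannZeta₁.continuous.comp Complex.continuous_ofReal).continuousOn
  refine ⟨max C 1, le_max_right _ _, fun σ t h1 h2 => ?_⟩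
  have hre : 1 < (σ + t * Complex.I : ℂ).re := by simpa using h1
  have hs1 : 1 < (σ : ℂ).re := by simpa using h1
  have hσ0 : 0 < σ - 1 := by linarith
  have hz : ‖riemannZeta σ‖ ≤ max C 1 / (σ - 1) := by
    have h3 := hC σ ⟨h1.le, h2⟩
    have hne : (σ:ℂ) ≠ 1 := by intro h; rw [h] at hs1; simp at hs1
    rw [z1_mul hne, norm_mul, ← Complex.ofReal_one, ← Complex.ofReal_sub, Complex.norm_real, Real.norm_of_nonneg hσ0.le] at h3
    rw [le_div_iff₀ hσ0, mul_comm]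
    exact h3.trans (le_max_left _ _)
  have hsum : HasSum (fun n : ℕ => if n = 0 then (0:ℝ) else (n:ℝ)^(-σ)) (riemannZeta σ).re := by
    have h := Complex.hasSum_re (LSeriesHasSum_one hs1)
    convert h using 1
    funext n
    rcases Nat.eq_zero_or_pos n with rfl | hn
    · simp
    · rw [if_neg hn.ne', LSeries.term_of_ne_zero hn.ne', Pi.one_apply, one_div, ← Complex.cpow_neg]
      have : (n:ℂ) ^ (-(σ:ℂ)) = (((n:ℝ)^(-σ) : ℝ) : ℂ) := by
        rw [Complex.ofReal_cpow (Nat.cast_nonneg _)]; push_cast; rfl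
      rw [this, Complex.ofReal_re]
  have hgen : ∀ a : ℕ → ℂ, (∀ n, ‖a n‖ ≤ 1) → ‖LSeries a (σ + t * Complex.I)‖ ≤ max C 1 / (σ - 1) := by
    intro a ha
    refine (tsum_of_norm_bounded hsum (fun n => ?_)).trans ((Complex.re_le_norm _).trans hz)
    rw [LSeries.norm_term_eq]
    split_ifs with h
    · exact le_rfl
    · rw [Real.rpow_neg (Nat.cast_nonneg _), div_eq_mul_inv]
      have : (0:ℝ) ≤ ((n:ℝ)^σ)⁻¹ := by positivity
      have h5 : (σ + t * Complex.I : ℂ).re = σ := by simp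
      rw [h5]
      exact mul_le_of_le_one_left this (ha n)
  constructor
  · have := hgen 1 (by simp)
    rwa [LSeries_one_eq_riemannZeta hre] at this
  · have h3 := ArithmeticFunction.LSeries_zeta_mul_Lseries_moebius hre
    rw [ArithmeticFunction.LSeries_zeta_eq_riemannZeta hre] at h3
    have h4 := hgen (fun n => ((ArithmeticFunction.moebius n : ℤ) : ℂ)) (fun n => by
      rw [Complex.norm_intCast]
      exact_mod_cast ArithmeticFunction.abs_moebius_le_one)
    have h5 := congrArg norm h3
    rw [norm_mul, norm_one] at h5
    have hm : 0 < max C 1 := by positivity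
    rw [div_le_iff₀ hm]
    rw [le_div_iff₀ hσ0] at h4
    have h6 := norm_nonneg (riemannZeta (σ + t * Complex.I))
    nlinarith

end VK

namespace VK
open Finset Metric

lemma z1_conj_zero {s : ℂ} (h : riemannZeta₁ s = 0) : riemannZeta₁ ((starRingEnd ℂ) s) = 0 := by
  have h1 : s ≠ 1 := by rintro rfl; rw [riemannZeta₁_one] at h; exact one_ne_zero h
  have h2 : (starRingEnd ℂ) s ≠ 1 := by
    intro h3; apply h1; have := congrArg (starRingEnd ℂ) h3; simpa using this
  rw [z1_mul h1] at h
  have h3 := (mul_eq_zero.mp h).resolve_left (sub_ne_zero.mpr h1)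
  rw [z1_mul h2, riemannZeta_conj, h3]; simp

lemma ev_log {η : ℝ} (hη : 0 < η) (A B : ℝ) : ∀ᶠ l : ℝ in Filter.atTop, A + B * Real.log l < l ^ η := by
  have h1 := (isLittleO_log_rpow_atTop hη).def (c := 1 / (4 * (|B| + 1))) (by positivity)
  have h2 := (tendsto_rpow_atTop hη).eventually_gt_atTop (2 * |A|)
  filter_upwards [h1, h2, Filter.eventually_ge_atTop 1] with l h1 h2 h3
  have hp : 0 < l ^ η := by positivity
  rw [Real.norm_of_nonneg (Real.log_nonneg h3), Real.norm_of_nonneg hp.le] at h1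
  have h4 : B * Real.log l ≤ |B| * Real.log l := mul_le_mul_of_nonneg_right (le_abs_self B) (Real.log_nonneg h3)
  have h5 : |B| * Real.log l ≤ l ^ η / 4 := by
    calc |B| * Real.log l ≤ (|B| + 1) * (1 / (4 * (|B| + 1)) * l ^ η) := by
          apply mul_le_mul (by linarith) h1 (Real.log_nonneg h3) (by positivity)
      _ = l ^ η / 4 := by have : |B| + 1 ≠ 0 := by positivity
                          field_simp
  linarith [le_abs_self A]

lemma zeta_landau {C : ℝ} (hC : 1 ≤ C) (hCz : ∀ σ t : ℝ, 1 < σ → σ ≤ 2 → 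
    ‖riemannZeta (σ + t * Complex.I)‖ ≤ C / (σ - 1) ∧ (σ - 1) / C ≤ ‖riemannZeta (σ + t * Complex.I)‖) 
    {t t' w R M : ℝ} (ht : 10 ≤ Real.log t) (ht0 : 0 < t) (h1 : t ≤ t') (h2 : t' ≤ 2 * t) (hw : 0 < w)
    (hR : R = 0.00001 * Real.log t ^ (-(2:ℝ)/3)) (hwR : 14 * w ≤ R) (hM : M = Real.log (1000 * C * Real.log t / w)) :
    (LL ((1 + 6 * w : ℝ) + t' * Complex.I)).re ≤ 48 * M / R + 1 ∧ ∀ β : ℝ, 1 - w ≤ β → riemannZeta₁ (β + t' * Complex.I) = 0 → 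
      (LL ((1 + 6 * w : ℝ) + t' * Complex.I)).re ≤ 48 * M / R + 1 - 1 / (7 * w) := by
  set l := Real.log t with hl
  have hl0 : 0 < l := by linarith
  have ht10 : 10 ≤ t := ht.trans (Real.log_le_self ht0.le)
  have hR0 : 0 < R := by rw [hR]; positivity
  have hRle : R ≤ 0.00001 := by
    rw [hR]
    have : l ^ (-(2:ℝ)/3) ≤ 1 := Real.rpow_le_one_of_one_le_of_nonpos (by linarith) (by norm_num)
    linarith
  set s0 : ℂ := ((1 + 6 * w : ℝ) + t' * Complex.I) with hs0
  have hs0re : s0.re = 1 + 6 * w := by simp [hs0]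
  have hs0im : s0.im = t' := by simp [hs0]
  have hs01 : s0 ≠ 1 := by intro h; rw [h] at hs0im; simp at hs0im; linarith
  have hs0n : t' ≤ ‖s0 - 1‖ := by
    have := Complex.abs_im_le_norm (s0 - 1)
    simp only [Complex.sub_im, hs0im, Complex.one_im, sub_zero] at this
    exact (le_abs_self _).trans this
  set f : ℂ → ℂ := fun z => riemannZeta₁ (s0 + z) with hf
  have hfd : Differentiable ℂ f := differentiable_riemannZeta₁.comp (by fun_prop)
  have hf0 : f 0 ≠ 0 := by simp only [hf, add_zero]; exact z1_ne (by rw [hs0re]; linarith)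
  have hlow : 6 * w / C ≤ ‖riemannZeta s0‖ := by
    have := (hCz (1 + 6 * w) t' (by linarith) (by linarith)).2
    rw [show (1 + 6 * w - 1) = 6 * w by ring] at this
    exact this
  have hMpos : 0 < M := by
    rw [hM]; apply Real.log_pos
    rw [lt_div_iff₀ hw]
    nlinarith
  have hexpM : Real.exp M = 1000 * C * l / w := by
    rw [hM, Real.exp_log]; positivity
  have hb : ∀ z, ‖z‖ = R → ‖f z‖ ≤ Real.exp M * ‖f 0‖ := by
    intro z hz
    have hre := (abs_le.mp ((Complex.abs_re_le_norm z).trans hz.le))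
    have him := (abs_le.mp ((Complex.abs_im_le_norm z).trans hz.le))
    set s := s0 + z with hs
    have hsre : s.re = 1 + 6 * w + z.re := by simp [hs, hs0re]
    have hsim : s.im = t' + z.im := by simp [hs, hs0im]
    have hs1 : s ≠ 1 := by intro h; rw [h] at hsim; simp at hsim; linarith
    have e : s = (s.re : ℂ) + s.im * Complex.I := (Complex.re_add_im s).symm
    have hlim : Real.log s.im ≤ 2 * l := by
      have : s.im ≤ t^2 := by rw [hsim]; nlinarith
      have h5 := Real.log_le_log (by rw [hsim]; linarith) this
      rwa [Real.log_pow, Nat.cast_ofNat] at h5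
    have hlim0 : 0 < Real.log s.im := Real.log_pos (by rw [hsim]; linarith)
    have hzb : ‖riemannZeta s‖ ≤ 1000 * l := by
      rw [e]
      refine (zeta_bound (by rw [hsim]; linarith) ?_ (by rw [hsre]; linarith)).trans (by linarith)
      have h6 : (2 * l) ^ (-(2:ℝ)/3) ≤ Real.log s.im ^ (-(2:ℝ)/3) := 
        Real.rpow_le_rpow_of_nonpos hlim0 hlim (by norm_num)
      rw [Real.mul_rpow (by norm_num) hl0.le] at h6
      have h7 : (1/2:ℝ) ≤ 2 ^ (-(2:ℝ)/3) := by
        calc (1/2:ℝ) = 2 ^ (-(1:ℝ)) := by rw [Real.rpow_neg_one]; norm_num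
          _ ≤ _ := Real.rpow_le_rpow_of_exponent_le (by norm_num) (by norm_num)
      have h8 : 0 < l ^ (-(2:ℝ)/3) := by positivity
      rw [hsre]
      nlinarith
    have hn : ‖s - 1‖ ≤ 2 * ‖s0 - 1‖ := by
      have : s - 1 = (s0 - 1) + z := by rw [hs]; ring
      rw [this]
      refine (norm_add_le _ _).trans ?_
      rw [hz]; linarith
    have e1 : f z = (s - 1) * riemannZeta s := z1_mul hs1
    have e0 : f 0 = (s0 - 1) * riemannZeta s0 := by simp only [hf, add_zero]; exact z1_mul hs01
    rw [e1, e0, norm_mul, norm_mul, hexpM]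
    have hn0 : 0 ≤ ‖s0 - 1‖ := norm_nonneg _
    calc ‖s - 1‖ * ‖riemannZeta s‖ ≤ (2 * ‖s0 - 1‖) * (1000 * l) := by gcongr
      _ ≤ (1000 * C * l / w) * (‖s0 - 1‖ * (6 * w / C)) := by
        have : (1000 * C * l / w) * (‖s0 - 1‖ * (6 * w / C)) = 6000 * l * ‖s0 - 1‖ := by field_simp; ring
        rw [this]; nlinarith [mul_nonneg hl0.le hn0]
      _ ≤ _ := by gcongr
  have hz : ∀ z, ‖z‖ ≤ R / 2 → f z = 0 → z.re ≤ 0 := by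
    intro z _ hfz
    by_contra h
    push Not at h
    exact z1_ne (s := s0 + z) (by rw [Complex.add_re, hs0re]; linarith) hfz
  have hld : deriv f 0 / f 0 = ld s0 := by
    simp only [hf, add_zero, ld]
    rw [deriv_comp_const_add]
    simp
  have hLL : (LL s0).re ≤ 1 + -(ld s0).re := by
    rw [LL_eq (by rw [hs0re]; linarith), Complex.sub_re]
    have h3 : (1 / (s0 - 1)).re ≤ 1 := by
      refine (Complex.re_le_norm _).trans ?_
      rw [norm_div, norm_one, div_le_one (by linarith)]
      linarith
    linarith
  obtain ⟨hA, hB⟩ := landau hR0 hMpos hfd hf0 hb hz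
  rw [hld] at hA hB
  refine ⟨by linarith, fun β hβ hβz => ?_⟩
  have hβ1 : β < 1 := by
    by_contra h
    push Not at h
    exact z1_ne (s := β + t' * Complex.I) (by simpa using h) hβz
  have hx := hB ((β - (1 + 6 * w) : ℝ) : ℂ) (by
    rw [Complex.norm_real, Real.norm_eq_abs, abs_of_neg (by linarith)]; linarith) (by
    simp only [hf, hs0]
    rw [← hβz]; congr 1; push_cast; ring)
  rw [← Complex.ofReal_one, ← Complex.ofReal_div, Complex.ofReal_re] at hx
  have h9 : 1 / (β - (1 + 6 * w)) ≤ - (1 / (7 * w)) := by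
    rw [← neg_sub, div_neg, neg_le_neg_iff]
    exact one_div_le_one_div_of_le (by linarith) (by linarith)
  linarith

lemma zero_free_large {η : ℝ} (hη : 0 < η) (hη1 : η ≤ 1) : ∃ t0 : ℝ, 10 ≤ t0 ∧ ∀ t : ℝ, t0 ≤ t → ∀ β : ℝ, 
    1 - Real.log t ^ (-(2:ℝ)/3 - η) ≤ β → riemannZeta₁ (β + t * Complex.I) ≠ 0 := by
  obtain ⟨C, hC, hCz⟩ := zeta_two_sided
  obtain ⟨C2, hC20, hC2⟩ := LL_real_le
  have ev1 := ev_log hη (14 * (3 * C2 + 5 + 240 * 100000 * Real.log (1000 * C))) (14 * (240 * 100000 * 3))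
  have ev2 := (tendsto_rpow_atTop hη).eventually_ge_atTop 1400000
  have ev := Real.tendsto_log_atTop.eventually (ev1.and (ev2.and (Filter.eventually_ge_atTop 10)))
  obtain ⟨t0, ht0⟩ := Filter.eventually_atTop.mp (ev.and (Filter.eventually_ge_atTop 10))
  refine ⟨max t0 10, le_max_right _ _, fun t ht β hβ hz => ?_⟩
  obtain ⟨⟨h1, h2, h3⟩, h4⟩ := ht0 t ((le_max_left _ _).trans ht)
  set l := Real.log t with hl
  have hl0 : 0 < l := by linarith
  set w := l ^ (-(2:ℝ)/3 - η) with hw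
  have hw0 : 0 < w := by positivity
  set p := l ^ ((2:ℝ)/3) with hp
  have hp1 : 1 ≤ p := Real.one_le_rpow (by linarith) (by norm_num)
  have ew : w = p⁻¹ * (l ^ η)⁻¹ := by
    rw [hw, hp, ← Real.rpow_neg hl0.le, ← Real.rpow_neg hl0.le, ← Real.rpow_add hl0]; congr 1; ring
  have eR : l ^ (-(2:ℝ)/3) = p⁻¹ := by
    rw [hp, ← Real.rpow_neg hl0.le]; congr 1; ring
  have hlη : 0 < l ^ η := by positivity
  have hwR : 14 * w ≤ 0.00001 * l ^ (-(2:ℝ)/3) := by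
    rw [ew, eR]
    have : (l ^ η)⁻¹ ≤ (1400000:ℝ)⁻¹ := inv_anti₀ (by norm_num) h2
    have h5 : 0 < p⁻¹ := by positivity
    norm_num at this ⊢
    nlinarith
  have hw1 : 6 * w ≤ 1 := by
    have : l ^ (-(2:ℝ)/3) ≤ 1 := by rw [eR]; exact inv_le_one_of_one_le₀ hp1
    norm_num at hwR
    linarith
  have ht0' : 0 < t := by linarith
  set M := Real.log (1000 * C * l / w) with hM
  obtain ⟨-, hA⟩ := zeta_landau hC hCz h3 ht0' le_rfl (by linarith) hw0 rfl hwR hM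
  obtain ⟨hB, -⟩ := zeta_landau hC hCz h3 ht0' (show t ≤ 2 * t by linarith) le_rfl hw0 rfl hwR hM
  have hA' := hA β hβ hz
  have h341 := three_four_one (show 1 < 1 + 6 * w by linarith) t
  have hreal := hC2 (1 + 6 * w) (by linarith) (by linarith)
  rw [show 1 + 6 * w - 1 = 6 * w by ring] at hreal
  rw [eR] at hA' hB
  have hMle : M ≤ Real.log (1000 * C) + 3 * Real.log l := by
    have h5 : 1000 * C * l / w = 1000 * C * l ^ ((5:ℝ)/3 + η) := by
      rw [hw, mul_div_assoc, ← Real.rpow_one_sub' hl0.le]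
      · congr 2; ring
      · ring_nf; positivity
    rw [hM, h5, Real.log_mul (by positivity) (by positivity), Real.log_rpow hl0]
    have : 0 ≤ Real.log l := Real.log_nonneg (by linarith)
    nlinarith
  have e7 : 48 * M / (0.00001 * p⁻¹) = 48 * 100000 * (M * p) := by field_simp; ring
  rw [e7] at hA' hB
  have e8 : 1 / (6 * w) = p * l ^ η / 6 := by rw [ew]; field_simp
  have e9 : 1 / (7 * w) = p * l ^ η / 7 := by rw [ew]; field_simp
  rw [e8] at hreal
  rw [e9] at hA'
  have hMp : M * p ≤ (Real.log (1000 * C) + 3 * Real.log l) * p := by gcongr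
  have h1p := mul_lt_mul_of_pos_right h1 (show 0 < p by linarith)
  have : (3 * C2 + 5) ≤ (3 * C2 + 5) * p := by nlinarith
  norm_num at *
  nlinarith

theorem zero_free {η : ℝ} (hη : 0 < η) (hη1 : η ≤ 1) : ∃ T0 : ℝ, 10 ≤ T0 ∧ ∀ T : ℝ, T0 ≤ T → ∀ s : ℂ, 
    1 - Real.log T ^ (-(2:ℝ)/3 - η) ≤ s.re → |s.im| ≤ T → riemannZeta₁ s ≠ 0 := by
  obtain ⟨t0, ht0, hlarge⟩ := zero_free_large hη hη1
  have hK : IsCompact ((fun x : ℝ => (1:ℂ) + x * Complex.I) '' Set.Icc (-t0) t0) := 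
    isCompact_Icc.image (by fun_prop)
  have hU : IsOpen {s : ℂ | riemannZeta₁ s ≠ 0} := isOpen_ne_fun differentiable_riemannZeta₁.continuous continuous_const
  obtain ⟨δ, hδ, hsub⟩ := hK.exists_thickening_subset_open hU (by
    rintro _ ⟨x, _, rfl⟩
    exact z1_ne (by simp))
  have ev : ∀ᶠ T : ℝ in Filter.atTop, Real.log T ^ (-((2:ℝ)/3 + η)) < δ := by
    have h1 := (tendsto_rpow_neg_atTop (show 0 < (2:ℝ)/3 + η by linarith)).comp Real.tendsto_log_atTop
    exact h1.eventually_lt_const hδ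
  obtain ⟨T1, hT1⟩ := Filter.eventually_atTop.mp ev
  refine ⟨max T1 t0, ht0.trans (le_max_right _ _), fun T hT s hre him hz => ?_⟩
  have h1 := hT1 T ((le_max_left _ _).trans hT)
  rw [show -((2:ℝ)/3 + η) = -(2:ℝ)/3 - η by ring] at h1
  have hs1 : s.re < 1 := by
    by_contra h
    push Not at h
    exact z1_ne h hz
  rcases le_or_gt |s.im| t0 with h | h
  · have : s ∈ Metric.thickening δ ((fun x : ℝ => (1:ℂ) + x * Complex.I) '' Set.Icc (-t0) t0) := by
      rw [Metric.mem_thickening_iff]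
      refine ⟨1 + s.im * Complex.I, ⟨s.im, abs_le.mp h, rfl⟩, ?_⟩
      have e : s - (1 + s.im * Complex.I) = ((s.re - 1 : ℝ) : ℂ) := by
        apply Complex.ext <;> simp
      rw [dist_eq_norm, e, Complex.norm_real, Real.norm_eq_abs, abs_of_neg (by linarith)]
      linarith
    exact hsub this hz
  · have hmono : 1 - Real.log |s.im| ^ (-(2:ℝ)/3 - η) ≤ s.re := by
      have : Real.log T ^ (-(2:ℝ)/3 - η) ≤ Real.log |s.im| ^ (-(2:ℝ)/3 - η) := by
        apply Real.rpow_le_rpow_of_nonpos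
        · exact Real.log_pos (by linarith)
        · exact Real.log_le_log (by linarith) him
        · linarith
      linarith
    have := hlarge |s.im| h.le s.re hmono
    rcases abs_cases s.im with ⟨h2, _⟩ | ⟨h2, _⟩
    · rw [h2, Complex.re_add_im] at this
      exact this hz
    · rw [h2] at this
      apply this
      have e : (s.re : ℂ) + ((-s.im : ℝ) : ℂ) * Complex.I = (starRingEnd ℂ) s := by
        apply Complex.ext <;> simp
      rw [e]
      exact z1_conj_zero hz

end VK

namespace VK
open Finset Metric

lemma z1_upper {s : ℂ} (hs : 1/2 ≤ s.re) : ‖riemannZeta₁ s‖ ≤ 6 * (1 + ‖s‖) ^ 2 := by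
  have hn := norm_nonneg s
  by_cases h1 : s = 1
  · rw [h1, riemannZeta₁_one]; norm_num
  have hz := zeta_approx 1 le_rfl (s := s) (by linarith) h1
  have h2 : ‖(2:ℂ) ^ (1 - s)‖ ≤ 2 := by
    have : (2:ℂ) = ((2:ℝ):ℂ) := by norm_num
    rw [this, Complex.norm_cpow_eq_rpow_re_of_pos (by norm_num)]
    calc (2:ℝ) ^ (1 - s).re ≤ 2 ^ (1:ℝ) := Real.rpow_le_rpow_of_exponent_le (by norm_num) (by simp; linarith)
      _ = 2 := by simp
  have hsub : s - 1 ≠ 0 := sub_ne_zero.mpr h1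
  have e : riemannZeta₁ s = (s - 1) * (riemannZeta s - ∑ n ∈ range 1, ((n:ℂ)+1)^(-s) - (((1:ℕ):ℂ)+1)^(1-s)/(s-1)) + (s - 1) + (2:ℂ) ^ (1 - s) := by
    rw [z1_mul h1]; simp; field_simp; norm_num; ring
  have hs1 : ‖s - 1‖ ≤ 1 + ‖s‖ := by
    calc _ ≤ ‖s‖ + ‖(1:ℂ)‖ := norm_sub_le _ _
      _ = _ := by simp; ring
  rw [e]
  have h3 : ‖s‖ * (((1:ℕ):ℝ) ^ (-s.re) / s.re) ≤ 2 * ‖s‖ := by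
    have : ((1:ℕ):ℝ) ^ (-s.re) / s.re ≤ 2 := by
      simp; rw [inv_le_comm₀ (by linarith) (by norm_num)]; linarith
    nlinarith
  refine (norm_add₃_le).trans ?_
  rw [norm_mul]
  have h4 : ‖s - 1‖ * ‖riemannZeta s - ∑ n ∈ range 1, ((n:ℂ)+1)^(-s) - (((1:ℕ):ℂ)+1)^(1-s)/(s-1)‖ ≤ (1 + ‖s‖) * (2 * ‖s‖) := by
    gcongr; exact hz.trans h3
  nlinarith

lemma z0_upper : ∃ C > 0, ∀ s : ℂ, 1/2 ≤ s.re → ‖riemannZeta₀ s‖ ≤ C * (1 + ‖s‖) := by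
  obtain ⟨C, hC⟩ := (isCompact_closedBall (1:ℂ) 1).exists_bound_of_continuousOn (differentiable_riemannZeta₀.continuous.continuousOn)
  refine ⟨max C 21, by positivity, fun s hs => ?_⟩
  have hn := norm_nonneg s
  by_cases h : ‖s - 1‖ ≤ 1
  · have := hC s (by simpa [dist_eq_norm] using h)
    calc _ ≤ C := this
      _ ≤ max C 21 * 1 := by simp
      _ ≤ _ := by gcongr; linarith
  · push Not at h
    have hs1 : s ≠ 1 := by rintro rfl; simp at h; linarith
    have e : riemannZeta₀ s * (s - 1) = riemannZeta₁ s - 1 := by simp [riemannZeta₁]; ring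
    have h2 : ‖riemannZeta₀ s‖ * ‖s - 1‖ ≤ 6 * (1 + ‖s‖) ^ 2 + 1 := by
      rw [← norm_mul, e]
      refine (norm_sub_le _ _).trans ?_
      simpa using z1_upper hs
    have h3 := norm_nonneg (riemannZeta₀ s)
    have h5 : 1 + ‖s‖ ≤ 3 * ‖s - 1‖ := by
      have := norm_le_norm_add_norm_sub' s 1
      rw [norm_one] at this; linarith
    have h6 : ‖riemannZeta₀ s‖ * (1 + ‖s‖) ≤ 21 * (1 + ‖s‖) * (1 + ‖s‖) := by nlinarith
    calc _ ≤ 21 * (1 + ‖s‖) := le_of_mul_le_mul_right h6 (by linarith)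
      _ ≤ _ := by gcongr; simp

lemma logs_le {T : ℝ} (hT : 1 ≤ T) : Real.log T ≤ T := (Real.log_le_sub_one_of_pos (by linarith)).trans (by linarith)

set_option maxHeartbeats 1000000 in
/-- bounds on a region left of the 1-line -/
theorem region_bound {η : ℝ} (hη : 0 < η) (hη1 : η ≤ 1) : ∃ T0 : ℝ, 10 ≤ T0 ∧ ∀ T : ℝ, T0 ≤ T → ∀ s : ℂ,
    1 - Real.log T ^ (-(2:ℝ)/3 - η) ≤ s.re → s.re ≤ 2 → |s.im| ≤ T →
    riemannZeta₁ s ≠ 0 ∧ ‖ld s + riemannZeta₀ s‖ ≤ T * √T := by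
  obtain ⟨T1, hT1, hzf⟩ := zero_free (η := η/2) (by linarith) (by linarith)
  obtain ⟨C1, hC1, hz0⟩ := z0_upper
  obtain ⟨C2, hC2, hLL⟩ := LL_real_le
  obtain ⟨C3, hC3, hts⟩ := zeta_two_sided
  have ev1 : ∀ᶠ T : ℝ in Filter.atTop, (5:ℝ) * 2 ^ (2:ℝ) < Real.log T ^ (η / 2) :=
    ((tendsto_rpow_atTop (by linarith : 0 < η / 2)).comp Real.tendsto_log_atTop).eventually_gt_atTop _
  have ev2 : ∀ᶠ T : ℝ in Filter.atTop, 100 * Real.log T ^ (3:ℝ) ≤ √T := by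
    have := (isLittleO_log_rpow_rpow_atTop (r := 3) (s := 1/2) (by norm_num)).def (c := 1/100) (by norm_num)
    filter_upwards [this, Filter.eventually_ge_atTop 1] with T h h1
    rw [← Real.sqrt_eq_rpow] at h
    rw [Real.norm_of_nonneg (by have := Real.log_nonneg h1; positivity), Real.norm_of_nonneg (Real.sqrt_nonneg _)] at h
    linarith
  obtain ⟨T2, hT2⟩ := Filter.eventually_atTop.mp (ev1.and (ev2.and (Filter.eventually_ge_atTop (max (max ((100 * C1)^2) ((4 * C2)^2)) (1000 * C3)))))
  refine ⟨max (max T1 T2) 100, le_trans (by norm_num) (le_max_right _ 100), fun T hT s hs1 hs2 hst => ?_⟩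
  have hTT1 : T1 ≤ T := le_trans (by simp) hT
  have hTT2 : T2 ≤ T := le_trans (by simp) hT
  have hT100 : 100 ≤ T := le_trans (by simp) hT
  obtain ⟨hA, hB, hD⟩ := hT2 T hTT2
  have hD1 : 100 * C1 ≤ √T := Real.le_sqrt_of_sq_le (le_trans (by simp) hD)
  have hD2 : 4 * C2 ≤ √T := Real.le_sqrt_of_sq_le (le_trans (by simp) hD)
  have hD3 : 1000 * C3 ≤ T := le_trans (by simp) hD
  set l := Real.log T with hl
  have hl2 : 2 ≤ l := by
    rw [hl, Real.le_log_iff_exp_le (by linarith)]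
    have := Real.exp_one_lt_d9
    calc Real.exp 2 = Real.exp 1 * Real.exp 1 := by rw [← Real.exp_add]; norm_num
      _ ≤ 3 * 3 := by gcongr <;> linarith
      _ ≤ T := by linarith
  have hl0 : 0 < l := by linarith
  set w := l ^ (-(2:ℝ)/3 - η) with hw
  have hw0 : 0 < w := by positivity
  have hlog2T : Real.log (2 * T) ≤ 2 * l := by
    rw [Real.log_mul (by norm_num) (by linarith)]
    have := Real.log_two_lt_d9; linarith
  have hlog2T0 : 0 < Real.log (2 * T) := Real.log_pos (by linarith)
  have hwide : 5 * w ≤ Real.log (2 * T) ^ (-(2:ℝ)/3 - η/2) := by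
    calc 5 * w = 5 * (l ^ (-(2:ℝ)/3 - η/2) * l ^ (-(η/2))) := by rw [hw, ← Real.rpow_add hl0]; congr 2; ring
      _ ≤ (2:ℝ) ^ (-(2:ℝ)) * l ^ (-(2:ℝ)/3 - η/2) := by
        rw [Real.rpow_neg hl0.le, Real.rpow_neg (by norm_num)]
        have : (l ^ (η/2))⁻¹ ≤ (5 * (2:ℝ) ^ (2:ℝ))⁻¹ := by gcongr
        have h5 : 0 < l ^ (-(2:ℝ)/3 - η/2) := by positivity
        rw [mul_inv] at this
        nlinarith only [this, h5]
      _ ≤ (2:ℝ) ^ (-(2:ℝ)/3 - η/2) * l ^ (-(2:ℝ)/3 - η/2) := by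
        gcongr
        · norm_num
        · linarith
      _ = (2 * l) ^ (-(2:ℝ)/3 - η/2) := by rw [Real.mul_rpow (by norm_num) hl0.le]
      _ ≤ _ := by
        apply Real.rpow_le_rpow_of_nonpos hlog2T0 hlog2T; linarith
  have hwu : 5 * w ≤ 1 / 2 := by
    have h1 : w ≤ (5 * (2:ℝ) ^ (2:ℝ))⁻¹ := by
      calc w = l ^ (-(2:ℝ)/3 - η/2) * (l ^ (η/2))⁻¹ := by rw [hw, ← Real.rpow_neg hl0.le, ← Real.rpow_add hl0]; congr 1; ring
        _ ≤ 1 * (5 * (2:ℝ) ^ (2:ℝ))⁻¹ := by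
          gcongr
          apply Real.rpow_le_one_of_one_le_of_nonpos (by linarith) (by linarith)
        _ = _ := one_mul _
    norm_num at h1; linarith
  have hwinv : 1 / w ≤ T := by
    rw [hw, one_div, ← Real.rpow_neg hl0.le]
    refine le_trans (b := l ^ (3:ℝ)) ?_ ?_
    · apply Real.rpow_le_rpow_of_exponent_le <;> linarith
    · have : 0 < l ^ (3:ℝ) := by positivity
      have h5 : √T * 1 ≤ √T * √T := by
        gcongr; apply Real.one_le_sqrt.mpr; linarith
      rw [Real.mul_self_sqrt (by linarith)] at h5
      linarith
  have hwl : 100 * (l * (1 / w)) ≤ √T := by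
    refine le_trans ?_ hB
    rw [hw, one_div, ← Real.rpow_neg hl0.le]
    gcongr
    calc l * l ^ (-(-(2:ℝ)/3 - η)) = l ^ (1 + (-(-(2:ℝ)/3 - η))) := by rw [Real.rpow_add hl0, Real.rpow_one]
      _ ≤ _ := by apply Real.rpow_le_rpow_of_exponent_le <;> linarith
  have hsq0 : 0 ≤ √T := Real.sqrt_nonneg T
  have hsqT : 100 * √T ≤ T * √T := by gcongr
  have hwT : 1 ≤ T * w := by rw [div_le_iff₀ hw0] at hwinv; linarith
  have hlT : l ≤ T := logs_le (by linarith)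
  -- nonvanishing on bigger region
  have hnz : ∀ z : ℂ, 1 - 5 * w ≤ z.re → |z.im| ≤ 2 * T → riemannZeta₁ z ≠ 0 := fun z h1 h2 =>
    hzf (2 * T) (by linarith) z (by linarith) h2
  refine ⟨hnz s (by linarith) (by linarith), ?_⟩
  have hsn : ‖s‖ ≤ 2 + T := by
    refine (Complex.norm_le_abs_re_add_abs_im s).trans ?_
    have : |s.re| ≤ 2 := abs_le.mpr ⟨by linarith, hs2⟩
    linarith
  have hz0' : ‖riemannZeta₀ s‖ ≤ T * √T / 2 := by
    refine (hz0 s (by linarith)).trans ?_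
    calc C1 * (1 + ‖s‖) ≤ (√T / 100) * (2 * T) := by gcongr <;> linarith
      _ ≤ T * √T / 2 := by nlinarith only [mul_nonneg hsq0 (by linarith : 0 ≤ T)]
  have hT3 : T ^ 3 * 100 ≤ T ^ 4 := by nlinarith only [pow_pos (by linarith : 0 < T) 3, hT100]
  have hT2' : T ^ 2 * 100 ≤ T ^ 3 := by nlinarith only [pow_pos (by linarith : 0 < T) 2, hT100]
  suffices hld : ‖ld s‖ ≤ T * √T / 2 by
    exact (norm_add_le _ _).trans (by linarith)
  by_cases hcase : s.re ≤ 1 + w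
  · -- near
    set s0 : ℂ := ((1 + 2 * w : ℝ) : ℂ) + (s.im : ℝ) * Complex.I with hs0
    have hs0re : s0.re = 1 + 2 * w := by simp [hs0]
    have hs0im : s0.im = s.im := by simp [hs0]
    have h0 := (hts (1 + 2 * w) s.im (by linarith) (by linarith)).2
    rw [← hs0] at h0
    have hs01 : s0 ≠ 1 := by
      intro h; have := congrArg Complex.re h; rw [hs0re] at this; simp at this; linarith
    have hlow : 4 * w ^ 2 / C3 ≤ ‖riemannZeta₁ s0‖ := by
      rw [z1_mul hs01, norm_mul]
      have h1 : 2 * w ≤ ‖s0 - 1‖ := by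
        calc 2 * w = (s0 - 1).re := by simp [hs0re]
          _ ≤ |(s0 - 1).re| := le_abs_self _
          _ ≤ _ := Complex.abs_re_le_norm _
      calc 4 * w ^ 2 / C3 = (2 * w) * ((1 + 2 * w - 1) / C3) := by ring
        _ ≤ _ := mul_le_mul h1 h0 (div_nonneg (by linarith) (by linarith)) (norm_nonneg _)
    have key := logderiv_ball (g := fun z => riemannZeta₁ (s0 + z)) (r := 6 * w) (M := 7 * l) (by linarith) (by linarith)
      (by fun_prop) ?_ ?_ (z := s - s0) ?_
    · rw [deriv_comp_const_add] at key
      rw [add_sub_cancel] at key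
      refine key.trans ?_
      calc 24 * (7 * l) / (6 * w) = 28 * (l * (1 / w)) := by field_simp; norm_num
        _ ≤ T * √T / 2 := by linarith
    · intro z hz
      rw [mem_ball_zero_iff] at hz
      apply hnz
      · have := (abs_le.mp (Complex.abs_re_le_norm z)).1
        rw [Complex.add_re, hs0re]; linarith
      · have h1 := Complex.abs_im_le_norm z
        rw [Complex.add_im, hs0im]
        refine (abs_add_le _ _).trans ?_
        linarith
    · intro z hz
      rw [mem_ball_zero_iff] at hz
      simp only [add_zero]
      have hre : 1/2 ≤ (s0 + z).re := by
        have := (abs_le.mp (Complex.abs_re_le_norm z)).1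
        rw [Complex.add_re, hs0re]; linarith
      have hnn : ‖s0 + z‖ ≤ 3 + T := by
        have h1 : ‖s0‖ ≤ 1 + 2 * w + T := by
          refine (Complex.norm_le_abs_re_add_abs_im s0).trans ?_
          rw [hs0re, hs0im, abs_of_pos (by linarith)]; linarith
        refine (norm_add_le _ _).trans ?_
        linarith
      have hup := z1_upper hre
      have hexp : Real.exp (7 * l) = T ^ 7 := by
        rw [hl, mul_comm, ← Real.rpow_def_of_pos (by linarith)]; norm_cast
      rw [hexp]
      calc ‖riemannZeta₁ (s0 + z)‖ ≤ 6 * (1 + ‖s0 + z‖) ^ 2 := hup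
        _ ≤ 6 * (2 * T) ^ 2 := by gcongr; linarith
        _ ≤ T ^ 3 * 4 := by linarith [sq_nonneg T]
        _ ≤ T ^ 7 * (4 * w ^ 2 / C3) := by
          have e : T ^ 7 * (4 * w ^ 2 / C3) = (T ^ 4 * 4 ) * ((T * w) ^ 2) * (T / C3) := by ring
          rw [e]
          have h1 : 1 ≤ T / C3 := by rw [le_div_iff₀ (by linarith)]; linarith
          have h2 : 1 ≤ (T * w) ^ 2 := one_le_pow₀ hwT
          calc T ^ 3 * 4 ≤ (T ^ 4 * 4) * 1 * 1 := by linarith [pow_pos (by linarith : 0 < T) 3]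
            _ ≤ _ := by gcongr
        _ ≤ _ := by gcongr
    · have e : s - s0 = ((s.re - (1 + 2 * w) : ℝ) : ℂ) := by
        apply Complex.ext <;> simp [hs0]
      rw [e, Complex.norm_real, Real.norm_eq_abs, abs_le]
      constructor <;> linarith
  · push Not at hcase
    have h1 : 1 < s.re := by linarith
    have e := LL_eq h1
    have e2 : ld s = 1 / (s - 1) - LL s := by rw [e]; ring
    have e3 : LL s = LL ((s.re : ℂ) + s.im * Complex.I) := by rw [Complex.re_add_im]
    have h2 : ‖LL s‖ ≤ 1 / (s.re - 1) + C2 := by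
      rw [e3]; exact (LL_norm_le h1 _).trans (hLL _ h1 hs2)
    have h3 : ‖1 / (s - 1)‖ ≤ 1 / w := by
      rw [norm_div, norm_one]
      apply one_div_le_one_div_of_le hw0
      calc w ≤ (s - 1).re := by simp; linarith
        _ ≤ |(s - 1).re| := le_abs_self _
        _ ≤ _ := Complex.abs_re_le_norm _
    have h4 : 1 / (s.re - 1) ≤ 1 / w := one_div_le_one_div_of_le hw0 (by linarith)
    rw [e2]
    refine (norm_sub_le _ _).trans ?_
    have h7 : 1 / w ≤ l * (1 / w) := le_mul_of_one_le_left (by positivity) (by linarith)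
    linarith
end VK

namespace VK
open Finset MeasureTheory

lemma den_ge {c : ℝ} (hc : 1/2 ≤ c) (t : ℝ) : (1 + t^2) / 4 ≤ ‖((c:ℂ) + t * Complex.I) * ((c:ℂ) + t * Complex.I + 1)‖ := by
  have e2 : (c:ℂ) + t * Complex.I + 1 = ((c + 1 : ℝ) : ℂ) + t * Complex.I := by push_cast; ring
  rw [norm_mul, e2, Complex.norm_add_mul_I, Complex.norm_add_mul_I]
  calc (1 + t^2) / 4 = √((1 + t^2)/4) * √((1 + t^2)/4) := by rw [Real.mul_self_sqrt (by positivity)]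
    _ ≤ _ := by gcongr <;> nlinarith [sq_nonneg t]

lemma den_ne {c : ℝ} (hc : 1/2 ≤ c) (t : ℝ) : ((c:ℂ) + t * Complex.I) * ((c:ℂ) + t * Complex.I + 1) ≠ 0 := by
  have h := den_ge hc t
  intro h0
  rw [h0, norm_zero] at h
  nlinarith [sq_nonneg t]

noncomputable def gg (t : ℝ) : ℂ := (Set.Ioc (0:ℝ) 1).indicator (fun _ => (1:ℂ)) t - (Set.Ioc (0:ℝ) 1).indicator (fun t => (t:ℂ) ^ (1:ℂ)) t

lemma gg_mellin {s : ℂ} (hs : 0 < s.re) : HasMellin gg s (1 / s - 1 / (s + 1)) := by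
  have h1 := hasMellin_one_Ioc hs
  have h2 := hasMellin_cpow_Ioc 1 (s := s) (by simp; linarith)
  have := hasMellin_sub h1.1 h2.1
  rw [h1.2, h2.2] at this
  exact this

lemma gg_eq {t : ℝ} (ht : 0 < t) : gg t = ((max (1 - t) 0 : ℝ) : ℂ) := by
  unfold gg
  by_cases h : t ≤ 1
  · rw [Set.indicator_of_mem (Set.mem_Ioc.mpr ⟨ht, h⟩), Set.indicator_of_mem (Set.mem_Ioc.mpr ⟨ht, h⟩), max_eq_left (by linarith)]
    simp
  · rw [Set.indicator_of_notMem (by simp [h]), Set.indicator_of_notMem (by simp [h]), max_eq_right (by linarith)]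
    simp

lemma gg_cont {t : ℝ} (ht : 0 < t) : ContinuousAt gg t := by
  have : gg =ᶠ[nhds t] fun t => ((max (1 - t) 0 : ℝ) : ℂ) := by
    filter_upwards [lt_mem_nhds ht] with x hx using gg_eq hx
  rw [continuousAt_congr this]
  fun_prop

lemma ker_integrable {c : ℝ} (hc : 1/2 ≤ c) : Integrable (fun t : ℝ => 1 / (((c:ℂ) + t * Complex.I) * ((c:ℂ) + t * Complex.I + 1))) := by
  refine Integrable.mono' (integrable_inv_one_add_sq.const_mul 4) ?_ ?_
  · apply Continuous.aestronglyMeasurable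
    apply Continuous.div (by fun_prop) (by fun_prop)
    intro t; exact den_ne hc t
  · filter_upwards with t
    rw [norm_div, norm_one, one_div]
    have h := den_ge hc t
    have h2 : 0 < (1 + t^2) / 4 := by positivity
    calc _ ≤ ((1 + t^2) / 4)⁻¹ := by gcongr
      _ = _ := by field_simp

lemma perron1 {c x : ℝ} (hc : 1/2 ≤ c) (hx : 0 < x) :
    (1 / (2 * Real.pi)) • ∫ t : ℝ, (x:ℂ) ^ (-((c:ℂ) + t * Complex.I)) * (1 / (((c:ℂ) + t * Complex.I) * ((c:ℂ) + t * Complex.I + 1)))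
     = ((max (1 - x) 0 : ℝ) : ℂ) := by
  have hm : ∀ t : ℝ, mellin gg ((c:ℂ) + t * Complex.I) = 1 / (((c:ℂ) + t * Complex.I) * ((c:ℂ) + t * Complex.I + 1)) := by
    intro t
    rw [(gg_mellin (s := (c:ℂ) + t * Complex.I) (by simp; linarith)).2]
    have := den_ne hc t
    have h1 := left_ne_zero_of_mul this
    have h2 := right_ne_zero_of_mul this
    field_simp
    ring
  have := mellinInv_mellin_eq c gg hx (gg_mellin (s := c) (by simp; linarith)).1 (by
    unfold Complex.VerticalIntegrable
    simp_rw [hm]; exact ker_integrable hc) (gg_cont hx)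
  rw [gg_eq hx] at this
  rw [← this]
  unfold mellinInv
  simp_rw [hm, smul_eq_mul]

noncomputable def aa (n : ℕ) : ℂ := (ArithmeticFunction.vonMangoldt n : ℂ) - 1

lemma aa_eq : aa = (fun n => (ArithmeticFunction.vonMangoldt n : ℂ)) - 1 := by
  ext n; simp [aa]

lemma aa_summable {s : ℂ} (hs : 1 < s.re) : LSeriesSummable aa s := by
  rw [aa_eq]
  have h : LSeriesSummable (fun n => (ArithmeticFunction.vonMangoldt n : ℂ)) s := LL_summable hs
  exact LSeriesSummable.sub h (LSeriesSummable_one_iff.mpr hs)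

lemma aa_series {s : ℂ} (hs : 1 < s.re) : LSeries aa s = -(ld s + riemannZeta₀ s) := by
  have h1 : s ≠ 1 := by rintro rfl; simp at hs
  have h : LSeriesSummable (fun n => (ArithmeticFunction.vonMangoldt n : ℂ)) s := LL_summable hs
  rw [aa_eq, LSeries_sub h (LSeriesSummable_one_iff.mpr hs), LSeries_one_eq_riemannZeta hs]
  have := LL_eq hs
  unfold LL at this
  rw [this, riemannZeta_eq_inv_sub_add h1]
  ring

noncomputable def ker (s : ℂ) : ℂ := 1 / (s * (s + 1))

lemma perron {N : ℕ} (hN : 1 ≤ N) {c : ℝ} (hc : 1 < c) :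
    (((∑ n ∈ Ico 1 N, (ArithmeticFunction.vonMangoldt n - 1) * (1 - (n:ℝ) / N) : ℝ)) : ℂ) = 
    (1 / (2 * Real.pi)) • ∫ t : ℝ, LSeries aa ((c:ℂ) + t * Complex.I) * ((N:ℂ) ^ ((c:ℂ) + t * Complex.I) * ker ((c:ℂ) + t * Complex.I)) := by
  have hN0 : (0:ℝ) < N := by exact_mod_cast hN
  set Fn : ℕ → ℝ → ℂ := fun n t => LSeries.term aa ((c:ℂ) + t * Complex.I) n * ((N:ℂ) ^ ((c:ℂ) + t * Complex.I) * ker ((c:ℂ) + t * Complex.I)) with hF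
  have hker : Integrable (fun t : ℝ => ker ((c:ℂ) + t * Complex.I)) := ker_integrable (by linarith)
  have hform : ∀ n t, 1 ≤ n → Fn n t = aa n * (((((n:ℝ) / N : ℝ) : ℂ)) ^ (-((c:ℂ) + t * Complex.I)) * (1 / (((c:ℂ) + t * Complex.I) * ((c:ℂ) + t * Complex.I + 1)))) := by
    intro n t hn
    have hn0 : (0:ℝ) < n := by exact_mod_cast hn
    simp only [hF, ker]
    have key : (((n:ℝ) / N : ℝ) : ℂ) ^ ((c:ℂ) + t * Complex.I) * (N:ℂ) ^ ((c:ℂ) + t * Complex.I) = (n:ℂ) ^ ((c:ℂ) + t * Complex.I) := by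
      rw [← Complex.ofReal_natCast N, ← Complex.mul_cpow_ofReal_nonneg (by positivity) (by positivity), ← Complex.ofReal_mul,
        div_mul_cancel₀ _ hN0.ne', Complex.ofReal_natCast]
    have hne : (((n:ℝ) / N : ℝ) : ℂ) ^ ((c:ℂ) + t * Complex.I) ≠ 0 := by
      rw [Complex.cpow_ne_zero_iff]; left
      exact_mod_cast (div_pos hn0 hN0).ne'
    have hne2 : (N:ℂ) ^ ((c:ℂ) + t * Complex.I) ≠ 0 := by
      rw [Complex.cpow_ne_zero_iff]; left
      exact_mod_cast hN0.ne'
    rw [LSeries.term_of_ne_zero (by omega), Complex.cpow_neg, ← key]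
    generalize (1 / (((c:ℂ) + t * Complex.I) * ((c:ℂ) + t * Complex.I + 1))) = K
    field_simp
  have hnorm : ∀ n t, ‖Fn n t‖ = ‖LSeries.term aa (c:ℂ) n‖ * (N:ℝ) ^ c * ‖ker ((c:ℂ) + t * Complex.I)‖ := by
    intro n t
    simp only [hF]
    rw [norm_mul, norm_mul, LSeries.norm_term_eq, LSeries.norm_term_eq, Complex.norm_natCast_cpow_of_pos (by omega)]
    simp [mul_assoc]
  have hintg : ∀ n, Integrable (Fn n) := by
    intro n
    have h1 : Continuous (fun t : ℝ => LSeries.term aa ((c:ℂ) + t * Complex.I) n * ((N:ℂ) ^ ((c:ℂ) + t * Complex.I))) := by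
      have hNc : (N:ℂ) ≠ 0 := by exact_mod_cast hN0.ne'
      by_cases h0 : n = 0
      · subst h0; simp; fun_prop
      · have hnc : (n:ℂ) ≠ 0 := by exact_mod_cast h0
        simp_rw [LSeries.term_of_ne_zero h0]
        apply Continuous.mul
        · apply Continuous.div (by fun_prop)
          · apply Continuous.const_cpow (by fun_prop); left; exact hnc
          · intro t; rw [Complex.cpow_ne_zero_iff]; left; exact hnc
        · apply Continuous.const_cpow (by fun_prop); left; exact hNc
    refine Integrable.mono' (g := fun t => ‖LSeries.term aa (c:ℂ) n‖ * (N:ℝ) ^ c * ‖ker ((c:ℂ) + t * Complex.I)‖) (hker.norm.const_mul _) ?_ ?_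
    · have := h1.aestronglyMeasurable.mul hker.aestronglyMeasurable (μ := volume)
      refine this.congr ?_
      filter_upwards with t
      simp [hF, mul_assoc]
    · filter_upwards with t
      rw [hnorm]
  have hsum := hasSum_integral_of_summable_integral_norm hintg (by
    simp_rw [hnorm, integral_const_mul]
    apply Summable.mul_right
    apply Summable.mul_right
    exact (aa_summable (s := c) (by simpa using hc)).norm)
  have h2 : ∀ t : ℝ, ∑' n, Fn n t = LSeries aa ((c:ℂ) + t * Complex.I) * ((N:ℂ) ^ ((c:ℂ) + t * Complex.I) * ker ((c:ℂ) + t * Complex.I)) := by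
    intro t
    simp only [hF]
    rw [tsum_mul_right]; rfl
  simp_rw [h2] at hsum
  have h3 := (hsum.const_smul (1 / (2 * Real.pi))).tsum_eq
  rw [← h3, tsum_eq_sum (s := Ico 1 N)]
  · push_cast
    apply sum_congr rfl
    intro n hn
    rw [mem_Ico] at hn
    simp_rw [hform n _ hn.1, integral_const_mul]
    have hn0 : (0:ℝ) < n := by exact_mod_cast hn.1
    have h5 := perron1 (c := c) (x := (n:ℝ)/N) (by linarith) (by positivity)
    have h6 : (n:ℝ) / N ≤ 1 := by rw [div_le_one hN0]; exact_mod_cast hn.2.le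
    rw [max_eq_left (by linarith)] at h5
    rw [← mul_smul_comm, h5]
    simp [aa]
  · intro n hn
    by_cases h0 : n = 0
    · subst h0; simp [hF]
    · have hn1 : 1 ≤ n := by omega
      simp_rw [hform n _ hn1, integral_const_mul]
      have hn0 : (0:ℝ) < n := by exact_mod_cast hn1
      have h5 := perron1 (c := c) (x := (n:ℝ)/N) (by linarith) (by positivity)
      have h6 : 1 ≤ (n:ℝ) / N := by
        rw [le_div_iff₀ hN0, one_mul]
        have : N ≤ n := by
          by_contra h; exact hn (mem_Ico.mpr ⟨hn1, by omega⟩)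
        exact_mod_cast this
      rw [max_eq_right (by linarith)] at h5
      rw [← mul_smul_comm, h5]
      simp
end VK

namespace VK
open Finset MeasureTheory

noncomputable def HH (N : ℕ) (s : ℂ) : ℂ := -(ld s + riemannZeta₀ s) * ((N:ℂ) ^ s * ker s)

lemma ker_le {c : ℝ} (hc : 1/2 ≤ c) (t : ℝ) : ‖ker ((c:ℂ) + t * Complex.I)‖ ≤ 4 / (1 + t^2) := by
  unfold ker
  rw [norm_div, norm_one]
  have h := den_ge hc t
  have h2 : 0 < (1 + t^2) / 4 := by positivity
  calc _ ≤ 1 / ((1 + t^2) / 4) := by gcongr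
    _ = _ := by field_simp

lemma HH_norm_le {N : ℕ} (hN : 1 ≤ N) {c : ℝ} (hc : 1/2 ≤ c) (t : ℝ) {A : ℝ} (hA : ‖ld ((c:ℂ) + t * Complex.I) + riemannZeta₀ ((c:ℂ) + t * Complex.I)‖ ≤ A) :
    ‖HH N ((c:ℂ) + t * Complex.I)‖ ≤ A * (N:ℝ)^c * (4 / (1 + t^2)) := by
  unfold HH
  rw [norm_mul, norm_mul, norm_neg, Complex.norm_natCast_cpow_of_pos (by omega)]
  have h1 := ker_le hc t
  have hA0 : 0 ≤ A := (norm_nonneg _).trans hA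
  simp only [Complex.add_re, Complex.ofReal_re, Complex.mul_re, Complex.I_re, mul_zero, Complex.ofReal_im, Complex.I_im, mul_one, sub_self, add_zero]
  rw [mul_assoc]
  gcongr

lemma HH_diff {N : ℕ} (hN : 1 ≤ N) {s : ℂ} (hs : 1/2 ≤ s.re) (hz : riemannZeta₁ s ≠ 0) : DifferentiableAt ℂ (HH N) s := by
  have hNc : (N:ℂ) ≠ 0 := by exact_mod_cast (by omega : N ≠ 0)
  have h1 : DifferentiableAt ℂ ld s := by
    unfold ld
    exact ((differentiable_riemannZeta₁.deriv) s).div (differentiable_riemannZeta₁ s) hz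
  have h2 : DifferentiableAt ℂ ker s := by
    unfold ker
    have := den_ne hs s.im
    rw [Complex.re_add_im] at this
    fun_prop (disch := exact this)
  have h3 : DifferentiableAt ℂ (fun s : ℂ => (N:ℂ) ^ s) s := differentiableAt_id.const_cpow (Or.inl hNc)
  unfold HH
  exact ((h1.add (differentiable_riemannZeta₀ s)).neg).mul (h3.mul h2)

set_option maxHeartbeats 1000000 in
lemma contour {N : ℕ} (hN : 1 ≤ N) {c w T A : ℝ} (hc : 1 < c) (hc2 : c ≤ 2) (hw : 0 < w) (hw2 : w ≤ 1/2) (hT : 10 ≤ T)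
    (hreg : ∀ s : ℂ, 1 - w ≤ s.re → s.re ≤ 2 → |s.im| ≤ T → riemannZeta₁ s ≠ 0 ∧ ‖ld s + riemannZeta₀ s‖ ≤ T * √T)
    (hA : ∀ t : ℝ, ‖LSeries aa ((c:ℂ) + t * Complex.I)‖ ≤ A) :
    |∑ n ∈ Ico 1 N, (ArithmeticFunction.vonMangoldt n - 1) * (1 - (n:ℝ) / N)| ≤ 
      8 * A * (N:ℝ)^c / T + 16 * (N:ℝ)^c / √T + 8 * T^3 * (N:ℝ)^(1-w) := by
  have hN0 : (0:ℝ) < N := by exact_mod_cast hN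
  have hT0 : 0 < T := by linarith
  have hA0 : 0 ≤ A := (norm_nonneg _).trans (hA 0)
  have hre : ∀ t : ℝ, ((c:ℂ) + t * Complex.I).re = c := by intro t; simp
  have hp := perron hN hc
  have hHH : ∀ t : ℝ, LSeries aa ((c:ℂ) + t * Complex.I) * ((N:ℂ) ^ ((c:ℂ) + t * Complex.I) * ker ((c:ℂ) + t * Complex.I)) = HH N ((c:ℂ) + t * Complex.I) := by
    intro t; rw [aa_series (by rw [hre]; exact hc)]; rfl
  simp_rw [hHH] at hp
  have hA' : ∀ t : ℝ, ‖ld ((c:ℂ) + t * Complex.I) + riemannZeta₀ ((c:ℂ) + t * Complex.I)‖ ≤ A := by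
    intro t; have := hA t; rwa [aa_series (by rw [hre]; exact hc), norm_neg] at this
  set h : ℝ → ℂ := fun t => HH N ((c:ℂ) + t * Complex.I) with hh
  have hcont : Continuous h := by
    rw [continuous_iff_continuousAt]; intro t
    have := (HH_diff hN (s := (c:ℂ) + t * Complex.I) (by rw [hre]; linarith) (z1_ne (by rw [hre]; linarith))).continuousAt
    exact ContinuousAt.comp (f := fun t : ℝ => (c:ℂ) + t * Complex.I) this (by fun_prop)
  have hbd : ∀ t, ‖h t‖ ≤ A * (N:ℝ)^c * (4 / (1 + t^2)) := fun t => HH_norm_le hN (by linarith) t (hA' t)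
  have hintg : Integrable h := by
    refine Integrable.mono' (integrable_inv_one_add_sq.const_mul (4 * (A * (N:ℝ)^c))) hcont.aestronglyMeasurable ?_
    filter_upwards with t
    refine (hbd t).trans (le_of_eq ?_)
    ring
  -- split
  have hsplit : ∫ t : ℝ, h t = (∫ t in Set.Iic (-T), h t) + (∫ t in (-T)..T, h t) + ∫ t in Set.Ioi T, h t := by
    rw [intervalIntegral.integral_of_le (by linarith)]
    rw [← setIntegral_union (Set.Iic_disjoint_Ioc le_rfl) measurableSet_Ioc hintg.integrableOn hintg.integrableOn, Set.Iic_union_Ioc_eq_Iic (by linarith),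
      ← setIntegral_union (Set.Iic_disjoint_Ioi le_rfl) measurableSet_Ioi hintg.integrableOn hintg.integrableOn, Set.Iic_union_Ioi, setIntegral_univ]
  have htail : ∀ h' : ℝ → ℂ, (∀ t, ‖h' t‖ ≤ A * (N:ℝ)^c * (4 / (1 + t^2))) → ‖∫ t in Set.Ioi T, h' t‖ ≤ A * (N:ℝ)^c * 4 / T := by
    intro h' hb
    have i1 := (integrableOn_Ioi_rpow_of_lt (a := -2) (by norm_num) hT0).const_mul (A * (N:ℝ)^c * 4)
    have := norm_integral_le_of_norm_le (f := h') i1 (by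
      rw [ae_restrict_iff' measurableSet_Ioi]
      filter_upwards with t ht
      rw [Set.mem_Ioi] at ht
      refine (hb t).trans ?_
      have ht0 : 0 < t := by linarith
      have : (4:ℝ) / (1 + t^2) ≤ 4 * t ^ (-2:ℝ) := by
        rw [Real.rpow_neg ht0.le, div_eq_mul_inv]
        gcongr
        norm_num
      calc _ ≤ A * (N:ℝ)^c * (4 * t ^ (-2:ℝ)) := by gcongr
        _ = _ := by ring)
    refine this.trans (le_of_eq ?_)
    rw [integral_const_mul, integral_Ioi_rpow_of_lt (by norm_num) hT0]
    have : T ^ ((-2:ℝ) + 1) = T⁻¹ := by norm_num [Real.rpow_neg_one]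
    rw [this]; norm_num; ring
  have ht1 := htail h hbd
  have ht2 : ‖∫ t in Set.Iic (-T), h t‖ ≤ A * (N:ℝ)^c * 4 / T := by
    have := htail (fun t => h (-t)) (fun t => by have := hbd (-t); rwa [neg_sq] at this)
    rwa [integral_comp_neg_Ioi] at this
  -- contour
  have hrect := Complex.integral_boundary_rect_eq_zero_of_differentiableOn (HH N) (⟨1 - w, -T⟩ : ℂ) (⟨c, T⟩ : ℂ) (by
    intro s hs
    rw [Complex.mem_reProdIm] at hs
    simp only at hs
    rw [Set.uIcc_of_le (by linarith), Set.uIcc_of_le (by linarith)] at hs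
    exact (HH_diff hN (by linarith [hs.1.1]) (hreg s hs.1.1 (by linarith [hs.1.2]) (abs_le.mpr hs.2)).1).differentiableWithinAt)
  simp only at hrect
  have hhor : ∀ τ : ℝ, |τ| = T → ‖∫ x in (1 - w)..c, HH N ((x:ℂ) + τ * Complex.I)‖ ≤ 8 * (N:ℝ)^c / √T := by
    intro τ hτ
    have := intervalIntegral.norm_integral_le_of_norm_le_const (a := 1 - w) (b := c) (f := fun x : ℝ => HH N ((x:ℂ) + τ * Complex.I)) (C := 4 * (N:ℝ)^c / √T) (by
      intro x hx
      rw [Set.uIoc_of_le (by linarith)] at hx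
      have hb := (hreg ((x:ℂ) + τ * Complex.I) (by simp; linarith [hx.1]) (by simp; linarith [hx.2]) (by simp [hτ])).2
      refine (HH_norm_le hN (by linarith [hx.1]) τ hb).trans ?_
      have e1 : (N:ℝ)^x ≤ (N:ℝ)^c := Real.rpow_le_rpow_of_exponent_le (by exact_mod_cast hN) hx.2
      have e2 : 4 / (1 + τ^2) ≤ 4 / T^2 := by
        rw [← sq_abs, hτ]; gcongr; linarith
      calc _ ≤ T * √T * (N:ℝ)^c * (4 / T^2) := by gcongr
        _ = _ := by
          have : T = √T * √T := (Real.mul_self_sqrt hT0.le).symm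
          have h5 : √T ≠ 0 := by positivity
          field_simp
          rw [Real.sq_sqrt hT0.le])
    refine this.trans ?_
    rw [abs_of_nonneg (by linarith)]
    calc _ ≤ 4 * (N:ℝ)^c / √T * 2 := by gcongr; linarith
      _ = _ := by ring
  have hleft : ‖∫ y in (-T)..T, HH N (((1 - w : ℝ):ℂ) + y * Complex.I)‖ ≤ 8 * T^3 * (N:ℝ)^(1-w) := by
    have := intervalIntegral.norm_integral_le_of_norm_le_const (a := -T) (b := T) (f := fun y : ℝ => HH N (((1 - w : ℝ):ℂ) + y * Complex.I)) (C := 4 * T^2 * (N:ℝ)^(1-w)) (by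
      intro y hy
      rw [Set.uIoc_of_le (by linarith)] at hy
      have hb := (hreg (((1 - w : ℝ):ℂ) + y * Complex.I) (by simp) (by simp; linarith) (by simp; exact abs_le.mpr ⟨hy.1.le, hy.2⟩)).2
      refine (HH_norm_le hN (by linarith) y hb).trans ?_
      have e2 : 4 / (1 + y^2) ≤ 4 := by
        rw [div_le_iff₀ (by positivity)]; nlinarith [sq_nonneg y]
      have e3 : √T ≤ T := by rw [Real.sqrt_le_left hT0.le]; nlinarith
      calc _ ≤ T * T * (N:ℝ)^(1-w) * 4 := by gcongr
        _ = _ := by ring)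
    refine this.trans (le_of_eq ?_)
    rw [abs_of_nonneg (by linarith)]; ring
  have hmid : ‖∫ t in (-T)..T, h t‖ ≤ 16 * (N:ℝ)^c / √T + 8 * T^3 * (N:ℝ)^(1-w) := by
    have e : Complex.I • (∫ t in (-T)..T, h t) = Complex.I • (∫ y in (-T)..T, HH N (((1 - w : ℝ):ℂ) + y * Complex.I)) + 
        (∫ x in (1 - w)..c, HH N ((x:ℂ) + (T:ℝ) * Complex.I)) - (∫ x in (1 - w)..c, HH N ((x:ℂ) + ((-T : ℝ)) * Complex.I)) := by
      linear_combination hrect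
    have e2 : ‖∫ t in (-T)..T, h t‖ = ‖Complex.I • (∫ t in (-T)..T, h t)‖ := by rw [norm_smul]; simp
    rw [e2, e]
    refine (norm_sub_le _ _).trans ?_
    have e3 := norm_add_le (Complex.I • (∫ y in (-T)..T, HH N (((1 - w : ℝ):ℂ) + y * Complex.I))) (∫ x in (1 - w)..c, HH N ((x:ℂ) + (T:ℝ) * Complex.I))
    rw [norm_smul, Complex.norm_I, one_mul] at e3
    have e4 := hhor T (abs_of_pos hT0)
    have e5 := hhor (-T) (by rw [abs_neg, abs_of_pos hT0])
    have e6 : 16 * (N:ℝ)^c / √T = 8 * (N:ℝ)^c / √T + 8 * (N:ℝ)^c / √T := by ring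
    linarith
  rw [← Real.norm_eq_abs, ← Complex.norm_real, hp, norm_smul, hsplit]
  have hpi : ‖1 / (2 * Real.pi)‖ ≤ 1 := by
    rw [Real.norm_of_nonneg (by positivity), div_le_one (by positivity)]
    linarith [Real.pi_gt_three]
  have htot := norm_add₃_le (a := ∫ t in Set.Iic (-T), h t) (b := ∫ t in (-T)..T, h t) (c := ∫ t in Set.Ioi T, h t)
  have e8 : 8 * A * (N:ℝ)^c / T = A * (N:ℝ)^c * 4 / T + A * (N:ℝ)^c * 4 / T := by ring
  calc _ ≤ 1 * _ := mul_le_mul_of_nonneg_right hpi (norm_nonneg _)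
    _ ≤ _ := by rw [one_mul]; linarith
end VK

namespace VK
open Finset MeasureTheory

noncomputable def PP (N : ℕ) : ℝ := ∑ n ∈ Ico 1 N, (ArithmeticFunction.vonMangoldt n - 1)
noncomputable def SS (N : ℕ) : ℝ := ∑ n ∈ Ico 1 N, (ArithmeticFunction.vonMangoldt n - 1) * ((N:ℝ) - n)

lemma SS_bound {b : ℝ} (hb : 0 < b) (hb2 : b < 3/5) : ∃ N0 : ℕ, 10 ≤ N0 ∧ ∀ N : ℕ, N0 ≤ N → 
    |SS N| ≤ (N:ℝ)^2 * Real.exp (-(Real.log N ^ b / 4)) := by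
  obtain ⟨η, hη, hη1, hbη⟩ : ∃ η : ℝ, 0 < η ∧ η ≤ 1 ∧ (5/3 + η) * b < 1 := by
    refine ⟨(3/5 - b), by linarith, by linarith, ?_⟩
    nlinarith
  obtain ⟨T0, hT0, hreg⟩ := region_bound hη hη1
  obtain ⟨C2, hC2, hLL⟩ := LL_real_le
  obtain ⟨C3, hC3, hts⟩ := zeta_two_sided
  have hlog : Filter.Tendsto (fun N : ℕ => Real.log N) Filter.atTop Filter.atTop := Real.tendsto_log_atTop.comp tendsto_natCast_atTop_atTop
  have hlb : Filter.Tendsto (fun N : ℕ => Real.log N ^ b) Filter.atTop Filter.atTop := (tendsto_rpow_atTop hb).comp hlog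
  have ev1 : ∀ᶠ N : ℕ in Filter.atTop, T0 ≤ Real.exp (Real.log N ^ b) := (Real.tendsto_exp_atTop.comp hlb).eventually_ge_atTop T0
  have ev2 : ∀ᶠ N : ℕ in Filter.atTop, 5 ≤ Real.log N ^ (1 - (5/3 + η) * b) := ((tendsto_rpow_atTop (by linarith)).comp hlog).eventually_ge_atTop 5
  have ev3 : ∀ᶠ N : ℕ in Filter.atTop, 2 ≤ Real.log N ^ (b * (2/3 + η)) := ((tendsto_rpow_atTop (by positivity)).comp hlog).eventually_ge_atTop 2
  have ev4 : ∀ᶠ N : ℕ in Filter.atTop, Real.log 24 * 4 + Real.log (C2 + 2 * C3 + 1000) * 4 + 4 * Real.log (Real.log N) < Real.log N ^ b := by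
    exact hlog.eventually (ev_log hb _ _)
  obtain ⟨N1, hN1⟩ := Filter.eventually_atTop.mp (ev1.and (ev2.and (ev3.and (ev4.and (hlog.eventually_ge_atTop 1)))))
  refine ⟨max N1 10, le_max_right _ _, fun N hN => ?_⟩
  obtain ⟨hT, h5, h2, h4, hL1⟩ := hN1 N (le_trans (le_max_left _ _) hN)
  have hN10 : 10 ≤ N := le_trans (le_max_right _ _) hN
  have hN0 : (0:ℝ) < N := by exact_mod_cast (by omega : 0 < N)
  set L := Real.log N with hL
  have hL0 : 0 < L := by linarith
  set l := L ^ b with hl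
  have hl0 : 0 < l := by positivity
  set T := Real.exp l with hTd
  have hlT : Real.log T = l := Real.log_exp l
  set w := Real.log T ^ (-(2:ℝ)/3 - η) with hw
  have hw' : w = L ^ (-(b * (2/3 + η))) := by
    rw [hw, hlT, hl, ← Real.rpow_mul hL0.le]; congr 1; ring
  have hw0 : 0 < w := by rw [hw']; positivity
  have hw2 : w ≤ 1/2 := by
    rw [hw', Real.rpow_neg hL0.le, one_div]; gcongr
  have hwL : 5 * l ≤ w * L := by
    have : w * L = L ^ (1 - (5/3 + η) * b) * l := by
      rw [hw', hl, ← Real.rpow_add hL0]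
      nth_rewrite 2 [← Real.rpow_one L]
      rw [← Real.rpow_add hL0]; congr 1; ring
    rw [this]; gcongr
  set c := 1 + 1 / L with hc
  have hc1 : 1 < c := by have : 0 < 1 / L := by positivity
                         linarith
  have hc2 : c ≤ 2 := by have : 1 / L ≤ 1 := by rw [div_le_one hL0]; exact hL1
                         linarith
  have hNc : (N:ℝ) ^ c = N * Real.exp 1 := by
    rw [hc, Real.rpow_add hN0, Real.rpow_one, Real.rpow_def_of_pos hN0, ← hL]
    congr 2; field_simp
  have hNw : (N:ℝ) ^ (1 - w) = N * Real.exp (-(w * L)) := by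
    rw [Real.rpow_sub hN0, Real.rpow_one, Real.rpow_def_of_pos hN0, ← hL, Real.exp_neg, mul_comm w]; rfl
  have hA : ∀ t : ℝ, ‖LSeries aa ((c:ℂ) + t * Complex.I)‖ ≤ (C2 + 2 * C3) * L := by
    intro t
    have hre : ((c:ℂ) + t * Complex.I).re = c := by simp
    have hs : 1 < ((c:ℂ) + t * Complex.I).re := by rw [hre]; exact hc1
    have h1 : LSeries aa ((c:ℂ) + t * Complex.I) = LL ((c:ℂ) + t * Complex.I) - riemannZeta ((c:ℂ) + t * Complex.I) := by
      have h : LSeriesSummable (fun n => (ArithmeticFunction.vonMangoldt n : ℂ)) ((c:ℂ) + t * Complex.I) := LL_summable hs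
      rw [aa_eq, LSeries_sub h (LSeriesSummable_one_iff.mpr hs), LSeries_one_eq_riemannZeta hs]; rfl
    rw [h1]
    have h2 := (LL_norm_le hc1 t).trans (hLL c hc1 hc2)
    have h3 := (hts c t hc1 hc2).1
    have e1 : c - 1 = 1 / L := by rw [hc]; ring
    rw [e1] at h2 h3
    rw [one_div_one_div] at h2
    rw [div_div_eq_mul_div, div_one] at h3
    refine (norm_sub_le _ _).trans ?_
    nlinarith
  have key := contour (N := N) (by omega) hc1 hc2 hw0 hw2 (le_trans hT0 hT) (fun s h1 h2 h3 => hreg T hT s h1 h2 h3) hA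
  have eS : SS N = N * ∑ n ∈ Ico 1 N, (ArithmeticFunction.vonMangoldt n - 1) * (1 - (n:ℝ) / N) := by
    unfold SS
    rw [mul_sum]
    apply sum_congr rfl
    intro n _
    field_simp
  rw [eS, abs_mul, abs_of_pos hN0, sq, mul_assoc]
  gcongr
  refine key.trans ?_
  rw [hNc, hNw]
  -- all terms ≤ N * exp(-l/2) * K
  have hsq : √T = Real.exp (l / 2) := by
    rw [hTd, Real.exp_half]
  have t1 : 8 * ((C2 + 2 * C3) * L) * (N * Real.exp 1) / T ≤ 24 * (C2 + 2 * C3) * L * (N * Real.exp (-(l/2))) := by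
    rw [hTd, div_eq_mul_inv, ← Real.exp_neg]
    have e1 : Real.exp (-l) ≤ Real.exp (-(l/2)) := Real.exp_le_exp.mpr (by linarith)
    have e2 : Real.exp 1 ≤ 3 := by linarith [Real.exp_one_lt_d9]
    calc _ ≤ 8 * ((C2 + 2 * C3) * L) * (N * 3) * Real.exp (-(l/2)) := by gcongr
      _ = _ := by ring
  have t2 : 16 * (N * Real.exp 1) / √T ≤ 48 * (N * Real.exp (-(l/2))) := by
    rw [hsq, div_eq_mul_inv, ← Real.exp_neg]
    have e2 : Real.exp 1 ≤ 3 := by linarith [Real.exp_one_lt_d9]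
    calc _ ≤ 16 * (N * 3) * Real.exp (-(l/2)) := by gcongr
      _ = _ := by ring
  have t3 : 8 * T^3 * (N * Real.exp (-(w * L))) ≤ 8 * (N * Real.exp (-(l/2))) := by
    rw [hTd, ← Real.exp_nat_mul]
    have : Real.exp ((3:ℕ) * l) * Real.exp (-(w * L)) ≤ Real.exp (-(l/2)) := by
      rw [← Real.exp_add]; apply Real.exp_le_exp.mpr; push_cast; linarith
    calc _ = 8 * (N * (Real.exp ((3:ℕ) * l) * Real.exp (-(w * L)))) := by ring
      _ ≤ _ := by gcongr
  have hfin : 24 * (C2 + 2 * C3 + 1000) * L ≤ Real.exp (l / 4) := by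
    rw [← Real.log_le_iff_le_exp (by positivity), Real.log_mul (by positivity) (by positivity), Real.log_mul (by positivity) (by positivity)]
    linarith
  have hsplit : Real.exp (-(l/4)) = Real.exp (l/4) * Real.exp (-(l/2)) := by rw [← Real.exp_add]; congr 1; ring
  have hpos : 0 < (N:ℝ) * Real.exp (-(l/2)) := by positivity
  calc _ ≤ (24 * (C2 + 2 * C3) * L + 56) * (N * Real.exp (-(l/2))) := by linarith
    _ ≤ Real.exp (l/4) * (N * Real.exp (-(l/2))) := by
      gcongr
      linarith
    _ = _ := by rw [hsplit]; ring

lemma unsmooth {N h : ℕ} (hN : 1 ≤ N) (hh : 1 ≤ h) (hhN : h ≤ N) : 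
    h * |PP N| ≤ |SS (N + h)| + |SS N| + |SS (N - h)| + (h:ℝ)^2 := by
  have hL : ∀ n : ℕ, 0 ≤ ArithmeticFunction.vonMangoldt n := fun n => ArithmeticFunction.vonMangoldt_nonneg
  have up : h * PP N ≤ SS (N + h) - SS N + (h:ℝ)^2 := by
    unfold PP SS
    rw [← sum_Ico_consecutive _ hN (by omega : N ≤ N + h), mul_sum]
    have e1 : ∑ n ∈ Ico 1 N, (ArithmeticFunction.vonMangoldt n - 1) * (((N + h : ℕ):ℝ) - n) - ∑ n ∈ Ico 1 N, (ArithmeticFunction.vonMangoldt n - 1) * ((N:ℝ) - n)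
       = ∑ n ∈ Ico 1 N, (h:ℝ) * (ArithmeticFunction.vonMangoldt n - 1) := by
      rw [← sum_sub_distrib]; apply sum_congr rfl; intro n _; push_cast; ring
    have e2 : -(h:ℝ)^2 ≤ ∑ n ∈ Ico N (N + h), (ArithmeticFunction.vonMangoldt n - 1) * (((N + h : ℕ):ℝ) - n) := by
      calc -(h:ℝ)^2 = ∑ n ∈ Ico N (N + h), (-(h:ℝ)) := by simp; ring
        _ ≤ _ := by
          apply sum_le_sum
          intro n hn
          rw [mem_Ico] at hn
          have h1 : (N:ℝ) ≤ n := by exact_mod_cast hn.1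
          have h2 : (n:ℝ) ≤ N + h := by exact_mod_cast hn.2.le
          push_cast
          nlinarith [hL n]
    linarith
  have lo : SS N - SS (N - h) - (h:ℝ)^2 ≤ h * PP N := by
    rcases Nat.lt_or_ge h N with hlt | hge
    · unfold PP SS
      rw [← sum_Ico_consecutive _ (by omega : 1 ≤ N - h) (by omega : N - h ≤ N), ← sum_Ico_consecutive (fun n => ArithmeticFunction.vonMangoldt n - 1) (by omega : 1 ≤ N - h) (by omega : N - h ≤ N), mul_add, mul_sum]
      have e1 : ∑ n ∈ Ico 1 (N - h), (ArithmeticFunction.vonMangoldt n - 1) * ((N:ℝ) - n) - ∑ n ∈ Ico 1 (N - h), (ArithmeticFunction.vonMangoldt n - 1) * (((N - h : ℕ):ℝ) - n)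
         = ∑ n ∈ Ico 1 (N - h), (h:ℝ) * (ArithmeticFunction.vonMangoldt n - 1) := by
        rw [← sum_sub_distrib]; apply sum_congr rfl; intro n _; rw [Nat.cast_sub hhN]; ring
      have e2 : ∑ n ∈ Ico (N - h) N, (ArithmeticFunction.vonMangoldt n - 1) * ((N:ℝ) - n) - (h:ℝ)^2 ≤ h * ∑ n ∈ Ico (N - h) N, (ArithmeticFunction.vonMangoldt n - 1) := by
        have : (h:ℝ)^2 = ∑ n ∈ Ico (N - h) N, (h:ℝ) := by
          simp; rw [Nat.cast_sub hhN]; ring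
        rw [this, mul_sum, ← sum_sub_distrib]
        apply sum_le_sum
        intro n hn
        rw [mem_Ico] at hn
        have h1 : (N:ℝ) ≤ n + h := by exact_mod_cast (by omega : N ≤ n + h)
        have h2 : (n:ℝ) ≤ N := by exact_mod_cast hn.2.le
        nlinarith [hL n]
      linarith
    · have : h = N := by omega
      subst this
      unfold PP SS
      simp only [Nat.sub_self]
      have : (h:ℝ)^2 = ∑ n ∈ range h, (h:ℝ) := by simp; ring
      have e3 : ∑ n ∈ Ico 1 h, (h:ℝ) ≤ (h:ℝ)^2 := by
        rw [this]; apply sum_le_sum_of_subset_of_nonneg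
        · intro n; simp
        · intros; positivity
      have e4 : ∑ n ∈ Ico 1 h, (ArithmeticFunction.vonMangoldt n - 1) * ((h:ℝ) - n) - ∑ n ∈ Ico 1 h, (h:ℝ) ≤ h * ∑ n ∈ Ico 1 h, (ArithmeticFunction.vonMangoldt n - 1) := by
        rw [mul_sum, ← sum_sub_distrib]
        apply sum_le_sum
        intro n hn
        rw [mem_Ico] at hn
        have h2 : (n:ℝ) ≤ h := by exact_mod_cast hn.2.le
        nlinarith [hL n]
      simp
      simp at e4 e3 
      linarith
  have a1 := le_abs_self (SS (N + h))
  have a2 := neg_abs_le (SS N)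
  have a3 := abs_nonneg (SS (N - h))
  have a4 := abs_nonneg (SS (N + h))
  have a5 := neg_abs_le (SS (N - h))
  have a6 := le_abs_self (SS (N - h))
  have a7 := le_abs_self (SS N)
  have : h * |PP N| = |h * PP N| := by rw [abs_mul, Nat.abs_cast]
  rw [this, abs_le]
  constructor <;> linarith

lemma pnt_ev {b : ℝ} (hb : 0 < b) (hb2 : b < 3/5) : ∃ N1 : ℕ, 10 ≤ N1 ∧ ∀ N : ℕ, N1 ≤ N → 
    |PP N| ≤ (N:ℝ) * Real.exp (-(Real.log N ^ b)) := by
  obtain ⟨b', hbb, hb'2⟩ := exists_between hb2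
  have hb'0 : 0 < b' := by linarith
  obtain ⟨N0, hN0, hS⟩ := SS_bound hb'0 hb'2
  have hlog : Filter.Tendsto (fun N : ℕ => Real.log N) Filter.atTop Filter.atTop := Real.tendsto_log_atTop.comp tendsto_natCast_atTop_atTop
  have ev1 : ∀ᶠ N : ℕ in Filter.atTop, 3 ≤ Real.log N ^ b := ((tendsto_rpow_atTop hb).comp hlog).eventually_ge_atTop 3
  have ev2 : ∀ᶠ N : ℕ in Filter.atTop, 32 ≤ Real.log N ^ (b' - b) := ((tendsto_rpow_atTop (by linarith)).comp hlog).eventually_ge_atTop 32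
  obtain ⟨N1, hN1⟩ := Filter.eventually_atTop.mp (ev1.and (ev2.and (hlog.eventually_ge_atTop 2)))
  refine ⟨max N1 (2 * N0), le_trans (by omega) (le_max_right _ _), fun N hN => ?_⟩
  obtain ⟨h3, h32, hL2⟩ := hN1 N (le_trans (le_max_left _ _) hN)
  have hNN0 : 2 * N0 ≤ N := le_trans (le_max_right _ _) hN
  have hNpos : (0:ℝ) < N := by exact_mod_cast (by omega : 0 < N)
  set L := Real.log N with hL
  have hL0 : 0 < L := by linarith
  have hsplit : L ^ b' = L ^ (b' - b) * L ^ b := by rw [← Real.rpow_add hL0]; congr 1; ring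
  have hlb : 0 < L ^ b := by positivity
  have h96 : 32 * L ^ b ≤ L ^ b' := by rw [hsplit]; gcongr
  have hbL : L ^ b' ≤ L := by
    calc L ^ b' ≤ L ^ (1:ℝ) := Real.rpow_le_rpow_of_exponent_le (by linarith) (by linarith)
      _ = L := Real.rpow_one L
  set δ := Real.exp (-(L ^ b' / 16)) with hδ
  have hδ0 : 0 < δ := Real.exp_pos _
  have hδe : 14 * δ ≤ Real.exp (-(L ^ b)) := by
    have : (14:ℝ) ≤ Real.exp 3 := by
      have e1 := Real.exp_one_gt_d9
      calc (14:ℝ) ≤ 2.7 ^ 3 := by norm_num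
        _ ≤ Real.exp 1 ^ 3 := by gcongr; linarith
        _ = Real.exp 3 := by rw [← Real.exp_nat_mul]; norm_num
    calc 14 * δ ≤ Real.exp 3 * δ := by gcongr
      _ = Real.exp (3 + -(L ^ b' / 16)) := by rw [Real.exp_add]
      _ ≤ _ := by apply Real.exp_le_exp.mpr; linarith
  have hδ14 : 14 * δ ≤ 1 := hδe.trans (Real.exp_le_one_iff.mpr (by linarith))
  have hNδ : 1 ≤ N * δ := by
    rw [← Real.exp_log hNpos, ← hL, hδ, ← Real.exp_add]
    apply Real.one_le_exp; linarith
  set h := ⌈(N:ℝ) * δ⌉₊ with hh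
  have hh1 : N * δ ≤ h := Nat.le_ceil _
  have hh2 : (h:ℝ) ≤ 2 * (N * δ) := by
    have := Nat.ceil_lt_add_one (a := (N:ℝ) * δ) (by positivity)
    rw [← hh] at this; linarith
  have hhpos : (0:ℝ) < h := by linarith
  have hhN : 2 * h ≤ N := by
    have : (2:ℝ) * h ≤ N := by nlinarith
    exact_mod_cast this
  have hbound : ∀ M : ℕ, N ≤ 2 * M → M ≤ 2 * N → |SS M| ≤ 4 * N^2 * δ^2 := by
    intro M h1 h2
    have hM : (0:ℝ) < M := by exact_mod_cast (by omega : 0 < M)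
    have h1' : (N:ℝ) ≤ 2 * M := by exact_mod_cast h1
    have h2' : (M:ℝ) ≤ 2 * N := by exact_mod_cast h2
    refine (hS M (by omega)).trans ?_
    have hlogM : L / 2 ≤ Real.log M := by
      have : L ≤ Real.log 2 + Real.log M := by
        rw [← Real.log_mul (by norm_num) hM.ne']; exact Real.log_le_log hNpos h1'
      linarith [Real.log_two_lt_d9]
    have e1 : L ^ b' / 2 ≤ Real.log M ^ b' := by
      calc L ^ b' / 2 = (1/2:ℝ) ^ (1:ℝ) * L ^ b' := by rw [Real.rpow_one]; ring
        _ ≤ (1/2:ℝ) ^ b' * L ^ b' := by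
          gcongr ?_ * _
          apply Real.rpow_le_rpow_of_exponent_ge (by norm_num) (by norm_num) (by linarith)
        _ = (L / 2) ^ b' := by rw [← Real.mul_rpow (by norm_num) hL0.le]; congr 1; ring
        _ ≤ _ := by gcongr
    have e2 : Real.exp (-(Real.log M ^ b' / 4)) ≤ δ ^ 2 := by
      rw [hδ, ← Real.exp_nat_mul]; apply Real.exp_le_exp.mpr; push_cast; linarith
    calc (M:ℝ)^2 * _ ≤ (2 * N)^2 * δ^2 := by gcongr
      _ = _ := by ring
  have hu := unsmooth (N := N) (h := h) (by omega) (by exact_mod_cast hhpos) (by omega)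
  have b1 := hbound (N + h) (by omega) (by omega)
  have b2 := hbound N (by omega) (by omega)
  have b3 := hbound (N - h) (by omega) (by omega)
  have h7 : h * |PP N| ≤ h * (14 * (N * δ)) := by
    have : 12 * (N:ℝ)^2 * δ^2 ≤ h * (12 * (N * δ)) := by
      have := mul_le_mul_of_nonneg_right hh1 (by positivity : 0 ≤ 12 * (N * δ))
      calc _ = N * δ * (12 * (N * δ)) := by ring
        _ ≤ _ := this
    have : (h:ℝ)^2 ≤ h * (2 * (N * δ)) := by rw [sq]; gcongr
    linarith
  have h8 := le_of_mul_le_mul_left h7 hhpos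
  calc |PP N| ≤ N * (14 * δ) := by linarith
    _ ≤ _ := by gcongr

theorem pnt {b : ℝ} (hb : 0 < b) (hb2 : b < 3/5) : ∃ C : ℝ, 1 ≤ C ∧ ∀ N : ℕ, 1 ≤ N → 
    |PP (N + 1)| ≤ C * (N:ℝ) * Real.exp (-(Real.log N ^ b)) := by
  obtain ⟨N1, hN10, h1⟩ := pnt_ev hb hb2
  -- crude for small N
  set K := ∑ n ∈ range (N1 + 2), |PP n| with hK
  have hK0 : 0 ≤ K := sum_nonneg (fun _ _ => abs_nonneg _)
  refine ⟨4 + K * Real.exp (Real.log N1 ^ b), by have := Real.exp_pos (Real.log N1 ^ b); nlinarith, fun N hN => ?_⟩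
  have hNpos : (1:ℝ) ≤ N := by exact_mod_cast hN
  have hE : 0 ≤ K * Real.exp (Real.log N1 ^ b) := by positivity
  by_cases hc : N1 ≤ N
  · have h2 := h1 (N + 1) (by omega)
    refine h2.trans ?_
    have h3 : Real.log N ^ b ≤ Real.log ((N + 1 : ℕ):ℝ) ^ b := by
      apply Real.rpow_le_rpow (Real.log_nonneg hNpos) _ hb.le
      apply Real.log_le_log (by linarith); push_cast; linarith
    have h4 : (((N + 1 : ℕ)):ℝ) ≤ (4 + K * Real.exp (Real.log N1 ^ b)) * N := by push_cast; nlinarith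
    gcongr
  · push Not at hc
    have h5 : |PP (N + 1)| ≤ K := single_le_sum (f := fun n => |PP n|) (fun _ _ => abs_nonneg _) (mem_range.mpr (by omega))
    have h6 : Real.log N ^ b ≤ Real.log N1 ^ b := by
      apply Real.rpow_le_rpow (Real.log_nonneg hNpos) _ hb.le
      apply Real.log_le_log (by linarith); exact_mod_cast hc.le
    have h7 : 1 ≤ Real.exp (Real.log N1 ^ b) * Real.exp (-(Real.log N ^ b)) := by
      rw [← Real.exp_add]; apply Real.one_le_exp; linarith
    have h8 := Real.exp_pos (-(Real.log N ^ b))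
    calc |PP (N + 1)| ≤ K * 1 * 1 := by linarith
      _ ≤ K * N * (Real.exp (Real.log N1 ^ b) * Real.exp (-(Real.log N ^ b))) := by gcongr
      _ ≤ _ := by
        have : 0 ≤ 4 * N * Real.exp (-(Real.log N ^ b)) := by positivity
        linarith
end VK

namespace VK
open Finset MeasureTheory

structure Dick (r : ℝ → ℝ) : Prop where
  cont : Continuous r
  one : ∀ u ≤ 1, r u = 1
  der : ∀ u, 1 < u → HasDerivAt r (-(r (u - 1)) / u) u

lemma Dick.mk' {ρ : ℝ → ℝ} (h1 : ContinuousOn ρ (Set.Ici 0)) (h2 : ∀ u : ℝ, 0 ≤ u → u ≤ 1 → ρ u = 1)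
    (h3 : ∀ u : ℝ, 1 < u → HasDerivAt ρ (-(ρ (u - 1)) / u) u) : Dick (fun w => ρ (max w 0)) where
  cont := h1.comp_continuous (by fun_prop) (by intro x; simp)
  one := by intro u hu; exact h2 _ (le_max_right _ _) (max_le hu zero_le_one)
  der := by
    intro u hu
    have e : (fun w => ρ (max w 0)) =ᶠ[nhds u] ρ := by
      filter_upwards [lt_mem_nhds (by linarith : 0 < u)] with w hw
      rw [max_eq_left hw.le]
    rw [max_eq_left (by linarith : 0 ≤ u - 1)]
    exact (h3 u hu).congr_of_eventuallyEq e

variable {r : ℝ → ℝ}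

lemma Dick.integral_eq (h : Dick r) {u : ℝ} (hu : 1 ≤ u) : u * r u = ∫ t in (u-1)..u, r t := by
  have hii : ∀ a b, IntervalIntegrable r volume a b := fun a b => h.cont.intervalIntegrable a b
  set F : ℝ → ℝ := fun u => u * r u - ((∫ t in (0:ℝ)..u, r t) - ∫ t in (0:ℝ)..(u-1), r t) with hF
  have hc : Continuous F := by
    have h1 : Continuous (fun u => ∫ t in (0:ℝ)..u, r t) := intervalIntegral.continuous_primitive hii 0
    have h2 : Continuous (fun u => ∫ t in (0:ℝ)..(u-1), r t) := h1.comp (by fun_prop : Continuous (fun u : ℝ => u - 1))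
    have := h.cont
    fun_prop
  have hd : ∀ x, 1 < x → HasDerivAt F 0 x := by
    intro x hx
    have d1 := (hasDerivAt_id x).fun_mul (h.der x hx)
    have d2 : HasDerivAt (fun u => ∫ t in (0:ℝ)..u, r t) (r x) x :=
      intervalIntegral.integral_hasDerivAt_right (hii 0 x) (h.cont.stronglyMeasurableAtFilter _ _) h.cont.continuousAt
    have d3 : HasDerivAt (fun u => ∫ t in (0:ℝ)..u, r t) (r (x-1)) (x-1) :=
      intervalIntegral.integral_hasDerivAt_right (hii 0 (x-1)) (h.cont.stronglyMeasurableAtFilter _ _) h.cont.continuousAt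
    have d4 := d3.comp_sub_const x 1
    have := d1.fun_sub (d2.fun_sub d4)
    have hx0 : x ≠ 0 := by linarith
    refine HasDerivAt.congr_deriv (f' := 1 * r x + id x * (-r (x - 1) / x) - (r x - r (x - 1))) this ?_
    rw [id]
    field_simp
    ring
  have hconst : F u = F 1 := by
    rcases eq_or_lt_of_le hu with h1 | h1
    · rw [← h1]
    · obtain ⟨c, _, hc2⟩ := exists_hasDerivAt_eq_slope F (fun _ => 0) h1 hc.continuousOn
        (fun x hx => hd x hx.1)
      have : u - 1 ≠ 0 := by linarith
      field_simp at hc2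
      linarith
  have hF1 : F 1 = 0 := by
    simp only [hF]
    rw [sub_self, intervalIntegral.integral_same, h.one 1 le_rfl]
    have : ∫ t in (0:ℝ)..1, r t = ∫ t in (0:ℝ)..1, (1:ℝ) := by
      apply intervalIntegral.integral_congr
      intro t ht
      rw [Set.uIcc_of_le zero_le_one] at ht
      exact h.one t ht.2
    rw [this]; simp
  rw [hF1] at hconst
  simp only [hF] at hconst
  rw [intervalIntegral.integral_interval_sub_left (hii _ _) (hii _ _)] at hconst
  linarith

lemma Dick.pos (h : Dick r) (u : ℝ) : 0 < r u := by
  by_contra hu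
  push Not at hu
  set S : Set ℝ := {w | r w ≤ 0} with hS
  have hcl : IsClosed S := isClosed_le h.cont continuous_const
  have hb : ∀ w ∈ S, 1 < w := by
    intro w hw
    by_contra h1
    push Not at h1
    have := h.one w h1
    have h2 : r w ≤ 0 := hw
    linarith
  have hbd : BddBelow S := ⟨1, fun w hw => (hb w hw).le⟩
  have hm : sInf S ∈ S := hcl.csInf_mem ⟨u, hu⟩ hbd
  set m := sInf S with hmd
  have h1 := hb m hm
  have hlt : ∀ w < m, 0 < r w := by
    intro w hw
    by_contra h2
    push Not at h2
    have := csInf_le hbd (show w ∈ S from h2)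
    linarith
  have h3 := h.integral_eq h1.le
  have h4 : 0 < ∫ t in (m-1)..m, r t :=
    intervalIntegral.intervalIntegral_pos_of_pos_on (h.cont.intervalIntegrable _ _)
      (fun x hx => hlt x hx.2) (by linarith)
  have h5 : r m ≤ 0 := hm
  nlinarith

lemma Dick.anti1 (h : Dick r) : AntitoneOn r (Set.Ici 1) := by
  apply antitoneOn_of_deriv_nonpos (convex_Ici 1) h.cont.continuousOn
  · intro x hx
    rw [interior_Ici] at hx
    exact (h.der x hx).differentiableAt.differentiableWithinAt
  · intro x hx
    rw [interior_Ici] at hx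
    have hx' : 1 < x := hx
    rw [(h.der x hx).deriv]
    apply div_nonpos_of_nonpos_of_nonneg
    · have := h.pos (x-1); linarith
    · linarith

lemma Dick.anti (h : Dick r) : Antitone r := by
  intro a b hab
  rcases le_total b 1 with hb | hb
  · rw [h.one a (hab.trans hb), h.one b hb]
  · rcases le_total a 1 with ha | ha
    · rw [h.one a ha, ← h.one 1 le_rfl]
      exact h.anti1 (Set.mem_Ici.mpr le_rfl) hb hb
    · exact h.anti1 ha hb hab

lemma Dick.le_one (h : Dick r) (u : ℝ) : r u ≤ 1 := by
  rw [← h.one (min u 1) (min_le_right _ _)]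
  exact h.anti (min_le_left _ _)

/-- the exponent `B_n` -/
noncomputable def BB (n : ℕ) : ℝ := 6 * Real.log (n + 2)

lemma BB_step (n : ℕ) : BB n + BB n / (Real.exp (BB n / 2) - 1) ≤ BB (n+1) := by
  have hm : (2:ℝ) ≤ n + 2 := by have : (0:ℝ) ≤ n := Nat.cast_nonneg n
                                linarith
  set m : ℝ := n + 2 with hmd
  have hm0 : 0 < m := by linarith
  have e1 : Real.exp (BB n / 2) = m ^ 3 := by
    have : BB n / 2 = Real.log (m^3) := by
      rw [Real.log_pow]; simp only [BB]; rw [← hmd]; push_cast; ring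
    rw [this, Real.exp_log (by positivity)]
  rw [e1]
  have e2 : BB (n+1) = 6 * Real.log (m+1) := by
    simp only [BB]; push_cast; congr 2; rw [hmd]; ring
  rw [e2]
  have e3 : BB n = 6 * Real.log m := rfl
  rw [e3]
  have l1 : Real.log m ≤ m - 1 := Real.log_le_sub_one_of_pos hm0
  have l2 : 1 / (m+1) ≤ Real.log (m+1) - Real.log m := by
    have := Real.one_sub_inv_le_log_of_pos (show 0 < (m+1)/m by positivity)
    rw [Real.log_div (by linarith) hm0.ne'] at this
    have h2 : 1 - ((m+1)/m)⁻¹ = 1/(m+1) := by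
      have : m + 1 ≠ 0 := by linarith
      field_simp; ring
    linarith
  have hm3 : 0 < m^3 - 1 := by nlinarith [sq_nonneg m]
  have l3 : Real.log m / (m^3-1) ≤ 1/(m+1) := by
    rw [div_le_div_iff₀ hm3 (by linarith)]
    nlinarith [sq_nonneg m]
  have : 6 * Real.log m / (m^3-1) = 6 * (Real.log m / (m^3-1)) := by ring
  rw [this]; linarith

lemma BB_pos (n : ℕ) : 4 ≤ BB n := by
  have h2 : Real.log 2 ≤ Real.log (n+2) := Real.log_le_log (by norm_num) (by simp)
  have := Real.log_two_gt_d9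
  simp only [BB]; linarith

lemma BB_mono {m n : ℕ} (h : m ≤ n) : BB m ≤ BB n := by
  simp only [BB]
  have : (m:ℝ) ≤ n := Nat.cast_le.mpr h
  have : Real.log (m+2) ≤ Real.log (n+2) := Real.log_le_log (by positivity) (by linarith)
  linarith

lemma Dick.ex (h : Dick r) (n : ℕ) : ∀ w w' : ℝ, w ≤ w' → w' ≤ (n:ℝ)/2 →
    r w ≤ r w' * Real.exp (BB n * (w' - w)) := by
  induction n with
  | zero =>
    intro w w' hw hw'
    norm_num at hw'
    rw [h.one w (by linarith), h.one w' (by linarith), one_mul, Real.one_le_exp_iff]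
    have := BB_pos 0
    exact mul_nonneg (by linarith) (by linarith)
  | succ n ih =>
    have hB := BB_pos n
    have hB1 := BB_pos (n+1)
    have hstep := BB_step n
    set B := BB n with hBd
    set B1 := BB (n+1) with hB1d
    -- derivative bound
    have hE : 1 < Real.exp (B/2) := by rw [Real.one_lt_exp_iff]; linarith
    have key : ∀ u, 1 < u → u ≤ ((n+1:ℕ):ℝ)/2 → r (u-1) / u ≤ B1 * r u := by
      intro u hu hun
      push_cast at hun
      have i1 := h.integral_eq hu.le
      have i2 : ∫ t in (u-1)..(u-1/2), r t ≤ ∫ t in (u-1)..u, r t := by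
        rw [← intervalIntegral.integral_add_adjacent_intervals (h.cont.intervalIntegrable (u-1) (u-1/2))
          (h.cont.intervalIntegrable (u-1/2) u)]
        have : 0 ≤ ∫ t in (u-1/2)..u, r t :=
          intervalIntegral.integral_nonneg (by linarith) (fun t _ => (h.pos t).le)
        linarith
      have i3 : ∫ t in (u-1)..(u-1/2), r (u-1) * Real.exp (-(B * (t - (u-1)))) ≤ ∫ t in (u-1)..(u-1/2), r t := by
        apply intervalIntegral.integral_mono_on (by linarith)
        · apply Continuous.intervalIntegrable; fun_prop
        · exact h.cont.intervalIntegrable _ _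
        · intro t ht
          have := ih (u-1) t ht.1 (by linarith [ht.2])
          rw [Real.exp_neg, ← div_eq_mul_inv, div_le_iff₀ (Real.exp_pos _)]
          exact this
      have i4 : ∫ t in (u-1)..(u-1/2), r (u-1) * Real.exp (-(B * (t - (u-1)))) =
          r (u-1) * ((1 - Real.exp (-(B/2))) / B) := by
        rw [intervalIntegral.integral_const_mul]
        congr 1
        have hd : ∀ t ∈ Set.uIcc (u-1) (u-1/2), HasDerivAt (fun t => - Real.exp (-(B * (t - (u-1)))) / B)
            (Real.exp (-(B * (t - (u-1))))) t := by
          intro t _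
          have d0 : HasDerivAt (fun t => -(B * (t - (u-1)))) (-(B*1)) t :=
            (((hasDerivAt_id t).sub_const (u-1)).const_mul B).fun_neg
          have d1 := (d0.exp.fun_neg).div_const B
          refine HasDerivAt.congr_deriv d1 ?_
          field_simp
        rw [intervalIntegral.integral_eq_sub_of_hasDerivAt hd (by apply Continuous.intervalIntegrable; fun_prop)]
        have a1 : -(B * (u - 1/2 - (u-1))) = -(B/2) := by ring
        have a2 : -(B * (u - 1 - (u-1))) = 0 := by ring
        rw [a1, a2, Real.exp_zero]
        ring
      have hp := h.pos (u-1)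
      have hpu := h.pos u
      have i5 : r (u-1) * ((1 - Real.exp (-(B/2))) / B) ≤ u * r u := by linarith
      have e1 : (B + B / (Real.exp (B/2) - 1)) * ((1 - Real.exp (-(B/2))) / B) = 1 := by
        rw [Real.exp_neg]
        have x1 : Real.exp (B/2) - 1 ≠ 0 := by linarith
        have x2 := Real.exp_pos (B/2)
        field_simp
        ring
      have hK : 0 ≤ B + B / (Real.exp (B/2) - 1) := by
        have : 0 ≤ B / (Real.exp (B/2) - 1) := div_nonneg (by linarith) (by linarith)
        linarith
      have i6 := mul_le_mul_of_nonneg_left i5 hK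
      have e2 : (B + B / (Real.exp (B/2) - 1)) * (r (u-1) * ((1 - Real.exp (-(B/2))) / B)) = r (u-1) := by
        rw [mul_left_comm, e1, mul_one]
      rw [e2] at i6
      rw [div_le_iff₀ (by linarith)]
      have i7 : (B + B / (Real.exp (B/2) - 1)) * (u * r u) ≤ B1 * (u * r u) :=
        mul_le_mul_of_nonneg_right hstep (by positivity)
      linarith
    have mono : MonotoneOn (fun w => r w * Real.exp (B1 * w)) (Set.Icc 1 (((n+1:ℕ):ℝ)/2)) := by
      have hd : ∀ x, 1 < x → HasDerivAt (fun w => r w * Real.exp (B1 * w))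
          (-(r (x-1))/x * Real.exp (B1 * x) + r x * (Real.exp (B1 * x) * (B1 * 1))) x := fun x hx =>
        (h.der x hx).fun_mul ((hasDerivAt_id x).const_mul B1).exp
      apply monotoneOn_of_deriv_nonneg (convex_Icc _ _)
      · have := h.cont
        apply Continuous.continuousOn; fun_prop
      · intro x hx
        rw [interior_Icc] at hx
        exact (hd x hx.1).differentiableAt.differentiableWithinAt
      · intro x hx
        rw [interior_Icc] at hx
        rw [(hd x hx.1).deriv]
        have k1 := key x hx.1 hx.2.le
        have : -(r (x-1))/x * Real.exp (B1 * x) + r x * (Real.exp (B1 * x) * (B1 * 1)) =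
          (B1 * r x - r (x-1)/x) * Real.exp (B1 * x) := by ring
        rw [this]
        exact mul_nonneg (by linarith) (Real.exp_pos _).le
    have main : ∀ w w', 1 ≤ w → w ≤ w' → w' ≤ ((n+1:ℕ):ℝ)/2 → r w ≤ r w' * Real.exp (B1 * (w' - w)) := by
      intro w w' h1 h2 h3
      have := mono ⟨h1, h2.trans h3⟩ ⟨h1.trans h2, h3⟩ h2
      simp only at this
      rw [mul_sub, Real.exp_sub, ← mul_div_assoc, le_div_iff₀ (Real.exp_pos _)]
      exact this
    intro w w' h2 h3
    rcases le_total 1 w with h1 | h1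
    · exact main w w' h1 h2 h3
    · rcases le_total w' 1 with h4 | h4
      · rw [h.one w h1, h.one w' h4, one_mul, Real.one_le_exp_iff]
        exact mul_nonneg (by linarith) (by linarith)
      · have := main 1 w' le_rfl h4 h3
        rw [h.one 1 le_rfl] at this
        rw [h.one w h1]
        refine this.trans ?_
        have hp := h.pos w'
        apply mul_le_mul_of_nonneg_left _ hp.le
        apply Real.exp_le_exp.mpr
        apply mul_le_mul_of_nonneg_left _ (by linarith)
        linarith

end VK

namespace VK
open Finset MeasureTheory

lemma summable_expneg {c b : ℝ} (hc : 0 < c) (hb : 0 < b) : Summable (fun k : ℕ => Real.exp (-(c * (k:ℝ)^b))) := by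
  have h1 := ev_log hb 0 (2/c)
  have h2 := tendsto_natCast_atTop_atTop (R := ℝ) |>.eventually h1
  apply Summable.of_norm_bounded_eventually_nat (g := fun k : ℕ => 1/(k:ℝ)^2) (Real.summable_one_div_nat_pow.mpr one_lt_two)
  filter_upwards [h2, Filter.eventually_gt_atTop 0] with k hk hk0
  have hk1 : (0:ℝ) < k := Nat.cast_pos.mpr hk0
  rw [Real.norm_of_nonneg (Real.exp_pos _).le]
  have e : 1/(k:ℝ)^2 = Real.exp (-(2 * Real.log k)) := by
    rw [Real.exp_neg, two_mul, Real.exp_add, Real.exp_log hk1]; ring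
  rw [e]
  apply Real.exp_le_exp.mpr
  have : 2 * Real.log k ≤ c * (k:ℝ)^b := by
    have := mul_le_mul_of_nonneg_left hk.le hc.le
    have e2 : c * (0 + 2/c * Real.log k) = 2 * Real.log k := by field_simp; ring
    linarith
  linarith

lemma summable_logexp {b : ℝ} (hb : 0 < b) :
    Summable (fun n : ℕ => Real.exp (-(1/2 * Real.log n ^ b)) / n) := by
  rw [← summable_condensed_iff_of_nonneg]
  · have h := summable_expneg (c := 1/2 * Real.log 2 ^ b) (b := b)
      (mul_pos (by norm_num) (Real.rpow_pos_of_pos (Real.log_pos one_lt_two) _)) hb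
    refine h.congr ?_
    intro k
    have : (0:ℝ) < 2^k := by positivity
    push_cast
    rw [Real.log_pow, Real.mul_rpow (Nat.cast_nonneg _) (Real.log_pos one_lt_two).le]
    field_simp
  · intro n; positivity
  · intro m n hm hmn
    have h0 : (0:ℝ) < m := Nat.cast_pos.mpr hm
    have h1 : (1:ℝ) ≤ m := Nat.one_le_cast.mpr hm
    have h2 : (m:ℝ) ≤ n := Nat.cast_le.mpr hmn
    apply div_le_div₀ (Real.exp_pos _).le _ h0 h2
    apply Real.exp_le_exp.mpr
    have := Real.rpow_le_rpow (Real.log_nonneg h1) (Real.log_le_log h0 h2) hb.le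
    linarith

/-- hypothesis on growth of `r` up to `v` -/
def Gr (r : ℝ → ℝ) (B v : ℝ) : Prop := ∀ w w', w ≤ w' → w' ≤ v → r w ≤ r w' * Real.exp (B * (w' - w))

lemma G_le {r : ℝ → ℝ} {B v L s t : ℝ} (hg : Gr r B v) (hL : 0 < L) (hs : 1 ≤ s)
    (hst : s ≤ t) : r (v - Real.log t / L) ≤ r (v - Real.log s / L) * (t / s) ^ (B / L) := by
  have hl : Real.log s ≤ Real.log t := Real.log_le_log (by linarith) hst
  have hl0 := Real.log_nonneg hs
  have := hg (v - Real.log t / L) (v - Real.log s / L) (by gcongr) (by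
    have : 0 ≤ Real.log s / L := by positivity
    linarith)
  refine this.trans (le_of_eq ?_)
  rw [Real.rpow_def_of_pos (by apply div_pos <;> linarith), Real.log_div (by linarith) (by linarith)]
  congr 2
  field_simp
  ring

lemma G_le1 {r : ℝ → ℝ} {B v L t : ℝ} (hg : Gr r B v) (hL : 0 < L)
    (ht : 1 ≤ t) : r (v - Real.log t / L) ≤ r v * t ^ (B / L) := by
  have := G_le hg hL le_rfl ht
  simpa using this

lemma sum_G_le {r : ℝ → ℝ} (h : Dick r) {B v L : ℝ} (hg : Gr r B v) (hL : 0 < L) (hBL : 2 * B ≤ L)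
    (Z : ℕ) (hZ : 1 ≤ Z) : ∑ n ∈ Ico 1 Z, r (v - Real.log n / L) / n ≤
      L * (∫ w in (v - Real.log Z / L)..v, r w) + r v * ∑ n ∈ Ico 1 Z, (n:ℝ) ^ (-(3/2) : ℝ) := by
  induction Z, hZ using Nat.le_induction with
  | base => simp
  | succ n hn ih =>
    rw [sum_Ico_succ_top hn, sum_Ico_succ_top hn]
    have hn1 : (1:ℝ) ≤ n := Nat.one_le_cast.mpr hn
    have hn0 : (0:ℝ) < n := by linarith
    have hlog : Real.log n ≤ Real.log ((n+1:ℕ):ℝ) := Real.log_le_log hn0 (by push_cast; linarith)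
    have hii : ∀ a b, IntervalIntegrable r volume a b := fun a b => h.cont.intervalIntegrable a b
    rw [← intervalIntegral.integral_add_adjacent_intervals (hii (v - Real.log ((n+1:ℕ):ℝ) / L) (v - Real.log n / L))
      (hii (v - Real.log n / L) v)]
    have i1 : (Real.log ((n+1:ℕ):ℝ) - Real.log n) / L * r (v - Real.log n / L) ≤
        ∫ w in (v - Real.log ((n+1:ℕ):ℝ) / L)..(v - Real.log n / L), r w := by
      have : ∫ w in (v - Real.log ((n+1:ℕ):ℝ) / L)..(v - Real.log n / L), r (v - Real.log n / L) ≤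
        ∫ w in (v - Real.log ((n+1:ℕ):ℝ) / L)..(v - Real.log n / L), r w := by
        apply intervalIntegral.integral_mono_on (by gcongr)
        · simp
        · exact hii _ _
        · intro w hw; exact h.anti hw.2
      rw [intervalIntegral.integral_const, smul_eq_mul] at this
      refine le_trans (le_of_eq ?_) this
      ring
    have i2 : 1/((n:ℝ)+1) ≤ Real.log ((n+1:ℕ):ℝ) - Real.log n := by
      have := Real.one_sub_inv_le_log_of_pos (show 0 < ((n:ℝ)+1)/n by positivity)
      rw [Real.log_div (by linarith) hn0.ne'] at this
      have h2 : 1 - (((n:ℝ)+1)/n)⁻¹ = 1/((n:ℝ)+1) := by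
        field_simp; ring
      push_cast
      linarith
    have hG := G_le1 hg hL hn1
    have hGp := h.pos (v - Real.log n / L)
    have hrv := h.pos v
    have i3 : r (v - Real.log n / L) / n - r (v - Real.log n / L) * (1/((n:ℝ)+1)) ≤ r v * (n:ℝ)^(-(3/2) : ℝ) := by
      have e1 : r (v - Real.log n / L) / n - r (v - Real.log n / L) * (1/((n:ℝ)+1)) =
        r (v - Real.log n / L) * (1/(n*(n+1))) := by field_simp; ring
      have e2 : r v * (n:ℝ)^(-(3/2) : ℝ) = r v * (n:ℝ)^(1/2:ℝ) * (1/((n:ℝ)^2)) := by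
        rw [mul_assoc]; congr 1
        rw [one_div ((n:ℝ)^2), ← Real.rpow_natCast (n:ℝ) 2, ← Real.rpow_neg hn0.le, ← Real.rpow_add hn0]; norm_num
      rw [e1, e2]
      apply mul_le_mul _ _ (by positivity) (by positivity)
      · refine hG.trans ?_
        apply mul_le_mul_of_nonneg_left _ hrv.le
        apply Real.rpow_le_rpow_of_exponent_le hn1
        rw [div_le_iff₀ hL]; linarith
      · apply one_div_le_one_div_of_le (by positivity); nlinarith
    have i4 := mul_le_mul_of_nonneg_left i1 hL.le
    have i5 : L * ((Real.log ((n+1:ℕ):ℝ) - Real.log n) / L * r (v - Real.log n / L)) =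
      (Real.log ((n+1:ℕ):ℝ) - Real.log n) * r (v - Real.log n / L) := by field_simp
    have i6 := mul_le_mul_of_nonneg_left i2 hGp.le
    rw [mul_add, mul_add]
    linarith

lemma abel_PP (g : ℕ → ℝ) (Z : ℕ) (hZ : 1 ≤ Z) :
    ∑ n ∈ Ico 1 (Z+1), (ArithmeticFunction.vonMangoldt n - 1) * g n =
      PP (Z+1) * g Z + ∑ n ∈ Ico 1 Z, PP (n+1) * (g n - g (n+1)) := by
  have hs : ∀ n, 1 ≤ n → PP (n+1) = PP n + (ArithmeticFunction.vonMangoldt n - 1) := by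
    intro n hn
    simp only [PP]
    rw [sum_Ico_succ_top hn]
  induction Z, hZ using Nat.le_induction with
  | base => simp [PP]
  | succ n hn ih =>
    rw [sum_Ico_succ_top (by omega), ih, sum_Ico_succ_top hn, hs (n+1) (by omega)]
    ring

theorem prime_sum {b : ℝ} (hb : 0 < b) (hb2 : b < 3/5) : ∃ E, 1 ≤ E ∧ ∀ r : ℝ → ℝ, Dick r →
    ∀ L v B θ : ℝ, 0 < L → 0 < B → 2 * B ≤ L → 2 * B ≤ L ^ b → Gr r B v → θ ≤ 1 →
    ∀ Z : ℕ, 1 ≤ Z → Real.log Z ≤ θ * L →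
    ∑ n ∈ Ico 1 (Z+1), ArithmeticFunction.vonMangoldt n * (r (v - Real.log n / L) / n) ≤
      L * (∫ w in (v - θ)..v, r w) + E * r v := by
  obtain ⟨C, hC1, hC⟩ := pnt hb hb2
  have hs1 := summable_logexp hb
  have hs2 : Summable (fun n : ℕ => (n:ℝ) ^ (-(3/2) : ℝ)) := Real.summable_nat_rpow.mpr (by norm_num)
  set K1 := ∑' n : ℕ, Real.exp (-(1/2 * Real.log n ^ b)) / n with hK1
  set K2 := ∑' n : ℕ, (n:ℝ) ^ (-(3/2) : ℝ) with hK2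
  have hK10 : 0 ≤ K1 := tsum_nonneg (fun n => by positivity)
  have hK20 : 0 ≤ K2 := tsum_nonneg (fun n => by positivity)
  refine ⟨1 + K2 + C * (1 + K1), by nlinarith, ?_⟩
  intro r h L v B θ hL hB hBL hBb hg hθ Z hZ hZL
  have hrv := h.pos v
  have hZ1 : (1:ℝ) ≤ Z := Nat.one_le_cast.mpr hZ
  have hlam : B / L ≤ 1/2 := by rw [div_le_iff₀ hL]; linarith
  have hlam0 : 0 < B / L := by positivity
  set G : ℕ → ℝ := fun n => r (v - Real.log n / L) with hGd
  have hG1 : ∀ n : ℕ, 1 ≤ n → G n ≤ r v * (n:ℝ)^(B/L) := fun n hn => G_le1 hg hL (Nat.one_le_cast.mpr hn)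
  have hGp : ∀ n, 0 < G n := fun n => h.pos _
  have hG2 : ∀ n : ℕ, 1 ≤ n → n ≤ Z → G n * Real.exp (-(Real.log n ^ b)) ≤ r v * Real.exp (-(1/2 * Real.log n ^ b)) := by
    intro n hn hnZ
    have hn1 : (1:ℝ) ≤ n := Nat.one_le_cast.mpr hn
    have hl0 := Real.log_nonneg hn1
    have hlL : Real.log n ≤ L := by
      have : Real.log n ≤ Real.log Z := Real.log_le_log (by linarith) (Nat.cast_le.mpr hnZ)
      nlinarith
    have e : r v * Real.exp (-(1/2 * Real.log n ^ b)) = r v * Real.exp (1/2 * Real.log n ^ b) * Real.exp (-(Real.log n ^ b)) := by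
      rw [mul_assoc, ← Real.exp_add]; congr 2; ring
    rw [e]
    apply mul_le_mul_of_nonneg_right _ (Real.exp_pos _).le
    refine (hG1 n hn).trans ?_
    apply mul_le_mul_of_nonneg_left _ hrv.le
    rw [Real.rpow_def_of_pos (by linarith)]
    apply Real.exp_le_exp.mpr
    rcases eq_or_lt_of_le hl0 with h0 | h0
    · rw [← h0]; simp [Real.zero_rpow hb.ne']
    · have e1 : Real.log n = Real.log n ^ b * Real.log n ^ (1-b) := by
        rw [← Real.rpow_add h0]; simp
      have e2 : L = L ^ b * L ^ (1-b) := by rw [← Real.rpow_add hL]; simp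
      have h3 : Real.log n ^ (1-b) ≤ L ^ (1-b) := Real.rpow_le_rpow hl0 hlL (by linarith)
      have h4 : 0 ≤ Real.log n ^ b := by positivity
      have h5 : Real.log n ^ (1-b) * (B/L) ≤ 1/2 := by
        rw [← mul_div_assoc, div_le_iff₀ hL]
        have h6 : 0 < L ^ (1-b) := by positivity
        calc Real.log n ^ (1-b) * B ≤ L ^ (1-b) * (L^b / 2) := by
              apply mul_le_mul h3 (by linarith) hB.le h6.le
          _ = 1/2 * (L ^ b * L ^ (1-b)) := by ring
          _ = 1/2 * L := by rw [← e2]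
      calc Real.log n * (B/L) = Real.log n ^ b * (Real.log n ^ (1-b) * (B/L)) := by rw [← mul_assoc, ← e1]
        _ ≤ Real.log n ^ b * (1/2) := mul_le_mul_of_nonneg_left h5 h4
        _ = _ := by ring
  -- split
  have hsplit : ∑ n ∈ Ico 1 (Z+1), ArithmeticFunction.vonMangoldt n * (r (v - Real.log n / L) / n) =
      ∑ n ∈ Ico 1 (Z+1), G n / n + ∑ n ∈ Ico 1 (Z+1), (ArithmeticFunction.vonMangoldt n - 1) * (G n / n) := by
    rw [← sum_add_distrib]; apply sum_congr rfl; intro n _; simp only [hGd]; ring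
  rw [hsplit]
  -- first
  have p1 : ∑ n ∈ Ico 1 (Z+1), G n / n ≤ L * (∫ w in (v - θ)..v, r w) + r v * K2 + r v := by
    rw [sum_Ico_succ_top hZ]
    have a1 := sum_G_le h hg hL hBL Z hZ
    have a2 : ∑ n ∈ Ico 1 Z, (n:ℝ) ^ (-(3/2) : ℝ) ≤ K2 := hs2.sum_le_tsum _ (fun n _ => by positivity)
    have a3 : G Z / Z ≤ r v := by
      rw [div_le_iff₀ (by linarith)]
      refine (hG1 Z hZ).trans ?_
      apply mul_le_mul_of_nonneg_left _ hrv.le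
      calc (Z:ℝ)^(B/L) ≤ (Z:ℝ)^(1:ℝ) := Real.rpow_le_rpow_of_exponent_le hZ1 (by linarith)
        _ = Z := Real.rpow_one _
    have a4 : ∫ w in (v - Real.log Z / L)..v, r w ≤ ∫ w in (v - θ)..v, r w := by
      have hle : Real.log Z / L ≤ θ := by rw [div_le_iff₀ hL]; exact hZL
      rw [← intervalIntegral.integral_add_adjacent_intervals (h.cont.intervalIntegrable (v-θ) (v - Real.log Z / L))
          (h.cont.intervalIntegrable (v - Real.log Z / L) v)]
      have : 0 ≤ ∫ t in (v-θ)..(v - Real.log Z / L), r t :=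
        intervalIntegral.integral_nonneg (by linarith) (fun t _ => (h.pos t).le)
      linarith
    have a5 := mul_le_mul_of_nonneg_left a4 hL.le
    have a6 := mul_le_mul_of_nonneg_left a2 hrv.le
    simp only [hGd] at *
    linarith
  have hdec : ∀ n : ℕ, 1 ≤ n → 0 ≤ G n / n - G (n+1) / ((n+1:ℕ):ℝ) ∧ G n / n - G (n+1) / ((n+1:ℕ):ℝ) ≤ G n / n / n := by
    intro n hn
    have hn1 : (1:ℝ) ≤ n := Nat.one_le_cast.mpr hn
    have hn0 : (0:ℝ) < n := by linarith
    have m1 : G n ≤ G (n+1) := by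
      apply h.anti
      have : Real.log n ≤ Real.log ((n+1:ℕ):ℝ) := Real.log_le_log hn0 (by push_cast; linarith)
      gcongr
    have m2 : G (n+1) ≤ G n * (((n+1:ℕ):ℝ)/n) := by
      have := G_le hg hL hn1 (show (n:ℝ) ≤ ((n+1:ℕ):ℝ) by push_cast; linarith)
      refine this.trans ?_
      apply mul_le_mul_of_nonneg_left _ (hGp n).le
      calc (((n+1:ℕ):ℝ)/n)^(B/L) ≤ (((n+1:ℕ):ℝ)/n)^(1:ℝ) := by
            apply Real.rpow_le_rpow_of_exponent_le _ (by linarith)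
            rw [le_div_iff₀ hn0]; push_cast; linarith
        _ = _ := Real.rpow_one _
    have m3 : (0:ℝ) < ((n+1:ℕ):ℝ) := by positivity
    constructor
    · have : G (n+1) / ((n+1:ℕ):ℝ) ≤ G n / n := by
        rw [div_le_iff₀ m3]; refine m2.trans (le_of_eq ?_); ring
      linarith
    · have : G n / ((n+1:ℕ):ℝ) ≤ G (n+1) / ((n+1:ℕ):ℝ) := by gcongr
      have e : G n / n - G n / ((n+1:ℕ):ℝ) ≤ G n / n / n := by
        have : G n / n - G n / ((n+1:ℕ):ℝ) = G n / n * (1 / ((n:ℝ)+1)) := by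
          push_cast; field_simp; ring
        rw [this, div_eq_mul_one_div (G n / n) (n:ℝ)]
        apply mul_le_mul_of_nonneg_left _ (by have := hGp n; positivity)
        apply one_div_le_one_div_of_le hn0; linarith
      linarith
  have p2 : ∑ n ∈ Ico 1 (Z+1), (ArithmeticFunction.vonMangoldt n - 1) * (G n / n) ≤ r v * (C * (1 + K1)) := by
    rw [abel_PP (fun n => G n / n) Z hZ]
    have b1 : PP (Z+1) * (G Z / Z) ≤ C * r v := by
      calc PP (Z+1) * (G Z / Z) ≤ (C * Z * Real.exp (-(Real.log Z ^ b))) * (G Z / Z) := by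
            apply mul_le_mul_of_nonneg_right ((le_abs_self _).trans (hC Z hZ)) (by have := hGp Z; positivity)
        _ = C * (G Z * Real.exp (-(Real.log Z ^ b))) := by field_simp
        _ ≤ C * (r v * Real.exp (-(1/2 * Real.log Z ^ b))) :=
            mul_le_mul_of_nonneg_left (hG2 Z hZ le_rfl) (by linarith)
        _ ≤ C * (r v * 1) := by
            gcongr
            rw [Real.exp_le_one_iff]
            have : 0 ≤ Real.log Z ^ b := Real.rpow_nonneg (Real.log_nonneg hZ1) _
            linarith
        _ = _ := by ring
    have b2 : ∑ n ∈ Ico 1 Z, PP (n+1) * (G n / n - G (n+1) / ((n+1:ℕ):ℝ)) ≤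
        C * r v * ∑ n ∈ Ico 1 Z, Real.exp (-(1/2 * Real.log n ^ b)) / n := by
      rw [mul_sum]
      apply sum_le_sum
      intro n hn
      rw [mem_Ico] at hn
      have hn1 : (1:ℝ) ≤ n := Nat.one_le_cast.mpr hn.1
      have hd := hdec n hn.1
      calc PP (n+1) * (G n / n - G (n+1) / ((n+1:ℕ):ℝ))
          ≤ (C * n * Real.exp (-(Real.log n ^ b))) * (G n / n / n) := by
            apply mul_le_mul ((le_abs_self _).trans (hC n hn.1)) hd.2 hd.1 (by positivity)
        _ = C * (G n * Real.exp (-(Real.log n ^ b))) / n := by field_simp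
        _ ≤ C * (r v * Real.exp (-(1/2 * Real.log n ^ b))) / n := by
            have := hG2 n hn.1 hn.2.le
            gcongr
        _ = _ := by ring
    have b3 : ∑ n ∈ Ico 1 Z, Real.exp (-(1/2 * Real.log n ^ b)) / n ≤ K1 := hs1.sum_le_tsum _ (fun n _ => by positivity)
    have b4 := mul_le_mul_of_nonneg_left b3 (show 0 ≤ C * r v by positivity)
    have : r v * (C * (1 + K1)) = C * r v + C * r v * K1 := by ring
    rw [this]
    linarith
  have : (1 + K2 + C * (1 + K1)) * r v = r v * K2 + r v + r v * (C * (1 + K1)) := by ring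
  rw [this]
  linarith
end VK

namespace VK
open Finset

structure CM (h : ℕ → ℝ) (L : ℝ) : Prop where
  mul : ∀ m n, 1 ≤ m → 1 ≤ n → h (m * n) = h m * h n
  bd : ∀ n, 1 ≤ n → |h n| ≤ 1
  big : ∀ p : ℕ, p.Prime → L < Real.log p → h p = 0

noncomputable def SA (h : ℕ → ℝ) (t : ℝ) : ℝ := ∑ n ∈ Ioc 0 ⌊t⌋₊, h n

lemma Ioc_eq_Ico (N : ℕ) : Ioc 0 N = Ico 1 (N+1) := by
  ext n; simp only [mem_Ioc, mem_Ico]; omega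

lemma SA_le {h : ℕ → ℝ} (hb : ∀ n, 1 ≤ n → |h n| ≤ 1) {t : ℝ} (ht : 0 ≤ t) : |SA h t| ≤ t := by
  have h1 : |SA h t| ≤ ∑ n ∈ Ioc 0 ⌊t⌋₊, (1:ℝ) := by
    refine (abs_sum_le_sum_abs _ _).trans (sum_le_sum ?_)
    intro n hn
    exact hb n (mem_Ioc.mp hn).1
  simp only [sum_const, Nat.card_Ioc, Nat.sub_zero, nsmul_eq_mul, mul_one] at h1
  exact h1.trans (Nat.floor_le ht)

lemma sum_hlog {h : ℕ → ℝ} {L : ℝ} (hc : CM h L) (N : ℕ) :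
    ∑ n ∈ Ioc 0 N, h n * Real.log n =
      ∑ q ∈ Ioc 0 N, ArithmeticFunction.vonMangoldt q * h q * ∑ m ∈ Ioc 0 (N / q), h m := by
  set f1 : ArithmeticFunction ℝ := ⟨fun n => ArithmeticFunction.vonMangoldt n * h n, by simp⟩ with hf1
  set g1 : ArithmeticFunction ℝ := ⟨fun n => if n = 0 then 0 else h n, by simp⟩ with hg1
  have key := ArithmeticFunction.sum_Ioc_mul_eq_sum_sum f1 g1 N
  have e1 : ∑ n ∈ Ioc 0 N, (f1 * g1) n = ∑ n ∈ Ioc 0 N, h n * Real.log n := by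
    apply sum_congr rfl
    intro n hn
    rw [ArithmeticFunction.mul_apply, ← ArithmeticFunction.vonMangoldt_sum, mul_sum,
      ← Nat.sum_divisorsAntidiagonal (f := fun i _ => h n * ArithmeticFunction.vonMangoldt i)]
    apply sum_congr rfl
    intro x hx
    have hx1 := Nat.mem_divisorsAntidiagonal.mp hx
    have n1 : x.1 ≠ 0 := fun h0 => hx1.2 (by rw [← hx1.1, h0]; simp)
    have n2 : x.2 ≠ 0 := fun h0 => hx1.2 (by rw [← hx1.1, h0]; simp)
    have e : h n = h x.1 * h x.2 := by rw [← hx1.1, hc.mul _ _ (by omega) (by omega)]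
    rw [e]
    change ArithmeticFunction.vonMangoldt x.1 * h x.1 * (if x.2 = 0 then 0 else h x.2) = _
    rw [if_neg n2]; ring
  rw [e1] at key
  rw [key]
  apply sum_congr rfl
  intro q _
  change ArithmeticFunction.vonMangoldt q * h q * _ = _
  congr 1
  apply sum_congr rfl
  intro m hm
  change (if m = 0 then 0 else h m) = h m
  rw [if_neg]; have := mem_Ioc.mp hm; omega

lemma abel_log (h : ℕ → ℝ) (N : ℕ) (lX : ℝ) (hN : 1 ≤ N) :
    ∑ n ∈ Ioc 0 N, h n * (lX - Real.log n) = (∑ n ∈ Ioc 0 N, h n) * (lX - Real.log N) +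
      ∑ n ∈ Ico 1 N, (∑ m ∈ Ioc 0 n, h m) * (Real.log ((n+1:ℕ):ℝ) - Real.log n) := by
  induction N, hN using Nat.le_induction with
  | base => simp
  | succ n hn ih =>
    rw [sum_Ioc_succ_top (by omega), ih, sum_Ico_succ_top hn, sum_Ioc_succ_top (by omega)]
    ring

lemma log_succ_sub {n : ℕ} (hn : 1 ≤ n) {X : ℝ} (h2 : X ≤ n + 1) (h1 : 0 < X) :
    Real.log X - Real.log n ≤ 1 / n := by
  have hn0 : (0:ℝ) < n := Nat.cast_pos.mpr hn
  have := Real.log_le_sub_one_of_pos (show 0 < X / n by positivity)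
  rw [Real.log_div h1.ne' hn0.ne'] at this
  refine this.trans ?_
  rw [div_sub_one hn0.ne']
  gcongr
  linarith

theorem log_ineq {h : ℕ → ℝ} {L : ℝ} (hc : CM h L) {X : ℝ} (hX : 1 ≤ X) :
    Real.log X * |SA h X| ≤
      ∑ q ∈ Ioc 0 ⌊X⌋₊, ArithmeticFunction.vonMangoldt q * |h q| * |SA h (X / q)| +
      ∑ n ∈ Ioc 0 ⌊X⌋₊, |SA h n| / n := by
  set N := ⌊X⌋₊ with hN
  have hN1 : 1 ≤ N := Nat.one_le_floor_iff X |>.mpr hX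
  have hN0 : (0:ℝ) < N := Nat.cast_pos.mpr hN1
  have hNX : (N:ℝ) ≤ X := Nat.floor_le (by linarith)
  have hXN : X < N + 1 := Nat.lt_floor_add_one X
  have e1 : Real.log X * SA h X = ∑ n ∈ Ioc 0 N, h n * Real.log n + ∑ n ∈ Ioc 0 N, h n * (Real.log X - Real.log n) := by
    rw [← sum_add_distrib, SA, mul_sum]
    apply sum_congr rfl; intro n _; ring
  have e2 : Real.log X * |SA h X| = |Real.log X * SA h X| := by
    rw [abs_mul, abs_of_nonneg (Real.log_nonneg hX)]
  have hS : ∀ n : ℕ, ∑ m ∈ Ioc 0 n, h m = SA h n := by intro n; rw [SA, Nat.floor_natCast]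
  rw [e2, e1]
  refine (abs_add_le _ _).trans (add_le_add ?_ ?_)
  · rw [sum_hlog hc]
    refine (abs_sum_le_sum_abs _ _).trans (le_of_eq (sum_congr rfl ?_))
    intro q _
    rw [abs_mul, abs_mul, abs_of_nonneg ArithmeticFunction.vonMangoldt_nonneg]
    congr 2
    rw [SA, Nat.floor_div_natCast]
  · rw [abel_log h N _ hN1]
    have e3 : ∑ n ∈ Ioc 0 N, |SA h n| / n = |SA h N| / N + ∑ n ∈ Ico 1 N, |SA h n| / n := by
      rw [Ioc_eq_Ico, sum_Ico_succ_top hN1, add_comm]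
    rw [e3, hS]
    refine (abs_add_le _ _).trans (add_le_add ?_ ?_)
    · rw [abs_mul, div_eq_mul_one_div]
      apply mul_le_mul_of_nonneg_left _ (abs_nonneg _)
      rw [abs_of_nonneg (by have := Real.log_le_log hN0 hNX; linarith)]
      exact log_succ_sub hN1 hXN.le (by linarith)
    · refine (abs_sum_le_sum_abs _ _).trans (sum_le_sum ?_)
      intro n hn
      have hn1 := (mem_Ico.mp hn).1
      have hn0 : (0:ℝ) < n := Nat.cast_pos.mpr hn1
      rw [abs_mul, hS, div_eq_mul_one_div]
      apply mul_le_mul_of_nonneg_left _ (abs_nonneg _)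
      rw [abs_of_nonneg (by
        have := Real.log_le_log hn0 (show (n:ℝ) ≤ ((n+1:ℕ):ℝ) by push_cast; linarith)
        linarith)]
      exact log_succ_sub hn1 (by push_cast; linarith) (by positivity)

/-- proper prime powers -/
theorem proper_sum : ∃ K : ℝ, 0 ≤ K ∧ ∀ N : ℕ, ∑ q ∈ (Ioc 0 N).filter (fun q => ¬ q.Prime),
    ArithmeticFunction.vonMangoldt q * (q:ℝ) ^ (-(5/7) : ℝ) ≤ K := by
  have hs : Summable (fun n : ℕ => (n:ℝ) ^ (-(9/7) : ℝ)) := Real.summable_nat_rpow.mpr (by norm_num)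
  set x0 : ℝ := (2:ℝ) ^ (-(5/7) : ℝ) with hx0
  have hx0p : 0 < x0 := by positivity
  have hx01 : x0 < 1 := Real.rpow_lt_one_of_one_lt_of_neg one_lt_two (by norm_num)
  refine ⟨(7 * ∑' n : ℕ, (n:ℝ) ^ (-(9/7) : ℝ)) * (1 - x0)⁻¹, by
    apply mul_nonneg
    · have : 0 ≤ ∑' n : ℕ, (n:ℝ) ^ (-(9/7) : ℝ) := tsum_nonneg (fun n => by positivity)
      linarith
    · exact inv_nonneg.mpr (by linarith), ?_⟩
  intro N
  set F : ℕ → ℝ := fun q => ArithmeticFunction.vonMangoldt q * (q:ℝ) ^ (-(5/7) : ℝ) with hF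
  have hF0 : ∀ q, 0 ≤ F q := fun q => mul_nonneg ArithmeticFunction.vonMangoldt_nonneg (by positivity)
  set T : Finset (ℕ × ℕ) := (Ioc 1 N) ×ˢ (range N) with hT
  have h1 : ∑ q ∈ (Ioc 0 N).filter (fun q => ¬ q.Prime), F q ≤ ∑ q ∈ T.image (fun x => x.1 ^ (x.2+2)), F q := by
    have e : ∑ q ∈ (Ioc 0 N).filter (fun q => ¬ q.Prime), F q =
      ∑ q ∈ ((Ioc 0 N).filter (fun q => ¬ q.Prime)).filter (fun q => IsPrimePow q), F q := by
      symm
      apply sum_filter_of_ne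
      intro q _ hq
      by_contra hp
      exact hq (by simp only [hF]; rw [ArithmeticFunction.vonMangoldt_eq_zero_iff.mpr hp, zero_mul])
    rw [e]
    apply sum_le_sum_of_subset_of_nonneg
    · intro q hq
      simp only [mem_filter, mem_Ioc] at hq
      obtain ⟨⟨⟨q0, qN⟩, qp⟩, qq⟩ := hq
      obtain ⟨p, k, hp, hk, rfl⟩ := (isPrimePow_nat_iff q).mp qq
      have hk2 : 2 ≤ k := by
        by_contra hh
        have : k = 1 := by omega
        rw [this, pow_one] at qp
        exact qp hp
      rw [mem_image]
      refine ⟨(p, k-2), ?_, ?_⟩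
      · simp only [hT, mem_product, mem_Ioc, mem_range]
        refine ⟨⟨hp.one_lt, ?_⟩, ?_⟩
        · exact (Nat.le_self_pow (by omega) p).trans qN
        · have := Nat.lt_pow_self (n := k) hp.one_lt
          omega
      · simp only; congr 1; omega
    · intro q _ _; exact hF0 q
  have h2 : ∑ q ∈ T.image (fun x => x.1 ^ (x.2+2)), F q ≤ ∑ x ∈ T, F (x.1 ^ (x.2+2)) :=
    sum_image_le_of_nonneg (fun q _ => hF0 q)
  refine h1.trans (h2.trans ?_)
  rw [hT, sum_product]
  have h3 : ∀ m ∈ Ioc 1 N, ∀ k ∈ range N, F (m^(k+2)) ≤ (7 * (m:ℝ)^(-(9/7):ℝ)) * x0 ^ k := by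
    intro m hm k _
    have hm1 := (mem_Ioc.mp hm).1
    have hm2 : (2:ℝ) ≤ m := by exact_mod_cast hm1
    have hm0 : (0:ℝ) < m := by linarith
    simp only [hF]
    rw [ArithmeticFunction.vonMangoldt_apply_pow (by omega)]
    have a1 : ArithmeticFunction.vonMangoldt m ≤ 7 * (m:ℝ)^(1/7:ℝ) := by
      have := Real.log_le_rpow_div hm0.le (show (0:ℝ) < 1/7 by norm_num)
      refine (ArithmeticFunction.vonMangoldt_le_log).trans (this.trans (le_of_eq ?_))
      ring
    have a2 : (((m^(k+2) : ℕ) : ℝ)) ^ (-(5/7) : ℝ) = (m:ℝ)^(-(10/7):ℝ) * ((m:ℝ)^(-(5/7):ℝ))^k := by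
      push_cast
      rw [← Real.rpow_natCast (m:ℝ) (k+2), ← Real.rpow_mul hm0.le, ← Real.rpow_natCast ((m:ℝ)^(-(5/7):ℝ)) k,
        ← Real.rpow_mul hm0.le, ← Real.rpow_add hm0]
      congr 1; push_cast; ring
    rw [a2]
    have a3 : (m:ℝ)^(-(5/7):ℝ) ≤ x0 := Real.rpow_le_rpow_of_nonpos (by norm_num) hm2 (by norm_num)
    have a4 : ((m:ℝ)^(-(5/7):ℝ))^k ≤ x0^k := pow_le_pow_left₀ (by positivity) a3 k
    calc ArithmeticFunction.vonMangoldt m * ((m:ℝ)^(-(10/7):ℝ) * ((m:ℝ)^(-(5/7):ℝ))^k)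
        ≤ (7 * (m:ℝ)^(1/7:ℝ)) * ((m:ℝ)^(-(10/7):ℝ) * x0^k) := by
          apply mul_le_mul a1 (mul_le_mul_of_nonneg_left a4 (by positivity)) (by positivity) (by positivity)
      _ = 7 * ((m:ℝ)^(1/7:ℝ) * (m:ℝ)^(-(10/7):ℝ)) * x0^k := by ring
      _ = _ := by rw [← Real.rpow_add hm0]; norm_num
  calc ∑ m ∈ Ioc 1 N, ∑ k ∈ range N, F (m^(k+2))
      ≤ ∑ m ∈ Ioc 1 N, ∑ k ∈ range N, (7 * (m:ℝ)^(-(9/7):ℝ)) * x0 ^ k :=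
        sum_le_sum (fun m hm => sum_le_sum (h3 m hm))
    _ = (7 * ∑ m ∈ Ioc 1 N, (m:ℝ)^(-(9/7):ℝ)) * ∑ k ∈ range N, x0^k := by
        rw [mul_sum (Ioc 1 N), sum_mul]; apply sum_congr rfl; intro m _; rw [mul_sum]
    _ ≤ _ := by
        have b1 : ∑ m ∈ Ioc 1 N, (m:ℝ)^(-(9/7):ℝ) ≤ ∑' n : ℕ, (n:ℝ) ^ (-(9/7) : ℝ) :=
          hs.sum_le_tsum _ (fun n _ => by positivity)
        have b2 : ∑ k ∈ range N, x0^k ≤ (1 - x0)⁻¹ := by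
          rw [← tsum_geometric_of_lt_one hx0p.le hx01]
          exact (summable_geometric_of_lt_one hx0p.le hx01).sum_le_tsum _ (fun n _ => by positivity)
        have b3 : 0 ≤ ∑ m ∈ Ioc 1 N, (m:ℝ)^(-(9/7):ℝ) := sum_nonneg (fun n _ => by positivity)
        apply mul_le_mul (by linarith) b2 (sum_nonneg (fun n _ => by positivity))
        linarith

lemma sum_inv_sqrt (N : ℕ) : ∑ n ∈ Ioc 0 N, (n:ℝ) ^ (-(1/2) : ℝ) ≤ 2 * (N:ℝ)^(1/2:ℝ) := by
  induction N with
  | zero => simp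
  | succ n ih =>
    rw [sum_Ioc_succ_top (by omega)]
    refine (add_le_add_left ih _).trans ?_
    rw [Real.rpow_neg (by positivity), ← Real.sqrt_eq_rpow, ← Real.sqrt_eq_rpow]
    push_cast
    have s1 : 0 < Real.sqrt ((n:ℝ)+1) := Real.sqrt_pos.mpr (by positivity)
    have s2 := Real.sq_sqrt (show (0:ℝ) ≤ n + 1 by positivity)
    have s3 := Real.sq_sqrt (show (0:ℝ) ≤ n by positivity)
    have s4 : Real.sqrt n ≤ Real.sqrt (n+1) := Real.sqrt_le_sqrt (by linarith)
    have s5 := Real.sqrt_nonneg (n:ℝ)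
    have : (Real.sqrt ((n:ℝ)+1))⁻¹ ≤ 2 * (Real.sqrt ((n:ℝ)+1) - Real.sqrt n) := by
      rw [inv_le_iff_one_le_mul₀ s1]
      nlinarith
    linarith
end VK

namespace VK
open Finset MeasureTheory

lemma sum_ite_le {F : ℕ → ℝ} (hF : ∀ n, 0 ≤ F n) (N Z : ℕ) :
    ∑ q ∈ Ioc 0 N, (if q ≤ Z then F q else 0) ≤ ∑ q ∈ Ico 1 (Z+1), F q := by
  rw [← sum_filter]
  apply sum_le_sum_of_subset_of_nonneg
  · intro q hq
    simp only [mem_filter, mem_Ioc, mem_Ico] at *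
    omega
  · intro q _ _; exact hF q

structure Setup (r : ℝ → ℝ) (h : ℕ → ℝ) (L a B V c : ℝ) : Prop where
  dick : Dick r
  cm : CM h L
  hL : 0 < L
  ha : 0 ≤ a
  hB : 0 < B
  hB7 : 7 * B ≤ L
  gr : Gr r B V
  hc : Real.exp (-(L/7)) ≤ c
  far : ∀ t, 1 ≤ t → Real.log t < a * L → |SA h t| ≤ 3 * (t * r (Real.log t / L))

def Near (r : ℝ → ℝ) (h : ℕ → ℝ) (L a c v D : ℝ) : Prop :=
  ∀ t, 1 ≤ t → a * L ≤ Real.log t → Real.log t ≤ v * L → |SA h t| ≤ D * c * (t * r (Real.log t / L))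

lemma all_bound {r : ℝ → ℝ} {h : ℕ → ℝ} {L a B V c v D : ℝ} (S : Setup r h L a B V c) (hD : 1 ≤ D)
    (hn : Near r h L a c v D) {t : ℝ} (ht : 1 ≤ t) (htv : Real.log t ≤ v * L) :
    |SA h t| ≤ 3 * D * c * Real.exp (L/7) * (t * r (Real.log t / L)) ∧
    (a * L ≤ Real.log t → |SA h t| ≤ 3 * D * c * (t * r (Real.log t / L))) := by
  have hL := S.hL
  have hc0 : 0 < c := (Real.exp_pos _).trans_le S.hc
  have hR : 0 < t * r (Real.log t / L) := mul_pos (by linarith) (S.dick.pos _)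
  have e1 : 1 ≤ Real.exp (L/7) := Real.one_le_exp (by linarith)
  have e2 : 1 ≤ c * Real.exp (L/7) := by
    have := mul_le_mul_of_nonneg_right S.hc (Real.exp_pos (L/7)).le
    rw [← Real.exp_add] at this
    simpa using this
  have hDc : 0 < D * c := by positivity
  have hn' : a * L ≤ Real.log t → |SA h t| ≤ 3 * D * c * (t * r (Real.log t / L)) := by
    intro hta
    refine (hn t ht hta htv).trans ?_
    apply mul_le_mul_of_nonneg_right _ hR.le
    nlinarith
  refine ⟨?_, hn'⟩
  rcases lt_or_ge (Real.log t) (a * L) with h1 | h1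
  · refine (S.far t ht h1).trans ?_
    apply mul_le_mul_of_nonneg_right _ hR.le
    have : 3 * D * c * Real.exp (L/7) = 3 * D * (c * Real.exp (L/7)) := by ring
    rw [this]
    nlinarith
  · refine (hn' h1).trans ?_
    apply mul_le_mul_of_nonneg_right _ hR.le
    nlinarith

lemma sum2_bound {r : ℝ → ℝ} {h : ℕ → ℝ} {L a B c v D : ℝ} (S : Setup r h L a B v c) (hD : 1 ≤ D)
    (hav : a + 1 ≤ v) (hn : Near r h L a c v D) :
    ∑ n ∈ Ioc 0 ⌊Real.exp (v * L)⌋₊, |SA h n| / n ≤ 6 * D * c * r v * Real.exp (v * L) := by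
  have hL := S.hL
  have hc0 : 0 < c := (Real.exp_pos _).trans_le S.hc
  set X := Real.exp (v * L) with hX
  have hX0 : 0 < X := Real.exp_pos _
  have hrv := S.dick.pos v
  have hlX : Real.log X = v * L := Real.log_exp _
  have term : ∀ n ∈ Ioc 0 ⌊X⌋₊, |SA h n| / n ≤ 3 * D * c * r v * X ^ (1/2:ℝ) * (n:ℝ) ^ (-(1/2):ℝ) := by
    intro n hn'
    have hn1 := (mem_Ioc.mp hn').1
    have hnX : (n:ℝ) ≤ X := (Nat.cast_le.mpr (mem_Ioc.mp hn').2).trans (Nat.floor_le hX0.le)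
    have hn1' : (1:ℝ) ≤ n := Nat.one_le_cast.mpr hn1
    have hn0 : (0:ℝ) < n := by linarith
    have hln : Real.log n ≤ v * L := by rw [← hlX]; exact Real.log_le_log hn0 hnX
    have hXn : 1 ≤ X / n := by rw [le_div_iff₀ hn0]; linarith
    have hb := all_bound S hD hn hn1' hln
    have hG : r (Real.log n / L) ≤ r v * (X / n) ^ (1/7:ℝ) := by
      have := G_le1 S.gr hL hXn
      rw [Real.log_div hX0.ne' hn0.ne', hlX] at this
      have e : v - (v * L - Real.log n) / L = Real.log n / L := by field_simp; ring
      rw [e] at this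
      refine this.trans (mul_le_mul_of_nonneg_left ?_ hrv.le)
      apply Real.rpow_le_rpow_of_exponent_le hXn
      rw [div_le_iff₀ hL]; linarith [S.hB7]
    have hfin : |SA h n| ≤ 3 * D * c * (n * (r v * (X/n)^(1/2:ℝ))) := by
      rcases lt_or_ge (Real.log n) (a * L) with h1 | h1
      · refine hb.1.trans ?_
        have e7 : Real.exp (L/7) ≤ (X / n) ^ (1/7:ℝ) := by
          rw [Real.rpow_def_of_pos (by linarith), Real.log_div hX0.ne' hn0.ne', hlX]
          apply Real.exp_le_exp.mpr
          nlinarith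
        have e8 : (X/n)^(1/7:ℝ) * (X/n)^(1/7:ℝ) ≤ (X/n)^(1/2:ℝ) := by
          rw [← Real.rpow_add (by linarith)]
          exact Real.rpow_le_rpow_of_exponent_le hXn (by norm_num)
        have e9 : Real.exp (L/7) * r (Real.log n / L) ≤ r v * (X/n)^(1/2:ℝ) := by
          calc Real.exp (L/7) * r (Real.log n / L) ≤ (X / n) ^ (1/7:ℝ) * (r v * (X / n) ^ (1/7:ℝ)) :=
                mul_le_mul e7 hG (S.dick.pos _).le (by positivity)
            _ = r v * ((X/n)^(1/7:ℝ) * (X/n)^(1/7:ℝ)) := by ring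
            _ ≤ _ := mul_le_mul_of_nonneg_left e8 hrv.le
        have : 3 * D * c * Real.exp (L/7) * (n * r (Real.log n / L)) =
          3 * D * c * (n * (Real.exp (L/7) * r (Real.log n / L))) := by ring
        rw [this]
        gcongr
      · refine (hb.2 h1).trans ?_
        have : r (Real.log n / L) ≤ r v * (X/n)^(1/2:ℝ) :=
          hG.trans (mul_le_mul_of_nonneg_left (Real.rpow_le_rpow_of_exponent_le hXn (by norm_num)) hrv.le)
        gcongr
    rw [div_le_iff₀ hn0]
    refine hfin.trans (le_of_eq ?_)
    rw [Real.div_rpow hX0.le hn0.le, Real.rpow_neg hn0.le]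
    ring
  refine (sum_le_sum term).trans ?_
  rw [← mul_sum]
  have s1 := sum_inv_sqrt ⌊X⌋₊
  have s2 : ((⌊X⌋₊:ℕ):ℝ) ^ (1/2:ℝ) ≤ X ^ (1/2:ℝ) :=
    Real.rpow_le_rpow (Nat.cast_nonneg _) (Nat.floor_le hX0.le) (by norm_num)
  have s3 : X ^ (1/2:ℝ) * X^(1/2:ℝ) = X := by rw [← Real.rpow_add hX0]; norm_num
  calc 3 * D * c * r v * X ^ (1/2:ℝ) * ∑ n ∈ Ioc 0 ⌊X⌋₊, (n:ℝ) ^ (-(1/2):ℝ)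
      ≤ 3 * D * c * r v * X ^ (1/2:ℝ) * (2 * X^(1/2:ℝ)) := by
        apply mul_le_mul_of_nonneg_left (by linarith) (by positivity)
    _ = 6 * D * c * r v * (X ^ (1/2:ℝ) * X^(1/2:ℝ)) := by ring
    _ = _ := by rw [s3]

lemma log_le_of_floor {L : ℝ} {q : ℕ} (hq : 1 ≤ q) : q ≤ ⌊Real.exp L⌋₊ ↔ Real.log q ≤ L := by
  rw [Nat.le_floor_iff (Real.exp_pos _).le, Real.log_le_iff_le_exp (Nat.cast_pos.mpr hq)]

lemma sum1_bound {r : ℝ → ℝ} {h : ℕ → ℝ} {L a B c v v' D D' : ℝ} (S : Setup r h L a B v' c) (hD : 1 ≤ D)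
    (hDD : D ≤ D') (hav : a + 1 ≤ v) (hvv : v ≤ v') (hvv2 : v' ≤ v + 1/2)
    (hn1 : Near r h L a c v D) (hn2 : Near r h L a c v' D') :
    ∑ q ∈ Ioc 0 ⌊Real.exp (v' * L)⌋₊, ArithmeticFunction.vonMangoldt q * |h q| * |SA h (Real.exp (v' * L) / q)| ≤
     (c * Real.exp (v' * L)) * (
      (D' - D) * (∑ q ∈ Ico 1 (⌊Real.exp (L/2)⌋₊+1), ArithmeticFunction.vonMangoldt q * (r (v' - Real.log q / L) / q)) +
      D * (∑ q ∈ Ico 1 (⌊Real.exp L⌋₊+1), ArithmeticFunction.vonMangoldt q * (r (v' - Real.log q / L) / q)) +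
      3 * D' * r v' * ∑ q ∈ (Ioc 0 ⌊Real.exp (v' * L)⌋₊).filter (fun q => ¬ q.Prime), ArithmeticFunction.vonMangoldt q * (q:ℝ) ^ (-(5/7) : ℝ)) := by
  have hL := S.hL
  have hc0 : 0 < c := (Real.exp_pos _).trans_le S.hc
  set X := Real.exp (v' * L) with hX
  have hX0 : 0 < X := Real.exp_pos _
  have hrv := S.dick.pos v'
  have hlX : Real.log X = v' * L := Real.log_exp _
  set Z1 := ⌊Real.exp (L/2)⌋₊ with hZ1
  set Z2 := ⌊Real.exp L⌋₊ with hZ2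
  set G : ℕ → ℝ := fun q => ArithmeticFunction.vonMangoldt q * (r (v' - Real.log q / L) / q) with hG
  have hG0 : ∀ q, 0 ≤ G q := fun q => mul_nonneg ArithmeticFunction.vonMangoldt_nonneg
    (div_nonneg (S.dick.pos _).le (Nat.cast_nonneg _))
  have hP0 : ∀ q : ℕ, 0 ≤ ArithmeticFunction.vonMangoldt q * (q:ℝ) ^ (-(5/7) : ℝ) := fun q => mul_nonneg ArithmeticFunction.vonMangoldt_nonneg
    (by positivity)
  have hDm : 0 ≤ D' - D := by linarith
  have term : ∀ q ∈ Ioc 0 ⌊X⌋₊, ArithmeticFunction.vonMangoldt q * |h q| * |SA h (X / q)| ≤ (c * X) * (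
      (D' - D) * (if q ≤ Z1 then G q else 0) + D * (if q ≤ Z2 then G q else 0) +
      3 * D' * r v' * (if ¬ q.Prime then ArithmeticFunction.vonMangoldt q * (q:ℝ) ^ (-(5/7) : ℝ) else 0)) := by
    intro q hq
    have hq1 := (mem_Ioc.mp hq).1
    have hqX : (q:ℝ) ≤ X := (Nat.cast_le.mpr (mem_Ioc.mp hq).2).trans (Nat.floor_le hX0.le)
    have hq1' : (1:ℝ) ≤ q := Nat.one_le_cast.mpr hq1
    have hq0 : (0:ℝ) < q := by linarith
    have hXq : 1 ≤ X / q := by rw [le_div_iff₀ hq0]; linarith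
    have hlq0 := Real.log_nonneg hq1'
    have hlq : Real.log (X / q) = v' * L - Real.log q := by rw [Real.log_div hX0.ne' hq0.ne', hlX]
    have hlq2 : Real.log (X / q) / L = v' - Real.log q / L := by rw [hlq]; field_simp
    have hΛ : 0 ≤ ArithmeticFunction.vonMangoldt q := ArithmeticFunction.vonMangoldt_nonneg
    have hhq := S.cm.bd q hq1
    have hT : ArithmeticFunction.vonMangoldt q * |h q| * |SA h (X / q)| ≤ ArithmeticFunction.vonMangoldt q * |SA h (X / q)| := by
      apply mul_le_mul_of_nonneg_right _ (abs_nonneg _)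
      nlinarith
    have hW : 0 ≤ 3 * D' * r v' * (if ¬ q.Prime then ArithmeticFunction.vonMangoldt q * (q:ℝ) ^ (-(5/7) : ℝ) else 0) := by
      apply mul_nonneg (by have : 0 < D' := by linarith
                           positivity)
      split_ifs
      · exact le_rfl
      · exact hP0 q
    have hcX : 0 ≤ c * X := by positivity
    have near : ∀ D0, |SA h (X/q)| ≤ D0 * c * ((X/q) * r (Real.log (X/q) / L)) →
        ArithmeticFunction.vonMangoldt q * |h q| * |SA h (X / q)| ≤ (c * X) * (D0 * G q) := by
      intro D0 h0
      refine hT.trans ((mul_le_mul_of_nonneg_left h0 hΛ).trans (le_of_eq ?_))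
      rw [hlq2]; simp only [hG]; field_simp
    by_cases c2 : q ≤ Z2
    · have l2 : Real.log q ≤ L := (log_le_of_floor hq1).mp c2
      rw [if_pos c2]
      by_cases c1 : q ≤ Z1
      · rw [if_pos c1]
        refine (near D' (hn2 _ hXq (by rw [hlq]; nlinarith) (by rw [hlq]; linarith))).trans ?_
        apply mul_le_mul_of_nonneg_left _ hcX
        linarith
      · have l1 : L/2 < Real.log q := by
          by_contra hh
          push Not at hh
          exact c1 ((log_le_of_floor hq1).mpr hh)
        rw [if_neg c1]
        refine (near D (hn1 _ hXq (by rw [hlq]; nlinarith) (by rw [hlq]; nlinarith))).trans ?_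
        apply mul_le_mul_of_nonneg_left _ hcX
        linarith
    · have l2 : L < Real.log q := by
        by_contra hh
        push Not at hh
        exact c2 ((log_le_of_floor hq1).mpr hh)
      have c1 : ¬ q ≤ Z1 := by
        intro hh
        have := (log_le_of_floor hq1).mp hh
        linarith
      rw [if_neg c1, if_neg c2]
      by_cases hp : q.Prime
      · rw [S.cm.big q hp l2, abs_zero, mul_zero, zero_mul]
        apply mul_nonneg hcX
        linarith
      · rw [if_pos hp]
        have b1 := (all_bound S (by linarith : 1 ≤ D') hn2 hXq (by rw [hlq]; linarith)).1
        rw [hlq2] at b1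
        have b2 : r (v' - Real.log q / L) ≤ r v' * (q:ℝ) ^ (1/7:ℝ) := by
          refine (G_le1 S.gr hL hq1').trans (mul_le_mul_of_nonneg_left ?_ hrv.le)
          apply Real.rpow_le_rpow_of_exponent_le hq1'
          rw [div_le_iff₀ hL]; linarith [S.hB7]
        have b3 : Real.exp (L/7) ≤ (q:ℝ)^(1/7:ℝ) := by
          rw [Real.rpow_def_of_pos hq0]
          apply Real.exp_le_exp.mpr
          linarith
        have hD'0 : 0 < D' := by linarith
        have b4 : |SA h (X/q)| ≤ 3 * D' * c * (q:ℝ)^(1/7:ℝ) * ((X/q) * (r v' * (q:ℝ) ^ (1/7:ℝ))) := by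
          refine b1.trans ?_
          have := (S.dick.pos (v' - Real.log q / L)).le
          gcongr
        refine hT.trans ((mul_le_mul_of_nonneg_left b4 hΛ).trans (le_of_eq ?_))
        have e5 : (q:ℝ)^(-(5/7):ℝ) = (q:ℝ)^(1/7:ℝ) * (q:ℝ)^(1/7:ℝ) / q := by
          rw [← Real.rpow_add hq0, ← Real.rpow_sub_one hq0.ne']; norm_num
        rw [e5]
        field_simp
        ring
  refine (sum_le_sum term).trans ?_
  rw [← mul_sum, sum_add_distrib, sum_add_distrib, ← mul_sum, ← mul_sum, ← mul_sum, ← sum_filter (fun q => ¬ Nat.Prime q)]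
  have s1 := mul_le_mul_of_nonneg_left (sum_ite_le hG0 ⌊X⌋₊ Z1) hDm
  have s2 := mul_le_mul_of_nonneg_left (sum_ite_le hG0 ⌊X⌋₊ Z2) (by linarith : 0 ≤ D)
  apply mul_le_mul_of_nonneg_left _ (by positivity)
  linarith

theorem step {b : ℝ} (hb : 0 < b) (hb2 : b < 3/5) : ∃ E, 1 ≤ E ∧ ∀ (r : ℝ → ℝ) (h : ℕ → ℝ) (L a B c v v' D D' : ℝ),
    Setup r h L a B v' c → 2 * B ≤ L ^ b → 1 ≤ D → D ≤ D' → a + 1 ≤ v → v ≤ v' → v' ≤ v + 1/2 →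
    Near r h L a c v D → Near r h L a c v' D' →
    |SA h (Real.exp (v' * L))| ≤ ((D' + D)/2 + D' * (E / (v * L))) * c * (Real.exp (v' * L) * r v') := by
  obtain ⟨E0, hE0, hE⟩ := prime_sum hb hb2
  obtain ⟨K, hK0, hK⟩ := proper_sum
  refine ⟨E0 + 3 * K + 6, by linarith, ?_⟩
  intro r h L a B c v v' D D' S hBb hD hDD hav hvv hvv2 hn1 hn2
  have hL := S.hL
  have ha := S.ha
  have hc0 : 0 < c := (Real.exp_pos _).trans_le S.hc
  have hB7 := S.hB7
  have hrv := S.dick.pos v'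
  have hv0 : 1 ≤ v := by linarith
  have s1 := sum1_bound S hD hDD hav hvv hvv2 hn1 hn2
  have s2 := sum2_bound S (by linarith : 1 ≤ D') (by linarith) hn2
  have hX1 : 1 ≤ Real.exp (v' * L) := Real.one_le_exp (mul_nonneg (by linarith) hL.le)
  have s0 := log_ineq S.cm hX1
  rw [Real.log_exp] at s0
  set X := Real.exp (v' * L) with hX
  have hfl : ∀ x, 0 ≤ x → 1 ≤ ⌊Real.exp x⌋₊ := fun x hx => (Nat.one_le_floor_iff _).mpr (Real.one_le_exp hx)
  have hZ1 := hfl (L/2) (by linarith)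
  have hZ2 := hfl L hL.le
  have p1 := hE r S.dick L v' B (1/2) hL S.hB (by linarith [S.hB]) hBb S.gr (by norm_num) _ hZ1
    ((log_le_of_floor hZ1).mp le_rfl |>.trans (by linarith))
  have p2 := hE r S.dick L v' B 1 hL S.hB (by linarith [S.hB]) hBb S.gr le_rfl _ hZ2
    ((log_le_of_floor hZ2).mp le_rfl |>.trans (by linarith))
  have i2 : ∫ w in (v'-1)..v', r w = v' * r v' := (S.dick.integral_eq (by linarith)).symm
  have i1 : ∫ w in (v'-1/2)..v', r w ≤ 1/2 * (v' * r v') := by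
    rw [← i2]
    have hii : ∀ a b, IntervalIntegrable r volume a b := fun a b => S.dick.cont.intervalIntegrable a b
    have j0 := intervalIntegral.integral_add_adjacent_intervals (hii (v'-1) (v'-1/2)) (hii (v'-1/2) v')
    have j1 : ∫ w in (v'-1/2)..v', r w ≤ ∫ w in (v'-1/2)..v', r (v' - 1/2) := by
      apply intervalIntegral.integral_mono_on (by linarith) (hii _ _) (by simp)
      intro w hw; exact S.dick.anti hw.1
    have j2 : ∫ w in (v'-1)..(v'-1/2), r (v' - 1/2) ≤ ∫ w in (v'-1)..(v'-1/2), r w := by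
      apply intervalIntegral.integral_mono_on (by linarith) (by simp) (hii _ _)
      intro w hw; exact S.dick.anti hw.2
    rw [intervalIntegral.integral_const, smul_eq_mul] at j1 j2
    rw [← j0]
    linarith
  have q1 := p1.trans (add_le_add_left (mul_le_mul_of_nonneg_left i1 hL.le) _)
  rw [i2] at p2
  have kk := hK ⌊X⌋₊
  have hD'0 : 0 < D' := by linarith
  have t1 := mul_le_mul_of_nonneg_left q1 (by linarith : 0 ≤ D' - D)
  have t2 := mul_le_mul_of_nonneg_left p2 (by linarith : 0 ≤ D)
  have t3 := mul_le_mul_of_nonneg_left kk (by positivity : 0 ≤ 3 * D' * r v')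
  have t4 := mul_le_mul_of_nonneg_left (add_le_add (add_le_add t1 t2) t3) (by positivity : 0 ≤ c * X)
  have tot : v' * L * |SA h X| ≤ c * X * r v' * ((D' + D)/2 * (v' * L) + D' * (E0 + 3 * K + 6)) := by
    refine s0.trans ((add_le_add (s1.trans t4) s2).trans (le_of_eq ?_))
    ring
  have hvL : 0 < v' * L := mul_pos (by linarith) hL
  have fin : |SA h X| ≤ ((D' + D)/2 + D' * ((E0 + 3 * K + 6) / (v' * L))) * c * (X * r v') := by
    rw [← mul_le_mul_iff_right₀ hvL]
    refine tot.trans (le_of_eq ?_)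
    have hv'0 : v' ≠ 0 := by linarith
    field_simp
  refine fin.trans ?_
  have : (E0 + 3 * K + 6) / (v' * L) ≤ (E0 + 3 * K + 6) / (v * L) := by gcongr
  gcongr
end VK

namespace VK
open Finset MeasureTheory

lemma Setup.mono {r : ℝ → ℝ} {h : ℕ → ℝ} {L a B V V' c : ℝ} (S : Setup r h L a B V c) (hV : V' ≤ V) :
    Setup r h L a B V' c :=
  ⟨S.dick, S.cm, S.hL, S.ha, S.hB, S.hB7, fun w w' h1 h2 => S.gr w w' h1 (h2.trans hV), S.hc, S.far⟩

lemma Near.mono {r : ℝ → ℝ} {h : ℕ → ℝ} {L a B V c v v' D D' : ℝ} (S : Setup r h L a B V c)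
    (hn : Near r h L a c v D) (hv : v' ≤ v) (hD : D ≤ D') : Near r h L a c v' D' := by
  intro t h1 h2 h3
  have hL := S.hL
  have hc0 : 0 < c := (Real.exp_pos _).trans_le S.hc
  refine (hn t h1 h2 (h3.trans (mul_le_mul_of_nonneg_right hv hL.le))).trans ?_
  have := S.dick.pos (Real.log t / L)
  gcongr

theorem step2 {b : ℝ} (hb : 0 < b) (hb2 : b < 3/5) : ∃ E, 1 ≤ E ∧ ∀ (r : ℝ → ℝ) (h : ℕ → ℝ) (L a B c v D : ℝ),
    Setup r h L a B (v + 1/2) c → 2 * B ≤ L ^ b → 1 ≤ D → a + 1 ≤ v → E / (v * L) ≤ 1/4 →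
    Near r h L a c v D → Near r h L a c (v + 1/2) (D * (1 + 4 * (E / (v * L)))) := by
  obtain ⟨E, hE1, hE⟩ := step hb hb2
  refine ⟨E, hE1, ?_⟩
  intro r h L a B c v D S hBb hD hav hδ hn
  have hL := S.hL
  have ha := S.ha
  have hv0 : 1 ≤ v := by linarith
  have hc0 : 0 < c := (Real.exp_pos _).trans_le S.hc
  set δ := E / (v * L) with hδd
  have hδ0 : 0 < δ := by positivity
  set T : Set ℝ := {x | ∃ t, 1 ≤ t ∧ a * L ≤ Real.log t ∧ Real.log t ≤ (v + 1/2) * L ∧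
    x = |SA h t| / (c * (t * r (Real.log t / L)))} with hT
  have hpos : ∀ t, 1 ≤ t → 0 < c * (t * r (Real.log t / L)) := fun t ht =>
    mul_pos hc0 (mul_pos (by linarith) (S.dick.pos _))
  have hbd : BddAbove T := by
    refine ⟨1 / (c * r (v + 1/2)), ?_⟩
    rintro x ⟨t, h1, h2, h3, rfl⟩
    have hr0 := S.dick.pos (v + 1/2)
    have hr : r (v + 1/2) ≤ r (Real.log t / L) := by
      apply S.dick.anti
      rw [div_le_iff₀ hL]; exact h3
    rw [div_le_div_iff₀ (hpos t h1) (by positivity), one_mul]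
    have := SA_le S.cm.bd (by linarith : 0 ≤ t)
    calc |SA h t| * (c * r (v+1/2)) ≤ t * (c * r (Real.log t / L)) := by gcongr
      _ = _ := by ring
  set D' := max D (sSup T) with hD'
  have hDD : D ≤ D' := le_max_left _ _
  have hn2 : Near r h L a c (v + 1/2) D' := by
    intro t h1 h2 h3
    have : |SA h t| / (c * (t * r (Real.log t / L))) ≤ D' :=
      (le_csSup hbd ⟨t, h1, h2, h3, rfl⟩).trans (le_max_right _ _)
    rw [div_le_iff₀ (hpos t h1)] at this
    rw [mul_assoc]; exact this
  have hsup : sSup T ≤ max D ((D' + D)/2 + D' * δ) := by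
    apply Real.sSup_le
    · rintro x ⟨t, h1, h2, h3, rfl⟩
      rw [div_le_iff₀ (hpos t h1)]
      rcases le_total (Real.log t) (v * L) with h4 | h4
      · have := hn t h1 h2 h4
        rw [mul_assoc] at this
        exact this.trans (mul_le_mul_of_nonneg_right (le_max_left _ _) (hpos t h1).le)
      · set v' := Real.log t / L with hv'
        have e1 : v' * L = Real.log t := by rw [hv']; field_simp
        have e2 : Real.exp (v' * L) = t := by rw [e1, Real.exp_log (by linarith)]
        have q1 : v ≤ v' := by rw [hv', le_div_iff₀ hL]; exact h4
        have q2 : v' ≤ v + 1/2 := by rw [hv', div_le_iff₀ hL]; exact h3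
        have := hE r h L a B c v v' D D' (S.mono q2) hBb hD hDD hav q1 q2 hn (hn2.mono S q2 le_rfl)
        rw [e2, mul_assoc] at this
        exact this.trans (mul_le_mul_of_nonneg_right (le_max_right _ _) (hpos t h1).le)
    · exact le_trans (by linarith) (le_max_left _ _)
  have hfin : D' ≤ D * (1 + 4 * δ) := by
    have : D' ≤ max D ((D' + D)/2 + D' * δ) := max_le (le_max_left _ _) hsup
    rcases le_max_iff.mp this with h1 | h1
    · nlinarith
    · have h2 : D' * (1 - 2 * δ) ≤ D := by linarith
      have h3 : 1 ≤ (1 - 2 * δ) * (1 + 4 * δ) := by nlinarith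
      have h4 : D' * (1 - 2*δ) * (1 + 4 * δ) ≤ D * (1 + 4 * δ) := mul_le_mul_of_nonneg_right h2 (by linarith)
      have h5 : D' * 1 ≤ D' * ((1 - 2 * δ) * (1 + 4 * δ)) := mul_le_mul_of_nonneg_left h3 (by linarith)
      linarith
  exact hn2.mono S le_rfl hfin

theorem iter {b : ℝ} (hb : 0 < b) (hb2 : b < 3/5) : ∃ E, 1 ≤ E ∧ ∀ (r : ℝ → ℝ) (h : ℕ → ℝ) (L a B c u : ℝ),
    Setup r h L a B (u + 1/2) c → 2 * B ≤ L ^ b → 4 * E ≤ L → a + 1 ≤ u →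
    Near r h L a c (a + 1) 1 → Near r h L a c u (Real.exp (E * Real.log (u + 1) / L)) := by
  obtain ⟨E, hE1, hE⟩ := step2 hb hb2
  refine ⟨16 * E, by linarith, ?_⟩
  intro r h L a B c u S hBb hEL hau hn
  have hL := S.hL
  have ha := S.ha
  have main : ∀ k : ℕ, a + 1 + (k:ℝ)/2 ≤ u + 1/2 →
      Near r h L a c (a + 1 + (k:ℝ)/2) (Real.exp (8 * E / L * Real.log (k + 1))) := by
    intro k
    induction k with
    | zero => intro _; simpa using hn
    | succ k ih =>
      intro hk
      push_cast at hk
      have hk' : a + 1 + (k:ℝ)/2 ≤ u + 1/2 := by linarith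
      have e0 : a + 1 + ((k+1:ℕ):ℝ)/2 = a + 1 + (k:ℝ)/2 + 1/2 := by push_cast; ring
      set v := a + 1 + (k:ℝ)/2 with hv
      have hk0 : (0:ℝ) ≤ k := Nat.cast_nonneg k
      have hv1 : 1 + (k:ℝ)/2 ≤ v := by linarith
      have hδ : E / (v * L) ≤ 2 * E / L * (1 / ((k:ℝ)+2)) := by
        have : 2 * E / L * (1 / ((k:ℝ)+2)) = E / ((1 + (k:ℝ)/2) * L) := by field_simp; ring
        rw [this]
        gcongr
      have hδ4 : E / (v * L) ≤ 1/4 := by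
        rw [div_le_iff₀ (mul_pos (by linarith) hL)]
        nlinarith
      have hD1 : 1 ≤ Real.exp (8 * E / L * Real.log (k + 1)) := by
        apply Real.one_le_exp
        have := Real.log_nonneg (show (1:ℝ) ≤ k + 1 by linarith)
        positivity
      have st := hE r h L a B c v _ (S.mono (by rw [hv]; linarith)) hBb hD1 (by linarith) hδ4 (ih hk')
      rw [e0]
      refine st.mono S le_rfl ?_
      have l2 : 1 / ((k:ℝ)+2) ≤ Real.log ((k+1:ℕ) + 1) - Real.log (k+1) := by
        have := Real.one_sub_inv_le_log_of_pos (show 0 < ((k:ℝ)+2)/(k+1) by positivity)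
        rw [Real.log_div (by linarith) (by linarith)] at this
        have h2 : 1 - (((k:ℝ)+2)/(k+1))⁻¹ = 1/((k:ℝ)+2) := by field_simp; ring
        have h3 : (((k+1:ℕ):ℝ) + 1) = (k:ℝ) + 2 := by push_cast; ring
        rw [h3]
        linarith
      have e1 : 1 + 4 * (E / (v * L)) ≤ Real.exp (8 * E / L * (Real.log ((k+1:ℕ) + 1) - Real.log (k+1))) := by
        have x1 := Real.add_one_le_exp (4 * (E / (v * L)))
        refine le_trans (by linarith) (x1.trans (Real.exp_le_exp.mpr ?_))
        have x2 := mul_le_mul_of_nonneg_left l2 (by positivity : 0 ≤ 8 * E / L)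
        refine le_trans ?_ x2
        have : 8 * E / L * (1 / ((k:ℝ)+2)) = 4 * (2 * E / L * (1 / ((k:ℝ)+2))) := by ring
        rw [this]; linarith
      calc Real.exp (8 * E / L * Real.log (k + 1)) * (1 + 4 * (E / (v * L)))
          ≤ Real.exp (8 * E / L * Real.log (k + 1)) * Real.exp (8 * E / L * (Real.log ((k+1:ℕ) + 1) - Real.log (k+1))) :=
            mul_le_mul_of_nonneg_left e1 (Real.exp_pos _).le
        _ = _ := by rw [← Real.exp_add]; congr 1; ring
  set k := ⌈2 * (u - a - 1)⌉₊ with hk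
  have k1 : 2 * (u - a - 1) ≤ k := Nat.le_ceil _
  have k2 : (k:ℝ) < 2 * (u - a - 1) + 1 := Nat.ceil_lt_add_one (by linarith)
  refine (main k (by linarith)).mono S (by linarith) ?_
  apply Real.exp_le_exp.mpr
  have l1 : Real.log (k + 1) ≤ 2 * Real.log (u + 1) := by
    have : 2 * Real.log (u + 1) = Real.log ((u+1)^2) := by rw [Real.log_pow]; norm_num
    rw [this]
    apply Real.log_le_log (by positivity)
    nlinarith
  calc 8 * E / L * Real.log (k + 1) ≤ 8 * E / L * (2 * Real.log (u + 1)) :=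
        mul_le_mul_of_nonneg_left l1 (by positivity)
    _ = _ := by ring

/-- full conclusion for the large `L` range -/
theorem big_range {b : ℝ} (hb : 0 < b) (hb2 : b < 3/5) : ∃ E, 1 ≤ E ∧ ∀ (r : ℝ → ℝ) (h : ℕ → ℝ) (L a c u B : ℝ),
    Dick r → CM h L → 0 < L → 0 ≤ a → Real.exp (-(L/7)) ≤ c → 0 < B → 7 * B ≤ L → 2 * B ≤ L ^ b → 4 * E ≤ L →
    E * Real.log (u + 1) ≤ L → Gr r B (u + 1/2) → a + 1 ≤ u → Near r h L a c (a + 1) 1 →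
    |SA h (Real.exp (u * L))| ≤ c * (Real.exp (u * L) * r u) * (1 + 2 * E * Real.log (u + 1) / L) := by
  obtain ⟨E, hE1, hE⟩ := iter hb hb2
  refine ⟨E, hE1, ?_⟩
  intro r h L a c u B hr hh hL ha hc hB hB7 hBb hEL hEu hg hau hn
  have hlu := Real.log_nonneg (show 1 ≤ u + 1 by linarith)
  have hx1 : E * Real.log (u + 1) / L ≤ 1 := by rw [div_le_iff₀ hL]; linarith
  have hx0 : 0 ≤ E * Real.log (u + 1) / L := by positivity
  -- trivial function
  classical
  set g : ℕ → ℝ := fun n => if ∀ p ∈ n.primeFactors, Real.log p ≤ L then 1 else 0 with hgd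
  have hgc : CM g L := by
    refine ⟨?_, ?_, ?_⟩
    · intro m n hm hn
      simp only [hgd]
      rw [Nat.primeFactors_mul (by omega) (by omega)]
      by_cases h1 : ∀ p ∈ m.primeFactors, Real.log p ≤ L
      · rw [if_pos h1, one_mul]
        by_cases h2 : ∀ p ∈ n.primeFactors, Real.log p ≤ L
        · rw [if_pos h2, if_pos]
          intro p hp
          rcases mem_union.mp hp with h | h
          · exact h1 p h
          · exact h2 p h
        · rw [if_neg h2, if_neg]
          exact fun h3 => h2 (fun p hp => h3 p (mem_union_right _ hp))
      · rw [if_neg h1, zero_mul, if_neg]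
        exact fun h3 => h1 (fun p hp => h3 p (mem_union_left _ hp))
    · intro n _
      simp only [hgd]
      split_ifs <;> simp
    · intro p hp hpL
      simp only [hgd]
      rw [if_neg]
      intro h1
      have := h1 p (by rw [hp.primeFactors]; simp)
      linarith
  have hg1 : ∀ n, g n ≤ 1 ∧ 0 ≤ g n := by
    intro n; simp only [hgd]; split_ifs <;> simp
  have Sg : Setup r g L 0 B (u + 1/2) 1 := by
    refine ⟨hr, hgc, hL, le_rfl, hB, hB7, hg, ?_, ?_⟩
    · rw [Real.exp_le_one_iff]; linarith
    · intro t h1 h2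
      have := Real.log_nonneg h1
      linarith
  have ng : Near r g L 0 1 (0 + 1) 1 := by
    intro t h1 _ h3
    rw [hr.one _ (by rw [div_le_iff₀ hL]; linarith), one_mul, one_mul, mul_one]
    exact SA_le hgc.bd (by linarith)
  have cg := hE r g L 0 B 1 u Sg hBb hEL (by linarith) ng
  have hhg : ∀ n, 1 ≤ n → |h n| ≤ g n := by
    intro n hn
    simp only [hgd]
    split_ifs with h1
    · exact hh.bd n hn
    · push Not at h1
      obtain ⟨p, hp, hpL⟩ := h1
      have hpp := Nat.prime_of_mem_primeFactors hp
      obtain ⟨m, rfl⟩ := Nat.dvd_of_mem_primeFactors hp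
      have hm : 1 ≤ m := by
        rcases Nat.eq_zero_or_pos m with h0 | h0
        · rw [h0] at hn; omega
        · exact h0
      rw [hh.mul _ _ hpp.one_lt.le hm, hh.big p hpp hpL, zero_mul, abs_zero]
  have hSA : ∀ t, |SA h t| ≤ |SA g t| := by
    intro t
    refine (abs_sum_le_sum_abs _ _).trans ((sum_le_sum ?_).trans (le_abs_self _))
    intro n hn
    exact hhg n (mem_Ioc.mp hn).1
  have Sh : Setup r h L a B (u + 1/2) c := by
    refine ⟨hr, hh, hL, ha, hB, hB7, hg, hc, ?_⟩
    intro t h1 h2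
    refine (hSA t).trans ((cg t h1 (by rw [zero_mul]; exact Real.log_nonneg h1) ?_).trans ?_)
    · nlinarith
    · apply mul_le_mul_of_nonneg_right _ (mul_nonneg (by linarith) (hr.pos _).le)
      rw [mul_one]
      have := Real.exp_le_exp.mpr hx1
      have := Real.exp_one_lt_d9
      linarith
  have ch := hE r h L a B c u Sh hBb hEL hau hn
  have hu0 : 0 ≤ u * L := mul_nonneg (by linarith) hL.le
  have f1 := ch (Real.exp (u * L)) (Real.one_le_exp hu0) (by rw [Real.log_exp]; nlinarith) (by rw [Real.log_exp])
  rw [Real.log_exp, mul_div_cancel_right₀ u hL.ne'] at f1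
  refine f1.trans ?_
  have hc0 : 0 < c := (Real.exp_pos _).trans_le hc
  have hexp : Real.exp (E * Real.log (u + 1) / L) ≤ 1 + 2 * E * Real.log (u+1) / L := by
    have h1 := Real.abs_exp_sub_one_le (x := E * Real.log (u + 1) / L) (by rw [abs_of_nonneg hx0]; exact hx1)
    rw [abs_of_nonneg hx0] at h1
    have h2 := (abs_le.mp h1).2
    have : 2 * E * Real.log (u+1) / L = 2 * (E * Real.log (u+1) / L) := by ring
    linarith
  have hR : 0 ≤ c * (Real.exp (u * L) * r u) := mul_nonneg hc0.le (mul_nonneg (Real.exp_pos _).le (hr.pos _).le)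
  calc _ = Real.exp (E * Real.log (u + 1) / L) * (c * (Real.exp (u * L) * r u)) := by ring
    _ ≤ (1 + 2 * E * Real.log (u+1) / L) * (c * (Real.exp (u * L) * r u)) := mul_le_mul_of_nonneg_right hexp hR
    _ = _ := by ring
end VK

namespace VK
open Finset MeasureTheory

theorem large_case {ε : ℝ} (hε : 0 < ε) : ∃ L0 E, 1 ≤ L0 ∧ 1 ≤ E ∧ ∀ (r : ℝ → ℝ) (h : ℕ → ℝ) (L a c u : ℝ),
    Dick r → CM h L → L0 ≤ L → 0 ≤ a → Real.exp (-(L/7)) ≤ c → a + 1 ≤ u →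
    Real.log u ≤ L ^ (1 / (5/3 + ε)) → Near r h L a c (a + 1) 1 →
    |SA h (Real.exp (u * L))| ≤ c * (Real.exp (u * L) * r u) * (1 + E * Real.log (u + 1) / L) := by
  set b0 : ℝ := 1 / (5/3 + ε) with hb0
  have hb0p : 0 < b0 := by positivity
  have hb03 : b0 < 3/5 := by
    rw [hb0, div_lt_iff₀ (by linarith)]; linarith
  set b := (b0 + 3/5)/2 with hb
  have hbp : 0 < b := by linarith
  have hb35 : b < 3/5 := by linarith
  have hbb : 0 < b - b0 := by linarith
  obtain ⟨E, hE1, hE⟩ := big_range hbp hb35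
  have ev := ((tendsto_rpow_atTop hbb).eventually_ge_atTop (3 * (42 + 4 * E))).and (Filter.eventually_ge_atTop (1:ℝ))
  obtain ⟨L0, hL0⟩ := Filter.eventually_atTop.mp ev
  refine ⟨max L0 1, 2 * E, le_max_right _ _, by linarith, ?_⟩
  intro r h L a c u hr hh hL ha hc hau hlu hn
  obtain ⟨p1, p2⟩ := hL0 L ((le_max_left _ _).trans hL)
  have hLp : 0 < L := by linarith
  have q0 : 1 ≤ L ^ b0 := Real.one_le_rpow p2 hb0p.le
  have q1 : (42 + 4 * E) * (2 + L ^ b0) ≤ L ^ b := by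
    have : L ^ b = L ^ b0 * L ^ (b - b0) := by rw [← Real.rpow_add hLp]; congr 1; ring
    rw [this]
    have := mul_le_mul_of_nonneg_left p1 (by linarith : 0 ≤ L ^ b0)
    refine le_trans ?_ this
    nlinarith
  have q2 : L ^ b ≤ L := by
    calc L ^ b ≤ L ^ (1:ℝ) := Real.rpow_le_rpow_of_exponent_le p2 (by linarith)
      _ = L := Real.rpow_one L
  have hu1 : 1 ≤ u := by linarith
  set n := ⌈2 * u + 1⌉₊ with hn'
  have n1 : 2 * u + 1 ≤ n := Nat.le_ceil _
  have n2 : (n:ℝ) < 2 * u + 1 + 1 := Nat.ceil_lt_add_one (by linarith)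
  have l6 : Real.log 6 ≤ 2 := by
    rw [Real.log_le_iff_le_exp (by norm_num)]
    have := Real.exp_one_gt_d9
    have e : Real.exp 2 = Real.exp 1 * Real.exp 1 := by rw [← Real.exp_add]; norm_num
    rw [e]; nlinarith
  have B1 : BB n ≤ 6 * (2 + L ^ b0) := by
    have : Real.log (n + 2) ≤ Real.log (6 * u) := Real.log_le_log (by positivity) (by linarith)
    rw [Real.log_mul (by norm_num) (by linarith)] at this
    simp only [BB]
    linarith
  have lu1 : Real.log (u + 1) ≤ 2 + L ^ b0 := by
    have : Real.log (u + 1) ≤ Real.log (6 * u) := Real.log_le_log (by positivity) (by linarith)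
    rw [Real.log_mul (by norm_num) (by linarith)] at this
    linarith
  have B0 := BB_pos n
  have hlu0 := Real.log_nonneg (show 1 ≤ u + 1 by linarith)
  have := hE r h L a c u (BB n) hr hh hLp ha hc (by linarith) (by nlinarith) (by nlinarith) (by nlinarith)
    (by nlinarith) (fun w w' h1 h2 => hr.ex n w w' h1 (by linarith)) hau hn
  exact this

lemma small_case {r : ℝ → ℝ} (hr : Dick r) {L L0 M0 c u x P : ℝ} (hL0 : 1 ≤ L0) (hLL : L ≤ L0)
    (hL2 : Real.log 2 ≤ L)
    (hc : Real.exp (-(L/7)) ≤ c) (hu1 : 1 ≤ u) (hM : u * L ≤ M0) (hx : 0 ≤ x) (hP : P ≤ x) {C : ℝ}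
    (hC : 2 * L0 * Real.exp (L0/7) * Real.exp (BB ⌈4 * M0⌉₊ * (2 * M0)) ≤ C) :
    P ≤ c * (x * r u) * (1 + C * Real.log (u + 1) / L) := by
  have l2 := Real.log_two_gt_d9
  have hLp : 0 < L := by linarith
  have hu2 : u ≤ 2 * M0 := by nlinarith
  have hM0 : 0 ≤ M0 := by linarith
  set n := ⌈4 * M0⌉₊ with hn
  have n1 : 4 * M0 ≤ n := Nat.le_ceil _
  have hB := BB_pos n
  have h1 := hr.ex n 0 u (by linarith) (by linarith)
  rw [hr.one 0 zero_le_one, sub_zero] at h1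
  have hru := hr.pos u
  have h2 : 1 ≤ r u * Real.exp (BB n * (2 * M0)) := by
    refine h1.trans (mul_le_mul_of_nonneg_left (Real.exp_le_exp.mpr ?_) hru.le)
    exact mul_le_mul_of_nonneg_left hu2 (by linarith)
  have hc2 : Real.exp (-(L0/7)) ≤ c := (Real.exp_le_exp.mpr (by linarith)).trans hc
  have hc3 : 1 ≤ c * Real.exp (L0/7) := by
    have := mul_le_mul_of_nonneg_right hc2 (Real.exp_pos (L0/7)).le
    rw [← Real.exp_add] at this
    simpa using this
  have hc0 : 0 < c := (Real.exp_pos _).trans_le hc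
  have hlu : 1/2 ≤ Real.log (u + 1) := by
    have : Real.log 2 ≤ Real.log (u+1) := Real.log_le_log (by norm_num) (by linarith)
    linarith
  set e1 := Real.exp (L0/7) with he1
  set e2 := Real.exp (BB n * (2 * M0)) with he2
  have he1p : 0 < e1 := Real.exp_pos _
  have he2p : 0 < e2 := Real.exp_pos _
  have hC0 : 0 < C := lt_of_lt_of_le (by positivity) hC
  have h4 : e1 * e2 ≤ C * Real.log (u + 1) / L := by
    rw [le_div_iff₀ hLp]
    calc e1 * e2 * L ≤ e1 * e2 * L0 := by gcongr
      _ = (2 * L0 * e1 * e2) * (1/2) := by ring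
      _ ≤ C * Real.log (u + 1) := by gcongr
  have h5 : 1 ≤ c * r u * (1 + C * Real.log (u + 1) / L) := by
    calc (1:ℝ) ≤ (c * e1) * (r u * e2) := by nlinarith
      _ = c * r u * (e1 * e2) := by ring
      _ ≤ c * r u * (1 + C * Real.log (u + 1) / L) := by
        apply mul_le_mul_of_nonneg_left _ (by positivity)
        linarith
  calc P ≤ x * 1 := by linarith
    _ ≤ x * (c * r u * (1 + C * Real.log (u + 1) / L)) := mul_le_mul_of_nonneg_left h5 hx
    _ = _ := by ring

lemma loglog_bound {x L s : ℝ} (hL : 0 ≤ L) (hs : 0 < s) (hx : 1 < Real.log x) (h : Real.log (Real.log x) ^ s ≤ L) :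
    Real.log (Real.log x) ≤ L ^ (1/s) := by
  have h0 : 0 ≤ Real.log (Real.log x) := Real.log_nonneg hx.le
  have := Real.rpow_le_rpow (Real.rpow_nonneg h0 s) h (by positivity : 0 ≤ 1/s)
  rw [← Real.rpow_mul h0, mul_one_div_cancel hs.ne', Real.rpow_one] at this
  exact this

end VK

open Finset
open scoped Classical


namespace VK

lemma Psif_eq (f : ℕ → ℝ) (t y : ℝ) :
    Psif f t y = SA (fun n => if ∀ p : ℕ, p ∈ n.primeFactors → (p : ℝ) ≤ y then f n else 0) t := by
  rw [Psif, SA, sum_filter]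
  rfl

lemma cm_smooth {f : ℕ → ℝ} {y : ℝ} (hy : 2 ≤ y) (hm : ∀ m n : ℕ, f (m * n) = f m * f n)
    (hb : ∀ n : ℕ, 1 ≤ n → |f n| ≤ 1) :
    CM (fun n => if ∀ p : ℕ, p ∈ n.primeFactors → (p : ℝ) ≤ y then f n else 0) (Real.log y) := by
  refine ⟨?_, ?_, ?_⟩
  · intro m n h1 h2
    rw [Nat.primeFactors_mul (by omega) (by omega)]
    by_cases c1 : ∀ p ∈ m.primeFactors, (p : ℝ) ≤ y
    · by_cases c2 : ∀ p ∈ n.primeFactors, (p : ℝ) ≤ y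
      · rw [if_pos c1, if_pos c2, if_pos, hm]
        intro p hp
        rcases mem_union.mp hp with h | h
        · exact c1 p h
        · exact c2 p h
      · rw [if_neg c2, mul_zero, if_neg]
        exact fun h3 => c2 (fun p hp => h3 p (mem_union_right _ hp))
    · rw [if_neg c1, zero_mul, if_neg]
      exact fun h3 => c1 (fun p hp => h3 p (mem_union_left _ hp))
  · intro n hn
    split_ifs
    · exact hb n hn
    · simp
  · intro p hp hpL
    rw [if_neg]
    intro h1
    have := Real.log_le_log (Nat.cast_pos.mpr hp.pos) (h1 p (by rw [hp.primeFactors]; simp))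
    linarith

end VK

theorem stmt10 :
    ∀ ε > (0 : ℝ), ∃ Cε > (0 : ℝ),
      ∀ ρ : ℝ → ℝ,
        ContinuousOn ρ (Set.Ici 0) →
        (∀ u : ℝ, 0 ≤ u → u ≤ 1 → ρ u = 1) →
        (∀ u : ℝ, 1 < u → HasDerivAt ρ (-(ρ (u - 1)) / u) u) →
        ∀ f : ℕ → ℝ, f 1 = 1 → (∀ m n : ℕ, f (m * n) = f m * f n) →
        (∀ n : ℕ, 1 ≤ n → |f n| ≤ 1) →
        ∀ a y c : ℝ, 0 ≤ a → 2 ≤ y → y ^ (-(1 : ℝ) / 7) ≤ c →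
        (∀ t : ℝ, y ^ a ≤ t → t ≤ y ^ (a + 1) →
          |Psif f t y| ≤ c * ρ (Real.log t / Real.log y) * t) →
        ∀ x : ℝ, y ^ a ≤ x →
          Real.log (Real.log x) ^ ((5 : ℝ) / 3 + ε) ≤ Real.log y →
          |Psif f x y| ≤ c * x * ρ (Real.log x / Real.log y) *
            (1 + Cε * (Real.log x / Real.log y) *
              Real.log (Real.log x / Real.log y + 1) / Real.log x) := by
  intro ε hε
  obtain ⟨L0, E, hL0, hE1, hmain⟩ := VK.large_case hε
  set M0 : ℝ := Real.exp (L0 ^ (1 / (5/3 + ε))) with hM0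
  have hM01 : 1 ≤ M0 := Real.one_le_exp (Real.rpow_nonneg (by linarith) _)
  set C1 : ℝ := 2 * L0 * Real.exp (L0/7) * Real.exp (VK.BB ⌈4 * M0⌉₊ * (2 * M0)) with hC1
  have hC1p : 0 < C1 := by positivity
  refine ⟨E + C1, by linarith, ?_⟩
  intro ρ hρ1 hρ2 hρ3 f _ hfm hfb a y c ha hy hc hyp x hx hxy
  have hr := VK.Dick.mk' hρ1 hρ2 hρ3
  set r : ℝ → ℝ := fun w => ρ (max w 0) with hrd
  have hrρ : ∀ w, 0 ≤ w → r w = ρ w := fun w hw => by simp only [hrd]; rw [max_eq_left hw]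
  have hh := VK.cm_smooth (f := f) hy hfm hfb
  set h : ℕ → ℝ := fun n => if ∀ p : ℕ, p ∈ n.primeFactors → (p : ℝ) ≤ y then f n else 0 with hhd
  have hP : ∀ t, Psif f t y = VK.SA h t := fun t => VK.Psif_eq f t y
  set L := Real.log y with hL
  have hy0 : 0 < y := by linarith
  have hL2 : Real.log 2 ≤ L := Real.log_le_log (by norm_num) hy
  have l2 := Real.log_two_gt_d9
  have hLp : 0 < L := by linarith
  have hpow : ∀ s : ℝ, y ^ s = Real.exp (s * L) := by
    intro s; rw [Real.rpow_def_of_pos hy0, mul_comm]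
  have hx1 : 1 ≤ x := by
    refine le_trans ?_ hx
    rw [hpow]; exact Real.one_le_exp (by positivity)
  have hlx : 0 ≤ Real.log x := Real.log_nonneg hx1
  set u := Real.log x / L with hu
  have hu0 : 0 ≤ u := by positivity
  have huL : u * L = Real.log x := by rw [hu]; field_simp
  have hc' : Real.exp (-(L/7)) ≤ c := by
    rw [hpow] at hc
    refine le_trans (le_of_eq ?_) hc
    congr 1; ring
  have hc0 : 0 < c := (Real.exp_pos _).trans_le hc'
  have hCp : 0 < E + C1 := by linarith
  have hlu : 0 ≤ Real.log (u + 1) := Real.log_nonneg (by linarith)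
  rcases le_total x (y ^ (a + 1)) with hcase | hcase
  · refine (hyp x hx hcase).trans ?_
    have hρp : 0 < ρ u := by rw [← hrρ u hu0]; exact hr.pos u
    have : 0 ≤ (E + C1) * u * Real.log (u + 1) / Real.log x := by positivity
    have h1 : 0 < c * x * ρ u := by positivity
    calc c * ρ u * x = c * x * ρ u * 1 := by ring
      _ ≤ _ := by
        apply mul_le_mul_of_nonneg_left _ h1.le
        linarith
  · have hau : a + 1 ≤ u := by
      rw [hpow, ← Real.le_log_iff_exp_le (by linarith)] at hcase
      rw [hu, le_div_iff₀ hLp]; exact hcase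
    have hu1 : 1 ≤ u := by linarith
    have hlxp : 0 < Real.log x := by rw [← huL]; positivity
    have hxe : Real.exp (u * L) = x := by rw [huL, Real.exp_log (by linarith)]
    have egoal : c * x * ρ u * (1 + (E + C1) * u * Real.log (u + 1) / Real.log x) =
        c * (x * r u) * (1 + (E + C1) * Real.log (u + 1) / L) := by
      rw [hrρ u hu0, ← huL]
      have hun : u ≠ 0 := by linarith
      have hLn : L ≠ 0 := hLp.ne'
      have : (E + C1) * u * Real.log (u + 1) / (u * L) = (E + C1) * Real.log (u + 1) / L := by
        field_simp
      rw [this]; ring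
    rw [egoal, hP]
    have hs : (0:ℝ) < 5/3 + ε := by linarith
    rcases lt_or_ge L L0 with hsm | hbig
    · have hM : u * L ≤ M0 := by
        rw [huL]
        rcases le_or_gt (Real.log x) 1 with h1 | h1
        · linarith
        · have := VK.loglog_bound hLp.le hs h1 hxy
          rw [← Real.log_le_iff_le_exp hlxp]
          exact this.trans (Real.rpow_le_rpow hLp.le hsm.le (by positivity))
      exact VK.small_case hr hL0 hsm.le hL2 hc' hu1 hM (by linarith) (VK.SA_le hh.bd (by linarith)) (by linarith)
    · have hlogu : Real.log u ≤ L ^ (1 / (5/3 + ε)) := by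
        have hux : u ≤ Real.log x := by rw [← huL]; nlinarith
        rcases le_or_gt (Real.log x) 1 with h1 | h1
        · have : Real.log u ≤ 0 := Real.log_nonpos hu0 (by linarith)
          exact this.trans (Real.rpow_nonneg hLp.le _)
        · exact (Real.log_le_log (by linarith) hux).trans (VK.loglog_bound hLp.le hs h1 hxy)
      have near : VK.Near r h L a c (a + 1) 1 := by
        intro t h1 h2 h3
        have ht0 : 0 < t := by linarith
        have := hyp t (by rw [hpow, ← Real.le_log_iff_exp_le ht0]; exact h2)
          (by rw [hpow, ← Real.log_le_iff_le_exp ht0]; exact h3)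
        rw [hP, ← hrρ _ (div_nonneg (Real.log_nonneg h1) hLp.le)] at this
        refine this.trans (le_of_eq ?_)
        ring
      have := hmain r h L a c u hr hh hbig ha hc' hau hlogu near
      rw [hxe] at this
      refine this.trans ?_
      apply mul_le_mul_of_nonneg_left _ (mul_nonneg hc0.le (mul_nonneg (by linarith) (hr.pos u).le))
      have : E * Real.log (u + 1) / L ≤ (E + C1) * Real.log (u + 1) / L := by
        gcongr
        linarith
      linarith
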